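/- Let A, B ∈ SL(2,ℂ) generate a discrete nonelementary subgroup, and suppose A is parabolic or is elliptic of order n for some n ≥ 3. Then for every C ∈ SL(2,ℂ), max{‖C·A·C⁻¹‖², ‖C·B·C⁻¹‖²} ≥ 2·(2·√(8+2√5) − (1+√5))/(6−√5). (Equivalently, every point x of hyperbolic 3-space is moved hyperbolic distance at least c = arccosh((2√(8+2√5)−(1+√5))/(6−√5)) = 0.1829… by A or by B.) -/

import Mathlib

open Matrix Real

noncomputable section

abbrev SL2C := Matrix.SpecialLinearGroup (Fin 2) ℂ

/-- The Frobenius (Hilbert–Schmidt) norm of a 2×2 complex matrix. -/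
def fnorm (A : Matrix (Fin 2) (Fin 2) ℂ) : ℝ :=
  @norm _ Matrix.frobeniusSeminormedAddCommGroup.toNorm A

instance : TopologicalSpace SL2C :=
  TopologicalSpace.induced (fun g => (g : Matrix (Fin 2) (Fin 2) ℂ)) inferInstance

/-- A subgroup of `SL(2,ℂ)` is discrete if it is a discrete subspace of `SL(2,ℂ)`. -/
def IsDiscreteSubgroup (Γ : Subgroup SL2C) : Prop := DiscreteTopology Γ

/-- `A` is elliptic of order `n`: `A^n = ±1` but `A^k ≠ ±1` for `1 ≤ k < n`. -/
def IsEllipticOfOrder (A : SL2C) (n : ℕ) : Prop :=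
  (A ^ n = 1 ∨ A ^ n = -1) ∧ ∀ k : ℕ, 1 ≤ k → k < n → A ^ k ≠ 1 ∧ A ^ k ≠ -1

/-- `A` is parabolic: `A ≠ ±1` and `tr A = ±2`. -/
def IsParabolic (A : SL2C) : Prop :=
  A ≠ 1 ∧ A ≠ -1 ∧ (Matrix.trace (A : Matrix (Fin 2) (Fin 2) ℂ) = 2 ∨
    Matrix.trace (A : Matrix (Fin 2) (Fin 2) ℂ) = -2)

/-- `S` and `T` have a common eigenvector in `ℂ²`. -/
def HasCommonEigenvector (S T : SL2C) : Prop :=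
  ∃ v : Fin 2 → ℂ, v ≠ 0 ∧ (∃ a : ℂ, (S : Matrix (Fin 2) (Fin 2) ℂ).mulVec v = a • v) ∧
    (∃ b : ℂ, (T : Matrix (Fin 2) (Fin 2) ℂ).mulVec v = b • v)

/-- A subgroup of `SL(2,ℂ)` is nonelementary if it contains two elements `S`, `T`
with `S^k ≠ ±1 ≠ T^k` for all `k ≥ 1` having no common eigenvector in `ℂ²`. -/
def IsNonelementary (Γ : Subgroup SL2C) : Prop :=
  ∃ S ∈ Γ, ∃ T ∈ Γ, (∀ k : ℕ, 1 ≤ k → S ^ k ≠ 1 ∧ S ^ k ≠ -1) ∧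
    (∀ k : ℕ, 1 ≤ k → T ^ k ≠ 1 ∧ T ^ k ≠ -1) ∧ ¬ HasCommonEigenvector S T

/-- The trace parameter `β(A) = tr²(A) - 4`. -/
def βp (A : SL2C) : ℂ := (Matrix.trace (A : Matrix (Fin 2) (Fin 2) ℂ)) ^ 2 - 4

/-- The commutator parameter `γ(A,B) = tr [A,B] - 2`. -/
def γp (A B : SL2C) : ℂ :=
  Matrix.trace ((A * B * A⁻¹ * B⁻¹ : SL2C) : Matrix (Fin 2) (Fin 2) ℂ) - 2

/-- `PSL(2,ℂ)`, the quotient of `SL(2,ℂ)` by its center `{1, -1}`. -/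
abbrev PSL2C := SL2C ⧸ Subgroup.center SL2C

/-- The image in `PSL(2,ℂ)` of a subgroup of `SL(2,ℂ)`. -/
def pslImage (Γ : Subgroup SL2C) : Subgroup PSL2C :=
  Γ.map (QuotientGroup.mk' (Subgroup.center SL2C))

open Classical in
/-- `t5`: the unique real `t > 1` with
`t (t - cos²(π/5)) + (t-1) √((t+1)(t+1-2 cos²(π/5))) = 1/2`. -/
def t5 : ℝ :=
  if h : ∃ t : ℝ, 1 < t ∧
      t * (t - Real.cos (π / 5) ^ 2) +
        (t - 1) * Real.sqrt ((t + 1) * (t + 1 - 2 * Real.cos (π / 5) ^ 2)) = 1 / 2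
  then h.choose else 0

/-- The value `t n = cosh (c n)` where `c n` is the sharp displacement bound for
discrete nonelementary groups with an elliptic generator of order `n ≥ 3`. -/
def tOf : ℕ → ℝ
  | 3 => (2 * Real.sqrt (8 + 2 * Real.sqrt 5) - (1 + Real.sqrt 5)) / (6 - Real.sqrt 5)
  | 4 => (Real.sqrt (6 + 2 * Real.sqrt 3) - Real.sqrt 3) / (3 - Real.sqrt 3)
  | 5 => t5
  | 6 => 17 / 16
  | n => (5 - 2 * Real.sin (π / n) ^ 2) / (4 + 2 * Real.sin (π / n) ^ 2)

namespace Marg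

/-- Complex disc in fixed point arithmetic with scale `2^20`. -/
structure Dk where
  x : Int
  y : Int
  r : Nat

/-- Force evaluation of a natural number (helps the kernel). -/
def fN {α : Type} (n : Nat) (f : Nat → α) : α :=
  Nat.rec (f 0) (fun k _ => f (Nat.succ k)) n

def fI {α : Type} (i : Int) (f : Int → α) : α :=
  Int.rec (fun n => fN n fun k => f (Int.ofNat k)) (fun n => fN n fun k => f (Int.negSucc k)) i

def mk (x y : Int) (r : Nat) : Dk := fI x fun x => fI y fun y => fN r fun r => ⟨x, y, r⟩

/-- Upper bound for the modulus of an integer point. -/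
def up (x y : Int) : Nat :=
  fN x.natAbs fun a => fN y.natAbs fun b =>
  bif Nat.ble b a then Nat.succ (Nat.add a (Nat.div (Nat.mul b 27146) 65536))
  else Nat.succ (Nat.add b (Nat.div (Nat.mul a 27146) 65536))

def Dk.add (a b : Dk) : Dk :=
  Dk.rec (fun ax ay ar => Dk.rec (fun bx' by' br =>
    mk (Int.add ax bx') (Int.add ay by') (Nat.add ar br)) b) a
def Dk.neg (a : Dk) : Dk := Dk.rec (fun ax ay ar => mk (Int.neg ax) (Int.neg ay) ar) a
def Dk.sub (a b : Dk) : Dk :=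
  Dk.rec (fun ax ay ar => Dk.rec (fun bx' by' br =>
    mk (Int.add ax (Int.neg bx')) (Int.add ay (Int.neg by')) (Nat.add ar br)) b) a
def Dk.muli (a : Dk) : Dk := Dk.rec (fun ax ay ar => mk (Int.neg ay) ax ar) a
def shI (i : Int) : Int :=
  Int.rec (fun n => Int.ofNat (Nat.div n 1048576)) (fun n => Int.negSucc (Nat.div n 1048576)) i
def Dk.mul (a b : Dk) : Dk :=
  Dk.rec (fun ax ay ar => Dk.rec (fun bx' by' br =>
    mk (shI (Int.add (Int.mul ax bx') (Int.neg (Int.mul ay by'))))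
      (shI (Int.add (Int.mul ax by') (Int.mul ay bx')))
      (Nat.add (Nat.div (Nat.add (Nat.add (Nat.mul (up ax ay) br) (Nat.mul (up bx' by') ar))
        (Nat.mul ar br)) 1048576) 3)) b) a
def Dk.hf (a : Dk) : Dk := mk (a.x / 2) (a.y / 2) (a.r / 2 + 2)
def ex (n : Int) : Dk := ⟨n * 1048576, 0, 0⟩
/-- Upper bound for the modulus on the disc. -/
def Dk.U (a : Dk) : Nat := up a.x a.y + a.r
/-- The disc does not contain `0`. -/
def Dk.nz (a : Dk) : Bool := Nat.blt a.r a.x.natAbs || Nat.blt a.r a.y.natAbs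

/-- The constants `cos 2θ`, `1 - cos² 2θ`, `1 - cos 2θ`, `(1 - cos 2θ)²`, `1 + cos 2θ`. -/
structure Cst where
  C : Dk
  S : Dk
  D : Dk
  DD : Dk
  C1 : Dk

def wordAux (K : Cst) (k : Dk) : List Bool → Bool → Dk × Dk × Dk
  | [], odd => bif odd then (ex 0, ex 1, ex 0) else (ex 1, ex 0, ex 0)
  | s :: l, odd =>
    match wordAux K k l (!odd) with
    | (a, b, g) =>
      let Sg := K.S.mul (bif s then g else g.neg)
      bif odd then
        ((K.C.mul a).add Sg, b.add (k.mul ((K.D.mul a).sub Sg)),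
          (K.C.mul g).sub (bif s then a else a.neg))
      else
        (a.add (k.mul ((K.D.mul b).add Sg)), (K.C.mul b).sub Sg,
          (K.C.mul g).add (bif s then b else b.neg))

def word (K : Cst) (w : List Bool) (k : Dk) : Dk :=
  match wordAux K k w true with
  | (a, b, _) => a.add (b.mul k)

def Uit (T : Dk) : Nat → Dk × Dk
  | 0 => (ex 0, ex 1)
  | m + 1 => match Uit T m with
    | (u, v) => (v, (T.mul v).sub u)

def test (K : Cst) (k : Dk) (m : Nat) (q : Bool) : Bool :=
  let w := K.DD.mul ((k.mul k).sub (ex 1))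
  let T := bif q then K.C1.add (K.D.mul k) else K.C1.sub (K.D.mul k)
  let b := (T.mul T).sub (ex 4)
  let u := (Uit T m).1
  Nat.blt ((b.U + w.U) * u.U * u.U) (1048576 * 1048576 * 1048576)

def nv (K : Cst) (k : Dk) (m : Nat) (q : Bool) : Bool :=
  let T := bif q then K.C1.add (K.D.mul k) else K.C1.sub (K.D.mul k)
  (Uit T m).1.nz && (k.sub (ex 1)).nz && (k.add (ex 1)).nz

inductive Tr where
  | s : Tr → Tr → Tr → Tr → Tr
  | l : Nat → Tr
  | o : Tr
  | d : Tr

def sqD (x y : Int) (h : Nat) : Dk := mk x y (h * 185364 / 131072 + 1)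

def bx (lo hi : Int) (z : Dk) : Bool :=
  decide (lo < z.x - z.r) && decide (z.x + z.r < hi)

/-- Leaf test of stage 1: path of words, test index, sign, mode. -/
def leaf1 (K : Cst) (k : Dk) (t : List (List Bool) × Nat × Bool × Nat) : Bool :=
  match t with
  | (p, m, q, mode) =>
    let z := p.foldl (fun z w => word K w z) k
    test K z m q && (match mode with
      | 0 => nv K z m q
      | 1 => p.isEmpty && Nat.beq m 1
      | 2 => p.isEmpty && Nat.beq m 2
      | 3 => p.isEmpty && Nat.beq m 5 && q && bx 524288 1258291 z
      | 4 => (match p with | [[true]] => true | _ => false) && Nat.beq m 5 && !q && bx (-1258291) (-524288) z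
      | _ => p.isEmpty && Nat.beq m 3 && !q && bx (-1572864) 1572864 z)

def lowC (x : Int) (h : Nat) : Nat := (x - h).toNat

def chk1 (K : Cst) (EA EB : Nat) (ks : List (List (List Bool) × Nat × Bool × Nat)) :
    Tr → Int → Int → Nat → Bool
  | .s ta tb tc td, x, y, h' =>
    fN (h' / 2) fun h =>
    fI (x - h) fun x0 => fI (x + h) fun x1 => fI (y - h) fun y0 => fI (y + h) fun y1 =>
      Nat.beq (h + h) h' && chk1 K EA EB ks ta x0 y0 h && chk1 K EA EB ks tb x0 y1 h &&
      chk1 K EA EB ks tc x1 y0 h && chk1 K EA EB ks td x1 y1 h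
  | .l i, x, y, h => match ks[i]? with
    | none => false
    | some t => leaf1 K (sqD x y h) t
  | .o, x, y, h =>
      Nat.blt (EA * EA * (EB * EB))
        (lowC x h * lowC x h * (EB * EB) + lowC y h * lowC y h * (EA * EA))
  | .d, _, _, _ => false

/-! Stage 2 checker -/

structure V3 where
  a : Dk
  b : Dk
  c : Dk

structure Cst2 where
  K : Cst
  KP : Dk
  SS : Dk
  HS : Dk
  ZP : Dk
  ZM : Dk
  QC : Dk
  AA : Dk
  BB : Nat
  T0 : Nat
  N0 : Nat
  EA : Nat
  EB : Nat
  LB : Int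

def V3.dot (u v : V3) : Dk := (u.a.mul v.a).add (((u.b.mul v.c).add (u.c.mul v.b)).hf)

def V3.rot (K : Cst2) (v : V3) (s : Bool) (u : V3) : V3 :=
  let t := K.K.D.mul (u.dot v)
  let ca := (v.b.mul u.c).sub (u.b.mul v.c)
  let cb := (v.a.mul u.b).sub (u.a.mul v.b)
  let cc := (u.a.mul v.c).sub (v.a.mul u.c)
  let J := Dk.muli (bif s then K.HS else K.HS.neg)
  ⟨((K.K.C.mul u.a).add (J.mul ca)).add (t.mul v.a),
   ((K.K.C.mul u.b).add (J.mul (cb.add cb))).add (t.mul v.b),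
   ((K.K.C.mul u.c).add (J.mul (cc.add cc))).add (t.mul v.c)⟩

def V3.rotp (K : Cst2) (s : Bool) (u : V3) : V3 :=
  ⟨u.a, (bif s then K.ZP else K.ZM).mul u.b, (bif s then K.ZM else K.ZP).mul u.c⟩

def axp : V3 := ⟨ex 1, ex 0, ex 0⟩

def axis (p f F : V3) (i : Nat) : V3 :=
  match i with
  | 0 => p
  | 1 => f
  | _ => F

def evalW (K : Cst2) (f F : V3) : List (Nat × Bool) → V3 → V3
  | [], u => u
  | (t, s) :: l, u =>
    match t with
    | 0 => V3.rotp K s (evalW K f F l u)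
    | 1 => V3.rot K f s (evalW K f F l u)
    | _ => V3.rot K F s (evalW K f F l u)

def inE (EA EB : Nat) (z : Dk) : Bool :=
  Nat.blt ((z.x.natAbs + z.r) * (z.x.natAbs + z.r) * (EB * EB) +
    (z.y.natAbs + z.r) * (z.y.natAbs + z.r) * (EA * EA)) (EA * EA * (EB * EB))

/-- Lower bound for the modulus. -/
def sqL (x y : Int) : Nat :=
  fN (x.natAbs * x.natAbs + y.natAbs * y.natAbs) fun X =>
  fN (up x y) fun m => fN ((m + X / m) / 2 + 1) fun m => fN ((m + X / m) / 2 + 1) fun m =>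
  fN (X / m) fun s => bif Nat.ble (s * s) X then s else 0

def Dk.L (a : Dk) : Nat := sqL a.x a.y - a.r

def leaf2 (K : Cst2) (f F : V3) (t : Nat × List (Nat × Bool) × Nat × Nat × Bool × Nat) : Bool :=
  match t with
  | (i, w, j, m, q, mode) =>
    let z := (axis axp f F i).dot (evalW K f F w (axis axp f F j))
    match mode with
    | 0 => test K.K z m q && nv K.K z m q
    | 1 => inE K.EA K.EB z && Nat.blt z.r z.y.natAbs
    | _ => Nat.beq i 1 && Nat.beq j 2 && w.all (fun p => Nat.beq p.1 0) && inE K.EA K.EB z &&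
        decide (K.LB < z.x - z.r)

/-- Enclosure of `1/g` for `g` in the disc with `1 ≤ |g|`. -/
def invD (g : Dk) : Dk :=
  fN (g.x.natAbs * g.x.natAbs + g.y.natAbs * g.y.natAbs) fun n2 =>
  fI (g.x * 1099511627776 / n2) fun hx => fI ((-g.y) * 1099511627776 / n2) fun hy =>
    mk hx hy ((ex 1).sub (Dk.mul ⟨hx, hy, 0⟩ g)).U

/-- Displacement exclusion. -/
def excl (K : Cst2) (g gi : Dk) : Bool :=
  let sm := g.add gi
  let q := K.QC.mul (sm.mul sm)
  fN q.L fun Lq => fN (q.sub (ex 1)).L fun Lv => fN ((q.sub K.AA).L + K.BB) fun LL =>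
  Nat.blt K.T0 Lq ||
  (fN (K.T0 - Lq) fun u => Nat.blt u Lv ||
    (fN (K.N0 * u / 1048576 + 1) fun NU => Nat.blt NU LL &&
      Nat.blt ((K.N0 * K.N0 - 1048576 * 1048576) * (u * u - Lv * Lv))
        ((LL - NU) * (LL - NU) * (1048576 * 1048576))))

def chk2 (K : Cst2) (ks : List (Nat × List (Nat × Bool) × Nat × Nat × Bool × Nat)) :
    Tr → Int → Int → Nat → Bool
  | .s ta tb tc td, x, y, h' =>
    fN (h' / 2) fun h =>
    fI (x - h) fun x0 => fI (x + h) fun x1 => fI (y - h) fun y0 => fI (y + h) fun y1 =>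
      Nat.beq (h + h) h' && chk2 K ks ta x0 y0 h && chk2 K ks tb x0 y1 h &&
      chk2 K ks tc x1 y0 h && chk2 K ks td x1 y1 h
  | .l i, x, y, h => match ks[i]? with
    | none => false
    | some t =>
      let g := sqD x y h
      let gi := invD g
      leaf2 K ⟨K.KP, (K.SS.mul gi).neg, (K.SS.mul g).neg⟩ ⟨K.KP, K.SS.mul g, K.SS.mul gi⟩ t
  | .o, x, y, h =>
      Nat.blt ((x.natAbs + h) * (x.natAbs + h) + (y.natAbs + h) * (y.natAbs + h))
        (1048576 * 1048576)
  | .d, x, y, h =>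
      let g := sqD x y h
      excl K g (invD g)

end Marg

namespace Marg

theorem fN_eq {α : Type} (n : Nat) (f : Nat → α) : fN n f = f n := by
  cases n <;> rfl

theorem fI_eq {α : Type} (i : Int) (f : Int → α) : fI i f = f i := by
  cases i <;> simp [fI, fN_eq]

theorem mk_eq (x y : Int) (r : Nat) : mk x y r = ⟨x, y, r⟩ := by
  simp [mk, fI_eq, fN_eq]

/-- The scaled center. -/
def Dk.c (d : Dk) : ℂ := (d.x : ℂ) + (d.y : ℂ) * Complex.I

/-- Membership in a scaled disc. -/
def Dk.mem (d : Dk) (z : ℂ) : Prop := ‖1048576 * z - d.c‖ ≤ d.r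

theorem up_nat (a b : ℕ) (h : b ≤ a) :
    Real.sqrt ((a:ℝ)^2 + (b:ℝ)^2) ≤ ((Nat.succ (Nat.add a (Nat.div (Nat.mul b 27146) 65536)) : ℕ) : ℝ) := by
  have h1 : (b * 27146 : ℝ) / 65536 ≤ ((b * 27146 / 65536 : ℕ) : ℝ) + 1 := by
    have := Nat.lt_div_mul_add (a := b * 27146) (b := 65536) (by norm_num)
    have h2 : ((b * 27146 : ℕ) : ℝ) < ((b * 27146 / 65536 * 65536 + 65536 : ℕ) : ℝ) := by exact_mod_cast this
    push_cast at h2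
    rw [div_le_iff₀ (by norm_num)]
    linarith
  have h3 : ((Nat.succ (Nat.add a (Nat.div (Nat.mul b 27146) 65536)) : ℕ) : ℝ) =
      a + (((b * 27146 / 65536 : ℕ) : ℝ) + 1) := by
    have : Nat.succ (Nat.add a (Nat.div (Nat.mul b 27146) 65536)) = a + (b * 27146 / 65536 + 1) := rfl
    rw [this]; push_cast; ring
  rw [h3]
  have hb : (0:ℝ) ≤ b := Nat.cast_nonneg _
  have hab : (b:ℝ) ≤ a := by exact_mod_cast h
  refine le_trans ?_ (add_le_add le_rfl h1)
  apply Real.sqrt_le_iff.mpr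
  constructor
  · positivity
  · nlinarith [mul_nonneg hb (sub_nonneg.mpr hab)]

theorem norm_c (d : Dk) : ‖d.c‖ = Real.sqrt ((d.x.natAbs:ℝ)^2 + (d.y.natAbs:ℝ)^2) := by
  have : d.c = ((d.x:ℝ):ℂ) + ((d.y:ℝ):ℂ) * Complex.I := by simp [Dk.c]
  rw [this, Complex.norm_add_mul_I]
  congr 1
  have h : ∀ x : ℤ, ((x.natAbs:ℝ))^2 = (x:ℝ)^2 := by
    intro x
    rw [Nat.cast_natAbs]; simp
  rw [h, h]

theorem up_ge (d : Dk) : ‖d.c‖ ≤ (up d.x d.y : ℝ) := by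
  rw [norm_c]
  simp only [up, fN_eq]
  cases h : Nat.ble d.y.natAbs d.x.natAbs
  · have : d.x.natAbs ≤ d.y.natAbs := by
      have := Nat.ble_eq_true_of_le (n := d.y.natAbs) (m := d.x.natAbs)
      by_contra hh
      rw [this (by omega)] at h
      cases h
    rw [add_comm]
    exact up_nat _ _ this
  · exact up_nat _ _ (Nat.le_of_ble_eq_true h)

theorem mem_add {a b : Dk} {z w : ℂ} (ha : a.mem z) (hb : b.mem w) : (a.add b).mem (z + w) := by
  have e : a.add b = ⟨a.x + b.x, a.y + b.y, a.r + b.r⟩ := rfl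
  rw [e]
  simp only [Dk.mem, Dk.c] at *
  push_cast
  calc _ = ‖(1048576 * z - ((a.x:ℂ) + a.y * Complex.I)) + (1048576 * w - ((b.x:ℂ) + b.y * Complex.I))‖ := by
        congr 1; ring
    _ ≤ _ := (norm_add_le _ _).trans (add_le_add ha hb)

theorem mem_neg {a : Dk} {z : ℂ} (ha : a.mem z) : a.neg.mem (-z) := by
  have e : a.neg = ⟨-a.x, -a.y, a.r⟩ := rfl
  rw [e]
  simp only [Dk.mem, Dk.c] at *
  push_cast
  rw [← norm_neg]
  refine le_trans (le_of_eq ?_) ha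
  congr 1; ring

theorem mem_sub {a b : Dk} {z w : ℂ} (ha : a.mem z) (hb : b.mem w) : (a.sub b).mem (z - w) := by
  have e : a.sub b = ⟨a.x + -b.x, a.y + -b.y, a.r + b.r⟩ := rfl
  rw [e]
  simp only [Dk.mem, Dk.c] at *
  push_cast
  calc _ = ‖(1048576 * z - ((a.x:ℂ) + a.y * Complex.I)) - (1048576 * w - ((b.x:ℂ) + b.y * Complex.I))‖ := by
        congr 1; ring
    _ ≤ _ := (norm_sub_le _ _).trans (add_le_add ha hb)

theorem mem_muli {a : Dk} {z : ℂ} (ha : a.mem z) : a.muli.mem (Complex.I * z) := by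
  have e : a.muli = ⟨-a.y, a.x, a.r⟩ := rfl
  rw [e]
  simp only [Dk.mem, Dk.c] at *
  push_cast
  have : (1048576 * (Complex.I * z) - (-(a.y:ℂ) + a.x * Complex.I)) =
      Complex.I * (1048576 * z - ((a.x:ℂ) + a.y * Complex.I)) := by
    linear_combination (a.y:ℂ) * Complex.I_sq
  rw [this, norm_mul, Complex.norm_I, one_mul]
  exact ha

theorem shI_bd (i : ℤ) : shI i * 1048576 ≤ i ∧ i < shI i * 1048576 + 1048576 := by
  have : shI i = i / 1048576 := by
    cases i with
    | ofNat n => rfl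
    | negSucc n =>
      show Int.negSucc (n / 1048576) = _
      rw [Int.negSucc_ediv _ (by norm_num)]
      rfl
  rw [this]
  omega

theorem norm_shI (p q : ℤ) : ‖((p:ℂ) + q * Complex.I) / 1048576 - ((shI p : ℂ) + (shI q : ℂ) * Complex.I)‖ ≤ 2 := by
  have h1 := shI_bd p
  have h2 := shI_bd q
  have e : ((p:ℂ) + q * Complex.I) / 1048576 - ((shI p : ℂ) + (shI q : ℂ) * Complex.I)
      = (((p - shI p * 1048576 : ℤ):ℝ) / 1048576 : ℝ) + (((q - shI q * 1048576 : ℤ):ℝ)/1048576 : ℝ) * Complex.I := by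
    push_cast; field_simp; ring
  rw [e]
  refine (norm_add_le _ _).trans ?_
  rw [norm_mul, Complex.norm_I, mul_one, Complex.norm_real, Complex.norm_real]
  have k : ∀ p : ℤ, shI p * 1048576 ≤ p ∧ p < shI p * 1048576 + 1048576 → ‖((p - shI p * 1048576 : ℤ):ℝ) / 1048576‖ ≤ 1 := by
    intro p hp
    have a1 : (0:ℝ) ≤ ((p - shI p * 1048576 : ℤ):ℝ) := by exact_mod_cast (by omega)
    have a2 : ((p - shI p * 1048576 : ℤ):ℝ) ≤ 1048576 := by exact_mod_cast (by omega)
    rw [Real.norm_of_nonneg (by positivity)]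
    rw [div_le_one (by norm_num)]; exact a2
  linarith [k p h1, k q h2]

theorem mem_mul {a b : Dk} {z w : ℂ} (ha : a.mem z) (hb : b.mem w) : (a.mul b).mem (z * w) := by
  have e : a.mul b = ⟨shI (a.x * b.x + -(a.y * b.y)), shI (a.x * b.y + a.y * b.x),
    (up a.x a.y * b.r + up b.x b.y * a.r + a.r * b.r) / 1048576 + 3⟩ := rfl
  rw [e]
  set P := a.x * b.x + -(a.y * b.y) with hP
  set Q := a.x * b.y + a.y * b.x with hQ
  set R := up a.x a.y * b.r + up b.x b.y * a.r + a.r * b.r with hR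
  have hR1 : (R:ℝ) / 1048576 ≤ ((R / 1048576 : ℕ):ℝ) + 1 := by
    have := Nat.lt_div_mul_add (a := R) (b := 1048576) (by norm_num)
    have h2 : (R : ℝ) < ((R / 1048576 * 1048576 + 1048576 : ℕ) : ℝ) := by exact_mod_cast this
    push_cast at h2
    rw [div_le_iff₀ (by norm_num)]
    linarith
  have hc : ((P:ℂ) + Q * Complex.I) = a.c * b.c := by
    simp only [Dk.c, hP, hQ]; push_cast
    linear_combination (-(a.y:ℂ) * b.y) * Complex.I_sq
  have key : ‖(1048576 * z) * (1048576 * w) - a.c * b.c‖ ≤ R := by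
    have e2 : (1048576 * z) * (1048576 * w) - a.c * b.c =
      a.c * (1048576 * w - b.c) + b.c * (1048576 * z - a.c) + (1048576 * z - a.c) * (1048576 * w - b.c) := by ring
    rw [e2]
    refine (norm_add₃_le).trans ?_
    rw [norm_mul, norm_mul, norm_mul, hR]
    push_cast
    simp only [Dk.mem] at ha hb
    have := up_ge a
    have := up_ge b
    gcongr
  simp only [Dk.mem, Dk.c]
  have e3 : 1048576 * (z * w) - (((shI P : ℤ):ℂ) + ((shI Q : ℤ):ℂ) * Complex.I)
     = ((1048576 * z) * (1048576 * w) - a.c * b.c) / 1048576 +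
       (((P:ℂ) + Q * Complex.I) / 1048576 - ((shI P : ℂ) + (shI Q : ℂ) * Complex.I)) := by
    rw [hc]; field_simp; ring
  rw [e3]
  refine (norm_add_le _ _).trans ?_
  rw [norm_div]
  have h5 : ‖(1048576:ℂ)‖ = 1048576 := by simp
  rw [h5]
  have h6 := norm_shI P Q
  have h7 : ‖1048576 * z * (1048576 * w) - a.c * b.c‖ / 1048576 ≤ (R:ℝ) / 1048576 := by gcongr
  push_cast
  linarith

theorem mem_hf {a : Dk} {z : ℂ} (ha : a.mem z) : a.hf.mem (z / 2) := by
  have e : a.hf = ⟨a.x / 2, a.y / 2, a.r / 2 + 2⟩ := rfl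
  rw [e]
  simp only [Dk.mem, Dk.c] at *
  have k : ∀ p : ℤ, ‖(p:ℂ) / 2 - ((p / 2 : ℤ):ℂ)‖ ≤ 1/2 := by
    intro p
    rcases Int.even_or_odd' p with ⟨k, rfl | rfl⟩
    · rw [Int.mul_ediv_cancel_left _ (by norm_num)]
      push_cast
      simp
    · have : (2 * k + 1) / 2 = k := by omega
      rw [this]; push_cast
      have : (2 * (k:ℂ) + 1) / 2 - k = 1/2 := by ring
      rw [this]; simp
  have hr : (a.r:ℝ)/2 ≤ ((a.r/2 : ℕ):ℝ) + 1 := by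
    have : a.r ≤ 2 * (a.r / 2) + 2 := by omega
    have : (a.r:ℝ) ≤ 2 * ((a.r / 2 : ℕ):ℝ) + 2 := by exact_mod_cast this
    linarith
  have e3 : 1048576 * (z / 2) - (((a.x/2 : ℤ):ℂ) + ((a.y/2 : ℤ):ℂ) * Complex.I) =
     (1048576 * z - ((a.x:ℂ) + a.y * Complex.I)) / 2 + ((a.x:ℂ)/2 - ((a.x / 2 : ℤ):ℂ)) +
      ((a.y:ℂ)/2 - ((a.y / 2 : ℤ):ℂ)) * Complex.I := by ring
  rw [e3]
  refine norm_add₃_le.trans ?_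
  rw [norm_mul, Complex.norm_I, norm_div]
  have h2 : ‖(2:ℂ)‖ = 2 := by simp
  rw [h2]
  push_cast
  linarith [k a.x, k a.y]

theorem mem_ex (n : ℤ) : (ex n).mem n := by
  simp [Dk.mem, Dk.c, ex, mul_comm]

theorem mem_ex0 : (ex 0).mem 0 := by simpa using mem_ex 0
theorem mem_ex1 : (ex 1).mem 1 := by simpa using mem_ex 1
theorem mem_ex4 : (ex 4).mem 4 := by simpa using mem_ex 4

theorem mem_U {a : Dk} {z : ℂ} (ha : a.mem z) : 1048576 * ‖z‖ ≤ a.U := by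
  have h5 : ‖(1048576:ℂ)‖ = 1048576 := by simp
  rw [← h5, ← norm_mul]
  have : (1048576:ℂ) * z = (1048576 * z - a.c) + a.c := by ring
  rw [this]
  refine (norm_add_le _ _).trans ?_
  simp only [Dk.U]; push_cast
  have := up_ge a
  simp only [Dk.mem] at ha
  linarith

theorem mem_re {a : Dk} {z : ℂ} (ha : a.mem z) : |1048576 * z.re - a.x| ≤ a.r := by
  have := (Complex.abs_re_le_norm (1048576 * z - a.c)).trans ha
  simpa [Dk.c] using this
theorem mem_im {a : Dk} {z : ℂ} (ha : a.mem z) : |1048576 * z.im - a.y| ≤ a.r := by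
  have := (Complex.abs_im_le_norm (1048576 * z - a.c)).trans ha
  simpa [Dk.c] using this

theorem blt_iff (a b : ℕ) : Nat.blt a b = true ↔ a < b := by
  simp [Nat.blt]

theorem natAbs_gt {x : ℤ} {r : ℕ} {t : ℝ} (h : r < x.natAbs) (ht : |1048576 * t - x| ≤ r) : t ≠ 0 := by
  rintro rfl
  simp at ht
  have h1 : ((x.natAbs : ℕ):ℝ) = |(x:ℝ)| := by rw [Nat.cast_natAbs]; simp
  have h2 : (r:ℝ) < x.natAbs := by exact_mod_cast h
  linarith

theorem mem_nz {a : Dk} {z : ℂ} (ha : a.mem z) (h : a.nz = true) : z ≠ 0 := by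
  simp only [Dk.nz, Bool.or_eq_true, blt_iff] at h
  rintro rfl
  rcases h with h | h
  · exact natAbs_gt h (mem_re ha) rfl
  · exact natAbs_gt h (mem_im ha) rfl

theorem sqD_eq (x y : ℤ) (h : ℕ) : sqD x y h = ⟨x, y, h * 185364 / 131072 + 1⟩ := by rw [← mk_eq]; rfl

theorem mem_sqD {x y : ℤ} {h : ℕ} {z : ℂ} (h1 : |1048576 * z.re - x| ≤ h) (h2 : |1048576 * z.im - y| ≤ h) :
    (sqD x y h).mem z := by
  rw [sqD_eq]
  simp only [Dk.mem, Dk.c]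
  have e : 1048576 * z - ((x:ℂ) + y * Complex.I) = ((1048576 * z.re - x : ℝ):ℂ) + ((1048576 * z.im - y:ℝ):ℂ) * Complex.I := by
    apply Complex.ext <;> simp
  rw [e, Complex.norm_add_mul_I]
  have hh : (h * 185364:ℝ) / 131072 ≤ ((h * 185364 / 131072 : ℕ):ℝ) + 1 := by
    have := Nat.lt_div_mul_add (a := h * 185364) (b := 131072) (by norm_num)
    have h2 : ((h * 185364 : ℕ) : ℝ) < ((h * 185364 / 131072 * 131072 + 131072 : ℕ) : ℝ) := by exact_mod_cast this
    push_cast at h2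
    rw [div_le_iff₀ (by norm_num)]
    linarith
  push_cast
  refine le_trans ?_ hh
  have hn : (0:ℝ) ≤ h := Nat.cast_nonneg _
  apply Real.sqrt_le_iff.mpr
  constructor
  · positivity
  · have a1 := sq_le_sq' (abs_le.mp h1).1 (abs_le.mp h1).2
    have a2 := sq_le_sq' (abs_le.mp h2).1 (abs_le.mp h2).2
    nlinarith

end Marg

namespace Marg

/-- Trace-free 2×2 matrices `[[a, b], [c, -a]]`, as vectors. -/
@[ext] structure W3 where
  a : ℂ
  b : ℂ
  c : ℂ

def dot (u v : W3) : ℂ := u.a * v.a + (u.b * v.c + u.c * v.b) / 2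
def W3.neg (u : W3) : W3 := ⟨-u.a, -u.b, -u.c⟩
/-- Half of the commutator `[v, u]`. -/
def cr (v u : W3) : W3 :=
  ⟨(v.b * u.c - u.b * v.c) / 2, v.a * u.b - u.a * v.b, u.a * v.c - v.a * u.c⟩
/-- Rotation about `v` with angle given by `c2`, `s2`. -/
def rot (c2 s2 : ℝ) (v : W3) (σ : ℂ) (u : W3) : W3 :=
  ⟨c2 * u.a + (1 - c2) * dot u v * v.a + σ * Complex.I * s2 * (cr v u).a,
   c2 * u.b + (1 - c2) * dot u v * v.b + σ * Complex.I * s2 * (cr v u).b,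
   c2 * u.c + (1 - c2) * dot u v * v.c + σ * Complex.I * s2 * (cr v u).c⟩

def sg (s : Bool) : ℂ := bif s then 1 else -1

/-- Chebyshev polynomials of the second kind, shifted pair. -/
def Up (T : ℂ) : ℕ → ℂ × ℂ
  | 0 => (0, 1)
  | m + 1 => ((Up T m).2, T * (Up T m).2 - (Up T m).1)

def Tq (c2 : ℝ) (q : Bool) (κ : ℂ) : ℂ := bif q then (1 + c2) + (1 - c2) * κ else (1 + c2) - (1 - c2) * κ

/-- A set of axes of elliptics in a discrete group. -/
structure AxSys (c2 s2 : ℝ) (Ax : W3 → Prop) : Prop where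
  unit : ∀ v, Ax v → dot v v = 1
  neg : ∀ v, Ax v → Ax v.neg
  rot : ∀ v u, Ax v → Ax u → ∀ s : Bool, Ax (rot c2 s2 v (sg s) u)
  test : ∀ u v, Ax u → Ax v → ∀ (m : ℕ) (q : Bool),
    (‖Tq c2 q (dot u v) ^ 2 - 4‖ + ‖(1 - c2 : ℂ) ^ 2 * (dot u v ^ 2 - 1)‖) *
      ‖(Up (Tq c2 q (dot u v)) m).1‖ ^ 2 < 1 →
    dot u v ^ 2 = 1 ∨ (Up (Tq c2 q (dot u v)) m).1 = 0

/-- `κ` is the inner product of two axes. -/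
def PP (Ax : W3 → Prop) (κ : ℂ) : Prop := ∃ u v, Ax u ∧ Ax v ∧ dot u v = κ

structure Cst.ok (K : Cst) (c2 : ℝ) : Prop where
  C : K.C.mem c2
  S : K.S.mem (1 - c2 ^ 2)
  D : K.D.mem (1 - c2)
  DD : K.DD.mem ((1 - c2) ^ 2)
  C1 : K.C1.mem (1 + c2)

def lin (e e1 : W3) (s2 : ℝ) (α β γ : ℂ) : W3 :=
  ⟨α * e.a + β * e1.a + γ * (Complex.I * s2 * (cr e e1).a),
   α * e.b + β * e1.b + γ * (Complex.I * s2 * (cr e e1).b),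
   α * e.c + β * e1.c + γ * (Complex.I * s2 * (cr e e1).c)⟩

theorem rot_lin1 (c2 s2 : ℝ) (hcs : c2 ^ 2 + s2 ^ 2 = 1) (e e1 : W3) (h1 : dot e1 e1 = 1)
    (σ α β γ : ℂ) :
    rot c2 s2 e1 σ (lin e e1 s2 α β γ) =
    lin e e1 s2 (c2 * α + (1 - c2 ^ 2) * (σ * γ))
      (β + dot e e1 * ((1 - c2) * α - (1 - c2 ^ 2) * (σ * γ))) (c2 * γ - σ * α) := by
  have hcs' : (1 - c2 ^ 2 : ℂ) = s2 ^ 2 := by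
    have : (1 - c2 ^ 2 : ℝ) = s2 ^ 2 := by linarith
    exact_mod_cast this
  rw [hcs']
  have hI := Complex.I_sq
  simp only [dot] at h1
  simp only [rot, lin, W3.mk.injEq, dot, cr]
  refine ⟨?_, ?_, ?_⟩
  · linear_combination ((1 - c2) * β * e1.a + σ * γ * s2 ^ 2 * e.a) * h1 +
      (σ * γ * s2 ^ 2 * ((e.a * e1.a + (e.b * e1.c + e.c * e1.b) / 2) * e1.a - (e1.a * e1.a + (e1.b * e1.c + e1.c * e1.b) / 2) * e.a)) * hI
  · linear_combination ((1 - c2) * β * e1.b + σ * γ * s2 ^ 2 * e.b) * h1 +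
      (σ * γ * s2 ^ 2 * ((e.a * e1.a + (e.b * e1.c + e.c * e1.b) / 2) * e1.b - (e1.a * e1.a + (e1.b * e1.c + e1.c * e1.b) / 2) * e.b)) * hI
  · linear_combination ((1 - c2) * β * e1.c + σ * γ * s2 ^ 2 * e.c) * h1 +
      (σ * γ * s2 ^ 2 * ((e.a * e1.a + (e.b * e1.c + e.c * e1.b) / 2) * e1.c - (e1.a * e1.a + (e1.b * e1.c + e1.c * e1.b) / 2) * e.c)) * hI

theorem rot_lin0 (c2 s2 : ℝ) (hcs : c2 ^ 2 + s2 ^ 2 = 1) (e e1 : W3) (h1 : dot e e = 1)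
    (σ α β γ : ℂ) :
    rot c2 s2 e σ (lin e e1 s2 α β γ) =
    lin e e1 s2 (α + dot e e1 * ((1 - c2) * β + (1 - c2 ^ 2) * (σ * γ)))
      (c2 * β - (1 - c2 ^ 2) * (σ * γ)) (c2 * γ + σ * β) := by
  have hcs' : (1 - c2 ^ 2 : ℂ) = s2 ^ 2 := by
    have : (1 - c2 ^ 2 : ℝ) = s2 ^ 2 := by linarith
    exact_mod_cast this
  rw [hcs']
  have hI := Complex.I_sq
  simp only [dot] at h1
  simp only [rot, lin, W3.mk.injEq, dot, cr]
  refine ⟨?_, ?_, ?_⟩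
  · linear_combination ((1 - c2) * α * e.a - σ * γ * s2 ^ 2 * e1.a) * h1 -
      (σ * γ * s2 ^ 2 * ((e.a * e1.a + (e.b * e1.c + e.c * e1.b) / 2) * e.a - (e.a * e.a + (e.b * e.c + e.c * e.b) / 2) * e1.a)) * hI
  · linear_combination ((1 - c2) * α * e.b - σ * γ * s2 ^ 2 * e1.b) * h1 -
      (σ * γ * s2 ^ 2 * ((e.a * e1.a + (e.b * e1.c + e.c * e1.b) / 2) * e.b - (e.a * e.a + (e.b * e.c + e.c * e.b) / 2) * e1.b)) * hI
  · linear_combination ((1 - c2) * α * e.c - σ * γ * s2 ^ 2 * e1.c) * h1 -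
      (σ * γ * s2 ^ 2 * ((e.a * e1.a + (e.b * e1.c + e.c * e1.b) / 2) * e.c - (e.a * e.a + (e.b * e.c + e.c * e.b) / 2) * e1.c)) * hI

/-- exact version of `wordAux`. -/
def wordC (c2 : ℝ) (k : ℂ) : List Bool → Bool → ℂ × ℂ × ℂ
  | [], odd => bif odd then (0, 1, 0) else (1, 0, 0)
  | s :: l, odd =>
    let t := wordC c2 k l (!odd)
    bif odd then
      (c2 * t.1 + (1 - c2 ^ 2) * (sg s * t.2.2),
        t.2.1 + k * ((1 - c2) * t.1 - (1 - c2 ^ 2) * (sg s * t.2.2)), c2 * t.2.2 - sg s * t.1)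
    else
      (t.1 + k * ((1 - c2) * t.2.1 + (1 - c2 ^ 2) * (sg s * t.2.2)),
        c2 * t.2.1 - (1 - c2 ^ 2) * (sg s * t.2.2), c2 * t.2.2 + sg s * t.2.1)

theorem mem_sg {d : Dk} {z : ℂ} (h : d.mem z) (s : Bool) : (bif s then d else d.neg).mem (sg s * z) := by
  cases s
  · simpa [sg] using mem_neg h
  · simpa [sg] using h

theorem wordAux_mem {K : Cst} {c2 : ℝ} (hK : K.ok c2) {k : Dk} {κ : ℂ} (hk : k.mem κ) (l : List Bool) :
    ∀ odd : Bool, (wordAux K k l odd).1.mem (wordC c2 κ l odd).1 ∧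
      (wordAux K k l odd).2.1.mem (wordC c2 κ l odd).2.1 ∧
      (wordAux K k l odd).2.2.mem (wordC c2 κ l odd).2.2 := by
  induction l with
  | nil =>
    intro odd
    cases odd <;> simp [wordAux, wordC, mem_ex0, mem_ex1]
  | cons s l ih =>
    intro odd
    obtain ⟨ha, hb, hg⟩ := ih (!odd)
    have hs := mem_mul hK.S (mem_sg hg s)
    cases odd
    · exact ⟨mem_add ha (mem_mul hk (mem_add (mem_mul hK.D hb) hs)), mem_sub (mem_mul hK.C hb) hs,
        mem_add (mem_mul hK.C hg) (mem_sg hb s)⟩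
    · exact ⟨mem_add (mem_mul hK.C ha) hs, mem_add hb (mem_mul hk (mem_sub (mem_mul hK.D ha) hs)),
        mem_sub (mem_mul hK.C hg) (mem_sg ha s)⟩

def wordV (c2 : ℝ) (w : List Bool) (k : ℂ) : ℂ := (wordC c2 k w true).1 + (wordC c2 k w true).2.1 * k

theorem word_mem {K : Cst} {c2 : ℝ} (hK : K.ok c2) {k : Dk} {κ : ℂ} (hk : k.mem κ) (l : List Bool) :
    (word K l k).mem (wordV c2 l κ) := by
  obtain ⟨ha, hb, _⟩ := wordAux_mem hK hk l true
  exact mem_add ha (mem_mul hb hk)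

theorem wordC_ax {c2 s2 : ℝ} {Ax : W3 → Prop} (hA : AxSys c2 s2 Ax) (hcs : c2 ^ 2 + s2 ^ 2 = 1)
    {e e1 : W3} (he : Ax e) (he1 : Ax e1) (l : List Bool) : ∀ odd : Bool,
    Ax (lin e e1 s2 (wordC c2 (dot e e1) l odd).1 (wordC c2 (dot e e1) l odd).2.1
      (wordC c2 (dot e e1) l odd).2.2) := by
  induction l with
  | nil =>
    intro odd
    cases odd
    · simpa [wordC, lin] using he
    · simpa [wordC, lin] using he1
  | cons s l ih =>
    intro odd
    cases odd
    · have := hA.rot _ _ he (ih true) s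
      rwa [rot_lin0 c2 s2 hcs e e1 (hA.unit _ he)] at this
    · have := hA.rot _ _ he1 (ih false) s
      rwa [rot_lin1 c2 s2 hcs e e1 (hA.unit _ he1)] at this

theorem dot_lin (e e1 : W3) (s2 : ℝ) (α β γ : ℂ) (h : dot e e = 1) :
    dot e (lin e e1 s2 α β γ) = α + β * dot e e1 := by
  simp only [dot] at h
  simp only [dot, lin, cr]
  linear_combination α * h

theorem PP_word {c2 s2 : ℝ} {Ax : W3 → Prop} (hA : AxSys c2 s2 Ax) (hcs : c2 ^ 2 + s2 ^ 2 = 1)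
    {κ : ℂ} (h : PP Ax κ) (l : List Bool) : PP Ax (wordV c2 l κ) := by
  obtain ⟨u, v, hu, hv, rfl⟩ := h
  exact ⟨u, _, hu, wordC_ax hA hcs hu hv l true, dot_lin _ _ _ _ _ _ (hA.unit _ hu)⟩

theorem PP_neg {c2 s2 : ℝ} {Ax : W3 → Prop} (hA : AxSys c2 s2 Ax) {κ : ℂ} (h : PP Ax κ) : PP Ax (-κ) := by
  obtain ⟨u, v, hu, hv, rfl⟩ := h
  exact ⟨u, _, hu, hA.neg _ hv, by simp [dot, W3.neg]; ring⟩

theorem Uit_mem {T : Dk} {t : ℂ} (h : T.mem t) (m : ℕ) :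
    (Uit T m).1.mem (Up t m).1 ∧ (Uit T m).2.mem (Up t m).2 := by
  induction m with
  | zero => exact ⟨mem_ex0, mem_ex1⟩
  | succ m ih => exact ⟨ih.2, mem_sub (mem_mul h ih.2) ih.1⟩

theorem mem_Tq {K : Cst} {c2 : ℝ} (hK : K.ok c2) {k : Dk} {κ : ℂ} (hk : k.mem κ) (q : Bool) :
    (bif q then K.C1.add (K.D.mul k) else K.C1.sub (K.D.mul k)).mem (Tq c2 q κ) := by
  cases q <;> simp only [Tq, cond_false, cond_true]
  · exact mem_sub hK.C1 (mem_mul hK.D hk)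
  · exact mem_add hK.C1 (mem_mul hK.D hk)

theorem test_sound {c2 s2 : ℝ} {Ax : W3 → Prop} (hA : AxSys c2 s2 Ax) {K : Cst} (hK : K.ok c2)
    {k : Dk} {κ : ℂ} (hk : k.mem κ) (h : PP Ax κ) (m : ℕ) (q : Bool) (ht : test K k m q = true) :
    κ ^ 2 = 1 ∨ (Up (Tq c2 q κ) m).1 = 0 := by
  obtain ⟨u, v, hu, hv, he⟩ := h
  have key := hA.test u v hu hv m q
  rw [he] at key
  refine key ?_
  clear key
  simp only [test, blt_iff] at ht
  have hT := mem_Tq hK hk q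
  generalize (bif q then K.C1.add (K.D.mul k) else K.C1.sub (K.D.mul k)) = T at hT ht
  have hw := mem_U (mem_mul hK.DD (mem_sub (mem_mul hk hk) mem_ex1))
  have hb := mem_U (mem_sub (mem_mul hT hT) mem_ex4)
  have hu' := mem_U (Uit_mem hT m).1
  rw [← sq] at hb hw
  generalize ((K.DD.mul ((k.mul k).sub (ex 1))).U) = N1 at *
  generalize ((T.mul T).sub (ex 4)).U = N2 at *
  generalize (Uit T m).1.U = N3 at *
  have ht' : ((N2:ℝ) + N1) * N3 * N3 < 1048576 * 1048576 * 1048576 := by exact_mod_cast ht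
  have hx := norm_nonneg ((1 - c2 : ℂ) ^ 2 * (κ ^ 2 - 1))
  have hy := norm_nonneg (Tq c2 q κ ^ 2 - 4)
  have hz := norm_nonneg (Up (Tq c2 q κ) m).1
  generalize ‖(1 - c2 : ℂ) ^ 2 * (κ ^ 2 - 1)‖ = x at *
  generalize ‖Tq c2 q κ ^ 2 - 4‖ = y at *
  generalize ‖(Up (Tq c2 q κ) m).1‖ = z at *
  have h1 : (1048576 * y + 1048576 * x) * (1048576 * z) * (1048576 * z) ≤ ((N2:ℝ) + N1) * N3 * N3 := by
    gcongr
  nlinarith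

theorem nv_sound {K : Cst} {c2 : ℝ} (hK : K.ok c2) {k : Dk} {κ : ℂ} (hk : k.mem κ) (m : ℕ) (q : Bool)
    (h : nv K k m q = true) : ¬ (κ ^ 2 = 1 ∨ (Up (Tq c2 q κ) m).1 = 0) := by
  simp only [nv, Bool.and_eq_true] at h
  obtain ⟨⟨h1, h2⟩, h3⟩ := h
  have a1 := mem_nz (Uit_mem (mem_Tq hK hk q) m).1 h1
  have a2 := mem_nz (mem_sub hk mem_ex1) h2
  have a3 := mem_nz (mem_add hk mem_ex1) h3
  rintro (h | h)
  · have : (κ - 1) * (κ + 1) = 0 := by linear_combination h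
    rcases mul_eq_zero.mp this with h | h
    · exact a2 h
    · exact a3 h
  · exact a1 h

/-- The outcome of stage 1. -/
def R1 (M : ℕ → Bool) (c2 : ℝ) (κ : ℂ) : Prop :=
  κ ^ 2 = 1 ∨ (M 2 = true ∧ ∃ q, Tq c2 q κ = 0) ∨
  (M 3 = true ∧ (Up (Tq c2 true κ) 5).1 = 0 ∧ 0.5 < κ.re ∧ κ.re < 1.21) ∨
  (M 4 = true ∧ (wordV c2 [true] κ) ^ 2 = 1 ∧ (wordV c2 [true] κ).re < 0) ∨
  (M 4 = true ∧ (Up (Tq c2 false (wordV c2 [true] κ)) 5).1 = 0 ∧ -1.21 < (wordV c2 [true] κ).re ∧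
    (wordV c2 [true] κ).re < -0.5) ∨
  ((∃ j, 5 ≤ j ∧ M j = true) ∧ (Up (Tq c2 false κ) 3).1 = 0 ∧ -1.5 ≤ κ.re ∧ κ.re ≤ 1.5)

theorem bx_sound {lo hi : ℤ} {z : Dk} {κ : ℂ} (hz : z.mem κ) (h : bx lo hi z = true) :
    (lo:ℝ) < 1048576 * κ.re ∧ 1048576 * κ.re < hi := by
  simp only [bx, Bool.and_eq_true, decide_eq_true_eq] at h
  have := abs_le.mp (mem_re hz)
  have h1 : (lo:ℝ) < z.x - z.r := by exact_mod_cast h.1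
  have h2 : (z.x:ℝ) + z.r < hi := by exact_mod_cast h.2
  constructor <;> linarith

theorem fold_sound {c2 s2 : ℝ} {Ax : W3 → Prop} (hA : AxSys c2 s2 Ax) (hcs : c2 ^ 2 + s2 ^ 2 = 1)
    {K : Cst} (hK : K.ok c2) (p : List (List Bool)) : ∀ {k : Dk} {κ : ℂ}, k.mem κ → PP Ax κ →
    (p.foldl (fun z w => word K w z) k).mem (p.foldl (fun z w => wordV c2 w z) κ) ∧
    PP Ax (p.foldl (fun z w => wordV c2 w z) κ) := by
  induction p with
  | nil => intro k κ h1 h2; exact ⟨h1, h2⟩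
  | cons w p ih => intro k κ h1 h2; exact ih (word_mem hK h1 w) (PP_word hA hcs h2 w)

theorem five_le (j : ℕ) (h0 : j = 0 → False) (h1 : j = 1 → False) (h2 : j = 2 → False)
    (h3 : j = 3 → False) (h4 : j = 4 → False) : 5 ≤ j := by
  by_contra h
  interval_cases j <;> simp_all

theorem leaf1_sound {c2 s2 : ℝ} {Ax : W3 → Prop} (hA : AxSys c2 s2 Ax) (hcs : c2 ^ 2 + s2 ^ 2 = 1)
    {K : Cst} (hK : K.ok c2) {k : Dk} {κ : ℂ} (hk : k.mem κ) (h : PP Ax κ)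
    (M : ℕ → Bool) (t : List (List Bool) × Nat × Bool × Nat) (hM : M t.2.2.2 = true)
    (ht : leaf1 K k t = true) : R1 M c2 κ := by
  obtain ⟨p, m, q, mode⟩ := t
  simp only at hM
  obtain ⟨hm, hP⟩ := fold_sound hA hcs hK p hk h
  simp only [leaf1, Bool.and_eq_true] at ht
  obtain ⟨h1, h2⟩ := ht
  have h3 := test_sound hA hK hm hP m q h1
  split at h2
  · exact absurd h3 (nv_sound hK hm m q h2)
  · simp only [Bool.and_eq_true, List.isEmpty_iff, Nat.beq_eq] at h2
    obtain ⟨rfl, rfl⟩ := h2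
    simp [Up] at h3
    rcases h3 with h | h <;> exact Or.inl (by simp [h])
  · simp only [Bool.and_eq_true, List.isEmpty_iff, Nat.beq_eq] at h2
    obtain ⟨rfl, rfl⟩ := h2
    rcases h3 with h | h
    · exact Or.inl h
    · right; left; exact ⟨hM, q, by simpa [Up] using h⟩
  · simp only [Bool.and_eq_true, List.isEmpty_iff, Nat.beq_eq] at h2
    obtain ⟨⟨⟨rfl, rfl⟩, rfl⟩, hb⟩ := h2
    rcases h3 with h | h
    · exact Or.inl h
    · right; right; left
      have := bx_sound hm hb
      simp only [List.foldl_nil] at this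
      push_cast at this
      exact ⟨hM, h, by linarith [this.1], by linarith [this.2]⟩
  · simp only [Bool.and_eq_true, Nat.beq_eq, Bool.not_eq_true'] at h2
    obtain ⟨⟨⟨hp, rfl⟩, rfl⟩, hb⟩ := h2
    have hp : p = [[true]] := by
      revert hp; split <;> simp
    subst hp
    have := bx_sound hm hb
    simp only [List.foldl_nil, List.foldl_cons] at this h3
    push_cast at this
    rcases h3 with h | h
    · right; right; right; left; exact ⟨hM, h, by linarith [this.2]⟩
    · right; right; right; right; left
      exact ⟨hM, h, by linarith [this.1], by linarith [this.2]⟩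
  · simp only [Bool.and_eq_true, List.isEmpty_iff, Nat.beq_eq, Bool.not_eq_true'] at h2
    obtain ⟨⟨⟨rfl, rfl⟩, rfl⟩, hb⟩ := h2
    rcases h3 with h | h
    · exact Or.inl h
    · right; right; right; right; right
      have := bx_sound hm hb
      simp only [List.foldl_nil] at this
      push_cast at this
      exact ⟨⟨mode, five_le mode ‹_› ‹_› ‹_› ‹_› ‹_›, hM⟩, h, by linarith [this.1], by linarith [this.2]⟩

/-- Inside the scaled ellipse. -/
def InE (EA EB : ℕ) (z : ℂ) : Prop :=
  (1048576 * z.re) ^ 2 * (EB:ℝ) ^ 2 + (1048576 * z.im) ^ 2 * (EA:ℝ) ^ 2 ≤ (EA:ℝ) ^ 2 * (EB:ℝ) ^ 2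

theorem sq_split {t : ℝ} {x : ℤ} {h : ℕ} (h0 : |t - x| ≤ ((h + h : ℕ):ℝ)) :
    |t - ((x - h : ℤ):ℝ)| ≤ h ∨ |t - ((x + h : ℤ):ℝ)| ≤ h := by
  push_cast at *
  rw [abs_le] at h0
  simp only [abs_le]
  rcases le_total t x with h | h
  · left; constructor <;> linarith
  · right; constructor <;> linarith

theorem lowC_le {t : ℝ} {x : ℤ} {h : ℕ} (ht : 0 ≤ t) (h0 : |t - x| ≤ h) : (lowC x h : ℝ) ≤ t := by
  have h1 := (abs_le.mp h0).1
  rcases le_total 0 (x - h) with h2 | h2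
  · have : ((lowC x h : ℕ) : ℤ) = x - h := Int.toNat_of_nonneg h2
    have : ((lowC x h : ℕ) : ℝ) = x - h := by exact_mod_cast this
    rw [this]; linarith
  · have : lowC x h = 0 := Int.toNat_of_nonpos h2
    rw [this]; simpa using ht

theorem chk1_sound {c2 s2 : ℝ} {Ax : W3 → Prop} (hA : AxSys c2 s2 Ax) (hcs : c2 ^ 2 + s2 ^ 2 = 1)
    {K : Cst} (hK : K.ok c2) (EA EB : ℕ) (ks : List (List (List Bool) × Nat × Bool × Nat))
    {κ : ℂ} (hP : PP Ax κ) (hE : InE EA EB κ) (h0 : 0 ≤ κ.re) (h0' : 0 ≤ κ.im) (M : ℕ → Bool)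
    (hM : ks.all (fun t => M t.2.2.2) = true) (tr : Tr) :
    ∀ (x y : ℤ) (h : ℕ), chk1 K EA EB ks tr x y h = true →
    |1048576 * κ.re - x| ≤ h → |1048576 * κ.im - y| ≤ h → R1 M c2 κ := by
  induction tr with
  | s ta tb tc td ia ib ic id =>
    intro x y h hc hx hy
    simp only [chk1, fN_eq, fI_eq, Bool.and_eq_true, Nat.beq_eq] at hc
    obtain ⟨⟨⟨⟨h1, h2⟩, h3⟩, h4⟩, h5⟩ := hc
    rw [← h1] at hx hy
    rcases sq_split hx with hx | hx <;> rcases sq_split hy with hy | hy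
    · exact ia _ _ _ h2 hx hy
    · exact ib _ _ _ h3 hx hy
    · exact ic _ _ _ h4 hx hy
    · exact id _ _ _ h5 hx hy
  | l i =>
    intro x y h hc hx hy
    simp only [chk1] at hc
    split at hc
    · cases hc
    · rename_i t he
      have := List.all_eq_true.mp hM t (List.mem_of_getElem? he)
      exact leaf1_sound hA hcs hK (mem_sqD hx hy) hP M _ this hc
  | o =>
    intro x y h hc hx hy
    exfalso
    simp only [chk1, blt_iff] at hc
    have hc' : (EA:ℝ) * EA * (EB * EB) < lowC x h * lowC x h * (EB * EB) + lowC y h * lowC y h * (EA * EA) := by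
      exact_mod_cast hc
    have a1 := lowC_le (by positivity) hx
    have a2 := lowC_le (by positivity) hy
    simp only [InE] at hE
    have b1 : (lowC x h : ℝ) * lowC x h * (EB * EB) ≤ (1048576 * κ.re) * (1048576 * κ.re) * (EB * EB) := by
      gcongr
    have b2 : (lowC y h : ℝ) * lowC y h * (EA * EA) ≤ (1048576 * κ.im) * (1048576 * κ.im) * (EA * EA) := by
      gcongr
    nlinarith
  | d =>
    intro x y h hc
    simp [chk1] at hc

def W3.conj (u : W3) : W3 := ⟨(starRingEnd ℂ) u.a, (starRingEnd ℂ) u.b, (starRingEnd ℂ) u.c⟩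

theorem star_two : (starRingEnd ℂ) 2 = 2 := Complex.conj_ofNat 2
theorem star_four : (starRingEnd ℂ) 4 = 4 := Complex.conj_ofNat 4

theorem dot_conj (u v : W3) : dot u.conj v.conj = (starRingEnd ℂ) (dot u v) := by
  simp [dot, W3.conj, star_two]

theorem conj_conj' (u : W3) : u.conj.conj = u := by simp [W3.conj]

theorem rot_conj (c2 s2 : ℝ) (v u : W3) (s : Bool) :
    (rot c2 s2 v (sg s) u).conj = rot c2 s2 v.conj (sg (!s)) u.conj := by
  cases s <;> simp [rot, W3.conj, sg, cr, dot, star_two]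

theorem Tq_conj (c2 : ℝ) (q : Bool) (κ : ℂ) : Tq c2 q ((starRingEnd ℂ) κ) = (starRingEnd ℂ) (Tq c2 q κ) := by
  cases q <;> simp [Tq]

theorem Up_conj (T : ℂ) (m : ℕ) : (Up ((starRingEnd ℂ) T) m).1 = (starRingEnd ℂ) (Up T m).1 ∧
    (Up ((starRingEnd ℂ) T) m).2 = (starRingEnd ℂ) (Up T m).2 := by
  induction m with
  | zero => simp [Up]
  | succ m ih => simp [Up, ih.1, ih.2]

theorem AxSys.conj {c2 s2 : ℝ} {Ax : W3 → Prop} (hA : AxSys c2 s2 Ax) :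
    AxSys c2 s2 (fun v => Ax v.conj) where
  unit v hv := by
    have := hA.unit _ hv
    rw [dot_conj] at this
    have := congrArg (starRingEnd ℂ) this
    simpa using this
  neg v hv := by
    have := hA.neg _ hv
    simpa [W3.neg, W3.conj] using this
  rot v u hv hu s := by
    simp only [rot_conj]
    exact hA.rot _ _ hv hu _
  test u v hu hv m q h := by
    have key := hA.test _ _ hu hv m q
    rw [dot_conj, Tq_conj, (Up_conj _ _).1] at key
    have e1 : ‖(starRingEnd ℂ) (Tq c2 q (dot u v)) ^ 2 - 4‖ = ‖Tq c2 q (dot u v) ^ 2 - 4‖ := by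
      rw [← Complex.norm_conj]; simp [star_four]
    have e2 : ‖(1 - c2 : ℂ) ^ 2 * ((starRingEnd ℂ) (dot u v) ^ 2 - 1)‖ =
        ‖(1 - c2 : ℂ) ^ 2 * (dot u v ^ 2 - 1)‖ := by
      rw [← Complex.norm_conj]; simp
    rw [e1, e2, Complex.norm_conj] at key
    rcases key h with h | h
    · left
      have := congrArg (starRingEnd ℂ) h
      simpa using this
    · right
      simpa using h

theorem PP_conj {Ax : W3 → Prop} {κ : ℂ} (h : PP Ax κ) :
    PP (fun v => Ax v.conj) ((starRingEnd ℂ) κ) := by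
  obtain ⟨u, v, hu, hv, rfl⟩ := h
  exact ⟨u.conj, v.conj, by simpa [conj_conj'] using hu, by simpa [conj_conj'] using hv, dot_conj _ _⟩

theorem InE_neg {EA EB : ℕ} {κ : ℂ} (h : InE EA EB κ) : InE EA EB (-κ) := by
  simpa [InE] using h
theorem InE_conj {EA EB : ℕ} {κ : ℂ} (h : InE EA EB κ) : InE EA EB ((starRingEnd ℂ) κ) := by
  simpa [InE] using h

theorem InE_re {EA EB : ℕ} {κ : ℂ} (hB : 0 < EB) (h : InE EA EB κ) : |1048576 * κ.re| ≤ EA := by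
  have hB' : (0:ℝ) < EB := by exact_mod_cast hB
  simp only [InE] at h
  apply abs_le_of_sq_le_sq _ (Nat.cast_nonneg _)
  have : 0 ≤ (1048576 * κ.im) ^ 2 * (EA:ℝ) ^ 2 := by positivity
  exact le_of_mul_le_mul_right (by linarith) (by positivity : 0 < (EB:ℝ)^2)

theorem InE_im {EA EB : ℕ} {κ : ℂ} (hA : 0 < EA) (h : InE EA EB κ) : |1048576 * κ.im| ≤ EB := by
  have hA' : (0:ℝ) < EA := by exact_mod_cast hA
  simp only [InE] at h
  apply abs_le_of_sq_le_sq _ (Nat.cast_nonneg _)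
  have : 0 ≤ (1048576 * κ.re) ^ 2 * (EB:ℝ) ^ 2 := by positivity
  exact le_of_mul_le_mul_right (by linarith) (by positivity : 0 < (EA:ℝ)^2)

/-- Stage 1, with the symmetries. -/
theorem stage1 {c2 s2 : ℝ} {Ax : W3 → Prop} (hA : AxSys c2 s2 Ax) (hcs : c2 ^ 2 + s2 ^ 2 = 1)
    {K : Cst} (hK : K.ok c2) (EA EB : ℕ) (ks : List (List (List Bool) × Nat × Bool × Nat)) (tr : Tr)
    (M : ℕ → Bool) (hM : ks.all (fun t => M t.2.2.2) = true)
    (hA0 : 0 < EA) (hB0 : 0 < EB) (hA1 : EA ≤ 2097152) (hB1 : EB ≤ 2097152)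
    (hc : chk1 K EA EB ks tr 1048576 1048576 1048576 = true)
    (Q : ℂ → Prop) (hn : ∀ z, Q (-z) → Q z) (hcj : ∀ z, Q ((starRingEnd ℂ) z) → Q z)
    (hQ : ∀ z, InE EA EB z → R1 M c2 z → Q z)
    {κ : ℂ} (hP : PP Ax κ) (hE : InE EA EB κ) : Q κ := by
  have main : ∀ (Ax : W3 → Prop), AxSys c2 s2 Ax → ∀ z : ℂ, PP Ax z → InE EA EB z → 0 ≤ z.re → 0 ≤ z.im → Q z := by
    intro Ax hA z hP hE h1 h2
    apply hQ z hE
    have hr := InE_re hB0 hE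
    have hi := InE_im hA0 hE
    rw [abs_le] at hr hi
    have hA1' : (EA:ℝ) ≤ 2097152 := by exact_mod_cast hA1
    have hB1' : (EB:ℝ) ≤ 2097152 := by exact_mod_cast hB1
    apply chk1_sound hA hcs hK EA EB ks hP hE h1 h2 M hM tr _ _ _ hc
    · rw [abs_le]; push_cast; constructor <;> linarith [hr.2]
    · rw [abs_le]; push_cast; constructor <;> linarith [hi.2]
  rcases le_total 0 κ.re with h1 | h1 <;> rcases le_total 0 κ.im with h2 | h2
  · exact main Ax hA κ hP hE h1 h2
  · exact hcj _ (main _ hA.conj _ (PP_conj hP) (InE_conj hE) (by simpa using h1) (by simpa using h2))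
  · apply hcj; apply hn
    apply main _ hA.conj _ (PP_neg hA.conj (PP_conj hP)) (InE_neg (InE_conj hE)) (by simpa using h1) (by simpa using h2)
  · apply hn
    exact main _ hA _ (PP_neg hA hP) (InE_neg hE) (by simpa using h1) (by simpa using h2)

end Marg

namespace Marg
def ks3 : List (List (List Bool) × Nat × Bool × Nat) :=
  [([[true]],2,true,0),
   ([[true],[true],[true]],2,true,0),
   ([],2,false,0),
   ([[true],[true,false]],2,true,0),
   ([[true]],5,true,0),
   ([[true]],5,false,4),
   ([[true],[true,false],[true]],2,true,0),
   ([[true],[true,false],[true],[true],[true]],2,true,0),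
   ([],2,false,2),
   ([[true,true],[true],[true,false],[true]],2,true,0),
   ([[true,true],[true]],2,true,0),
   ([[true],[true,false],[true],[true,false]],2,true,0),
   ([[true,true,false,false]],3,true,0),
   ([[true],[true,false],[true],[true,false],[true]],2,true,0),
   ([[true,true],[true],[true]],2,false,0),
   ([[true],[true,false]],2,false,0),
   ([[true,true],[true],[true,false]],2,true,0),
   ([[true,true],[true],[true],[true]],2,true,0),
   ([[true,true],[true]],5,true,0),
   ([[true,true],[true]],5,false,0),
   ([[true],[true],[true],[true]],2,true,0),
   ([[true],[true]],2,true,0),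
   ([[true,true]],2,false,0),
   ([],5,false,0),
   ([],5,true,3),
   ([[true]],2,false,0),
   ([[true,true]],2,true,0),
   ([[true],[true,true],[true],[true],[true]],2,true,0),
   ([],3,false,0),
   ([[true],[true,true],[true]],2,true,0),
   ([[true,false,false,false]],2,false,0),
   ([[true,false,false,false],[true]],2,true,0),
   ([[true,true,true,false],[true]],2,true,0),
   ([[true,true,true],[true],[true],[true],[true]],2,true,0),
   ([[true,true,true],[true,true],[true]],2,true,0),
   ([[true,true,true],[true,true]],2,false,0),
   ([[true,true,true]],2,false,0),
   ([[true,true,true],[true],[true]],2,true,0),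
   ([[true],[true,true]],2,true,0),
   ([[true,false,false,false],[true],[true],[true]],2,true,0),
   ([],1,true,1),
   ([[true,true],[true,true]],2,true,0),
   ([[true],[true,true],[true],[true]],2,true,0),
   ([[true,true],[true,true],[true],[true]],2,true,0),
   ([[true],[true,true],[true]],2,false,0),
   ([[true],[true,true]],3,true,0),
   ([[true,true,true],[true,true],[true],[true],[true]],2,true,0),
   ([[true,true,true],[true,true],[true],[true,false]],2,true,0),
   ([[true,true,true,true],[true],[true],[true]],2,true,0),
   ([[true,true,true,true,true]],3,false,0),
   ([[true,true,true,true],[true]],2,false,0),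
   ([[true,true],[true,true]],3,true,0),
   ([[true,true,true,true]],5,false,0),
   ([[true,true,true],[true,true]],2,true,0)]

def tr3 : Tr :=
  (.s (.s (.s (.s (.l 0) (.l 1) (.l 2) (.s (.l 0) (.l 3) (.l 2) (.l 0))) (.s (.s (.l 3) (.l 1) (.l
  3) (.s (.l 3) (.l 3) (.l 3) (.l 3))) (.s (.s (.s (.l 4) (.l 5) (.l 4) (.l 4)) .o (.l 4) .o) .o
  (.s (.l 3) .o (.l 6) .o) .o) (.s (.l 6) (.s (.l 6) (.l 6) (.l 6) (.l 6)) (.l 6) (.l 6)) (.s (.s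
  (.s (.l 3) (.l 6) (.l 6) (.l 6)) .o (.l 7) .o) .o (.s (.l 7) .o (.l 6) .o) .o)) (.s (.l 8) (.s
  (.l 2) (.s (.l 2) (.l 6) (.l 2) (.l 6)) (.l 2) (.s (.l 2) (.l 2) (.l 2) (.l 9))) (.l 2) (.s (.l
  2) (.s (.l 2) (.l 9) (.l 2) (.l 10)) (.l 2) (.l 10))) (.s (.s (.l 7) (.l 7) (.s (.l 9) (.l 7)
  (.l 9) (.l 7)) (.s (.l 7) (.s (.l 6) (.l 6) (.l 6) (.l 6)) (.s (.l 11) (.l 11) (.l 9) (.s (.l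
  12) (.l 12) (.l 12) (.l 12))) (.s (.l 13) (.l 13) (.s (.l 12) (.l 12) (.l 12) (.l 12)) (.s (.l
  12) (.l 13) (.l 12) (.l 14))))) (.s (.s (.l 6) .o (.l 6) .o) .o (.s (.s (.l 15) .o (.l 15) .o)
  .o (.s (.s (.l 15) (.l 15) (.l 6) .o) .o (.s (.l 13) .o (.l 14) .o) .o) .o) .o) (.s (.s (.l 9)
  (.s (.l 16) (.l 16) (.l 16) (.l 16)) (.l 16) (.l 17)) (.s (.s (.l 16) (.s (.l 12) (.l 12) (.l
  12) (.l 12)) (.l 16) (.l 17)) (.s (.s (.l 12) (.l 12) (.l 12) (.l 18)) (.l 14) (.l 14) (.s (.l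
  18) (.s (.l 19) (.l 18) (.l 18) (.l 14)) (.l 14) (.s (.s (.l 19) (.l 18) (.l 19) (.l 18)) (.s
  (.l 12) (.l 12) (.l 12) (.l 12)) (.l 18) (.s (.l 18) (.l 12) (.l 19) (.l 18))))) (.l 17) (.s (.l
  14) (.s (.l 18) (.l 14) (.l 18) (.l 18)) (.l 14) (.l 14))) (.l 17) (.s (.l 17) (.s (.l 16) (.l
  16) (.l 16) (.l 16)) (.l 16) (.l 17))) (.s (.s (.s (.l 14) .o (.s (.l 14) .o (.s (.l 13) .o (.l
  14) .o) .o) .o) .o .o .o) .o .o .o))) .o (.s (.s (.l 20) (.s (.l 10) (.l 10) (.l 10) (.l 10))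
  (.s (.l 21) (.s (.l 22) (.l 22) (.l 22) (.l 22)) (.s (.l 23) (.l 23) (.s (.l 23) (.l 23) (.l 24)
  (.l 23)) (.l 23)) (.s (.l 25) (.l 22) (.l 25) (.l 22))) (.s (.s (.l 22) (.l 10) (.l 10) (.l 10))
  (.l 17) (.s (.l 10) (.l 10) (.l 10) (.s (.l 10) (.l 10) (.l 10) (.l 9))) (.s (.l 17) (.l 17) (.s
  (.l 16) (.l 16) (.l 9) (.l 9)) (.s (.l 16) (.l 16) (.l 17) (.l 16))))) (.s (.s (.l 10) (.s (.l
  10) (.l 17) (.l 10) (.l 10)) (.l 10) (.s (.l 10) (.l 26) (.l 10) .o)) .o (.s (.s (.l 10) (.l 10)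
  (.l 10) (.l 17)) (.s (.l 10) .o (.s (.l 10) .o (.l 10) .o) .o) (.s (.l 17) (.l 17) (.s (.l 16)
  (.l 16) (.l 17) (.l 17)) (.s (.l 17) (.l 17) (.l 17) .o)) .o) .o) (.s (.s (.s (.s (.l 24) (.l
  23) (.l 23) (.l 23)) (.l 23) (.l 23) (.l 23)) (.s (.l 25) (.l 22) (.l 22) (.s (.l 22) (.l 22)
  (.l 22) (.l 27))) (.s (.l 25) (.l 22) (.l 28) (.l 28)) (.s (.l 29) (.l 27) (.l 29) (.l 29))) (.s
  (.s (.s (.l 22) (.l 10) (.s (.l 22) (.l 22) (.l 22) (.l 22)) (.l 9)) (.s (.l 9) (.l 9) (.l 9)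
  (.l 9)) (.s (.s (.l 22) (.l 30) (.l 22) (.l 30)) (.s (.l 30) (.l 30) (.l 30) (.l 31)) (.l 27)
  (.s (.l 31) (.l 31) (.l 31) (.l 31))) (.s (.s (.l 31) (.l 32) (.l 32) (.l 32)) (.l 9) (.s (.l
  32) (.l 32) (.l 31) (.l 32)) (.l 33))) (.s (.s (.l 9) (.l 9) (.l 9) (.s (.l 31) (.l 31) (.l 31)
  (.l 31))) (.s (.l 9) (.s (.l 16) (.l 16) (.l 16) (.l 16)) (.s (.l 34) (.l 34) (.l 34) (.l 34))
  (.s (.l 16) (.l 16) (.l 34) (.l 34))) (.s (.l 9) (.s (.l 31) (.l 31) (.l 32) (.l 31)) (.s (.l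
  35) (.l 35) (.l 35) (.l 35)) (.s (.l 32) (.l 32) (.l 35) (.l 36))) (.s (.s (.l 31) (.l 31) (.l
  31) (.l 31)) (.s (.l 34) (.l 34) (.l 36) (.l 36)) (.s (.l 32) (.l 36) (.l 36) (.l 36)) (.s (.l
  36) (.l 36) (.l 36) (.l 36)))) (.s (.s (.l 27) (.s (.l 31) (.l 31) (.l 31) (.l 31)) (.l 29) (.s
  (.l 31) (.l 31) (.l 29) (.l 29))) (.s (.l 37) (.l 37) (.s (.l 31) (.l 31) (.l 37) (.l 37)) (.l
  37)) (.s (.l 29) (.l 29) (.l 29) (.s (.l 38) (.l 38) (.l 38) (.l 33))) (.s (.s (.l 29) (.l 37)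
  (.l 38) (.l 38)) (.s (.l 37) (.l 37) (.l 37) (.l 37)) (.s (.l 38) (.l 38) (.l 33) (.l 38)) (.s
  (.l 37) (.l 37) (.l 38) (.l 34)))) (.s (.s (.l 37) (.l 31) (.s (.l 36) (.l 36) (.l 36) (.l 36))
  (.s (.l 36) (.l 36) (.l 36) (.l 36))) (.s (.s (.l 36) (.l 36) (.l 36) (.l 36)) (.s (.l 36) (.l
  36) (.l 36) (.l 36)) (.l 36) (.s (.l 36) (.l 36) (.l 36) (.l 36))) (.s (.s (.l 37) (.l 36) (.l
  37) (.l 36)) (.s (.l 36) (.l 36) (.l 36) (.l 36)) (.s (.l 37) (.l 36) (.l 39) (.l 37)) (.s (.l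
  36) (.l 36) (.l 36) (.l 36))) (.s (.s (.l 36) (.l 36) (.l 36) (.l 36)) (.s (.l 36) (.l 36) (.l
  36) (.l 36)) (.s (.l 36) (.l 36) (.l 36) (.l 36)) (.s (.l 36) (.s (.l 36) .o (.l 36) .o) (.l 36)
  .o)))) (.s (.l 28) (.s (.l 28) (.s (.l 28) (.l 29) (.l 28) (.l 28)) (.l 28) (.l 28)) (.l 40) (.l
  28)) (.s (.s (.s (.s (.l 38) (.l 38) (.l 38) (.l 38)) (.s (.s (.l 38) (.l 38) (.l 38) (.l 38))
  (.l 33) (.l 38) (.l 38)) (.s (.l 28) (.l 29) (.l 28) (.l 41)) (.s (.l 38) (.l 38) (.s (.l 38)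
  (.l 38) (.l 41) (.l 41)) (.s (.l 38) (.l 38) (.l 41) (.l 34)))) (.s (.s (.l 33) (.l 38) (.l 38)
  (.l 38)) (.s (.l 38) (.l 34) (.l 42) (.l 42)) (.s (.l 38) (.l 34) (.s (.l 38) (.l 34) (.l 34)
  (.l 34)) (.s (.l 34) (.l 34) (.l 34) (.l 34))) (.s (.l 34) (.l 34) (.l 34) (.l 34))) (.s (.s (.l
  28) (.s (.l 28) (.l 41) (.l 28) (.l 41)) (.l 28) (.s (.l 28) (.l 28) (.l 28) (.l 28))) (.s (.l
  41) (.s (.l 41) (.l 34) (.l 41) (.l 34)) (.s (.l 41) (.l 41) (.l 41) (.l 41)) (.s (.l 41) (.l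
  34) (.l 41) (.l 34))) (.l 28) (.s (.s (.l 41) (.l 41) (.l 41) (.l 41)) (.s (.l 41) (.l 34) (.l
  34) (.l 34)) (.s (.l 41) (.l 41) (.l 28) (.l 43)) (.s (.l 34) (.l 34) (.l 34) (.l 34)))) (.s (.s
  (.s (.l 34) (.l 34) (.l 34) (.l 34)) (.s (.l 34) (.l 34) (.l 34) (.l 34)) (.s (.l 34) (.l 34)
  (.l 34) (.l 34)) (.s (.l 34) (.l 34) (.l 34) (.l 34))) (.s (.l 34) (.l 34) (.l 34) (.l 34)) (.s
  (.s (.l 34) (.l 34) (.l 34) (.l 34)) (.s (.l 34) (.l 34) (.l 34) (.l 34)) (.s (.l 34) (.l 34)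
  (.l 34) (.l 34)) (.s (.l 34) (.l 34) (.l 34) (.l 34))) (.s (.l 34) (.l 34) (.l 34) (.l 34))))
  (.s (.s (.s (.l 34) (.s (.l 36) (.l 36) (.l 36) (.l 36)) (.l 34) (.l 34)) (.s (.l 36) (.l 36)
  (.s (.l 36) (.l 36) (.l 36) (.l 36)) (.l 36)) (.s (.l 34) (.l 34) (.l 34) (.s (.l 44) (.l 34)
  (.l 34) (.l 34))) (.s (.s (.l 36) (.l 36) (.l 36) (.l 36)) (.s (.l 36) (.l 36) (.l 36) (.l 36))
  (.s (.l 36) (.l 36) (.l 45) (.l 45)) (.s (.l 36) (.l 36) (.l 36) (.l 36)))) (.s (.s (.l 36) (.l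
  36) (.l 36) (.l 36)) (.s (.l 36) .o .o .o) (.s (.l 36) (.l 36) (.s (.l 36) (.l 36) (.l 36) .o)
  .o) .o) (.s (.s (.s (.l 34) (.l 34) (.l 34) (.l 34)) (.s (.l 34) (.l 34) (.l 34) (.l 34)) (.s
  (.l 34) (.l 34) (.l 34) (.l 34)) (.s (.l 34) (.l 34) (.l 34) (.l 34))) (.s (.s (.l 45) (.l 34)
  (.l 34) (.l 45)) (.s (.l 34) (.l 45) (.l 34) (.l 45)) (.s (.l 34) (.l 34) (.l 34) (.l 34)) (.s
  (.l 34) (.l 34) (.l 34) .o)) (.s (.l 46) (.s (.l 34) (.l 34) (.l 34) (.l 34)) (.l 46) (.s (.l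
  34) (.l 34) (.l 34) (.l 34))) (.s (.s (.l 34) (.l 34) (.l 34) (.l 34)) .o (.s (.l 34) .o .o .o)
  .o)) (.s (.s (.s (.l 34) .o .o .o) .o .o .o) .o .o .o)) (.s (.s (.l 28) (.s (.s (.l 28) (.l 46)
  (.l 28) (.l 46)) (.s (.l 46) (.l 34) (.l 46) (.l 34)) (.s (.l 28) (.l 46) (.l 28) (.l 46)) (.s
  (.l 46) (.l 46) (.l 46) (.l 46))) (.l 28) (.s (.s (.l 28) (.l 28) (.l 28) (.l 28)) (.s (.s (.l
  47) (.l 34) (.l 47) (.l 47)) (.s (.l 34) (.l 34) (.l 34) (.l 34)) (.s (.l 47) (.l 47) (.l 46)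
  (.l 47)) (.s (.l 47) (.l 34) (.l 47) (.l 47))) (.l 28) (.s (.s (.l 28) (.l 46) (.l 28) (.l 48))
  (.s (.l 46) (.l 47) (.l 46) (.l 46)) (.s (.l 28) (.l 48) (.l 28) (.l 48)) (.s (.s (.l 49) (.l
  50) (.l 49) (.l 50)) (.s (.l 50) (.l 50) (.l 50) (.l 50)) (.l 48) (.s (.l 50) (.l 50) (.l 50)
  (.l 50)))))) (.s (.s (.s (.l 34) (.l 34) (.l 34) (.l 34)) (.s (.l 34) (.l 34) (.l 34) (.l 34))
  (.s (.l 34) (.l 34) (.l 46) (.l 34)) (.s (.l 34) (.l 34) (.l 34) (.l 34))) (.s (.s (.l 34) (.l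
  34) (.l 34) (.l 34)) (.s (.l 34) (.l 34) (.l 34) (.l 34)) (.s (.l 34) (.l 34) (.l 34) (.l 34))
  (.s (.l 34) (.l 34) (.l 34) (.l 34))) (.s (.s (.l 46) (.l 46) (.s (.l 34) (.l 34) (.l 34) (.l
  34)) (.s (.l 34) (.l 34) (.l 34) (.l 34))) (.s (.l 34) (.l 34) (.s (.l 51) (.l 51) (.l 34) (.l
  34)) (.l 34)) (.s (.s (.l 47) (.l 34) (.l 46) (.l 34)) (.s (.l 34) (.l 34) (.l 34) (.l 34)) (.s
  (.l 46) (.l 46) (.s (.l 50) (.l 50) (.l 50) (.l 50)) (.s (.l 50) (.l 50) (.l 52) (.l 52))) (.s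
  (.l 34) (.l 34) (.l 34) (.l 34))) (.s (.s (.l 34) (.l 34) (.l 34) (.l 34)) (.s (.l 34) (.l 34)
  (.l 34) (.l 34)) (.s (.l 34) (.l 34) (.l 34) (.l 50)) (.s (.l 34) (.l 53) (.l 53) (.l 53)))) (.s
  (.s (.l 34) (.l 34) (.l 34) (.l 34)) (.s (.l 34) (.l 34) (.l 34) (.l 34)) (.s (.l 34) (.l 34)
  (.s (.l 53) (.l 53) (.l 53) (.l 53)) (.s (.l 53) (.l 53) (.l 53) (.l 53))) (.s (.l 34) (.l 34)
  (.s (.l 53) .o .o .o) .o))) (.s (.l 28) (.s (.l 28) (.s (.s (.l 28) (.l 48) (.l 28) (.l 28)) (.s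
  (.l 48) (.l 48) (.l 48) (.l 48)) (.l 28) (.s (.s (.l 49) (.l 49) (.l 28) (.l 49)) (.s (.l 52)
  (.l 52) (.l 52) (.l 52)) (.s (.l 28) (.l 49) (.l 28) (.l 49)) (.s (.l 52) (.l 52) (.l 52) (.l
  52)))) (.l 28) (.s (.l 28) (.s (.s (.l 28) (.l 49) (.l 28) (.l 50)) (.s (.l 52) (.l 52) (.l 52)
  (.l 52)) (.s (.l 28) (.l 28) (.l 28) (.l 28)) (.s (.l 52) (.l 52) (.l 52) (.l 52))) (.l 28) (.s
  (.l 28) (.s (.l 50) (.l 52) (.l 50) (.l 52)) (.l 28) (.s (.l 50) (.l 52) (.l 28) (.l 52))))) (.l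
  28) (.s (.l 28) (.s (.l 28) (.s (.l 28) (.s (.l 28) (.l 52) (.l 28) (.l 52)) (.l 28) (.s (.l 28)
  (.l 52) (.l 28) (.l 52))) (.l 28) (.s (.l 28) (.l 28) (.l 28) (.l 28))) (.l 28) (.l 28))) (.s
  (.s (.s (.s (.s (.l 52) (.l 52) (.l 52) (.l 52)) (.s (.l 52) (.l 52) (.l 52) (.l 52)) (.l 48)
  (.s (.l 52) (.l 52) (.l 52) (.l 52))) (.s (.s (.l 52) (.l 52) (.l 52) (.l 52)) (.l 34) (.l 50)
  (.l 50)) (.s (.s (.l 52) (.l 52) (.l 52) (.l 52)) (.l 50) (.s (.l 52) (.l 52) (.l 52) (.l 52))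
  (.l 50)) (.s (.l 50) (.l 50) (.l 50) (.l 50))) (.s (.s (.l 50) (.l 50) (.l 50) (.l 50)) (.s (.l
  53) (.l 53) (.l 53) (.l 53)) (.s (.l 50) (.l 50) (.l 50) (.l 34)) (.s (.l 53) (.l 53) (.l 53)
  (.l 53))) (.s (.s (.s (.l 52) (.l 52) (.l 52) (.l 52)) (.l 50) (.s (.l 52) (.l 52) (.l 52) (.l
  52)) (.l 50)) (.s (.l 50) (.l 50) (.l 50) (.l 50)) (.s (.s (.l 52) (.l 52) (.l 52) (.l 52)) (.l
  50) (.s (.l 52) (.l 52) (.l 52) (.l 52)) (.l 50)) (.s (.l 50) (.l 50) (.l 50) (.s (.l 52) (.l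
  52) (.l 52) (.l 52)))) (.s (.s (.l 50) (.s (.l 52) (.l 52) (.l 52) (.l 52)) (.s (.l 52) (.l 52)
  (.l 52) (.l 52)) (.s (.l 52) (.l 52) (.l 52) (.l 52))) (.s (.l 53) (.l 53) (.l 53) (.l 53)) (.s
  (.s (.l 52) (.l 52) (.l 52) (.l 52)) (.s (.l 52) (.l 52) (.l 52) (.l 52)) (.s (.l 52) (.l 52)
  (.l 52) (.l 52)) (.s (.l 52) (.l 52) (.l 52) .o)) (.s (.l 53) .o .o .o))) (.s (.s (.s (.l 53)
  (.l 53) (.l 53) (.l 53)) (.s (.l 53) (.l 53) (.l 53) .o) (.s (.l 53) (.l 53) (.l 53) .o) .o) .o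
  (.s (.s (.l 53) .o .o .o) .o .o .o) .o) (.s (.s (.s (.s (.l 52) (.l 52) (.l 52) (.l 52)) (.l 50)
  (.s (.l 52) (.l 52) (.l 52) (.l 52)) (.l 50)) (.s (.s (.l 52) (.l 52) (.l 52) (.l 52)) (.s (.l
  52) (.l 52) (.l 52) (.l 52)) (.s (.l 52) (.l 52) (.l 52) (.l 52)) (.s (.l 52) (.l 52) (.l 52)
  .o)) (.s (.s (.l 52) (.l 52) (.l 52) (.l 52)) (.s (.l 52) (.l 52) (.l 52) (.l 52)) (.s (.l 52)
  (.l 52) (.l 52) (.l 52)) (.s (.l 52) (.l 52) (.l 52) (.l 52))) (.s (.s (.l 52) (.l 52) (.l 52)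
  (.l 52)) (.s (.l 52) .o .o .o) (.s (.l 52) .o .o .o) .o)) (.s (.s (.s (.l 52) (.l 52) (.l 52)
  .o) .o .o .o) .o .o .o) (.s (.s (.s (.l 52) (.l 52) (.l 28) (.l 52)) (.s (.l 52) .o .o .o) (.s
  (.l 28) .o (.l 28) .o) .o) .o .o .o) .o) .o)) (.s (.s (.s (.s (.l 34) (.l 34) (.l 34) (.l 34))
  (.s (.l 34) (.l 34) (.l 34) .o) (.s (.l 34) (.l 34) (.l 34) (.l 34)) .o) .o (.s (.s (.l 34) .o
  .o .o) .o .o .o) .o) .o .o .o))) (.s (.s (.s (.s (.s (.l 16) (.l 14) (.l 16) (.l 14)) (.s (.l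
  14) (.l 18) (.l 18) (.l 14)) (.s (.l 16) (.l 14) (.l 16) (.l 16)) (.s (.l 18) (.l 14) (.l 14)
  (.l 14))) (.s (.s (.l 18) (.l 18) (.s (.l 18) (.l 18) (.l 18) (.l 14)) .o) .o (.s (.s (.l 34) .o
  (.l 14) .o) .o (.s (.l 18) .o .o .o) .o) .o) (.s (.s (.l 34) (.s (.l 36) (.l 36) (.l 36) (.l
  36)) (.l 36) (.l 36)) (.s (.l 16) (.l 14) (.s (.l 36) (.l 36) (.l 36) (.l 36)) (.s (.l 36) .o
  (.l 36) .o)) (.s (.l 36) (.l 36) (.l 36) (.l 36)) (.s (.l 36) .o (.l 36) .o)) .o) .o (.s (.s (.s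
  (.l 36) (.l 36) (.l 36) (.l 36)) (.s (.l 36) .o .o .o) (.s (.l 36) (.l 36) (.l 36) .o) .o) .o
  (.s (.s (.s (.l 36) .o (.l 36) .o) .o .o .o) .o .o .o) .o) .o) .o .o .o)) .o) .o (.s (.s (.s (.s
  (.l 40) (.l 28) (.l 28) (.s (.l 28) .o .o .o)) (.s (.s (.s (.l 28) (.l 28) (.l 28) .o) .o .o .o)
  .o .o .o) .o .o) .o .o .o) .o .o .o) .o)

def ks4 : List (List (List Bool) × Nat × Bool × Nat) :=
  [([],3,false,5),
   ([],3,false,0),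
   ([[true]],3,false,0),
   ([[true,true]],2,false,0),
   ([[true,true]],1,true,0),
   ([],1,true,1),
   ([],1,true,0),
   ([],2,false,0)]

def tr4 : Tr :=
  (.s (.s (.s (.s (.l 0) (.s (.l 1) (.l 2) (.l 2) (.l 2)) (.s (.l 2) (.l 2) (.l 2) (.l 2)) (.l 2))
  (.s (.l 2) (.l 3) (.l 3) (.l 3)) (.s (.l 4) (.l 2) (.l 3) (.l 3)) (.s (.l 3) (.l 3) (.l 3) (.l
  3))) .o (.s (.s (.l 3) (.l 3) (.l 3) (.l 3)) (.s (.l 3) (.s (.l 3) .o (.l 3) .o) (.l 3) (.s (.l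
  3) .o (.l 3) .o)) (.s (.l 3) (.l 3) (.s (.l 4) (.l 3) (.l 5) (.l 6)) (.l 7)) (.s (.s (.l 7) (.l
  3) (.l 3) (.l 3)) .o (.l 7) .o)) .o) .o (.s (.s (.s (.s (.l 5) (.l 6) (.l 6) (.l 7)) (.l 7) .o
  .o) .o .o .o) .o .o .o) .o)

def ks5 : List (List (List Bool) × Nat × Bool × Nat) :=
  [([[true]],3,false,0),
   ([[true],[true]],3,false,0),
   ([],3,false,5),
   ([[true],[true],[true,false]],3,true,0),
   ([[true],[true],[true]],3,false,0),
   ([],3,false,0),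
   ([[true],[true],[true],[true]],3,false,0),
   ([],1,true,1),
   ([],1,true,0),
   ([[true,true]],1,true,0),
   ([[true,true,true]],1,true,0),
   ([[true],[true]],2,false,0)]

def tr5 : Tr :=
  (.s (.s (.s (.l 0) (.l 1) (.l 2) (.l 3)) (.s (.l 3) .o (.l 4) .o) (.s (.s (.l 5) (.l 5) (.l 5)
  (.l 4)) (.s (.l 4) (.l 4) (.l 4) (.l 4)) (.s (.l 4) (.s (.l 4) (.l 4) (.l 4) (.l 6)) (.l 7) (.s
  (.l 8) (.s (.l 8) (.l 6) (.l 8) (.l 9)) (.l 8) (.s (.l 8) (.l 10) (.l 10) (.l 10)))) (.s (.l 6)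
  (.l 6) (.s (.s (.l 6) (.l 6) (.l 9) (.l 9)) (.s (.l 9) (.l 9) (.l 9) (.l 9)) (.s (.l 9) (.l 9)
  (.l 9) (.l 9)) (.s (.l 9) (.l 9) (.l 9) .o)) (.s (.l 9) .o .o .o))) (.s (.s (.l 6) .o .o .o) .o
  .o .o)) .o (.s (.s (.s (.l 7) (.s (.l 8) (.s (.l 8) (.l 8) (.l 8) (.l 9)) (.l 8) (.s (.l 8) (.l
  9) (.l 9) (.l 9))) (.s (.l 8) (.l 8) (.l 11) (.s (.l 11) .o .o .o)) (.s (.s (.l 8) (.l 8) (.l 8)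
  .o) (.s (.l 9) .o .o .o) .o .o)) (.s (.s (.s (.l 9) (.l 9) (.l 9) (.l 9)) .o (.s (.l 9) .o .o
  .o) .o) .o .o .o) .o .o) .o .o .o) .o)

def ks6 : List (List (List Bool) × Nat × Bool × Nat) :=
  [([[true],[true]],1,true,0),
   ([[true],[true]],3,false,0),
   ([[true],[true],[true]],1,true,0),
   ([],1,true,1),
   ([[true],[true],[true],[true]],3,false,0),
   ([[true],[true],[true],[true]],1,true,0),
   ([],3,false,0)]

def tr6 : Tr :=
  (.s (.s (.s (.l 0) (.l 1) (.l 0) (.l 1)) (.s (.l 1) .o (.l 2) .o) (.s (.l 2) (.l 2) (.l 3) (.l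
  4)) (.s (.l 5) .o .o .o)) .o (.s (.s (.l 3) (.s (.l 6) .o .o .o) .o .o) .o .o .o) .o)

def ksD3m1 : List (Nat × List (Nat × Bool) × Nat × Nat × Bool × Nat) :=
  [(1,[(0,true)],2,0,false,2),
   (1,[],2,0,false,2),
   (1,[(0,false)],2,0,false,2),
   (0,[(1,true)],2,0,false,1),
   (1,[(2,true)],1,0,false,1),
   (0,[(1,true),(2,true)],1,0,false,1),
   (1,[(0,false),(2,false),(0,true)],1,3,true,0),
   (1,[(2,false),(1,true)],2,0,false,1),
   (1,[(0,false),(2,false),(0,true)],1,0,false,1),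
   (1,[(0,false),(2,true)],1,0,false,1),
   (1,[(2,true),(1,false)],2,0,false,1),
   (1,[],2,0,false,1),
   (1,[],2,3,true,0),
   (0,[(1,false),(2,true),(1,false)],2,2,false,0),
   (1,[(0,true),(2,true),(1,false)],2,0,false,1),
   (1,[(0,true),(2,true),(1,false)],2,2,false,0),
   (1,[(0,false),(2,false),(0,true)],1,1,false,0),
   (0,[(1,false)],2,3,false,0),
   (1,[(0,true)],2,3,false,0),
   (1,[(2,false),(0,true)],1,0,false,1)]

def trD3m1 : Tr :=
  (.s (.s (.s (.s .o (.s .o (.s .o (.l 0) .o (.l 0)) .o (.s .o (.l 0) (.s .o .o .o (.l 1)) (.l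
  1))) (.s .o .o (.s .o .o (.l 2) (.l 1)) (.s .o (.l 1) (.l 1) (.l 1))) (.s (.s .o .o .o (.l 1))
  (.s (.l 1) (.s (.l 1) (.l 1) (.l 1) (.l 1)) (.l 1) (.s (.l 1) (.l 1) (.l 1) (.l 2))) (.s (.l 1)
  (.l 1) (.l 1) (.s (.l 1) (.l 1) (.l 1) (.s (.l 1) (.l 1) (.l 1) (.l 3)))) (.s (.s (.l 1) (.l 1)
  (.l 1) (.l 1)) (.s (.l 3) (.l 2) (.s (.l 1) (.l 3) (.l 3) (.l 3)) (.s (.l 3) (.l 3) (.l 3) (.l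
  2))) (.s (.l 1) (.s (.l 1) (.l 3) (.l 3) (.l 2)) (.s (.l 1) (.l 3) (.l 2) (.s (.l 3) (.l 3) (.l
  2) (.l 4))) (.s (.s (.l 3) (.l 3) (.l 3) (.l 3)) (.s (.l 3) (.l 3) (.l 2) (.s .d .d .d .d)) (.s
  (.l 2) (.s (.l 3) .d .d .d) (.l 4) (.l 4)) (.s (.s .d .d .d .d) (.s .d .d .d .d) (.s .d .d .d
  .d) .d))) (.s (.s (.l 3) (.l 2) (.s (.l 3) (.l 3) (.l 3) (.l 3)) (.s (.l 3) .d .d .d)) (.s (.s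
  .d .d .d .d) (.s .d .d .d .d) (.s .d .d .d .d) .d) (.s (.s (.l 2) .d (.s .d .d .d .d) .d) (.s .d
  .d .d .d) (.s .d .d .d .d) (.s .d .d .d .d)) (.s (.s .d .d .d .d) .d .d .d))))) (.s (.s (.s (.l
  0) (.s (.l 3) (.s .d .d .d .d) (.l 3) (.s .d .d .d .d)) (.l 0) (.s (.l 3) (.s .d .d .d .d) (.l
  3) (.s .d .d .d .d))) (.s (.s .d .d .d .d) .d (.s .d .d .d .d) .d) (.s (.l 0) (.s (.l 2) (.s .d
  .d .d .d) (.l 2) (.s .d .d .d .d)) (.s (.l 1) (.l 0) (.l 1) (.l 2)) (.s (.l 2) (.s .d .d .d .d)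
  (.l 2) .d)) (.s (.s .d .d .d .d) .d (.s .d .d .d .d) .d)) (.s .d .d .d .d) (.s (.s (.s (.l 0)
  (.l 2) (.l 2) (.l 2)) (.s (.l 2) .d (.l 2) .d) (.s (.l 2) (.l 2) (.l 2) (.l 2)) (.s (.s .d .d .d
  .d) .d (.s .d .d .d .d) .d)) (.s .d .d .d .d) (.s (.s (.s (.l 3) (.l 3) (.l 3) .d) (.s .d .d .d
  .d) (.s (.l 3) .d .d .d) (.s .d .d .d .d)) (.s .d .d .d .d) (.s (.s .d .d .d .d) .d (.s .d .d .d
  .d) .d) (.s .d .d .d .d)) (.s .d .d .d .d)) (.s .d .d .d .d)) (.s (.s (.s (.l 1) (.l 1) (.s (.l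
  1) (.l 1) (.l 1) (.l 1)) (.s (.l 1) (.l 1) (.l 1) (.l 1))) (.s (.l 2) (.s (.l 1) (.l 1) (.l 1)
  (.l 1)) (.s (.l 1) (.l 1) (.s (.l 1) (.l 1) (.l 1) (.l 1)) (.s (.l 1) (.l 1) (.l 1) (.s (.l 1)
  (.l 1) (.l 1) (.l 1)))) (.s (.s (.l 1) (.l 1) (.l 1) (.l 1)) (.s (.l 1) (.l 1) (.s (.l 1) (.l 1)
  (.l 1) (.l 1)) (.s (.l 1) (.l 1) (.l 5) (.l 5))) (.s (.l 1) (.s (.l 1) (.l 1) (.l 1) (.s (.l 1)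
  (.l 1) (.l 1) (.l 1))) (.s (.l 1) (.l 1) (.s (.l 1) (.l 1) (.l 1) (.l 1)) (.s (.l 1) (.l 1) (.l
  6) (.l 6))) (.s (.s (.l 1) (.l 1) (.l 1) (.l 7)) (.s (.l 1) (.l 7) (.l 7) (.l 7)) (.s (.l 6) (.l
  7) (.l 6) (.l 6)) (.s (.l 8) (.l 8) (.l 8) (.l 8)))) (.s (.s (.l 1) (.l 8) (.l 8) (.l 8)) (.s
  (.l 9) (.l 9) (.s (.l 9) (.l 9) (.l 9) (.l 9)) (.l 9)) (.s (.l 8) (.s (.l 8) (.l 8) (.l 8) (.l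
  8)) (.l 8) (.s (.l 8) (.l 8) (.l 8) (.l 8))) (.s (.s (.l 8) (.l 8) (.l 8) (.l 8)) (.s (.l 9) (.l
  9) (.l 9) (.l 9)) (.s (.l 8) (.s (.l 8) (.l 8) (.l 8) (.l 8)) (.l 8) (.l 10)) (.s (.s (.l 10)
  (.l 10) (.l 10) (.l 10)) (.l 9) (.s (.l 9) (.l 9) (.l 10) (.l 10)) (.s (.l 10) (.l 10) .d
  .d)))))) (.s (.s (.l 1) (.l 1) (.s (.l 1) (.l 1) (.l 1) (.l 1)) (.s (.l 1) (.l 1) (.l 1) (.l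
  1))) (.s (.l 1) (.s (.l 1) (.l 1) (.l 1) (.l 1)) (.s (.l 1) (.l 1) (.l 1) (.s (.l 1) (.l 1) (.l
  1) (.l 1))) (.s (.s (.l 1) (.l 1) (.l 1) (.l 1)) (.s (.l 1) (.l 1) (.l 1) (.s (.l 1) (.l 1) (.l
  1) (.l 1))) (.s (.l 1) (.l 1) (.l 1) (.s (.l 1) (.l 1) .d .d)) (.s (.s (.l 1) (.l 1) (.l 1) (.l
  1)) (.s (.l 1) (.l 1) (.s .d .d .d .d) (.s .d .d .d .d)) (.s (.l 1) (.s .d .d .d .d) .d .d) (.s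
  (.s .d .d .d .d) .d .d .d)))) (.s (.s (.s (.l 1) (.l 1) (.s .d .d .d .d) (.l 11)) (.l 11) (.s
  (.s .d .d .d .d) (.l 11) .d .d) (.l 11)) (.s (.l 11) (.l 11) (.l 12) (.l 12)) (.s (.s .d .d .d
  .d) (.l 12) .d .d) (.s (.l 12) (.s .d .d .d .d) .d .d)) (.s (.s (.s (.l 1) (.l 1) (.l 1) (.l 1))
  (.s (.l 1) (.s .d .d .d .d) (.s .d .d .d .d) (.s .d .d .d .d)) (.s (.l 11) .d .d .d) (.s .d .d
  .d .d)) (.s (.s (.s .d .d .d .d) (.s .d .d .d .d) (.s .d .d .d .d) (.s .d .d .d .d)) (.s (.s .d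
  .d .d .d) (.s .d .d .d .d) (.s .d .d .d .d) .d) (.s .d .d .d .d) (.s .d .d .d .d)) (.s (.s .d .d
  .d .d) (.s .d .d .d .d) .d .d) (.s (.s .d .d .d .d) (.s .d .d .d .d) .d .d))) (.s (.s (.s (.l 1)
  (.s (.l 1) (.l 1) (.l 1) (.l 1)) (.s (.l 1) (.l 1) (.l 1) (.l 1)) (.s (.l 1) (.l 1) (.s (.l 1)
  (.l 1) (.l 1) (.l 1)) (.s (.l 1) (.l 1) (.l 1) (.s (.l 1) (.l 1) (.l 1) (.l 13))))) (.s (.s (.l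
  1) (.l 1) (.l 1) (.s (.l 1) (.l 1) (.l 1) (.l 1))) (.s (.l 1) (.l 8) (.s (.l 1) (.l 1) (.s (.l
  1) (.l 1) (.l 1) (.l 1)) (.l 8)) (.s (.l 8) (.l 8) (.l 8) (.l 8))) (.s (.s (.l 1) (.l 1) (.l 1)
  (.s (.l 1) (.l 1) (.l 1) (.l 1))) (.s (.l 1) (.s (.l 1) (.l 1) (.l 1) (.l 1)) (.s (.l 1) (.l 1)
  (.l 1) (.l 14)) (.s (.l 14) (.l 14) (.l 14) (.l 14))) (.s (.s (.l 1) (.l 1) (.l 1) (.l 1)) (.s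
  (.l 1) (.l 1) (.l 15) (.l 15)) (.s (.l 1) (.l 15) (.l 15) (.l 15)) (.s (.l 15) (.l 15) (.l 15)
  (.l 15))) (.s (.s (.l 15) (.l 14) (.l 15) (.l 14)) (.s (.l 14) (.l 14) (.l 14) (.l 14)) (.s (.l
  15) (.l 14) (.l 15) (.l 14)) (.s (.l 14) (.l 14) (.l 14) (.l 14)))) (.s (.s (.s (.l 1) (.l 14)
  (.l 14) (.l 14)) (.s (.l 14) (.l 14) (.l 14) (.l 14)) (.s (.l 14) (.l 14) (.l 14) (.l 14)) (.s
  (.l 14) (.l 14) (.l 14) (.l 14))) (.s (.l 14) (.l 14) (.l 14) (.l 14)) (.s (.s (.l 14) (.l 14)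
  (.l 14) (.l 14)) (.s (.l 14) (.l 14) (.l 14) (.l 14)) (.s (.l 14) (.l 14) (.l 14) (.l 14)) (.l
  14)) (.s (.l 14) (.l 14) (.l 14) (.l 14)))) (.s (.s (.l 1) (.s (.l 1) (.l 1) (.l 1) (.l 1)) (.s
  (.l 1) (.l 1) (.l 1) (.l 14)) (.s (.s (.l 1) (.l 1) (.l 1) (.l 1)) (.s (.l 1) (.l 1) (.l 1) (.l
  14)) (.s .d .d .d .d) (.s .d .d .d .d))) (.s (.s (.l 1) (.s (.l 1) (.l 1) (.l 1) (.l 1)) (.s (.l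
  1) (.l 1) (.l 1) (.l 1)) (.s (.l 1) (.l 15) (.s .d .d .d .d) (.s .d .d .d .d))) (.s (.s (.l 1)
  (.l 1) (.l 1) (.l 15)) (.s (.l 15) (.l 15) (.l 15) (.l 15)) (.s (.l 15) (.l 15) (.s .d .d .d .d)
  (.s .d .d .d .d)) (.s (.l 15) (.l 15) .d .d)) (.s (.s (.l 1) (.l 14) .d .d) (.s (.s .d .d .d .d)
  .d .d .d) (.s .d .d .d .d) (.s .d .d .d .d)) (.s (.s .d .d .d .d) (.s .d .d .d .d) (.s .d .d .d
  .d) (.s .d .d .d .d))) (.s (.s (.s .d .d .d .d) (.l 14) (.s .d .d .d .d) (.l 14)) (.s (.s .d .d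
  .d .d) (.s .d .d .d .d) (.l 14) .d) (.s .d .d .d .d) (.s .d .d .d .d)) (.s (.s (.s .d .d .d .d)
  (.s .d .d .d .d) .d .d) (.s .d .d .d .d) (.s .d .d .d .d) (.s .d .d .d .d))) (.s (.s (.s (.s (.l
  15) (.l 15) (.l 15) (.l 15)) (.s (.l 15) (.l 15) (.l 15) (.l 15)) (.s (.s .d .d .d .d) (.s .d .d
  .d .d) .d .d) (.s .d .d .d .d)) (.s (.s (.l 15) (.l 14) (.l 15) .d) (.s (.l 14) (.l 14) .d .d)
  (.s .d .d .d .d) (.s .d .d .d .d)) (.s (.s .d .d .d .d) (.s .d .d .d .d) (.s .d .d .d .d) (.s .d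
  .d .d .d)) (.s (.s .d .d .d .d) (.s .d .d .d .d) .d .d)) (.s (.s (.s .d .d .d .d) (.l 14) (.s .d
  .d .d .d) (.l 14)) (.s (.l 14) (.l 14) (.l 14) .d) (.s (.s .d .d .d .d) .d .d .d) (.s .d .d .d
  .d)) (.s (.s .d .d .d .d) (.s .d .d .d .d) (.s .d .d .d .d) (.s .d .d .d .d)) (.s (.s .d .d .d
  .d) (.s .d .d .d .d) (.s .d .d .d .d) .d))) (.s (.s (.s (.s (.l 1) (.l 14) (.l 14) (.l 14)) (.s
  (.l 14) (.l 14) (.l 14) (.l 6)) (.s (.l 8) (.l 8) (.l 8) (.l 8)) (.s (.l 8) (.l 6) (.l 8) (.l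
  6))) (.s (.l 6) (.s (.l 6) (.l 8) (.l 6) (.l 8)) (.s (.l 6) (.l 6) (.l 16) (.s (.l 16) (.l 16)
  (.l 16) (.l 16))) (.s (.l 6) (.l 8) (.s (.l 8) (.l 8) (.l 16) (.l 8)) (.l 8))) (.s (.s (.l 8)
  (.l 8) (.l 6) (.l 8)) (.s (.l 8) (.s (.l 8) (.l 8) (.l 8) (.l 8)) (.l 8) (.l 8)) (.s (.l 6) (.l
  6) (.s .d .d .d .d) (.l 6)) (.s (.l 6) (.l 8) (.l 6) (.l 6))) (.s (.s (.s (.l 8) (.l 16) (.l 8)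
  .d) (.s (.l 16) (.l 16) .d .d) (.s .d .d .d .d) (.s .d .d .d .d)) (.s (.s .d .d .d .d) (.s .d .d
  .d .d) (.s .d .d .d .d) (.s .d .d .d .d)) (.s (.s .d .d .d .d) (.s .d .d .d .d) .d .d) (.s (.s
  .d .d .d .d) .d .d .d))) (.s (.s (.s (.l 8) (.l 8) (.l 8) (.l 8)) (.s (.l 8) (.l 8) (.l 8) (.l
  10)) (.s (.l 8) (.l 8) (.l 8) (.l 8)) (.s (.l 8) (.s .d .d .d .d) (.l 6) (.s .d .d .d .d))) (.s
  (.s (.l 10) (.l 10) (.l 10) (.l 10)) (.s (.l 10) (.s .d .d .d .d) (.l 10) (.l 10)) (.s (.s .d .d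
  .d .d) (.l 10) (.s .d .d .d .d) .d) (.s (.l 10) .d .d .d)) (.s (.s (.l 8) (.l 6) (.l 6) .d) (.s
  (.l 6) .d .d .d) (.s .d .d .d .d) (.s .d .d .d .d)) (.s (.s .d .d .d .d) (.s .d .d .d .d) (.s .d
  .d .d .d) (.s .d .d .d .d))) (.s (.s (.s (.s .d .d .d .d) (.s .d .d .d .d) .d .d) (.s .d .d .d
  .d) (.s .d .d .d .d) (.s .d .d .d .d)) (.s (.s .d .d .d .d) (.s .d .d .d .d) (.s .d .d .d .d)
  (.s .d .d .d .d)) (.s (.s .d .d .d .d) .d .d .d) (.s .d .d .d .d)) (.s (.s (.s .d .d .d .d) (.s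
  .d .d .d .d) .d .d) (.s .d .d .d .d) (.s .d .d .d .d) (.s .d .d .d .d))) (.s (.s (.s (.s .d .d
  .d .d) (.s .d .d .d .d) .d .d) (.s (.s .d .d .d .d) .d .d .d) (.s .d .d .d .d) (.s .d .d .d .d))
  (.s (.s .d .d .d .d) (.s .d .d .d .d) (.s .d .d .d .d) (.s .d .d .d .d)) (.s .d .d .d .d) (.s .d
  .d .d .d)) (.s (.s (.s .d .d .d .d) (.s .d .d .d .d) .d .d) (.s (.s .d .d .d .d) .d .d .d) (.s
  .d .d .d .d) (.s .d .d .d .d)))) (.s (.s (.s (.l 1) (.l 1) (.s (.l 1) (.l 1) (.l 1) (.l 1)) (.s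
  (.l 1) (.l 17) (.l 18) (.l 18))) (.s (.s (.l 1) (.l 1) (.l 1) (.l 17)) (.s (.l 17) (.l 9) (.l
  18) (.l 9)) (.s (.l 17) (.l 18) (.l 18) (.s (.l 17) (.l 17) (.l 17) (.s (.l 17) (.l 17) (.l 17)
  (.l 17)))) (.s (.s (.l 17) (.l 17) (.l 17) (.l 9)) (.l 9) (.s (.l 9) (.l 9) (.l 9) (.l 9)) (.l
  9))) (.s (.s (.l 18) (.l 19) (.l 19) (.l 19)) (.s (.s (.l 17) (.l 17) (.l 17) (.l 18)) (.s (.l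
  17) (.l 17) (.l 18) (.l 18)) (.l 19) (.s (.l 19) (.l 19) (.l 19) (.l 19))) (.s (.s (.l 19) (.l
  19) (.l 19) (.l 19)) (.l 19) (.s (.l 19) (.l 19) (.s (.l 19) (.l 19) (.l 19) (.l 19)) (.s (.l
  19) (.l 19) (.l 19) (.l 19))) (.s (.l 19) (.l 19) (.l 19) (.l 19))) (.s (.l 19) (.s (.l 19) (.l
  19) (.l 19) (.l 19)) (.s (.l 19) (.l 19) (.l 19) (.l 19)) (.l 19))) (.s (.s (.s (.l 17) (.l 17)
  (.s (.l 17) (.l 17) (.l 17) (.l 17)) (.s (.l 17) (.l 17) (.l 17) (.l 17))) (.s (.l 18) (.s (.l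
  17) (.l 18) (.l 17) (.l 19)) (.s (.l 17) (.l 17) (.l 18) .d) (.s (.s .d .d .d .d) .d .d .d)) (.s
  (.s (.l 18) (.l 19) (.l 19) (.l 19)) (.s (.l 19) (.s .d .d .d .d) (.l 19) .d) (.l 19) (.s .d .d
  .d .d)) (.s (.s .d .d .d .d) (.s .d .d .d .d) (.s .d .d .d .d) (.s .d .d .d .d))) (.s (.s (.s
  (.l 19) .d .d .d) (.l 19) (.s .d .d .d .d) (.l 19)) (.s (.l 19) .d .d .d) (.s (.s .d .d .d .d)
  .d .d .d) (.s .d .d .d .d)) (.s (.s (.l 19) (.l 19) (.l 19) (.l 19)) (.s (.s .d .d .d .d) .d .d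
  .d) (.s .d .d .d .d) (.s .d .d .d .d)) (.s (.s .d .d .d .d) (.s .d .d .d .d) (.s .d .d .d .d)
  .d))) (.s (.s (.s (.l 19) (.s (.l 4) (.l 4) (.l 19) (.l 19)) (.l 19) (.s (.l 19) (.l 19) (.l 19)
  (.l 19))) (.s (.s (.l 4) (.l 4) (.s .d .d .d .d) (.s .d .d .d .d)) (.s (.l 4) .d .d .d) (.s (.s
  .d .d .d .d) .d .d .d) (.s .d .d .d .d)) (.s (.l 19) (.s (.l 19) .d .d .d) (.l 19) (.s .d .d .d
  .d)) (.s (.s .d .d .d .d) (.s .d .d .d .d) (.s .d .d .d .d) .d)) (.s (.s (.s .d .d .d .d) .d (.s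
  .d .d .d .d) .d) (.s .d .d .d .d) (.s .d .d .d .d) (.s .d .d .d .d)) (.s (.s (.l 19) (.s .d .d
  .d .d) (.l 19) .d) (.s .d .d .d .d) (.s .d .d .d .d) (.s .d .d .d .d)) (.s (.s .d .d .d .d) .d
  .d .d)) (.s (.s (.s (.s (.s (.s .d .d .d .d) (.s .d .d .d .d) (.s .d .d .d .d) .d) (.s (.l 19)
  .d .d .d) (.s .d .d .d .d) (.s .d .d .d .d)) (.s (.s .d .d .d .d) (.l 19) (.s .d .d .d .d) (.s
  .d .d .d .d)) (.s (.s .d .d .d .d) (.s .d .d .d .d) .d .d) (.s .d .d .d .d)) (.s (.s (.l 19) .d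
  .d .d) (.s .d .d .d .d) (.s .d .d .d .d) (.s .d .d .d .d)) (.s (.s .d .d .d .d) (.s .d .d .d .d)
  (.s .d .d .d .d) .d) (.s (.s .d .d .d .d) .d .d .d)) (.s (.s (.l 19) (.s .d .d .d .d) .d .d) (.s
  .d .d .d .d) (.s .d .d .d .d) (.s .d .d .d .d)) (.s (.s .d .d .d .d) (.s .d .d .d .d) .d .d) (.s
  .d .d .d .d)) (.s (.s (.s .d .d .d .d) .d .d .d) (.s .d .d .d .d) (.s .d .d .d .d) .d)) (.s (.s
  (.s (.s .d .d .d .d) (.s .d .d .d .d) .d .d) (.s (.s .d .d .d .d) (.s .d .d .d .d) .d .d) (.s .d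
  .d .d .d) (.s .d .d .d .d)) (.s (.s (.s .d .d .d .d) (.s .d .d .d .d) .d .d) (.s .d .d .d .d)
  (.s .d .d .d .d) .d) (.s .d .d .d .d) (.s .d .d .d .d)) (.s (.s (.s .d .d .d .d) (.s .d .d .d
  .d) .d .d) (.s .d .d .d .d) (.s .d .d .d .d) .d)) (.s (.s (.s (.s .d .d .d .d) .d (.s .d .d .d
  .d) .d) (.s .d .d .d .d) (.s .d .d .d .d) .d) (.s .d .d .d .d) (.s .d .d .d .d) .d)) (.s (.s .d
  .d .d .d) .d (.s .d .d .d .d) .d) (.s (.s (.s .d .d .d .d) (.s .d .d .d .d) .d .d) (.s .d .d .d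
  .d) .d .d) (.s .d .d .d .d)) (.s (.s .d .d .d .d) (.s .d .d .d .d) (.s .d .d .d .d) (.s .d .d .d
  .d)) (.s (.s .d .d .d .d) (.s .d .d .d .d) (.s .d .d .d .d) (.s .d .d .d .d)) (.s (.s .d .d .d
  .d) (.s .d .d .d .d) (.s .d .d .d .d) (.s .d .d .d .d)))

def ksD3p1 : List (Nat × List (Nat × Bool) × Nat × Nat × Bool × Nat) :=
  [(1,[(0,true)],2,0,false,2),
   (1,[],2,0,false,2),
   (1,[(0,false)],2,0,false,2),
   (0,[(1,false)],2,0,false,1),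
   (0,[(1,true)],2,0,false,1),
   (0,[(1,true)],2,3,true,0),
   (1,[(0,true)],2,3,false,0),
   (1,[(0,false),(2,false)],1,0,false,1),
   (1,[(2,true),(0,true)],1,0,false,1)]

def trD3p1 : Tr :=
  (.s (.s (.s (.s .o (.s .o (.s .o (.l 0) .o (.l 0)) .o (.s .o (.l 0) (.s .o .o .o (.l 1)) (.l
  1))) (.s .o .o (.s .o .o (.l 2) (.l 1)) (.s .o (.l 1) (.l 1) (.l 1))) (.s (.s .o .o .o (.l 1))
  (.s (.l 1) (.s (.l 1) (.l 1) (.l 1) (.l 1)) (.l 1) (.s (.l 1) (.l 1) (.l 1) (.l 2))) (.s (.l 1)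
  (.l 1) (.l 1) (.s (.l 1) (.l 1) (.l 1) (.s (.l 1) (.l 1) (.l 1) (.l 3)))) (.s (.s (.l 1) (.l 1)
  (.l 1) (.l 1)) (.s (.l 3) (.l 2) (.s (.l 1) (.l 3) (.l 3) (.l 3)) (.s .d .d .d .d)) (.s (.l 1)
  (.s (.l 1) (.l 3) (.l 3) (.l 2)) (.s (.l 1) (.l 3) (.l 2) (.s .d .d .d .d)) (.s (.s .d .d .d .d)
  .d (.s .d .d .d .d) .d)) (.s (.s (.l 3) .d .d .d) (.s .d .d .d .d) (.s .d .d .d .d) .d)))) (.s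
  (.s (.s (.l 0) (.s (.l 4) .d (.l 4) .d) (.l 0) (.s (.l 4) .d (.l 3) .d)) (.s .d .d .d .d) (.s
  (.l 0) (.s (.l 2) .d (.l 2) .d) (.s (.l 1) (.l 0) (.l 1) (.l 2)) (.s (.l 2) .d (.l 2) .d)) (.s
  .d .d .d .d)) (.s .d .d .d .d) (.s (.s (.s (.l 0) (.l 2) (.l 2) (.l 2)) (.s (.l 2) .d .d .d) (.s
  (.l 2) (.l 2) (.l 2) (.l 2)) (.s .d .d .d .d)) (.s .d .d .d .d) (.s (.s (.s .d .d .d .d) .d (.s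
  .d .d .d .d) .d) (.s .d .d .d .d) (.s .d .d .d .d) .d) (.s .d .d .d .d)) (.s .d .d .d .d)) (.s
  (.s (.s (.l 1) (.l 1) (.s (.l 1) (.l 1) (.l 1) (.l 1)) (.s (.l 1) (.l 1) (.l 1) (.l 1))) (.s (.l
  2) (.s (.l 1) (.l 1) (.l 1) (.l 1)) (.s (.l 1) (.l 1) (.s (.l 1) (.l 1) (.l 1) (.l 1)) (.s (.l
  1) (.l 1) (.l 1) (.s (.l 1) .d .d .d))) (.s (.s (.l 1) (.l 1) (.l 1) (.l 1)) (.s (.l 1) (.l 1)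
  (.s (.l 1) (.l 1) (.l 1) (.l 1)) (.s (.l 1) (.l 1) .d .d)) (.s (.l 1) (.s (.l 1) (.l 1) .d .d)
  (.s .d .d .d .d) (.s .d .d .d .d)) (.s (.s .d .d .d .d) (.s .d .d .d .d) (.s .d .d .d .d) (.s .d
  .d .d .d)))) (.s (.s (.l 1) (.l 1) (.s (.l 1) (.l 1) .d .d) (.s (.l 1) (.l 1) .d .d)) (.s (.l 1)
  (.s (.l 1) (.l 1) (.l 1) (.l 1)) (.s (.l 1) (.l 1) .d .d) (.s (.s .d .d .d .d) .d .d .d)) (.s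
  (.s .d .d .d .d) (.s .d .d .d .d) .d .d) (.s (.s .d .d .d .d) (.s .d .d .d .d) .d .d)) (.s (.s
  (.s (.l 1) (.s .d .d .d .d) (.s .d .d .d .d) (.s .d .d .d .d)) (.s (.s .d .d .d .d) (.s .d .d .d
  .d) (.s .d .d .d .d) .d) (.s .d .d .d .d) (.s .d .d .d .d)) (.s (.s (.s .d .d .d .d) (.s .d .d
  .d .d) .d .d) (.s .d .d .d .d) (.s .d .d .d .d) (.s .d .d .d .d)) (.s (.s .d .d .d .d) .d .d .d)
  (.s .d .d .d .d))) (.s (.s (.s (.l 1) (.l 1) (.s (.l 1) (.l 1) (.l 1) (.l 1)) (.s (.l 1) (.l 5)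
  (.l 6) (.l 6))) (.s (.s (.l 1) (.l 1) (.l 1) (.l 5)) (.s (.l 5) (.l 7) (.l 6) (.l 7)) (.s (.l 5)
  (.l 6) (.l 6) (.s .d .d .d .d)) (.s (.s .d .d .d .d) (.l 7) .d .d)) (.s (.s (.l 6) (.l 8) (.l 8)
  (.l 8)) (.s (.s .d .d .d .d) (.s .d .d .d .d) (.l 8) (.s .d .d .d .d)) (.s (.s .d .d .d .d) (.l
  8) .d .d) (.s .d .d .d .d)) (.s (.s (.s .d .d .d .d) .d .d .d) (.s .d .d .d .d) (.s .d .d .d .d)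
  (.s .d .d .d .d))) (.s (.s (.s (.l 8) (.s .d .d .d .d) (.l 8) .d) (.s .d .d .d .d) (.s .d .d .d
  .d) (.s .d .d .d .d)) (.s (.s .d .d .d .d) .d .d .d) (.s (.s .d .d .d .d) .d .d .d) (.s .d .d .d
  .d)) (.s (.s (.s .d .d .d .d) (.s .d .d .d .d) .d .d) (.s .d .d .d .d) (.s .d .d .d .d) .d) (.s
  (.s .d .d .d .d) .d .d .d)) (.s (.s (.s .d .d .d .d) (.s .d .d .d .d) .d .d) (.s (.s .d .d .d
  .d) .d .d .d) .d .d) (.s (.s .d .d .d .d) .d .d .d)) (.s (.s (.s (.s .d .d .d .d) .d .d .d) .d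
  (.s .d .d .d .d) .d) .d (.s .d .d .d .d) .d)) (.s (.s .d .d .d .d) .d (.s .d .d .d .d) .d) (.s
  (.s (.s .d .d .d .d) .d .d .d) (.s .d .d .d .d) .d .d) (.s .d .d .d .d)) (.s (.s .d .d .d .d)
  (.s .d .d .d .d) (.s .d .d .d .d) (.s .d .d .d .d)) (.s (.s .d .d .d .d) (.s .d .d .d .d) (.s .d
  .d .d .d) (.s .d .d .d .d)) (.s (.s .d .d .d .d) (.s .d .d .d .d) (.s .d .d .d .d) (.s .d .d .d
  .d)))

def ksD3p2 : List (Nat × List (Nat × Bool) × Nat × Nat × Bool × Nat) :=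
  [(1,[(0,true)],2,0,false,2),
   (1,[(0,false)],2,0,false,2),
   (1,[],2,0,false,2)]

def trD3p2 : Tr :=
  (.s (.s (.s (.s .o (.s .o (.l 0) .o (.l 1)) (.s .o .o (.l 2) (.l 2)) (.s (.l 1) (.l 1) (.l 2)
  (.l 1))) (.s (.s (.l 0) (.s .d .d .d .d) (.l 1) (.l 1)) (.s .d .d .d .d) (.s (.l 1) (.l 1) (.l
  1) (.l 1)) (.s .d .d .d .d)) (.s (.s (.l 2) (.l 2) (.l 2) (.l 2)) (.s (.s (.l 2) (.l 2) (.l 2)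
  (.l 2)) (.s (.l 2) (.l 1) (.l 1) .d) (.s (.l 2) (.s .d .d .d .d) (.l 2) .d) (.s .d .d .d .d))
  (.s (.l 2) (.s .d .d .d .d) .d .d) (.s (.s .d .d .d .d) .d .d .d)) (.s (.s (.s .d .d .d .d) .d
  .d .d) .d (.s .d .d .d .d) .d)) (.s (.s .d .d .d .d) .d (.s .d .d .d .d) .d) (.s (.s .d .d .d
  .d) (.s .d .d .d .d) .d .d) (.s .d .d .d .d)) (.s (.s .d .d .d .d) (.s .d .d .d .d) (.s .d .d .d
  .d) (.s .d .d .d .d)) (.s (.s .d .d .d .d) (.s .d .d .d .d) (.s .d .d .d .d) (.s .d .d .d .d))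
  (.s (.s .d .d .d .d) (.s .d .d .d .d) (.s .d .d .d .d) (.s .d .d .d .d)))

def ksD3m2 : List (Nat × List (Nat × Bool) × Nat × Nat × Bool × Nat) :=
  [(1,[(0,true)],2,0,false,2),
   (1,[(0,false)],2,0,false,2),
   (1,[],2,0,false,2),
   (0,[(1,false)],2,0,false,1),
   (1,[(2,false)],0,0,false,1),
   (0,[(1,true),(0,false)],2,0,false,1),
   (1,[(0,true)],2,4,false,0),
   (1,[(0,false),(2,true)],0,0,false,1),
   (1,[],2,0,false,1)]

def trD3m2 : Tr :=
  (.s (.s (.s (.s .o (.s .o (.l 0) .o (.l 1)) (.s .o .o (.l 2) (.l 2)) (.s (.l 1) (.l 1) (.l 2)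
  (.l 1))) (.s (.s (.l 0) (.s (.l 0) .d (.l 0) .d) (.l 1) (.l 1)) (.s .d .d .d .d) (.s (.l 1) (.l
  1) (.l 1) (.l 1)) (.s .d .d .d .d)) (.s (.s (.l 2) (.l 2) (.l 2) (.l 2)) (.s (.s (.l 2) (.l 2)
  (.l 2) (.l 2)) (.s (.l 2) (.l 1) (.l 1) (.l 1)) (.s (.l 2) (.s (.l 2) (.l 2) (.l 2) (.l 2)) (.l
  2) (.s (.l 2) (.l 3) (.l 3) (.l 3))) (.s (.s (.l 3) (.l 1) (.l 4) (.l 5)) (.s (.l 1) (.l 1) (.l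
  5) (.l 5)) (.s (.s (.l 3) (.l 3) (.l 3) (.l 3)) (.s (.l 6) (.l 6) (.l 6) .d) (.s (.l 3) (.l 3)
  (.l 3) .d) (.s .d .d .d .d)) (.s (.s .d .d .d .d) (.l 7) (.s .d .d .d .d) .d))) (.s (.l 2) (.s
  (.l 2) (.l 2) (.l 2) (.l 2)) (.s (.l 2) (.l 2) (.s .d .d .d .d) (.l 8)) (.s (.l 2) (.s (.l 2) .d
  .d .d) (.l 8) (.s .d .d .d .d))) (.s (.s (.s (.l 2) (.l 2) (.l 2) (.s (.l 2) (.l 2) (.l 2) .d))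
  (.s (.l 3) (.l 3) (.l 3) (.l 4)) (.s (.l 2) (.s .d .d .d .d) (.s .d .d .d .d) (.s .d .d .d .d))
  (.s (.l 4) .d .d .d)) (.s (.s (.s .d .d .d .d) (.s .d .d .d .d) (.s .d .d .d .d) .d) (.s .d .d
  .d .d) (.s .d .d .d .d) .d) (.s (.s .d .d .d .d) (.s .d .d .d .d) .d .d) (.s .d .d .d .d))) (.s
  (.s (.s (.l 1) (.l 1) (.l 1) (.l 1)) (.s (.l 1) .d .d .d) (.s (.s (.l 1) .d .d .d) (.s .d .d .d
  .d) (.s .d .d .d .d) .d) (.s .d .d .d .d)) (.s .d .d .d .d) (.s (.s .d .d .d .d) .d (.s .d .d .d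
  .d) .d) (.s .d .d .d .d))) (.s (.s .d .d .d .d) .d (.s .d .d .d .d) .d) (.s (.s (.s (.s .d .d .d
  .d) (.s .d .d .d .d) .d .d) (.s (.s .d .d .d .d) .d .d .d) (.s .d .d .d .d) .d) (.s (.s .d .d .d
  .d) .d .d .d) (.s .d .d .d .d) .d) (.s .d .d .d .d)) (.s (.s .d .d .d .d) (.s .d .d .d .d) (.s
  .d .d .d .d) (.s .d .d .d .d)) (.s (.s .d .d .d .d) (.s .d .d .d .d) (.s .d .d .d .d) (.s .d .d
  .d .d)) (.s (.s .d .d .d .d) (.s .d .d .d .d) (.s .d .d .d .d) (.s .d .d .d .d)))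

def ksD4 : List (Nat × List (Nat × Bool) × Nat × Nat × Bool × Nat) :=
  [(1,[(0,true)],2,0,false,2),
   (1,[],2,0,false,2),
   (0,[(1,true)],2,2,true,0),
   (0,[(1,true)],2,0,false,1),
   (1,[],2,2,false,0),
   (1,[],2,1,false,0),
   (1,[],2,2,true,0),
   (0,[(1,true),(2,true)],1,2,false,0)]

def trD4 : Tr :=
  (.s (.s (.s (.s .o (.s .o (.s .o (.l 0) .o (.l 0)) .o (.s .o (.l 0) (.s .o .o .o (.l 1)) (.l
  1))) (.s .o .o (.s .o .o (.l 0) (.l 0)) (.s .o (.s .o .o .o (.l 1)) (.l 0) (.l 1))) (.s (.s .o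
  .o .o (.l 1)) (.s (.l 1) (.l 1) (.l 1) (.s (.l 1) (.l 1) (.l 1) (.l 2))) (.s (.l 1) (.l 1) (.l
  1) (.s (.l 1) (.l 1) (.l 1) (.l 2))) (.s (.l 1) (.s (.l 1) (.l 2) (.l 2) (.l 2)) (.s (.l 1) (.l
  2) (.l 2) (.l 2)) (.s (.l 2) (.l 2) (.l 2) (.l 2))))) (.s (.s (.s (.l 0) (.s (.l 3) .d (.l 3)
  .d) (.l 0) (.s (.l 3) .d (.l 4) .d)) (.s .d .d .d .d) (.s (.s (.l 1) (.l 1) (.l 1) (.l 1)) (.l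
  4) (.s (.l 1) (.l 4) (.l 1) (.l 2)) (.s (.l 4) .d (.s .d .d .d .d) .d)) (.s .d .d .d .d)) (.s .d
  .d .d .d) (.s (.s (.s (.l 1) (.l 2) (.l 2) (.l 2)) (.s (.s .d .d .d .d) .d (.s .d .d .d .d) .d)
  (.l 2) (.s .d .d .d .d)) (.s .d .d .d .d) (.s (.s (.l 2) (.l 2) (.l 2) .d) (.s .d .d .d .d) (.s
  (.l 2) .d .d .d) (.s .d .d .d .d)) (.s .d .d .d .d)) (.s .d .d .d .d)) (.s (.s (.s (.l 0) (.l 0)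
  (.s (.l 3) (.l 3) (.s (.l 1) (.l 5) (.l 5) (.l 5)) (.s (.l 5) (.l 5) (.l 5) (.l 5))) (.s (.l 3)
  (.l 6) (.l 6) (.l 6))) (.s (.s (.l 1) (.l 1) (.l 1) (.l 1)) (.s (.l 1) (.l 1) (.l 6) (.l 2)) (.l
  6) (.s (.l 6) (.s (.l 6) (.l 2) (.l 6) (.l 7)) (.s (.l 6) (.l 6) (.l 6) (.l 6)) (.s (.l 7) (.l
  7) (.l 7) (.l 7)))) (.s (.s (.l 6) (.l 6) (.l 6) (.l 6)) (.s (.l 6) (.l 6) (.l 6) (.l 6)) (.s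
  (.l 6) (.l 6) (.l 6) (.l 6)) (.s (.l 6) (.l 6) (.s .d .d .d .d) (.s .d .d .d .d))) (.s (.s (.l
  6) (.l 6) (.l 6) (.s (.l 6) (.l 6) (.l 6) (.s .d .d .d .d))) (.s (.s (.l 6) (.l 6) (.l 6) (.l
  7)) (.s (.l 7) (.s .d .d .d .d) (.l 7) (.l 7)) (.s (.l 6) (.l 7) (.s .d .d .d .d) .d) (.s (.l 7)
  .d .d .d)) (.s (.s (.l 6) (.l 6) .d .d) (.s .d .d .d .d) (.s .d .d .d .d) (.s .d .d .d .d)) (.s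
  (.s .d .d .d .d) (.s .d .d .d .d) .d .d))) (.s (.s (.s (.l 1) (.l 2) (.l 2) (.l 2)) (.l 2) (.s
  (.s (.l 2) (.l 2) (.l 7) (.l 2)) (.s (.l 2) (.l 2) (.l 2) (.l 2)) (.s (.l 7) (.l 7) (.l 7) (.s
  .d .d .d .d)) (.s (.l 7) (.l 2) (.l 7) (.l 7))) (.s (.l 2) (.l 2) (.s (.l 2) (.l 2) .d .d) (.s
  .d .d .d .d))) (.s (.s (.l 2) (.l 2) (.l 2) (.l 2)) (.s (.l 2) .d (.l 2) .d) (.s (.l 2) (.l 2)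
  (.s .d .d .d .d) .d) (.s .d .d .d .d)) (.s (.s (.s (.s .d .d .d .d) (.s .d .d .d .d) (.s .d .d
  .d .d) .d) (.s (.l 7) .d .d .d) (.s .d .d .d .d) (.s .d .d .d .d)) (.s (.s .d .d .d .d) (.s .d
  .d .d .d) .d .d) (.s (.s .d .d .d .d) .d .d .d) (.s .d .d .d .d)) (.s (.s .d .d .d .d) (.s .d .d
  .d .d) .d .d)) (.s (.s (.s .d .d .d .d) (.s .d .d .d .d) .d .d) (.s (.s .d .d .d .d) (.s .d .d
  .d .d) .d .d) (.s .d .d .d .d) (.s .d .d .d .d)) (.s (.s (.s .d .d .d .d) .d .d .d) (.s .d .d .d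
  .d) .d .d)) (.s (.s (.s (.s .d .d .d .d) .d .d .d) .d (.s .d .d .d .d) .d) (.s .d .d .d .d) (.s
  .d .d .d .d) .d)) (.s (.s .d .d .d .d) .d (.s .d .d .d .d) .d) (.s (.s (.s .d .d .d .d) (.s .d
  .d .d .d) .d .d) (.s .d .d .d .d) .d .d) (.s .d .d .d .d)) (.s (.s .d .d .d .d) (.s .d .d .d .d)
  (.s .d .d .d .d) (.s .d .d .d .d)) (.s (.s .d .d .d .d) (.s .d .d .d .d) (.s .d .d .d .d) (.s .d
  .d .d .d)) (.s (.s .d .d .d .d) (.s .d .d .d .d) (.s .d .d .d .d) (.s .d .d .d .d)))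

def ksD5p : List (Nat × List (Nat × Bool) × Nat × Nat × Bool × Nat) :=
  [(1,[(0,true)],2,0,false,2),
   (1,[],2,0,false,2),
   (1,[(0,false)],2,0,false,2),
   (0,[(1,true)],2,0,false,1),
   (1,[(0,false),(0,false)],2,0,false,2)]

def trD5p : Tr :=
  (.s (.s (.s (.s .o (.s .o (.s .o (.l 0) .o (.l 1)) .o (.l 2)) (.s .o .o (.s .o .o (.l 1) (.l 1))
  (.l 1)) (.s (.s .o .o .o (.l 1)) (.l 2) (.l 1) (.s (.l 1) (.l 1) (.l 1) (.l 2)))) (.s (.s (.s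
  (.l 1) (.l 3) (.l 1) (.l 3)) (.s .d .d .d .d) (.s (.l 1) (.l 3) (.l 1) (.l 2)) (.s .d .d .d .d))
  (.s .d .d .d .d) (.s (.s (.l 3) (.l 4) (.l 3) (.l 4)) (.s .d .d .d .d) (.s (.l 2) (.s .d .d .d
  .d) (.s .d .d .d .d) .d) (.s .d .d .d .d)) (.s .d .d .d .d)) (.s (.s (.l 1) (.s (.l 1) (.l 1)
  (.l 1) (.l 1)) (.s (.l 1) (.l 1) (.l 1) (.l 1)) (.s (.l 1) (.s (.l 1) (.l 1) (.l 1) (.l 1)) (.s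
  (.l 1) (.l 1) .d .d) (.s .d .d .d .d))) (.s (.s (.l 1) (.l 1) (.l 2) (.l 2)) (.s (.l 2) (.l 2)
  (.l 2) (.s .d .d .d .d)) (.s (.s (.l 1) (.l 3) (.l 3) .d) (.s .d .d .d .d) (.s .d .d .d .d) (.s
  .d .d .d .d)) (.s (.s .d .d .d .d) .d .d .d)) (.s (.s (.s .d .d .d .d) (.s .d .d .d .d) .d .d)
  (.s (.s .d .d .d .d) .d .d .d) .d .d) (.s (.s .d .d .d .d) (.s .d .d .d .d) .d .d)) (.s (.s (.s
  (.s .d .d .d .d) .d .d .d) .d (.s .d .d .d .d) .d) .d (.s .d .d .d .d) .d)) (.s (.s .d .d .d .d)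
  .d (.s .d .d .d .d) .d) (.s (.s (.s .d .d .d .d) .d .d .d) (.s .d .d .d .d) .d .d) (.s .d .d .d
  .d)) (.s (.s .d .d .d .d) (.s .d .d .d .d) (.s .d .d .d .d) (.s .d .d .d .d)) (.s (.s .d .d .d
  .d) (.s .d .d .d .d) (.s .d .d .d .d) (.s .d .d .d .d)) (.s (.s .d .d .d .d) (.s .d .d .d .d)
  (.s .d .d .d .d) (.s .d .d .d .d)))

def ksD5m : List (Nat × List (Nat × Bool) × Nat × Nat × Bool × Nat) :=
  [(1,[(0,true)],2,0,false,2),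
   (1,[],2,0,false,2),
   (1,[(0,false)],2,0,false,2),
   (0,[(1,true)],2,0,false,1),
   (0,[(1,false)],2,0,false,1),
   (1,[(0,false),(2,false)],0,0,false,1),
   (1,[(0,false),(0,false)],2,0,false,2),
   (0,[(1,true),(0,true)],2,2,true,0),
   (0,[(1,false)],2,1,true,0),
   (1,[(0,true),(0,true)],2,2,false,0),
   (1,[(0,true),(2,true)],1,0,false,1),
   (1,[(0,false),(2,true)],1,0,false,1),
   (1,[],2,0,false,1),
   (1,[],2,1,false,0),
   (1,[(2,false),(0,true)],1,0,false,1)]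

def trD5m : Tr :=
  (.s (.s (.s (.s .o (.s .o (.s .o (.l 0) .o (.l 1)) .o (.l 2)) (.s .o .o (.s .o .o (.l 1) (.l 1))
  (.l 1)) (.s (.s .o .o .o (.l 1)) (.l 2) (.l 1) (.s (.l 1) (.l 1) (.l 1) (.l 2)))) (.s (.s (.s
  (.l 1) (.l 3) (.l 1) (.l 4)) (.s (.l 5) .d (.l 6) .d) (.s (.l 1) (.l 4) (.l 1) (.l 2)) (.s (.l
  6) .d (.l 6) .d)) (.s .d .d .d .d) (.s (.s (.l 4) (.l 6) (.l 4) (.l 6)) (.s (.l 6) .d .d .d) (.s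
  (.l 2) (.s .d .d .d .d) (.s (.l 4) (.l 4) (.l 4) .d) (.s .d .d .d .d)) (.s .d .d .d .d)) (.s .d
  .d .d .d)) (.s (.s (.l 1) (.s (.l 1) (.l 1) (.l 1) (.l 1)) (.s (.l 1) (.l 1) (.l 1) (.l 1)) (.s
  (.l 1) (.s (.l 1) (.l 1) (.l 1) (.l 1)) (.s (.l 1) (.l 1) (.l 1) (.s (.l 1) (.l 1) (.l 1) (.l
  1))) (.s (.l 1) (.s (.l 1) (.l 1) (.l 1) (.l 7)) (.s (.l 1) (.l 7) (.l 7) (.l 7)) (.l 7)))) (.s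
  (.s (.l 1) (.l 1) (.l 2) (.l 2)) (.s (.l 2) (.l 2) (.l 2) (.s (.l 8) (.l 4) (.l 8) .d)) (.s (.s
  (.l 1) (.l 4) (.l 4) (.l 4)) (.s (.l 4) (.l 4) (.l 4) (.l 4)) (.s (.s (.l 4) (.l 4) (.l 7) (.l
  2)) (.s (.l 4) (.l 4) (.l 2) (.l 2)) (.l 7) (.l 9)) (.s (.l 10) (.l 10) (.s .d .d .d .d) (.s .d
  .d .d .d))) (.s (.s (.l 4) (.l 2) (.l 4) (.l 4)) (.s (.s .d .d .d .d) .d .d .d) (.s (.l 11) .d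
  .d .d) (.s .d .d .d .d))) (.s (.s (.s (.l 1) (.l 1) (.s (.l 1) (.l 1) (.l 11) (.l 12)) (.l 12))
  (.s (.l 1) (.l 1) (.l 12) (.l 11)) (.s (.s .d .d .d .d) (.l 12) (.l 13) (.l 13)) (.s (.s .d .d
  .d .d) (.s .d .d .d .d) (.s .d .d .d .d) .d)) (.s (.s (.s (.l 1) (.l 1) (.l 1) (.l 1)) (.s (.l
  1) (.l 7) (.l 7) (.l 7)) (.s (.l 1) (.l 11) .d .d) (.l 9)) (.s (.l 7) (.l 7) (.l 7) (.l 7)) (.s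
  (.l 14) (.l 7) .d .d) (.l 7)) (.s (.s .d .d .d .d) (.s .d .d .d .d) .d .d) (.s (.s .d .d .d .d)
  (.l 9) .d .d)) (.s (.s (.l 9) (.s (.l 7) .d .d .d) (.l 7) (.l 7)) (.s (.s .d .d .d .d) .d .d .d)
  (.s .d .d .d .d) (.s .d .d .d .d))) (.s (.s (.s (.s (.l 4) .d .d .d) (.s .d .d .d .d) (.s .d .d
  .d .d) .d) (.s .d .d .d .d) (.s (.s .d .d .d .d) .d .d .d) .d) (.s .d .d .d .d) (.s (.s .d .d .d
  .d) .d .d .d) .d)) (.s (.s .d .d .d .d) .d (.s .d .d .d .d) .d) (.s (.s (.s (.s .d .d .d .d) (.s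
  .d .d .d .d) .d .d) (.s .d .d .d .d) .d .d) (.s (.s .d .d .d .d) .d .d .d) .d .d) (.s .d .d .d
  .d)) (.s (.s .d .d .d .d) (.s .d .d .d .d) (.s .d .d .d .d) (.s .d .d .d .d)) (.s (.s .d .d .d
  .d) (.s .d .d .d .d) (.s .d .d .d .d) (.s .d .d .d .d)) (.s (.s .d .d .d .d) (.s .d .d .d .d)
  (.s .d .d .d .d) (.s .d .d .d .d)))

def K3 : Cst := ⟨⟨-524288, 0, 0⟩, ⟨786432, 0, 0⟩, ⟨1572864, 0, 0⟩, ⟨2359296, 0, 0⟩, ⟨524288, 0, 0⟩⟩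
def K4 : Cst := ⟨⟨0, 0, 0⟩, ⟨1048576, 0, 0⟩, ⟨1048576, 0, 0⟩, ⟨1048576, 0, 0⟩, ⟨1048576, 0, 0⟩⟩
def K5 : Cst := ⟨⟨324028, 0, 1⟩, ⟨948446, 0, 1⟩, ⟨724548, 0, 1⟩, ⟨500650, 0, 1⟩, ⟨1372604, 0, 1⟩⟩
def K6 : Cst := ⟨⟨524288, 0, 0⟩, ⟨786432, 0, 0⟩, ⟨524288, 0, 0⟩, ⟨262144, 0, 0⟩, ⟨1572864, 0, 0⟩⟩
def KD3m1 : Cst2 := ⟨K3, ⟨-349525, 0, 1⟩, ⟨988607, 0, 1⟩, ⟨454047, 0, 1⟩, ⟨-524288, 908093, 2⟩, ⟨-524288, -908093, 2⟩,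
  ⟨87381, 0, 1⟩, ⟨349525, 0, 1⟩, 699049, 1066179, 1072046, 1130992, 424032, -1048576⟩
def KD3p1 : Cst2 := ⟨K3, ⟨349525, 0, 1⟩, ⟨988607, 0, 1⟩, ⟨454047, 0, 1⟩, ⟨-524288, 908093, 2⟩, ⟨-524288, -908093, 2⟩,
  ⟨174763, 0, 1⟩, ⟨699051, 0, 1⟩, 349524, 1066179, 1072046, 1130992, 424032, -1048576⟩
def KD3p2 : Cst2 := ⟨K3, ⟨781562, 0, 1⟩, ⟨699051, 0, 1⟩, ⟨454047, 0, 1⟩, ⟨-524288, 908093, 2⟩, ⟨-524288, -908093, 2⟩,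
  ⟨228767, 0, 1⟩, ⟨915069, 0, 1⟩, 133505, 1066179, 1072046, 1130992, 424032, -349490⟩
def KD3m2 : Cst2 := ⟨K3, ⟨-781562, 0, 1⟩, ⟨699051, 0, 1⟩, ⟨454047, 0, 1⟩, ⟨-524288, 908093, 2⟩, ⟨-524288, -908093, 2⟩,
  ⟨33377, 0, 1⟩, ⟨133507, 0, 1⟩, 915068, 1066179, 1072046, 1130992, 424032, -349490⟩
def KD4 : Cst2 := ⟨K4, ⟨0, 0, 1⟩, ⟨1048576, 0, 1⟩, ⟨524288, 0, 1⟩, ⟨0, 1048576, 2⟩, ⟨0, -1048576, 2⟩,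
  ⟨131072, 0, 1⟩, ⟨524288, 0, 1⟩, 524287, 1066179, 1083781, 1174400, 503312, -9437184⟩
def KD5p : Cst2 := ⟨K5, ⟨468937, 0, 1⟩, ⟨937875, 0, 1⟩, ⟨498628, 0, 1⟩, ⟨324028, 997255, 2⟩, ⟨324028, -997255, 2⟩,
  ⟨189689, 0, 1⟩, ⟨758757, 0, 1⟩, 289818, 1066179, 1099524, 1258288, 587200, -1048576⟩
def KD5m : Cst2 := ⟨K5, ⟨-468937, 0, 1⟩, ⟨937875, 0, 1⟩, ⟨498628, 0, 1⟩, ⟨324028, 997255, 2⟩, ⟨324028, -997255, 2⟩,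
  ⟨72455, 0, 1⟩, ⟨289819, 0, 1⟩, 758755, 1066179, 1099524, 1258288, 587200, -1048576⟩
theorem cert3 : chk1 K3 1131216 424256 ks3 tr3 1048576 1048576 1048576 = true := by decide +kernel
theorem cert4 : chk1 K4 1174416 503328 ks4 tr4 1048576 1048576 1048576 = true := by decide +kernel
theorem cert5 : chk1 K5 1258304 587216 ks5 tr5 1048576 1048576 1048576 = true := by decide +kernel
theorem cert6 : chk1 K6 1258304 629152 ks6 tr6 1048576 1048576 1048576 = true := by decide +kernel
theorem certD3m1 : chk2 KD3m1 ksD3m1 trD3m1 4194304 4194304 4194304 = true := by decide +kernel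
theorem certD3p1 : chk2 KD3p1 ksD3p1 trD3p1 4194304 4194304 4194304 = true := by decide +kernel
theorem certD3p2 : chk2 KD3p2 ksD3p2 trD3p2 4194304 4194304 4194304 = true := by decide +kernel
theorem certD3m2 : chk2 KD3m2 ksD3m2 trD3m2 4194304 4194304 4194304 = true := by decide +kernel
theorem certD4 : chk2 KD4 ksD4 trD4 4194304 4194304 4194304 = true := by decide +kernel
theorem certD5p : chk2 KD5p ksD5p trD5p 4194304 4194304 4194304 = true := by decide +kernel
theorem certD5m : chk2 KD5m ksD5m trD5m 4194304 4194304 4194304 = true := by decide +kernel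
end Marg

namespace Marg

theorem mem_real {x : ℤ} {r : ℕ} {t : ℝ} (h : |1048576 * t - x| ≤ r) : (⟨x, 0, r⟩ : Dk).mem (t : ℂ) := by
  simp only [Dk.mem, Dk.c]
  have : 1048576 * (t:ℂ) - ((x:ℂ) + ((0:ℤ):ℂ) * Complex.I) = ((1048576 * t - x : ℝ) : ℂ) := by
    push_cast; ring
  rw [this, Complex.norm_real]
  exact h

theorem mem_real' {x : ℤ} {r : ℕ} {t : ℝ} {z : ℂ} (hz : z = (t:ℂ)) (h : |1048576 * t - x| ≤ r) : (⟨x, 0, r⟩ : Dk).mem z := by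
  rw [hz]; exact mem_real h

theorem s5sq : Real.sqrt 5 ^ 2 = 5 := Real.sq_sqrt (by norm_num)
theorem s5lo : 2.23606797 < Real.sqrt 5 := by
  apply Real.lt_sqrt_of_sq_lt; norm_num
theorem s5hi : Real.sqrt 5 < 2.23606798 := by
  rw [Real.sqrt_lt' (by norm_num)]; norm_num

theorem K3ok : K3.ok (-1/2) where
  C := mem_real (by norm_num)
  S := mem_real' (t := 1 - (-1/2)^2) (by push_cast; ring) (by norm_num)
  D := mem_real' (t := 1 - (-1/2)) (by push_cast; ring) (by norm_num)
  DD := mem_real' (t := (1 - (-1/2))^2) (by push_cast; ring) (by norm_num)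
  C1 := mem_real' (t := 1 + (-1/2)) (by push_cast; ring) (by norm_num)

theorem K4ok : K4.ok 0 where
  C := mem_real (by norm_num)
  S := mem_real' (t := 1) (by push_cast; ring) (by norm_num)
  D := mem_real' (t := 1) (by push_cast; ring) (by norm_num)
  DD := mem_real' (t := 1) (by push_cast; ring) (by norm_num)
  C1 := mem_real' (t := 1) (by push_cast; ring) (by norm_num)

theorem K6ok : K6.ok (1/2) where
  C := mem_real (by norm_num)
  S := mem_real' (t := 1 - (1/2)^2) (by push_cast; ring) (by norm_num)
  D := mem_real' (t := 1 - (1/2)) (by push_cast; ring) (by norm_num)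
  DD := mem_real' (t := (1 - (1/2))^2) (by push_cast; ring) (by norm_num)
  C1 := mem_real' (t := 1 + (1/2)) (by push_cast; ring) (by norm_num)

theorem K5ok : K5.ok ((Real.sqrt 5 - 1)/4) where
  C := mem_real (by rw [abs_le]; constructor <;> push_cast <;> linarith [s5lo, s5hi])
  S := mem_real' (t := 1 - ((Real.sqrt 5 - 1)/4)^2) (by push_cast; ring)
    (by rw [abs_le]; constructor <;> push_cast <;> nlinarith [s5lo, s5hi, s5sq])
  D := mem_real' (t := 1 - (Real.sqrt 5 - 1)/4) (by push_cast; ring)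
    (by rw [abs_le]; constructor <;> push_cast <;> linarith [s5lo, s5hi])
  DD := mem_real' (t := (1 - (Real.sqrt 5 - 1)/4)^2) (by push_cast; ring)
    (by rw [abs_le]; constructor <;> push_cast <;> nlinarith [s5lo, s5hi, s5sq])
  C1 := mem_real' (t := 1 + (Real.sqrt 5 - 1)/4) (by push_cast; ring)
    (by rw [abs_le]; constructor <;> push_cast <;> linarith [s5lo, s5hi])

theorem Up3 (T : ℂ) : (Up T 3).1 = T ^ 2 - 1 := by simp [Up]; ring
theorem Up5 (T : ℂ) : (Up T 5).1 = (T ^ 2 - T - 1) * (T ^ 2 + T - 1) := by simp [Up]; ring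
theorem wordV1 (c2 : ℝ) (κ : ℂ) : wordV c2 [true] κ = c2 + (1 - c2) * κ ^ 2 := by
  simp [wordV, wordC, sg]; ring

theorem sqrt_unique {w : ℂ} {r : ℝ} (h : w ^ 2 = (r:ℂ) ^ 2) (hr : 0 < r) (hw : r < w.re) : False := by
  have : (w - r) * (w + r) = 0 := by linear_combination h
  rcases mul_eq_zero.mp this with h | h
  · have := congrArg Complex.re h; simp at this; linarith
  · have := congrArg Complex.re h; simp at this; linarith

theorem s5C : ((Real.sqrt 5 : ℝ):ℂ) ^ 2 = 5 := by
  have := s5sq; exact_mod_cast this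

/-- Possible values of `κ` for order 3. -/
def Q3 (κ : ℂ) : Prop := κ ^ 2 = 1 ∨ κ ^ 2 = 1/9 ∨ κ ^ 2 = 5/9 ∨ κ ^ 2 = ((3 - 2 * Real.sqrt 5) / 9 : ℝ)
def Q4 (κ : ℂ) : Prop := κ ^ 2 = 1 ∨ κ = 0
def Q5 (κ : ℂ) : Prop := κ ^ 2 = 1 ∨ κ ^ 2 = 1 / 5
def Q6 (κ : ℂ) : Prop := κ ^ 2 = 1

theorem sq_conj_real {z : ℂ} {r : ℝ} (h : (starRingEnd ℂ) z ^ 2 = (r:ℂ)) : z ^ 2 = r := by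
  have := congrArg (starRingEnd ℂ) h
  simpa using this

theorem U5_case {w : ℂ} (h : (Up (1/2 + w) 5).1 = 0) (hw : 0.75 < w.re) : w ^ 2 = 5 / 4 := by
  rw [Up5] at h
  rcases mul_eq_zero.mp h with h | h
  · linear_combination h
  · exfalso
    apply sqrt_unique (w := w + 1) (r := Real.sqrt 5 / 2)
    · push_cast; linear_combination h - s5C / 4
    · linarith [s5lo]
    · simp; linarith [s5hi]

theorem stage1_3 {s2 : ℝ} {Ax : W3 → Prop} (hA : AxSys (-1/2) s2 Ax) (hcs : (-1/2) ^ 2 + s2 ^ 2 = 1)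
    {κ : ℂ} (hP : PP Ax κ) (hE : InE 1131216 424256 κ) : Q3 κ := by
  refine stage1 hA hcs K3ok 1131216 424256 ks3 tr3 (fun m => Nat.ble m 4) (by decide +kernel) (by norm_num)
    (by norm_num) (by norm_num) (by norm_num) cert3 Q3 ?_ ?_ ?_ hP hE
  · intro z h; simpa [Q3] using h
  · intro z h
    rcases h with h | h | h | h
    · left; have := sq_conj_real (r := 1) (by simpa using h); simpa using this
    · right; left; have := sq_conj_real (r := 1/9) (by simpa using h); simpa using this
    · right; right; left; have := sq_conj_real (r := 5/9) (by simpa using h); simpa using this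
    · right; right; right; exact sq_conj_real h
  · intro z hE h
    rcases h with h | ⟨-, q, h⟩ | ⟨-, h, h1, h2⟩ | ⟨-, h, h1⟩ | ⟨-, h, h1, h2⟩ | ⟨⟨j, h1, h2⟩, -⟩
    · left; exact h
    · right; left
      cases q
      · simp only [Tq, cond_false] at h
        push_cast at h
        have : z = 1/3 := by linear_combination (-2/3) * h
        rw [this]; norm_num
      · simp only [Tq, cond_true] at h
        push_cast at h
        have : z = -1/3 := by linear_combination (2/3) * h
        rw [this]; norm_num
    · right; right; left
      have e : Tq (-1/2) true z = 1/2 + 3/2 * z := by simp [Tq]; ring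
      rw [e] at h
      have := U5_case h (by simp; linarith)
      linear_combination (4/9) * this
    · exfalso
      have hz : wordV (-1/2) [true] z = -1 := by
        have : (wordV (-1/2) [true] z - 1) * (wordV (-1/2) [true] z + 1) = 0 := by linear_combination h
        rcases mul_eq_zero.mp this with h | h
        · exfalso
          have := congrArg Complex.re h
          simp at this; linarith
        · linear_combination h
      rw [wordV1] at hz
      push_cast at hz
      have h3 : z ^ 2 = ((-1/3 : ℝ):ℂ) := by push_cast; linear_combination (2/3) * hz
      have hr := congrArg Complex.re h3
      have hi := congrArg Complex.im h3
      simp only [sq, Complex.mul_re, Complex.mul_im, Complex.ofReal_re, Complex.ofReal_im] at hr hi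
      have h5 := InE_im (by norm_num) hE
      have h6 := sq_le_sq' (abs_le.mp h5).1 (abs_le.mp h5).2
      push_cast at h6
      nlinarith [sq_nonneg z.re]
    · right; right; right
      have e : Tq (-1/2) false (wordV (-1/2) [true] z) = 1/2 + (-3/2 * wordV (-1/2) [true] z) := by simp [Tq]; ring
      rw [e] at h
      have h7 := U5_case h (by
        have : (-3/2 * wordV (-1/2) [true] z).re = -3/2 * (wordV (-1/2) [true] z).re := by
          have : (-3/2 * wordV (-1/2) [true] z) = ((-3/2 : ℝ):ℂ) * wordV (-1/2) [true] z := by push_cast; ring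
          rw [this, Complex.re_ofReal_mul]
        rw [this]; linarith)
      set w := wordV (-1/2) [true] z with hw
      have h8 : (w - Real.sqrt 5 / 3) * (w + Real.sqrt 5 / 3) = 0 := by
        linear_combination (4/9) * h7 - s5C / 9
      rw [wordV1] at hw
      push_cast at hw
      rcases mul_eq_zero.mp h8 with h | h
      · exfalso
        have := congrArg Complex.re h
        have e : (w - Real.sqrt 5 / 3) = w - ((Real.sqrt 5 / 3 : ℝ):ℂ) := by push_cast; ring
        rw [e] at this
        simp at this
        linarith [s5lo]
      · push_cast; linear_combination (2/3) * h - (2/3) * hw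
    · simp [Nat.ble_eq] at h2; omega

theorem stage1_4 {s2 : ℝ} {Ax : W3 → Prop} (hA : AxSys 0 s2 Ax) (hcs : (0:ℝ) ^ 2 + s2 ^ 2 = 1)
    {κ : ℂ} (hP : PP Ax κ) (hE : InE 1174416 503328 κ) : Q4 κ := by
  refine stage1 hA hcs K4ok 1174416 503328 ks4 tr4 (fun m => m == 0 || m == 1 || m == 5) (by decide +kernel) (by norm_num)
    (by norm_num) (by norm_num) (by norm_num) cert4 Q4 ?_ ?_ ?_ hP hE
  · intro z h; simpa [Q4] using h
  · intro z h
    rcases h with h | h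
    · left; have := sq_conj_real (r := 1) (by simpa using h); simpa using this
    · right; simpa using h
  · intro z hE h
    rcases h with h | ⟨h, -⟩ | ⟨h, -⟩ | ⟨h, -⟩ | ⟨h, -⟩ | ⟨-, h, h1, h2⟩
    · left; exact h
    · simp at h
    · simp at h
    · simp at h
    · simp at h
    · right
      rw [Up3] at h
      simp only [Tq, cond_false] at h
      push_cast at h
      have : z * (z - 2) = 0 := by linear_combination h
      rcases mul_eq_zero.mp this with h | h
      · exact h
      · exfalso
        have := congrArg Complex.re h
        simp at this; linarith

theorem stage1_5 {s2 : ℝ} {Ax : W3 → Prop} (hA : AxSys ((Real.sqrt 5 - 1)/4) s2 Ax)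
    (hcs : ((Real.sqrt 5 - 1)/4) ^ 2 + s2 ^ 2 = 1)
    {κ : ℂ} (hP : PP Ax κ) (hE : InE 1258304 587216 κ) : Q5 κ := by
  refine stage1 hA hcs K5ok 1258304 587216 ks5 tr5 (fun m => m == 0 || m == 1 || m == 5) (by decide +kernel) (by norm_num)
    (by norm_num) (by norm_num) (by norm_num) cert5 Q5 ?_ ?_ ?_ hP hE
  · intro z h; simpa [Q5] using h
  · intro z h
    rcases h with h | h
    · left; have := sq_conj_real (r := 1) (by simpa using h); simpa using this
    · right; have := sq_conj_real (r := 1/5) (by simpa using h); simpa using this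
  · intro z hE h
    rcases h with h | ⟨h, -⟩ | ⟨h, -⟩ | ⟨h, -⟩ | ⟨h, -⟩ | ⟨-, h, h1, h2⟩
    · left; exact h
    · simp at h
    · simp at h
    · simp at h
    · simp at h
    · right
      rw [Up3] at h
      simp only [Tq, cond_false] at h
      push_cast at h
      have e := s5C
      set s : ℂ := ((Real.sqrt 5 : ℝ):ℂ) with hs
      have h4 : ((s - 1) - (5 - s) * z) * ((s + 7) - (5 - s) * z) = 0 := by
        linear_combination 16 * h
      rcases mul_eq_zero.mp h4 with h | h
      · have : (5 - s) * (5 * z - s) = 0 := by linear_combination (-5) * h + e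
        rcases mul_eq_zero.mp this with h' | h'
        · exfalso
          have := congrArg Complex.re h'
          simp [hs] at this; linarith [s5hi]
        · have : z = s / 5 := by linear_combination h' / 5
          rw [this]; linear_combination e / 25
      · exfalso
        have h5 := congrArg Complex.re h
        have e2 : (s + 7 - (5 - s) * z) = ((Real.sqrt 5 + 7 : ℝ) : ℂ) - ((5 - Real.sqrt 5 : ℝ):ℂ) * z := by
          rw [hs]; push_cast; ring
        rw [e2, Complex.sub_re, Complex.re_ofReal_mul, Complex.ofReal_re, Complex.zero_re] at h5
        nlinarith [s5hi, s5lo]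

theorem stage1_6 {s2 : ℝ} {Ax : W3 → Prop} (hA : AxSys (1/2) s2 Ax) (hcs : (1/2:ℝ) ^ 2 + s2 ^ 2 = 1)
    {κ : ℂ} (hP : PP Ax κ) (hE : InE 1258304 629152 κ) : Q6 κ := by
  refine stage1 hA hcs K6ok 1258304 629152 ks6 tr6 (fun m => m == 0 || m == 1) (by decide +kernel) (by norm_num)
    (by norm_num) (by norm_num) (by norm_num) cert6 Q6 ?_ ?_ ?_ hP hE
  · intro z h; simpa [Q6] using h
  · intro z h
    have := sq_conj_real (r := 1) (by simpa [Q6] using h); simpa [Q6] using this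
  · intro z hE h
    rcases h with h | ⟨h, -⟩ | ⟨h, -⟩ | ⟨h, -⟩ | ⟨h, -⟩ | ⟨⟨j, h1, h2⟩, -⟩
    · exact h
    · simp at h
    · simp at h
    · simp at h
    · simp at h
    · simp at h2; omega

end Marg

namespace Marg

structure V3.mem (V : V3) (v : W3) : Prop where
  a : V.a.mem v.a
  b : V.b.mem v.b
  c : V.c.mem v.c

structure Cst2.ok (K : Cst2) (c2 s2 κ0 s0 t0 N : ℝ) : Prop where
  KK : K.K.ok c2
  KP : K.KP.mem κ0
  SS : K.SS.mem s0
  HS : K.HS.mem (s2 / 2)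
  ZP : K.ZP.mem (c2 + Complex.I * s2)
  ZM : K.ZM.mem (c2 - Complex.I * s2)
  QC : K.QC.mem ((1 + κ0) / 8)
  AA : K.AA.mem ((1 + κ0) / 2)
  BB : (K.BB : ℝ) ≤ 1048576 * ((1 - κ0) / 2)
  T0 : 1048576 * t0 ≤ K.T0
  N0 : 1048576 * N ≤ K.N0
  N1 : 1 ≤ N

theorem V3_dot_mem {U V : V3} {u v : W3} (hU : U.mem u) (hV : V.mem v) : (U.dot V).mem (dot u v) :=
  mem_add (mem_mul hU.a hV.a) (mem_hf (mem_add (mem_mul hU.b hV.c) (mem_mul hU.c hV.b)))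

theorem mem_cast {d : Dk} {z w : ℂ} (h : d.mem z) (e : w = z) : d.mem w := e ▸ h

theorem V3_rot_mem {K : Cst2} {c2 s2 κ0 s0 t0 N : ℝ} (hK : K.ok c2 s2 κ0 s0 t0 N) {U V : V3} {u v : W3}
    (hU : U.mem u) (hV : V.mem v) (s : Bool) : (V3.rot K V s U).mem (rot c2 s2 v (sg s) u) := by
  have ht := mem_mul hK.KK.D (V3_dot_mem hU hV)
  have ha := mem_sub (mem_mul hV.b hU.c) (mem_mul hU.b hV.c)
  have hb := mem_sub (mem_mul hV.a hU.b) (mem_mul hU.a hV.b)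
  have hc := mem_sub (mem_mul hU.a hV.c) (mem_mul hV.a hU.c)
  have hJ := mem_muli (mem_sg hK.HS s)
  have h1 := mem_add (mem_add (mem_mul hK.KK.C hU.a) (mem_mul hJ ha)) (mem_mul ht hV.a)
  have h2 := mem_add (mem_add (mem_mul hK.KK.C hU.b) (mem_mul hJ (mem_add hb hb))) (mem_mul ht hV.b)
  have h3 := mem_add (mem_add (mem_mul hK.KK.C hU.c) (mem_mul hJ (mem_add hc hc))) (mem_mul ht hV.c)
  refine ⟨?_, ?_, ?_⟩
  · refine mem_cast h1 ?_; simp only [rot, cr]; ring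
  · refine mem_cast h2 ?_; simp only [rot, cr]; ring
  · refine mem_cast h3 ?_; simp only [rot, cr]; ring

def w0 : W3 := ⟨1, 0, 0⟩

theorem rot_w0 (c2 s2 : ℝ) (σ : ℂ) (u : W3) : rot c2 s2 w0 σ u =
    ⟨u.a, (c2 + σ * Complex.I * s2) * u.b, (c2 - σ * Complex.I * s2) * u.c⟩ := by
  simp only [rot, w0, dot, cr, W3.mk.injEq]
  refine ⟨by ring, by ring, by ring⟩

theorem V3_rotp_mem {K : Cst2} {c2 s2 κ0 s0 t0 N : ℝ} (hK : K.ok c2 s2 κ0 s0 t0 N) {U : V3} {u : W3}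
    (hU : U.mem u) (s : Bool) : (V3.rotp K s U).mem (rot c2 s2 w0 (sg s) u) := by
  rw [rot_w0]
  cases s
  · refine ⟨hU.a, ?_, ?_⟩
    · refine mem_cast (mem_mul hK.ZM hU.b) ?_; simp [sg]; left; ring
    · refine mem_cast (mem_mul hK.ZP hU.c) ?_; simp [sg]
  · refine ⟨hU.a, ?_, ?_⟩
    · refine mem_cast (mem_mul hK.ZP hU.b) ?_; simp [sg]
    · refine mem_cast (mem_mul hK.ZM hU.c) ?_; simp [sg]

theorem axp_mem : axp.mem w0 := ⟨mem_ex1, mem_ex0, mem_ex0⟩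

def axisC (p f F : W3) (i : ℕ) : W3 :=
  match i with
  | 0 => p
  | 1 => f
  | _ => F

theorem axis_mem {P F G : V3} {p f g : W3} (hP : P.mem p) (hF : F.mem f) (hG : G.mem g) (i : ℕ) :
    (axis P F G i).mem (axisC p f g i) := by
  rcases i with _ | _ | i
  · exact hP
  · exact hF
  · exact hG

theorem axisC_ax {Ax : W3 → Prop} {p f g : W3} (hP : Ax p) (hF : Ax f) (hG : Ax g) (i : ℕ) :
    Ax (axisC p f g i) := by
  rcases i with _ | _ | i
  · exact hP
  · exact hF
  · exact hG

def evalC (c2 s2 : ℝ) (f F : W3) : List (ℕ × Bool) → W3 → W3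
  | [], u => u
  | (t, s) :: l, u => rot c2 s2 (axisC w0 f F t) (sg s) (evalC c2 s2 f F l u)

theorem evalW_mem {K : Cst2} {c2 s2 κ0 s0 t0 N : ℝ} (hK : K.ok c2 s2 κ0 s0 t0 N) {F G U : V3} {f g u : W3}
    (hF : F.mem f) (hG : G.mem g) (hU : U.mem u) (l : List (ℕ × Bool)) :
    (evalW K F G l U).mem (evalC c2 s2 f g l u) := by
  induction l with
  | nil => exact hU
  | cons p l ih =>
    obtain ⟨t, s⟩ := p
    rcases t with _ | _ | t
    · exact V3_rotp_mem hK ih s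
    · exact V3_rot_mem hK ih hF s
    · exact V3_rot_mem hK ih hG s

theorem evalC_ax {c2 s2 : ℝ} {Ax : W3 → Prop} (hA : AxSys c2 s2 Ax) {f g u : W3} (h0 : Ax w0)
    (hF : Ax f) (hG : Ax g) (hU : Ax u) (l : List (ℕ × Bool)) : Ax (evalC c2 s2 f g l u) := by
  induction l with
  | nil => exact hU
  | cons p l ih => exact hA.rot _ _ (axisC_ax h0 hF hG _) ih _

theorem evalC_zero {c2 s2 : ℝ} (hcs : c2 ^ 2 + s2 ^ 2 = 1) (f g u : W3) (l : List (ℕ × Bool))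
    (hl : l.all (fun p => Nat.beq p.1 0) = true) :
    ∃ μ ν : ℂ, μ * ν = 1 ∧ ‖μ‖ = 1 ∧ evalC c2 s2 f g l u = ⟨u.a, μ * u.b, ν * u.c⟩ := by
  induction l with
  | nil => exact ⟨1, 1, by simp, by simp, by simp [evalC]⟩
  | cons p l ih =>
    obtain ⟨t, s⟩ := p
    simp only [List.all_cons, Bool.and_eq_true, Nat.beq_eq] at hl
    obtain ⟨rfl, hl⟩ := hl
    obtain ⟨μ, ν, h1, h2, h3⟩ := ih hl
    have hcs' : (c2:ℂ) ^ 2 + (s2:ℂ) ^ 2 = 1 := by exact_mod_cast hcs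
    have hsg : sg s ^ 2 = 1 := by cases s <;> simp [sg]
    refine ⟨(c2 + sg s * Complex.I * s2) * μ, (c2 - sg s * Complex.I * s2) * ν, ?_, ?_, ?_⟩
    · linear_combination (c2 ^ 2 - sg s ^ 2 * Complex.I ^ 2 * s2 ^ 2) * h1 + hcs' + (s2:ℂ)^2 * hsg - (sg s ^ 2 * s2 ^ 2 : ℂ) * Complex.I_sq
    · rw [norm_mul, h2, mul_one]
      have : ‖(c2:ℂ) + sg s * Complex.I * s2‖ ^ 2 = 1 := by
        rw [← Complex.normSq_eq_norm_sq, Complex.normSq_apply]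
        cases s <;> simp [sg] <;> nlinarith
      have h0 := norm_nonneg ((c2:ℂ) + sg s * Complex.I * s2)
      nlinarith
    · show rot c2 s2 w0 (sg s) (evalC c2 s2 f g l u) = _
      rw [h3, rot_w0]
      simp only [W3.mk.injEq]
      refine ⟨trivial, by ring, by ring⟩

theorem inE_sound {EA EB : ℕ} {Z : Dk} {z : ℂ} (hz : Z.mem z) (h : inE EA EB Z = true) : InE EA EB z := by
  simp only [inE, blt_iff] at h
  have h' : ((Z.x.natAbs:ℝ) + Z.r) * (Z.x.natAbs + Z.r) * (EB * EB) + ((Z.y.natAbs:ℝ) + Z.r) * (Z.y.natAbs + Z.r) * (EA * EA)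
    < EA * EA * (EB * EB) := by exact_mod_cast h
  have k : ∀ (x : ℤ) (r : ℕ) (t : ℝ), |1048576 * t - x| ≤ r → (1048576 * t) ^ 2 ≤ ((x.natAbs:ℝ) + r) * (x.natAbs + r) := by
    intro x r t ht
    have e : ((x.natAbs : ℕ):ℝ) = |(x:ℝ)| := by rw [Nat.cast_natAbs]; simp
    rw [e, ← sq]
    apply sq_le_sq'
    · have := abs_le.mp ht; have := neg_abs_le (x:ℝ); linarith
    · have := abs_le.mp ht; have := le_abs_self (x:ℝ); linarith
  have k1 := k _ _ _ (mem_re hz)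
  have k2 := k _ _ _ (mem_im hz)
  simp only [InE]
  have b1 : (1048576 * z.re) ^ 2 * (EB:ℝ) ^ 2 ≤ ((Z.x.natAbs:ℝ) + Z.r) * (Z.x.natAbs + Z.r) * (EB * EB) := by
    rw [sq (EB:ℝ)]; gcongr
  have b2 : (1048576 * z.im) ^ 2 * (EA:ℝ) ^ 2 ≤ ((Z.y.natAbs:ℝ) + Z.r) * (Z.y.natAbs + Z.r) * (EA * EA) := by
    rw [sq (EA:ℝ)]; gcongr
  nlinarith

theorem sqL_le (d : Dk) : (sqL d.x d.y : ℝ) ≤ ‖d.c‖ := by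
  simp only [sqL, fN_eq]
  generalize (d.x.natAbs * d.x.natAbs + d.y.natAbs * d.y.natAbs) /
    (((up d.x d.y + (d.x.natAbs * d.x.natAbs + d.y.natAbs * d.y.natAbs) / up d.x d.y) / 2 + 1 +
      (d.x.natAbs * d.x.natAbs + d.y.natAbs * d.y.natAbs) /
        ((up d.x d.y + (d.x.natAbs * d.x.natAbs + d.y.natAbs * d.y.natAbs) / up d.x d.y) / 2 + 1)) / 2 + 1) = s
  cases h : Nat.ble (s * s) (d.x.natAbs * d.x.natAbs + d.y.natAbs * d.y.natAbs)
  · simp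
  · rw [norm_c]
    have := Nat.le_of_ble_eq_true h
    apply Real.le_sqrt_of_sq_le
    have h2 : (s:ℝ) * s ≤ d.x.natAbs * d.x.natAbs + d.y.natAbs * d.y.natAbs := by exact_mod_cast this
    simp only [cond_true]
    nlinarith

theorem mem_L {a : Dk} {z : ℂ} (ha : a.mem z) : (a.L : ℝ) ≤ 1048576 * ‖z‖ := by
  have h5 : ‖(1048576:ℂ)‖ = 1048576 := by simp
  have h1 := sqL_le a
  have h2 : ‖a.c‖ ≤ 1048576 * ‖z‖ + a.r := by
    have : a.c = 1048576 * z - (1048576 * z - a.c) := by ring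
    rw [this]
    refine (norm_sub_le _ _).trans ?_
    rw [norm_mul, h5]
    have : ‖1048576 * z - a.c‖ ≤ a.r := ha
    linarith
  simp only [Dk.L]
  rcases le_total (sqL a.x a.y) a.r with h | h
  · rw [Nat.sub_eq_zero_of_le h]; simp
  · rw [Nat.cast_sub h]; linarith

theorem real_joukowski {y : ℂ} {r : ℝ} (h : y ^ 2 - 2 * r * y + 1 = 0) (hr : |r| ≤ 1) : ‖y‖ = 1 := by
  have h1 := congrArg Complex.re h
  have h2 := congrArg Complex.im h
  simp [sq] at h1 h2
  have hr2 : r ^ 2 ≤ 1 := by rw [← sq_abs]; nlinarith [abs_nonneg r]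
  have : ‖y‖ ^ 2 = 1 := by
    rw [← Complex.normSq_eq_norm_sq, Complex.normSq_apply]
    have h3 : y.im * (y.re - r) = 0 := by linarith
    rcases mul_eq_zero.mp h3 with h3 | h3
    · rw [h3] at h1 ⊢
      have : (y.re - r) ^ 2 = r ^ 2 - 1 := by linarith
      have h4 : (y.re - r) ^ 2 = 0 := le_antisymm (by linarith) (sq_nonneg _)
      have h5 : y.re = r := by have := pow_eq_zero_iff (two_ne_zero) |>.mp h4; linarith
      rw [h5]; nlinarith
    · have : y.re = r := by linarith
      rw [this] at h1 ⊢; linarith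
  nlinarith [norm_nonneg y]

/-- The other axes. -/
def eF (κ0 s0 : ℝ) (g : ℂ) : W3 := ⟨κ0, s0 * g, s0 * g⁻¹⟩
def ef (κ0 s0 : ℝ) (g : ℂ) : W3 := ⟨κ0, -(s0 * g⁻¹), -(s0 * g)⟩

theorem leaf2_sound {c2 s2 κ0 s0 t0 N : ℝ} {Ax : W3 → Prop} (hA : AxSys c2 s2 Ax) (hcs : c2 ^ 2 + s2 ^ 2 = 1)
    {K : Cst2} (hK : K.ok c2 s2 κ0 s0 t0 N) {g : ℂ} (hg0 : g ≠ 0) (hs0 : s0 ≠ 0) (h0 : Ax w0)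
    (hf : Ax (ef κ0 s0 g)) (hF : Ax (eF κ0 s0 g))
    (hQ : ∀ z, PP Ax z → InE K.EA K.EB z → z.im = 0)
    (hQ2 : ∀ z, PP Ax z → InE K.EA K.EB z → (K.LB:ℝ) < 1048576 * z.re → |z.re - κ0 ^ 2| ≤ s0 ^ 2)
    {f F : V3} (hfm : f.mem (ef κ0 s0 g)) (hFm : F.mem (eF κ0 s0 g))
    (t : Nat × List (Nat × Bool) × Nat × Nat × Bool × Nat) (ht : leaf2 K f F t = true) : ‖g‖ = 1 := by
  obtain ⟨i, w, j, m, q, mode⟩ := t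
  have hz := V3_dot_mem (axis_mem axp_mem hfm hFm i) (evalW_mem hK hfm hFm (axis_mem axp_mem hfm hFm j) w)
  have hP : PP Ax (dot (axisC w0 (ef κ0 s0 g) (eF κ0 s0 g) i)
      (evalC c2 s2 (ef κ0 s0 g) (eF κ0 s0 g) w (axisC w0 (ef κ0 s0 g) (eF κ0 s0 g) j))) :=
    ⟨_, _, axisC_ax h0 hf hF i, evalC_ax hA h0 hf hF (axisC_ax h0 hf hF j) w, rfl⟩
  simp only [leaf2] at ht
  split at ht
  · exfalso
    simp only [Bool.and_eq_true] at ht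
    exact nv_sound hK.KK hz m q ht.2 (test_sound hA hK.KK hz hP m q ht.1)
  · exfalso
    simp only [Bool.and_eq_true, blt_iff] at ht
    exact natAbs_gt ht.2 (mem_im hz) (hQ _ hP (inE_sound hz ht.1))
  · simp only [Bool.and_eq_true, Nat.beq_eq, decide_eq_true_eq] at ht
    obtain ⟨⟨⟨⟨rfl, rfl⟩, hw⟩, hE⟩, hlb⟩ := ht
    have hE' := inE_sound hz hE
    have hr := hQ _ hP hE'
    have h2 := hQ2 _ hP hE' (by
      have := abs_le.mp (mem_re hz)
      have h1 : ((K.LB:ℤ):ℝ) < _ := Int.cast_lt.mpr hlb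
      push_cast at h1
      linarith)
    obtain ⟨μ, ν, h3, h4, h5⟩ := evalC_zero hcs (ef κ0 s0 g) (eF κ0 s0 g) (axisC w0 (ef κ0 s0 g) (eF κ0 s0 g) 2) w hw
    rw [h5] at hr h2
    have e : dot (axisC w0 (ef κ0 s0 g) (eF κ0 s0 g) 1) ⟨(axisC w0 (ef κ0 s0 g) (eF κ0 s0 g) 2).a,
      μ * (axisC w0 (ef κ0 s0 g) (eF κ0 s0 g) 2).b, ν * (axisC w0 (ef κ0 s0 g) (eF κ0 s0 g) 2).c⟩ =
      κ0 ^ 2 - s0 ^ 2 / 2 * (μ * g ^ 2 + ν * g⁻¹ ^ 2) := by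
      simp only [axisC, ef, eF, dot]; ring
    rw [e] at hr h2
    set zz : ℂ := κ0 ^ 2 - s0 ^ 2 / 2 * (μ * g ^ 2 + ν * g⁻¹ ^ 2) with hzz
    have hzr : zz = (zz.re : ℂ) := by apply Complex.ext <;> simp [hr]
    have hs2 : (0:ℝ) < s0 ^ 2 := by positivity
    have hs2C : (s0:ℂ) ^ 2 ≠ 0 := by exact_mod_cast hs2.ne'
    have hs1C : (s0:ℂ) ≠ 0 := by exact_mod_cast hs0
    have hμ : ‖μ * g ^ 2‖ = 1 := by
      apply real_joukowski (r := (κ0 ^ 2 - zz.re) / s0 ^ 2)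
      · push_cast
        rw [← hzr, hzz]
        have h6 : (μ * g ^ 2) * (ν * g⁻¹ ^ 2) = 1 := by
          have : g * g⁻¹ = 1 := mul_inv_cancel₀ hg0
          linear_combination h3 * (g * g⁻¹) ^ 2 + (g * g⁻¹ + 1) * this
        have h7 : (s0:ℂ) ^ 2 * ((s0:ℂ) ^ 2)⁻¹ = 1 := mul_inv_cancel₀ hs2C
        rw [div_eq_mul_inv]
        linear_combination (-1:ℂ) * h6 - (μ * g ^ 2 + ν * g⁻¹ ^ 2) * (μ * g ^ 2) * h7
      · rw [abs_div, abs_of_pos hs2, div_le_one hs2, abs_sub_comm]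
        exact h2
    rw [norm_mul, h4, one_mul, norm_pow] at hμ
    nlinarith [norm_nonneg g]

theorem mem_invD {G : Dk} {g : ℂ} (h : G.mem g) (hg : 1 ≤ ‖g‖) : (invD G).mem g⁻¹ := by
  simp only [invD, fN_eq, fI_eq, mk_eq]
  generalize G.x * 1099511627776 / ((G.x.natAbs * G.x.natAbs + G.y.natAbs * G.y.natAbs : ℕ):ℤ) = hx
  generalize (-G.y) * 1099511627776 / ((G.x.natAbs * G.x.natAbs + G.y.natAbs * G.y.natAbs : ℕ):ℤ) = hy
  set h0 : ℂ := (Dk.c ⟨hx, hy, 0⟩) / 1048576 with hh0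
  have m0 : (⟨hx, hy, 0⟩ : Dk).mem h0 := by
    simp only [Dk.mem]
    rw [show 1048576 * h0 - Dk.c ⟨hx, hy, 0⟩ = 0 by rw [hh0]; field_simp; ring]
    simp
  have m1 := mem_U (mem_sub mem_ex1 (mem_mul m0 h))
  simp only [Dk.mem]
  refine le_trans ?_ m1
  have hg0 : g ≠ 0 := by rintro rfl; simp at hg; linarith
  have e : 1048576 * g⁻¹ - Dk.c ⟨hx, hy, (((ex 1).sub (Dk.mul ⟨hx, hy, 0⟩ G)).U)⟩ = 1048576 * ((1 - h0 * g) * g⁻¹) := by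
    have : Dk.c ⟨hx, hy, (((ex 1).sub (Dk.mul ⟨hx, hy, 0⟩ G)).U)⟩ = 1048576 * h0 := by
      rw [hh0]; simp [Dk.c]; ring
    rw [this]; field_simp
  rw [e, norm_mul, norm_mul, norm_inv]
  have h5 : ‖(1048576:ℂ)‖ = 1048576 := by simp
  rw [h5]
  have : ‖g‖⁻¹ ≤ 1 := inv_le_one_of_one_le₀ hg
  have := mul_le_mul_of_nonneg_left this (norm_nonneg (1 - h0 * g))
  linarith

/-- The displacement condition. -/
def Disp (κ0 t0 N : ℝ) (g : ℂ) : Prop :=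
  let q : ℂ := (1 + κ0) / 8 * (g + g⁻¹) ^ 2
  ‖q‖ + ‖q - 1‖ ≤ t0 ∧
  ‖q - (1 + κ0) / 2‖ + (1 - κ0) / 2 ≤ N * (t0 - ‖q‖) +
    Real.sqrt (N ^ 2 - 1) * Real.sqrt ((t0 - ‖q‖) ^ 2 - ‖q - 1‖ ^ 2)

theorem excl_sound {c2 s2 κ0 s0 t0 N : ℝ} {K : Cst2} (hK : K.ok c2 s2 κ0 s0 t0 N) {g : ℂ} {G Gi : Dk}
    (hG : G.mem g) (hGi : Gi.mem g⁻¹) (h : excl K G Gi = true) (hD : Disp κ0 t0 N g) : False := by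
  simp only [excl, fN_eq] at h
  have hq := mem_mul hK.QC (mem_mul (mem_add hG hGi) (mem_add hG hGi))
  rw [← sq] at hq
  have e1 := mem_L hq
  have e2 := mem_L (mem_sub hq mem_ex1)
  have e3 := mem_L (mem_sub hq hK.AA)
  simp only [Disp] at hD
  obtain ⟨d1, d2⟩ := hD
  have hn1 := norm_nonneg ((1 + κ0 : ℂ) / 8 * (g + g⁻¹) ^ 2)
  have hn2 := norm_nonneg ((1 + κ0 : ℂ) / 8 * (g + g⁻¹) ^ 2 - 1)
  generalize ‖(1 + κ0 : ℂ) / 8 * (g + g⁻¹) ^ 2‖ = Q at *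
  generalize ‖(1 + κ0 : ℂ) / 8 * (g + g⁻¹) ^ 2 - 1‖ = V at *
  generalize ‖(1 + κ0 : ℂ) / 8 * (g + g⁻¹) ^ 2 - (1 + κ0) / 2‖ = W at *
  generalize (K.QC.mul ((G.add Gi).mul (G.add Gi))).L = Lq at *
  generalize ((K.QC.mul ((G.add Gi).mul (G.add Gi))).sub (ex 1)).L = Lv at *
  generalize ((K.QC.mul ((G.add Gi).mul (G.add Gi))).sub K.AA).L = LA at *
  have hT0 := hK.T0
  have hN0 := hK.N0
  have hN1 := hK.N1
  have hBB := hK.BB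
  have hLqT : Lq ≤ K.T0 := by
    have : (Lq:ℝ) ≤ K.T0 := by linarith
    exact_mod_cast this
  simp only [Bool.or_eq_true, Bool.and_eq_true, blt_iff] at h
  rcases h with h | h | ⟨h, h'⟩
  · omega
  · have : ((K.T0 - Lq : ℕ):ℝ) < Lv := by exact_mod_cast h
    rw [Nat.cast_sub hLqT] at this
    linarith
  · obtain ⟨u, hu⟩ : ∃ u, u = K.T0 - Lq := ⟨_, rfl⟩
    rw [← hu] at h h'
    have hu' : (u:ℝ) = K.T0 - Lq := by rw [hu, Nat.cast_sub hLqT]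
    set A := t0 - Q with hA
    have hA0 : V ≤ A := by linarith
    have hAu : 1048576 * A ≤ u := by rw [hu']; linarith
    have hLvu : (Lv:ℝ) ≤ u := by linarith
    have hLvu' : Lv * Lv ≤ u * u := by
      have : Lv ≤ u := by exact_mod_cast hLvu
      exact Nat.mul_le_mul this this
    have hN0' : 1048576 * 1048576 ≤ K.N0 * K.N0 := by
      have : (1048576:ℝ) ≤ K.N0 := by linarith
      have : 1048576 ≤ K.N0 := by exact_mod_cast this
      exact Nat.mul_le_mul this this
    have hNU : 1048576 * (N * A) ≤ ((K.N0 * u / 1048576 + 1 : ℕ):ℝ) := by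
      have := Nat.lt_div_mul_add (a := K.N0 * u) (b := 1048576) (by norm_num)
      have h2 : ((K.N0 * u : ℕ) : ℝ) < ((K.N0 * u / 1048576 * 1048576 + 1048576 : ℕ) : ℝ) := by exact_mod_cast this
      push_cast at h2 ⊢
      have h3 : (1048576 * N) * (1048576 * A) ≤ K.N0 * u := by
        apply mul_le_mul hN0 hAu (by linarith) (Nat.cast_nonneg _)
      linarith
    generalize K.N0 * u / 1048576 + 1 = NU at *
    have hc : (((K.N0 * K.N0 - 1048576 * 1048576) * (u * u - Lv * Lv) : ℕ):ℝ) <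
       (((LA + K.BB - NU) * (LA + K.BB - NU) * (1048576 * 1048576) : ℕ):ℝ) := by exact_mod_cast h'
    rw [Nat.cast_mul, Nat.cast_mul, Nat.cast_mul, Nat.cast_sub hN0', Nat.cast_sub hLvu', Nat.cast_sub (le_of_lt h)] at hc
    push_cast at hc
    have hNN : (0:ℝ) ≤ N ^ 2 - 1 := by
      have := mul_self_le_mul_self zero_le_one hN1
      linarith
    have hAV : (0:ℝ) ≤ A ^ 2 - V ^ 2 := by
      have := mul_self_le_mul_self hn2 hA0
      linarith
    have hR : Real.sqrt (N ^ 2 - 1) * Real.sqrt (A ^ 2 - V ^ 2) = Real.sqrt ((N ^ 2 - 1) * (A ^ 2 - V ^ 2)) := by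
      rw [Real.sqrt_mul hNN]
    rw [hR] at d2
    have hx0 : (0:ℝ) ≤ (LA:ℝ) + K.BB - NU := by
      have : (NU:ℝ) < ((LA + K.BB : ℕ):ℝ) := by exact_mod_cast h
      push_cast at this; linarith
    have hx : (LA:ℝ) + K.BB - NU ≤ 1048576 * Real.sqrt ((N ^ 2 - 1) * (A ^ 2 - V ^ 2)) := by
      linarith
    have hx2 := mul_self_le_mul_self hx0 hx
    have hs := Real.mul_self_sqrt (mul_nonneg hNN hAV)
    have p1 : (1048576:ℝ) ^ 2 * (N ^ 2 - 1) ≤ K.N0 * K.N0 - 1048576 * 1048576 := by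
      have : (1048576 * N) * (1048576 * N) ≤ K.N0 * K.N0 := mul_self_le_mul_self (by linarith) hN0
      linarith
    have p2 : (1048576:ℝ) ^ 2 * (A ^ 2 - V ^ 2) ≤ u * u - Lv * Lv := by
      have a1 : (1048576 * A) * (1048576 * A) ≤ u * u := mul_self_le_mul_self (by linarith) hAu
      have a2 : (Lv:ℝ) * Lv ≤ (1048576 * V) * (1048576 * V) := mul_self_le_mul_self (Nat.cast_nonneg _) e2
      linarith
    have p3 := mul_le_mul p1 p2 (by positivity) (le_trans (by positivity) p1)
    clear h h' hN0' hLvu'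
    linarith

theorem mem_eF {K : Cst2} {c2 s2 κ0 s0 t0 N : ℝ} (hK : K.ok c2 s2 κ0 s0 t0 N) {g : ℂ} {G Gi : Dk}
    (hG : G.mem g) (hGi : Gi.mem g⁻¹) :
    (⟨K.KP, (K.SS.mul Gi).neg, (K.SS.mul G).neg⟩ : V3).mem (ef κ0 s0 g) ∧
    (⟨K.KP, K.SS.mul G, K.SS.mul Gi⟩ : V3).mem (eF κ0 s0 g) :=
  ⟨⟨hK.KP, mem_neg (mem_mul hK.SS hGi), mem_neg (mem_mul hK.SS hG)⟩,
   ⟨hK.KP, mem_mul hK.SS hG, mem_mul hK.SS hGi⟩⟩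

theorem chk2_sound {c2 s2 κ0 s0 t0 N : ℝ} {Ax : W3 → Prop} (hA : AxSys c2 s2 Ax) (hcs : c2 ^ 2 + s2 ^ 2 = 1)
    {K : Cst2} (hK : K.ok c2 s2 κ0 s0 t0 N) {g : ℂ} (hg1 : 1 ≤ ‖g‖) (hs0 : s0 ≠ 0) (h0 : Ax w0)
    (hf : Ax (ef κ0 s0 g)) (hF : Ax (eF κ0 s0 g)) (hD : Disp κ0 t0 N g)
    (hQ : ∀ z, PP Ax z → InE K.EA K.EB z → z.im = 0)
    (hQ2 : ∀ z, PP Ax z → InE K.EA K.EB z → (K.LB:ℝ) < 1048576 * z.re → |z.re - κ0 ^ 2| ≤ s0 ^ 2)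
    (ks : List (Nat × List (Nat × Bool) × Nat × Nat × Bool × Nat)) (tr : Tr) :
    ∀ (x y : ℤ) (h : ℕ), chk2 K ks tr x y h = true →
    |1048576 * g.re - x| ≤ h → |1048576 * g.im - y| ≤ h → ‖g‖ = 1 := by
  have hg0 : g ≠ 0 := by rintro rfl; simp at hg1; linarith
  induction tr with
  | s ta tb tc td ia ib ic id =>
    intro x y h hc hx hy
    simp only [chk2, fN_eq, fI_eq, Bool.and_eq_true, Nat.beq_eq] at hc
    obtain ⟨⟨⟨⟨h1, h2⟩, h3⟩, h4⟩, h5⟩ := hc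
    rw [← h1] at hx hy
    rcases sq_split hx with hx | hx <;> rcases sq_split hy with hy | hy
    · exact ia _ _ _ h2 hx hy
    · exact ib _ _ _ h3 hx hy
    · exact ic _ _ _ h4 hx hy
    · exact id _ _ _ h5 hx hy
  | l i =>
    intro x y h hc hx hy
    simp only [chk2] at hc
    split at hc
    · cases hc
    · have hG := mem_sqD hx hy
      have hGi := mem_invD hG hg1
      have := mem_eF hK hG hGi
      exact leaf2_sound hA hcs hK hg0 hs0 h0 hf hF hQ hQ2 this.1 this.2 _ hc
  | o =>
    intro x y h hc hx hy
    exfalso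
    simp only [chk2, blt_iff] at hc
    have hc' : ((x.natAbs:ℝ) + h) * (x.natAbs + h) + ((y.natAbs:ℝ) + h) * (y.natAbs + h) < 1048576 * 1048576 := by
      exact_mod_cast hc
    have k : ∀ (x : ℤ) (r : ℕ) (t : ℝ), |1048576 * t - x| ≤ r → (1048576 * t) ^ 2 ≤ ((x.natAbs:ℝ) + r) * (x.natAbs + r) := by
      intro x r t ht
      have e : ((x.natAbs : ℕ):ℝ) = |(x:ℝ)| := by rw [Nat.cast_natAbs]; simp
      rw [e, ← sq]
      apply sq_le_sq'
      · have := abs_le.mp ht; have := neg_abs_le (x:ℝ); linarith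
      · have := abs_le.mp ht; have := le_abs_self (x:ℝ); linarith
    have k1 := k _ _ _ hx
    have k2 := k _ _ _ hy
    have hn : ‖g‖ ^ 2 = g.re * g.re + g.im * g.im := by
      rw [← Complex.normSq_eq_norm_sq, Complex.normSq_apply]
    nlinarith
  | d =>
    intro x y h hc hx hy
    exfalso
    have hG := mem_sqD hx hy
    exact excl_sound hK hG (mem_invD hG hg1) hc hD

/-- The symmetry `(a,b,c) ↦ (a,-b,-c)`. -/
def W3.phi (u : W3) : W3 := ⟨u.a, -u.b, -u.c⟩

theorem dot_phi (u v : W3) : dot u.phi v.phi = dot u v := by simp [dot, W3.phi]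

theorem rot_phi (c2 s2 : ℝ) (v u : W3) (σ : ℂ) :
    (rot c2 s2 v σ u).phi = rot c2 s2 v.phi σ u.phi := by
  simp only [rot, W3.phi, cr, dot, W3.mk.injEq]
  refine ⟨by ring, by ring, by ring⟩

theorem AxSys.phi {c2 s2 : ℝ} {Ax : W3 → Prop} (hA : AxSys c2 s2 Ax) :
    AxSys c2 s2 (fun v => Ax v.phi) where
  unit v hv := by
    have := hA.unit _ hv
    rwa [dot_phi] at this
  neg v hv := by
    have := hA.neg _ hv
    simpa [W3.neg, W3.phi] using this
  rot v u hv hu s := by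
    simp only [rot_phi]
    exact hA.rot _ _ hv hu _
  test u v hu hv m q h := by
    have key := hA.test _ _ hu hv m q
    rw [dot_phi] at key
    exact key h

theorem stage2 {c2 s2 κ0 s0 t0 N : ℝ} (hcs : c2 ^ 2 + s2 ^ 2 = 1)
    {K : Cst2} (hK : K.ok c2 s2 κ0 s0 t0 N) (hs0 : s0 ≠ 0)
    (hκ : 8 * t0 ≤ 49 * (1 + κ0))
    (hQ : ∀ Ax, AxSys c2 s2 Ax → ∀ z, PP Ax z → InE K.EA K.EB z → z.im = 0)
    (hQ2 : ∀ Ax, AxSys c2 s2 Ax → ∀ z, PP Ax z → InE K.EA K.EB z → (K.LB:ℝ) < 1048576 * z.re → |z.re - κ0 ^ 2| ≤ s0 ^ 2)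
    (ks : List (Nat × List (Nat × Bool) × Nat × Nat × Bool × Nat)) (tr : Tr)
    (hc : chk2 K ks tr 4194304 4194304 4194304 = true)
    {Ax : W3 → Prop} (hA : AxSys c2 s2 Ax)
    {g : ℂ} (hg : g ≠ 0) (h0 : Ax w0)
    (hf : Ax (ef κ0 s0 g)) (hF : Ax (eF κ0 s0 g)) (hD : Disp κ0 t0 N g) : ‖g‖ = 1 := by
  have main : ∀ Ax : W3 → Prop, AxSys c2 s2 Ax → ∀ g : ℂ, 1 ≤ ‖g‖ → Ax w0 → Ax (ef κ0 s0 g) → Ax (eF κ0 s0 g) →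
      Disp κ0 t0 N g → 0 ≤ g.re → 0 ≤ g.im → ‖g‖ = 1 := by
    intro Ax hA g hg1 h0 hf hF hD hr hi
    have hg8 : ‖g‖ ≤ 8 := by
      have h1 : ‖(1 + κ0 : ℂ) / 8 * (g + g⁻¹) ^ 2‖ ≤ t0 := by
        have := hD.1
        have := norm_nonneg ((1 + κ0 : ℂ) / 8 * (g + g⁻¹) ^ 2 - 1)
        linarith
      have e : (1 + κ0 : ℂ) / 8 = (((1 + κ0) / 8 : ℝ) : ℂ) := by push_cast; ring
      have hκ1 : 0 < 1 + κ0 := by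
        have : 0 ≤ t0 := le_trans (norm_nonneg _) h1
        by_contra hh
        have hh1 : 1 + κ0 = 0 := by linarith
        have ht : t0 = 0 := by linarith
        have := hD.1
        rw [e, hh1, ht] at this
        simp at this
        linarith
      rw [norm_mul, e, Complex.norm_real, Real.norm_of_nonneg (by positivity), norm_pow] at h1
      have h2 : ‖g + g⁻¹‖ ^ 2 ≤ 7 ^ 2 := by
        have h3 : (1 + κ0) / 8 * ‖g + g⁻¹‖ ^ 2 ≤ (1 + κ0) / 8 * 7 ^ 2 := by linarith
        exact le_of_mul_le_mul_left h3 (by positivity)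
      have h3 : ‖g + g⁻¹‖ ≤ 7 := by
        have := abs_le_of_sq_le_sq h2 (by norm_num)
        rwa [abs_of_nonneg (norm_nonneg _)] at this
      have h4 : ‖g⁻¹‖ ≤ 1 := by rw [norm_inv]; exact inv_le_one_of_one_le₀ hg1
      have h5 : ‖g‖ ≤ ‖g + g⁻¹‖ + ‖g⁻¹‖ := by
        have : g = (g + g⁻¹) - g⁻¹ := by ring
        conv_lhs => rw [this]
        exact norm_sub_le _ _
      linarith
    have a1 := (Complex.abs_re_le_norm g).trans hg8
    have a2 := (Complex.abs_im_le_norm g).trans hg8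
    apply chk2_sound hA hcs hK hg1 hs0 h0 hf hF hD (hQ Ax hA) (hQ2 Ax hA) ks tr _ _ _ hc
    · rw [abs_le] at a1 ⊢; push_cast; constructor <;> linarith [a1.2]
    · rw [abs_le] at a2 ⊢; push_cast; constructor <;> linarith [a2.2]
  have w0phi : w0.phi = w0 := by simp [w0, W3.phi]
  have w0conj : w0.conj = w0 := by simp [w0, W3.conj]
  -- im sign
  have main2 : ∀ Ax : W3 → Prop, AxSys c2 s2 Ax → ∀ g : ℂ, 1 ≤ ‖g‖ → Ax w0 → Ax (ef κ0 s0 g) → Ax (eF κ0 s0 g) →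
      Disp κ0 t0 N g → 0 ≤ g.re → ‖g‖ = 1 := by
    intro Ax hA g hg1 h0 hf hF hD hr
    rcases le_total 0 g.im with hi | hi
    · exact main Ax hA g hg1 h0 hf hF hD hr hi
    · rw [← Complex.norm_conj]
      apply main _ hA.conj
      · rwa [Complex.norm_conj]
      · simpa [w0conj] using h0
      · convert hf using 1; simp [ef, W3.conj]
      · convert hF using 1; simp [eF, W3.conj]
      · have e : (1 + κ0 : ℂ) / 8 * ((starRingEnd ℂ) g + ((starRingEnd ℂ) g)⁻¹) ^ 2 = (starRingEnd ℂ) ((1 + κ0 : ℂ) / 8 * (g + g⁻¹) ^ 2) := by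
          have : (starRingEnd ℂ) 8 = 8 := Complex.conj_ofNat 8
          simp [this]
        simp only [Disp] at hD ⊢
        rw [e]
        have e1 : ∀ z : ℂ, ‖(starRingEnd ℂ) z - 1‖ = ‖z - 1‖ := by
          intro z; rw [← Complex.norm_conj]; simp
        have e2 : ∀ z : ℂ, ‖(starRingEnd ℂ) z - (1 + κ0) / 2‖ = ‖z - (1 + κ0) / 2‖ := by
          intro z; rw [← Complex.norm_conj]; simp [star_two]
        rw [e1, e2, Complex.norm_conj]
        exact hD
      · simpa using hr
      · simpa using hi
  have main3 : ∀ Ax : W3 → Prop, AxSys c2 s2 Ax → ∀ g : ℂ, 1 ≤ ‖g‖ → Ax w0 → Ax (ef κ0 s0 g) → Ax (eF κ0 s0 g) →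
      Disp κ0 t0 N g → ‖g‖ = 1 := by
    intro Ax hA g hg1 h0 hf hF hD
    rcases le_total 0 g.re with hi | hi
    · exact main2 Ax hA g hg1 h0 hf hF hD hi
    · rw [← norm_neg]
      apply main2 _ hA.phi
      · rwa [norm_neg]
      · simpa [w0phi] using h0
      · convert hf using 1; simp [ef, W3.phi, inv_neg]
      · convert hF using 1; simp [eF, W3.phi, inv_neg]
      · have e : (-g + (-g)⁻¹) ^ 2 = (g + g⁻¹) ^ 2 := by rw [inv_neg]; ring
        simp only [Disp] at hD ⊢
        rw [e]; exact hD
      · simpa using hi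
  rcases le_total 1 ‖g‖ with h1 | h1
  · exact main3 Ax hA g h1 h0 hf hF hD
  · have hpos : 0 < ‖g‖ := norm_pos_iff.mpr hg
    have : ‖g⁻¹‖ = 1 := by
      apply main3 _ hA.phi
      · rw [norm_inv]; exact (one_le_inv₀ hpos).mpr h1
      · simpa [w0phi] using h0
      · convert hF using 1; simp [ef, eF, W3.phi]
      · convert hf using 1; simp [ef, eF, W3.phi]
      · have e : (g⁻¹ + (g⁻¹)⁻¹) ^ 2 = (g + g⁻¹) ^ 2 := by rw [inv_inv]; ring
        simp only [Disp] at hD ⊢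
        rw [e]; exact hD
    rw [norm_inv] at this
    exact inv_eq_one.mp this

end Marg

namespace Marg

/-- The bound. -/
def tc : ℝ := (2 * Real.sqrt (8 + 2 * Real.sqrt 5) - (1 + Real.sqrt 5)) / (6 - Real.sqrt 5)

theorem tc_quad : (6 - Real.sqrt 5) * tc + (1 + Real.sqrt 5) = 2 * Real.sqrt (8 + 2 * Real.sqrt 5) := by
  have : 6 - Real.sqrt 5 ≠ 0 := by linarith [s5hi]
  rw [tc]; field_simp; ring

theorem s85sq : Real.sqrt (8 + 2 * Real.sqrt 5) ^ 2 = 8 + 2 * Real.sqrt 5 :=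
  Real.sq_sqrt (by linarith [s5lo])

theorem s85lo : 3.53159113 < Real.sqrt (8 + 2 * Real.sqrt 5) := by
  apply Real.lt_sqrt_of_sq_lt; norm_num; linarith [s5lo]
theorem s85hi : Real.sqrt (8 + 2 * Real.sqrt 5) < 3.53159114 := by
  rw [Real.sqrt_lt' (by norm_num)]; norm_num; linarith [s5hi]

theorem tc_lo : 1.0167862 < tc := by
  have h1 := tc_quad
  have h2 := s85lo
  have h3 := s5lo
  have h4 := s5hi
  by_contra hh
  push Not at hh
  nlinarith

theorem tc_hi : tc < 1.0167863 := by
  have h1 := tc_quad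
  have h2 := s85hi
  have h3 := s5lo
  have h4 := s5hi
  by_contra hh
  push Not at hh
  nlinarith

theorem mem_cx {x y : ℤ} {p q : ℝ} {z : ℂ} (hz : z = p + Complex.I * q) (h : |1048576 * p - x| ≤ 1) (h' : |1048576 * q - y| ≤ 1) :
    (⟨x, y, 2⟩ : Dk).mem z := by
  rw [hz]
  simp only [Dk.mem, Dk.c]
  have : 1048576 * ((p:ℂ) + Complex.I * q) - ((x:ℂ) + (y:ℂ) * Complex.I) = ((1048576 * p - x : ℝ) : ℂ) + ((1048576 * q - y : ℝ) : ℂ) * Complex.I := by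
    push_cast; ring
  rw [this]
  refine (norm_add_le _ _).trans ?_
  rw [norm_mul, Complex.norm_real, Complex.norm_real, Complex.norm_I, mul_one, Real.norm_eq_abs, Real.norm_eq_abs]
  push_cast
  linarith

theorem okmk {K : Cst} {c2 s2 κ0 s0 t0 N : ℝ} (hK : K.ok c2) {kp ss hs zx zy qc aa : ℤ} {BB T0 N0 EA EB : ℕ} {LB : ℤ}
    (h1 : |1048576 * κ0 - kp| ≤ 1) (h2 : |1048576 * s0 - ss| ≤ 1) (h3 : |1048576 * (s2 / 2) - hs| ≤ 1)
    (h4 : |1048576 * c2 - zx| ≤ 1) (h5 : |1048576 * s2 - zy| ≤ 1) (h6 : |1048576 * ((1 + κ0) / 8) - qc| ≤ 1)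
    (h7 : |1048576 * ((1 + κ0) / 2) - aa| ≤ 1) (h8 : (BB : ℝ) ≤ 1048576 * ((1 - κ0) / 2))
    (h9 : 1048576 * t0 ≤ T0) (h10 : 1048576 * N ≤ N0) (h11 : 1 ≤ N) :
    (⟨K, ⟨kp, 0, 1⟩, ⟨ss, 0, 1⟩, ⟨hs, 0, 1⟩, ⟨zx, zy, 2⟩, ⟨zx, -zy, 2⟩, ⟨qc, 0, 1⟩, ⟨aa, 0, 1⟩, BB, T0, N0, EA, EB, LB⟩ : Cst2).ok
      c2 s2 κ0 s0 t0 N where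
  KK := hK
  KP := mem_real (by exact_mod_cast h1)
  SS := mem_real (by exact_mod_cast h2)
  HS := mem_real' (t := s2 / 2) (by push_cast; rfl) (by exact_mod_cast h3)
  ZP := mem_cx rfl h4 h5
  ZM := mem_cx (p := c2) (q := -s2) (by push_cast; ring) h4 (by
    push_cast; rw [← abs_neg]; convert h5 using 2; ring)
  QC := mem_real' (t := (1 + κ0) / 8) (by push_cast; rfl) (by exact_mod_cast h6)
  AA := mem_real' (t := (1 + κ0) / 2) (by push_cast; rfl) (by exact_mod_cast h7)
  BB := h8
  T0 := h9
  N0 := h10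
  N1 := h11

theorem sq_bd {x lo hi : ℝ} (hx : 0 ≤ x) (hlo : lo ^ 2 ≤ x ^ 2) (hhi : x ^ 2 ≤ hi ^ 2) (hh : 0 ≤ hi) :
    lo ≤ x ∧ x ≤ hi :=
  ⟨le_of_sq_le_sq' hlo hx, le_of_sq_le_sq' hhi hh⟩
where
  le_of_sq_le_sq' {a b : ℝ} (h : a ^ 2 ≤ b ^ 2) (hb : 0 ≤ b) : a ≤ b := le_of_abs_le (abs_le_of_sq_le_sq h hb)

theorem s2_3 {s2 : ℝ} (h0 : 0 ≤ s2) (hcs : (-1/2:ℝ) ^ 2 + s2 ^ 2 = 1) : 0.866025 ≤ s2 ∧ s2 ≤ 0.8660255 := by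
  apply sq_bd h0 <;> norm_num <;> linarith
theorem s2_4 {s2 : ℝ} (h0 : 0 ≤ s2) (hcs : (0:ℝ) ^ 2 + s2 ^ 2 = 1) : 1 ≤ s2 ∧ s2 ≤ 1 := by
  apply sq_bd h0 <;> linarith
theorem s2_5 {s2 : ℝ} (h0 : 0 ≤ s2) (hcs : ((Real.sqrt 5 - 1)/4) ^ 2 + s2 ^ 2 = 1) : 0.9510563 ≤ s2 ∧ s2 ≤ 0.9510567 := by
  have : s2 ^ 2 = (10 + 2 * Real.sqrt 5) / 16 := by linear_combination hcs - s5sq / 16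
  apply sq_bd h0 <;> norm_num <;> rw [this] <;> linarith [s5lo, s5hi]
theorem s0_1 {s0 : ℝ} (h0 : 0 ≤ s0) (h : s0 ^ 2 = 1 - 1 / 9) : 0.942809 ≤ s0 ∧ s0 ≤ 0.9428091 := by
  apply sq_bd h0 <;> norm_num <;> linarith
theorem s0_2 {s0 : ℝ} (h0 : 0 ≤ s0) (h : s0 ^ 2 = 1 - 5 / 9) : 2/3 ≤ s0 ∧ s0 ≤ 2/3 := by
  apply sq_bd h0 <;> norm_num <;> linarith
theorem s0_4 {s0 : ℝ} (h0 : 0 ≤ s0) (h : s0 ^ 2 = 1 - 0) : 1 ≤ s0 ∧ s0 ≤ 1 := by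
  apply sq_bd h0 <;> linarith
theorem s0_5 {s0 : ℝ} (h0 : 0 ≤ s0) (h : s0 ^ 2 = 1 - 1 / 5) : 0.894427 ≤ s0 ∧ s0 ≤ 0.8944273 := by
  apply sq_bd h0 <;> norm_num <;> linarith

theorem kd3m1 {s2 s0 : ℝ} (h2 : 0 ≤ s2) (hcs : (-1/2:ℝ) ^ 2 + s2 ^ 2 = 1) (h0 : 0 ≤ s0) (hs : s0 ^ 2 = 1 - 1 / 9) :
    KD3m1.ok (-1/2) s2 (-1/3) s0 tc (1 + (tc - 1) * (4 / 3)) := by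
  obtain ⟨a, b⟩ := s2_3 h2 hcs
  obtain ⟨c, d⟩ := s0_1 h0 hs
  have e := tc_lo
  have f := tc_hi
  apply okmk K3ok <;> (try rw [abs_le]; constructor) <;> norm_num <;> linarith

theorem kd3p1 {s2 s0 : ℝ} (h2 : 0 ≤ s2) (hcs : (-1/2:ℝ) ^ 2 + s2 ^ 2 = 1) (h0 : 0 ≤ s0) (hs : s0 ^ 2 = 1 - 1 / 9) :
    KD3p1.ok (-1/2) s2 (1/3) s0 tc (1 + (tc - 1) * (4 / 3)) := by
  obtain ⟨a, b⟩ := s2_3 h2 hcs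
  obtain ⟨c, d⟩ := s0_1 h0 hs
  have e := tc_lo
  have f := tc_hi
  apply okmk K3ok <;> (try rw [abs_le]; constructor) <;> norm_num <;> linarith

theorem kd3p2 {s2 s0 : ℝ} (h2 : 0 ≤ s2) (hcs : (-1/2:ℝ) ^ 2 + s2 ^ 2 = 1) (h0 : 0 ≤ s0) (hs : s0 ^ 2 = 1 - 5 / 9) :
    KD3p2.ok (-1/2) s2 (Real.sqrt 5/3) s0 tc (1 + (tc - 1) * (4 / 3)) := by
  obtain ⟨a, b⟩ := s2_3 h2 hcs
  obtain ⟨c, d⟩ := s0_2 h0 hs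
  have e := tc_lo
  have f := tc_hi
  have g := s5lo
  have h := s5hi
  apply okmk K3ok <;> (try rw [abs_le]; constructor) <;> norm_num <;> linarith

theorem kd3m2 {s2 s0 : ℝ} (h2 : 0 ≤ s2) (hcs : (-1/2:ℝ) ^ 2 + s2 ^ 2 = 1) (h0 : 0 ≤ s0) (hs : s0 ^ 2 = 1 - 5 / 9) :
    KD3m2.ok (-1/2) s2 (-(Real.sqrt 5/3)) s0 tc (1 + (tc - 1) * (4 / 3)) := by
  obtain ⟨a, b⟩ := s2_3 h2 hcs
  obtain ⟨c, d⟩ := s0_2 h0 hs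
  have e := tc_lo
  have f := tc_hi
  have g := s5lo
  have h := s5hi
  apply okmk K3ok <;> (try rw [abs_le]; constructor) <;> norm_num <;> linarith

theorem kd4 {s2 s0 : ℝ} (h2 : 0 ≤ s2) (hcs : (0:ℝ) ^ 2 + s2 ^ 2 = 1) (h0 : 0 ≤ s0) (hs : s0 ^ 2 = 1 - 0) :
    KD4.ok 0 s2 0 s0 tc (1 + (tc - 1) * 2) := by
  obtain ⟨a, b⟩ := s2_4 h2 hcs
  obtain ⟨c, d⟩ := s0_4 h0 hs
  have e := tc_lo
  have f := tc_hi
  apply okmk K4ok <;> (try rw [abs_le]; constructor) <;> norm_num <;> linarith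

theorem n5_bd : 1 ≤ 1 + (tc - 1) * (8 / (5 - Real.sqrt 5)) ∧ 1 + (tc - 1) * (8 / (5 - Real.sqrt 5)) ≤ 1.0485875 := by
  have e := tc_lo
  have f := tc_hi
  have g := s5lo
  have h := s5hi
  have h5 : 8 / (5 - Real.sqrt 5) = 2 + 2 * Real.sqrt 5 / 5 := by
    have : (5 - Real.sqrt 5) ≠ 0 := by linarith
    field_simp; linear_combination 2 * s5sq
  rw [h5]
  constructor
  · nlinarith
  · nlinarith

theorem kd5p {s2 s0 : ℝ} (h2 : 0 ≤ s2) (hcs : ((Real.sqrt 5 - 1)/4) ^ 2 + s2 ^ 2 = 1) (h0 : 0 ≤ s0) (hs : s0 ^ 2 = 1 - 1 / 5) :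
    KD5p.ok ((Real.sqrt 5 - 1)/4) s2 (Real.sqrt 5/5) s0 tc (1 + (tc - 1) * (8 / (5 - Real.sqrt 5))) := by
  obtain ⟨a, b⟩ := s2_5 h2 hcs
  obtain ⟨c, d⟩ := s0_5 h0 hs
  obtain ⟨i, j⟩ := n5_bd
  have e := tc_lo
  have f := tc_hi
  have g := s5lo
  have h := s5hi
  generalize (1 + (tc - 1) * (8 / (5 - Real.sqrt 5))) = N at *
  apply okmk K5ok <;> (try rw [abs_le]; constructor) <;> norm_num <;> linarith

theorem kd5m {s2 s0 : ℝ} (h2 : 0 ≤ s2) (hcs : ((Real.sqrt 5 - 1)/4) ^ 2 + s2 ^ 2 = 1) (h0 : 0 ≤ s0) (hs : s0 ^ 2 = 1 - 1 / 5) :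
    KD5m.ok ((Real.sqrt 5 - 1)/4) s2 (-(Real.sqrt 5/5)) s0 tc (1 + (tc - 1) * (8 / (5 - Real.sqrt 5))) := by
  obtain ⟨a, b⟩ := s2_5 h2 hcs
  obtain ⟨c, d⟩ := s0_5 h0 hs
  obtain ⟨i, j⟩ := n5_bd
  have e := tc_lo
  have f := tc_hi
  have g := s5lo
  have h := s5hi
  generalize (1 + (tc - 1) * (8 / (5 - Real.sqrt 5))) = N at *
  apply okmk K5ok <;> (try rw [abs_le]; constructor) <;> norm_num <;> linarith

end Marg

namespace Marg

theorem InE_mono {EA EB EA' EB' : ℕ} {z : ℂ} (hA0 : 0 < EA) (hB0 : 0 < EB) (hA : EA ≤ EA') (hB : EB ≤ EB') (h : InE EA EB z) : InE EA' EB' z := by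
  simp only [InE] at *
  have hA0' : (0:ℝ) < EA := by exact_mod_cast hA0
  have hB0' : (0:ℝ) < EB := by exact_mod_cast hB0
  have hA' : (EA:ℝ) ≤ EA' := by exact_mod_cast hA
  have hB' : (EB:ℝ) ≤ EB' := by exact_mod_cast hB
  generalize (EA:ℝ) = a at *
  generalize (EB:ℝ) = b at *
  generalize (EA':ℝ) = a' at *
  generalize (EB':ℝ) = b' at *
  have hX0 : 0 ≤ (1048576 * z.re) ^ 2 := by positivity
  generalize (1048576 * z.re) ^ 2 = X at *
  have hX : 0 ≤ (1048576 * z.im) ^ 2 := by positivity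
  generalize (1048576 * z.im) ^ 2 = Y at *
  have ha : a ^ 2 ≤ a' ^ 2 := by gcongr
  have hb : b ^ 2 ≤ b' ^ 2 := by gcongr
  have ha0 : 0 < a ^ 2 := by positivity
  have hb0 : 0 < b ^ 2 := by positivity
  generalize a ^ 2 = a at *
  generalize b ^ 2 = b at *
  generalize a' ^ 2 = a' at *
  generalize b' ^ 2 = b' at *
  have h1 : X / a + Y / b ≤ 1 := by
    rw [div_add_div _ _ ha0.ne' hb0.ne', div_le_one (by positivity)]; linarith
  have ha0' : 0 < a' := by linarith
  have hb0' : 0 < b' := by linarith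
  have h2 : X / a' + Y / b' ≤ 1 := by
    have : X / a' ≤ X / a := by gcongr
    have : Y / b' ≤ Y / b := by gcongr
    linarith
  rw [div_add_div _ _ ha0'.ne' hb0'.ne', div_le_one (by positivity)] at h2
  linarith

theorem sq_real_pos {z : ℂ} {r : ℝ} (h : z ^ 2 = (r:ℂ)) (hr : 0 ≤ r) : z.im = 0 ∧ z.re ^ 2 = r := by
  have h1 := congrArg Complex.re h
  have h2 := congrArg Complex.im h
  simp [sq] at h1 h2
  rcases (by by_cases h : z.re = 0; exact Or.inl h; right; have : z.re * z.im = 0 := by linarith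
             exact (mul_eq_zero.mp this).resolve_left h : z.re = 0 ∨ z.im = 0) with h3 | h3
  · rw [h3] at h1
    have : z.im ^ 2 = 0 := le_antisymm (by nlinarith) (sq_nonneg _)
    have := pow_eq_zero_iff two_ne_zero |>.mp this
    refine ⟨this, ?_⟩
    rw [h3]; rw [this] at h1; linarith
  · refine ⟨h3, ?_⟩
    rw [h3] at h1; linarith

theorem sq_real_neg {z : ℂ} {r : ℝ} (h : z ^ 2 = (r:ℂ)) (hr : r < 0) : z.im ^ 2 = -r ∧ z.re = 0 := by
  have h1 := congrArg Complex.re h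
  have h2 := congrArg Complex.im h
  simp [sq] at h1 h2
  have : z.re * z.im = 0 := by linarith
  rcases mul_eq_zero.mp this with h3 | h3
  · rw [h3] at h1; exact ⟨by linarith, h3⟩
  · rw [h3] at h1; nlinarith

theorem q3_real {z : ℂ} (h : Q3 z) (hE : InE 1130992 424032 z) : z.im = 0 ∧ (z.re ^ 2 = 1 ∨ z.re ^ 2 = 1/9 ∨ z.re ^ 2 = 5/9) := by
  rcases h with h | h | h | h
  · have := sq_real_pos (r := 1) (by rw [h]; norm_num) (by norm_num); exact ⟨this.1, by simp [this.2]⟩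
  · have := sq_real_pos (r := 1/9) (by rw [h]; norm_num) (by norm_num); exact ⟨this.1, by simp [this.2]⟩
  · have := sq_real_pos (r := 5/9) (by rw [h]; norm_num) (by norm_num); exact ⟨this.1, by simp [this.2]⟩
  · exfalso
    have h1 := sq_real_neg h (by linarith [s5lo])
    have h2 := InE_im (by norm_num) hE
    have h3 := s5lo
    rw [abs_le] at h2
    push_cast at h2
    nlinarith [h1.1, h2.1, h2.2]

theorem sq_cases {x r : ℝ} (h : x ^ 2 = r ^ 2) : x = r ∨ x = -r := sq_eq_sq_iff_eq_or_eq_neg.mp h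

theorem r3 {x : ℝ} (h : x ^ 2 = 1 ∨ x ^ 2 = 1/9 ∨ x ^ 2 = 5/9) :
    (x = 1 ∨ x = -1) ∨ (x = 1/3 ∨ x = -(1/3)) ∨ (x = Real.sqrt 5 / 3 ∨ x = -(Real.sqrt 5 / 3)) := by
  rcases h with h | h | h
  · left; apply sq_cases; rw [h]; norm_num
  · right; left; apply sq_cases; rw [h]; norm_num
  · right; right; apply sq_cases; rw [h, div_pow, s5sq]; norm_num

theorem st2_3 {s2 κ0 s0 : ℝ} (h2 : 0 ≤ s2) (hcs : (-1/2:ℝ) ^ 2 + s2 ^ 2 = 1) (hs0 : 0 < s0) (hs : s0 ^ 2 = 1 - κ0 ^ 2)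
    (hκ : κ0 ^ 2 = 1/9 ∨ κ0 ^ 2 = 5/9) {Ax : W3 → Prop} (hA : AxSys (-1/2) s2 Ax)
    {g : ℂ} (hg : g ≠ 0) (h0 : Ax w0) (hf : Ax (ef κ0 s0 g)) (hF : Ax (eF κ0 s0 g))
    (hD : Disp κ0 tc (1 + (tc - 1) * (4 / 3)) g) : ‖g‖ = 1 := by
  have key : ∀ Ax : W3 → Prop, AxSys (-1/2) s2 Ax → ∀ z, PP Ax z → InE 1130992 424032 z →
      z.im = 0 ∧ (z.re ^ 2 = 1 ∨ z.re ^ 2 = 1/9 ∨ z.re ^ 2 = 5/9) := by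
    intro Ax hA z hP hE
    exact q3_real (stage1_3 hA hcs hP (InE_mono (by norm_num) (by norm_num) (by norm_num) (by norm_num) hE)) hE
  have t1 := tc_hi
  have g1 := s5lo
  have g2 := s5hi
  rcases hκ with hκ | hκ
  · have hs' := hs
    rw [hκ] at hs'
    have hQ2 : ∀ Ax : W3 → Prop, AxSys (-1/2) s2 Ax → ∀ z, PP Ax z → InE 1130992 424032 z → ((-1048576:ℤ):ℝ) < 1048576 * z.re →
        |z.re - κ0 ^ 2| ≤ s0 ^ 2 := by
      intro Ax hA z hP hE hl
      rw [hs, hκ, abs_le]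
      push_cast at hl
      rcases r3 (key Ax hA z hP hE).2 with (h | h) | (h | h) | (h | h) <;> rw [h] at hl ⊢ <;> constructor <;> linarith
    rcases sq_cases (r := 1/3) (by rw [hκ]; norm_num) with rfl | rfl
    · exact stage2 hcs (kd3p1 h2 hcs hs0.le hs') hs0.ne' (by linarith) (fun Ax hA z hP hE => (key Ax hA z hP hE).1)
        hQ2 _ _ certD3p1 hA hg h0 hf hF hD
    · rw [show -(1/3 : ℝ) = -1/3 by ring] at *
      exact stage2 hcs (kd3m1 h2 hcs hs0.le hs') hs0.ne' (by linarith) (fun Ax hA z hP hE => (key Ax hA z hP hE).1)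
        hQ2 _ _ certD3m1 hA hg h0 hf hF hD
  · have hs' := hs
    rw [hκ] at hs'
    have hQ2 : ∀ Ax : W3 → Prop, AxSys (-1/2) s2 Ax → ∀ z, PP Ax z → InE 1130992 424032 z → ((-349490:ℤ):ℝ) < 1048576 * z.re →
        |z.re - κ0 ^ 2| ≤ s0 ^ 2 := by
      intro Ax hA z hP hE hl
      rw [hs, hκ, abs_le]
      push_cast at hl
      rcases r3 (key Ax hA z hP hE).2 with (h | h) | (h | h) | (h | h) <;> rw [h] at hl ⊢ <;> constructor <;> linarith
    rcases sq_cases (r := Real.sqrt 5/3) (by rw [hκ, div_pow, s5sq]; norm_num) with rfl | rfl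
    · exact stage2 hcs (kd3p2 h2 hcs hs0.le hs') hs0.ne' (by linarith) (fun Ax hA z hP hE => (key Ax hA z hP hE).1)
        hQ2 _ _ certD3p2 hA hg h0 hf hF hD
    · exact stage2 hcs (kd3m2 h2 hcs hs0.le hs') hs0.ne' (by linarith) (fun Ax hA z hP hE => (key Ax hA z hP hE).1)
        hQ2 _ _ certD3m2 hA hg h0 hf hF hD

theorem st2_4 {s2 κ0 s0 : ℝ} (h2 : 0 ≤ s2) (hcs : (0:ℝ) ^ 2 + s2 ^ 2 = 1) (hs0 : 0 < s0) (hs : s0 ^ 2 = 1 - κ0 ^ 2)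
    (hκ : κ0 = 0) {Ax : W3 → Prop} (hA : AxSys 0 s2 Ax)
    {g : ℂ} (hg : g ≠ 0) (h0 : Ax w0) (hf : Ax (ef κ0 s0 g)) (hF : Ax (eF κ0 s0 g))
    (hD : Disp κ0 tc (1 + (tc - 1) * 2) g) : ‖g‖ = 1 := by
  have key : ∀ Ax : W3 → Prop, AxSys 0 s2 Ax → ∀ z, PP Ax z → InE 1174400 503312 z →
      z.im = 0 ∧ (z.re ^ 2 = 1 ∨ z.re = 0) := by
    intro Ax hA z hP hE
    rcases stage1_4 hA hcs hP (InE_mono (by norm_num) (by norm_num) (by norm_num) (by norm_num) hE) with h | h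
    · have := sq_real_pos (r := 1) (by rw [h]; norm_num) (by norm_num); exact ⟨this.1, by simp [this.2]⟩
    · simp [h]
  have t1 := tc_hi
  subst hκ
  have hs' := hs
  rw [show (0:ℝ) ^ 2 = 0 by norm_num] at hs'
  refine stage2 hcs (kd4 h2 hcs hs0.le hs') hs0.ne' (by linarith) (fun Ax hA z hP hE => (key Ax hA z hP hE).1)
        ?_ _ _ certD4 hA hg h0 hf hF hD
  intro Ax hA z hP hE hl
  rw [hs, abs_le]
  rcases (key Ax hA z hP hE).2 with h | h
  · rcases sq_cases (r := 1) (by rw [h]; norm_num) with h | h <;> rw [h] <;> norm_num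
  · rw [h]; norm_num

theorem st2_5 {s2 κ0 s0 : ℝ} (h2 : 0 ≤ s2) (hcs : ((Real.sqrt 5 - 1)/4) ^ 2 + s2 ^ 2 = 1) (hs0 : 0 < s0) (hs : s0 ^ 2 = 1 - κ0 ^ 2)
    (hκ : κ0 ^ 2 = 1/5) {Ax : W3 → Prop} (hA : AxSys ((Real.sqrt 5 - 1)/4) s2 Ax)
    {g : ℂ} (hg : g ≠ 0) (h0 : Ax w0) (hf : Ax (ef κ0 s0 g)) (hF : Ax (eF κ0 s0 g))
    (hD : Disp κ0 tc (1 + (tc - 1) * (8 / (5 - Real.sqrt 5))) g) : ‖g‖ = 1 := by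
  have t1 := tc_hi
  have g1 := s5lo
  have g2 := s5hi
  have key : ∀ Ax : W3 → Prop, AxSys ((Real.sqrt 5 - 1)/4) s2 Ax → ∀ z, PP Ax z → InE 1258288 587200 z →
      z.im = 0 ∧ (z.re ^ 2 = 1 ∨ z.re ^ 2 = 1/5) := by
    intro Ax hA z hP hE
    rcases stage1_5 hA hcs hP (InE_mono (by norm_num) (by norm_num) (by norm_num) (by norm_num) hE) with h | h
    · have := sq_real_pos (r := 1) (by rw [h]; norm_num) (by norm_num); exact ⟨this.1, by simp [this.2]⟩
    · have := sq_real_pos (r := 1/5) (by rw [h]; norm_num) (by norm_num); exact ⟨this.1, by simp [this.2]⟩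
  have hs' := hs
  rw [hκ] at hs'
  have h55 : (Real.sqrt 5/5) ^ 2 = 1/5 := by rw [div_pow, s5sq]; norm_num
  have hQ2 : ∀ Ax : W3 → Prop, AxSys ((Real.sqrt 5 - 1)/4) s2 Ax → ∀ z, PP Ax z → InE 1258288 587200 z → ((-1048576:ℤ):ℝ) < 1048576 * z.re →
        |z.re - κ0 ^ 2| ≤ s0 ^ 2 := by
    intro Ax hA z hP hE hl
    rw [hs, hκ, abs_le]
    push_cast at hl
    rcases (key Ax hA z hP hE).2 with h | h
    · rcases sq_cases (r := 1) (by rw [h]; norm_num) with h | h <;> rw [h] at hl ⊢ <;> constructor <;> linarith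
    · rcases sq_cases (r := Real.sqrt 5/5) (by rw [h, h55]) with h | h <;> rw [h] at hl ⊢ <;> constructor <;> linarith
  rcases sq_cases (r := Real.sqrt 5/5) (by rw [hκ, h55]) with rfl | rfl
  · exact stage2 hcs (kd5p h2 hcs hs0.le hs') hs0.ne' (by linarith) (fun Ax hA z hP hE => (key Ax hA z hP hE).1)
        hQ2 _ _ certD5p hA hg h0 hf hF hD
  · exact stage2 hcs (kd5m h2 hcs hs0.le hs') hs0.ne' (by linarith) (fun Ax hA z hP hE => (key Ax hA z hP hE).1)
        hQ2 _ _ certD5m hA hg h0 hf hF hD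

end Marg

namespace Marg
open Filter Topology

theorem mul_ent (A B : SL2C) (i j : Fin 2) : (A * B).1 i j = A.1 i 0 * B.1 0 j + A.1 i 1 * B.1 1 j := by
  simp [Matrix.mul_apply, Fin.sum_univ_two]
theorem inv00 (A : SL2C) : (A⁻¹).1 0 0 = A.1 1 1 := by
  rw [Matrix.SpecialLinearGroup.SL2_inv_expl]; simp
theorem inv01 (A : SL2C) : (A⁻¹).1 0 1 = -A.1 0 1 := by
  rw [Matrix.SpecialLinearGroup.SL2_inv_expl]; simp
theorem inv10 (A : SL2C) : (A⁻¹).1 1 0 = -A.1 1 0 := by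
  rw [Matrix.SpecialLinearGroup.SL2_inv_expl]; simp
theorem inv11 (A : SL2C) : (A⁻¹).1 1 1 = A.1 0 0 := by
  rw [Matrix.SpecialLinearGroup.SL2_inv_expl]; simp
theorem det_ent (A : SL2C) : A.1 0 0 * A.1 1 1 - A.1 0 1 * A.1 1 0 = 1 := by
  have := A.2; rwa [Matrix.det_fin_two] at this
theorem one00 : (1 : SL2C).1 0 0 = 1 := by simp
theorem one01 : (1 : SL2C).1 0 1 = 0 := by simp
theorem one10 : (1 : SL2C).1 1 0 = 0 := by simp
theorem one11 : (1 : SL2C).1 1 1 = 1 := by simp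
theorem ext4 {A B : SL2C} (h1 : A.1 0 0 = B.1 0 0) (h2 : A.1 0 1 = B.1 0 1) (h3 : A.1 1 0 = B.1 1 0) (h4 : A.1 1 1 = B.1 1 1) : A = B := by
  apply Subtype.ext
  ext i j
  fin_cases i <;> fin_cases j <;> assumption
theorem mext {A B : Matrix (Fin 2) (Fin 2) ℂ} (h1 : A 0 0 = B 0 0) (h2 : A 0 1 = B 0 1) (h3 : A 1 0 = B 1 0) (h4 : A 1 1 = B 1 1) : A = B := by
  ext i j
  fin_cases i <;> fin_cases j <;> assumption
theorem tr_ent (A : Matrix (Fin 2) (Fin 2) ℂ) : A.trace = A 0 0 + A 1 1 := Matrix.trace_fin_two A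

/-- Sequential discreteness. -/
def Disc (Γ : Subgroup SL2C) : Prop := ∀ g : ℕ → SL2C, (∀ k, g k ∈ Γ) →
  Tendsto (fun k => (g k).1) atTop (𝓝 1) → ∀ᶠ k in atTop, g k = 1

theorem tends_ent {g : ℕ → SL2C} (h1 : Tendsto (fun k => (g k).1 0 0) atTop (𝓝 1)) (h2 : Tendsto (fun k => (g k).1 0 1) atTop (𝓝 0))
    (h3 : Tendsto (fun k => (g k).1 1 0) atTop (𝓝 0)) (h4 : Tendsto (fun k => (g k).1 1 1) atTop (𝓝 1)) :
    Tendsto (fun k => (g k).1) atTop (𝓝 1) := by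
  refine tendsto_pi_nhds.mpr fun i => tendsto_pi_nhds.mpr fun j => ?_
  fin_cases i <;> fin_cases j <;> simpa

theorem Disc.conj {Γ : Subgroup SL2C} (h : Disc Γ) (C : SL2C) : Disc (Γ.map (MulAut.conj C).toMonoidHom) := by
  intro g hg ht
  have h1 : ∀ k, C⁻¹ * g k * C ∈ Γ := by
    intro k
    obtain ⟨x, hx, he⟩ := Subgroup.mem_map.mp (hg k)
    simp at he
    rw [← he]
    simpa [mul_assoc] using hx
  have h2 := h _ h1 (by
    have : (fun k => (C⁻¹ * g k * C).1) = fun k => (C⁻¹).1 * (g k).1 * C.1 := rfl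
    rw [this]
    have e : (1 : Matrix (Fin 2) (Fin 2) ℂ) = (C⁻¹).1 * 1 * C.1 := by
      have : ((C⁻¹ * C : SL2C)).1 = (1 : SL2C).1 := by rw [inv_mul_cancel]
      rw [mul_one]; exact this.symm
    rw [e]
    exact (tendsto_const_nhds.mul ht).mul tendsto_const_nhds)
  filter_upwards [h2] with k hk
  have : g k = C * (C⁻¹ * g k * C) * C⁻¹ := by group
  rw [this, hk]; group

theorem mem_conj {Γ : Subgroup SL2C} {X : SL2C} (h : X ∈ Γ) (C : SL2C) : C * X * C⁻¹ ∈ Γ.map (MulAut.conj C).toMonoidHom :=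
  Subgroup.mem_map.mpr ⟨X, h, by simp⟩

/-- Existence of a square-root-free diagonalisation. -/
theorem exists_diag (M : Matrix (Fin 2) (Fin 2) ℂ) (h : M.trace ^ 2 - 4 * M.det ≠ 0) :
    ∃ (C : SL2C) (l m : ℂ), l + m = M.trace ∧ l * m = M.det ∧ C.1 * M * (C⁻¹).1 = !![l, 0; 0, m] := by
  obtain ⟨r, hr⟩ := IsAlgClosed.exists_pow_nat_eq (M.trace ^ 2 - 4 * M.det) (show 0 < 2 by norm_num)
  have hr0 : r ≠ 0 := by rintro rfl; simp at hr; exact h hr.symm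
  rw [tr_ent, Matrix.det_fin_two] at *
  generalize hp : M 0 0 = p at *
  generalize hq : M 0 1 = q at *
  generalize hrr : M 1 0 = s at *
  generalize ht : M 1 1 = t at *
  have hM : M = !![p, q; s, t] := by apply mext <;> simp [hp, hq, hrr, ht]
  -- it suffices to find the inverse change of basis
  suffices hV : ∃ (V : SL2C) (l m : ℂ), l + m = p + t ∧ l * m = p * t - q * s ∧ M * V.1 = V.1 * !![l, 0; 0, m] by
    obtain ⟨V, l, m, h1, h2, h3⟩ := hV
    refine ⟨V⁻¹, l, m, h1, h2, ?_⟩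
    have e : (V⁻¹).1 * V.1 = 1 := by
      have : ((V⁻¹ * V : SL2C)).1 = (1 : SL2C).1 := by rw [inv_mul_cancel]
      exact this
    rw [inv_inv, mul_assoc, h3, ← mul_assoc, e, one_mul]
  set l := (p + t + r) / 2 with hl
  set m := (p + t - r) / 2 with hm
  have hlm : l - m = r := by rw [hl, hm]; ring
  have h1 : l + m = p + t := by rw [hl, hm]; ring
  have h2 : l * m = p * t - q * s := by rw [hl, hm]; linear_combination -hr / 4
  by_cases hq0 : q = 0
  · by_cases hs0 : s = 0
    · have h3 : (l - p) * (l - t) = 0 := by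
        have : m = p + t - l := by linear_combination h1
        rw [this, hq0] at h2
        linear_combination -h2
      subst hq0 hs0
      refine ⟨1, p, t, rfl, by ring, ?_⟩
      rw [hM]; apply mext <;> simp
    · refine ⟨⟨!![l - t, (m - t) / (s * r); s, s / (s * r)], ?_⟩, l, m, h1, h2, ?_⟩
      · rw [Matrix.det_fin_two]; simp; field_simp; rw [← hlm]; ring
      · rw [hM]; apply mext <;> simp [Matrix.mul_apply, Fin.sum_univ_two] <;> field_simp
        · linear_combination (1:ℂ) * h2 - l * h1
        · linear_combination (1:ℂ) * h2 - m * h1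
        · ring
        · ring
  · refine ⟨⟨!![q, q / (-(q * r)); l - p, (m - p) / (-(q * r))], ?_⟩, l, m, h1, h2, ?_⟩
    · rw [Matrix.det_fin_two]; simp; field_simp; rw [← hlm]; ring
    · rw [hM]; apply mext <;> simp [Matrix.mul_apply, Fin.sum_univ_two] <;> field_simp
      · ring
      · ring
      · linear_combination (1:ℂ) * h2 - l * h1
      · linear_combination -(1:ℂ) * h2 + m * h1

end Marg

namespace Marg
set_option linter.unusedSimpArgs false
open Filter Topology

/-- Iterated conjugation sequence. -/
def itc (X Y : SL2C) : ℕ → SL2C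
  | 0 => Y
  | k + 1 => itc X Y k * X * (itc X Y k)⁻¹

theorem itc_mem {Γ : Subgroup SL2C} {X Y : SL2C} (hX : X ∈ Γ) (hY : Y ∈ Γ) (k : ℕ) : itc X Y k ∈ Γ := by
  induction k with
  | zero => exact hY
  | succ k ih => exact Γ.mul_mem (Γ.mul_mem ih hX) (Γ.inv_mem ih)

theorem pow_diag {X : SL2C} {l m : ℂ} (h1 : X.1 0 0 = l) (h2 : X.1 0 1 = 0) (h3 : X.1 1 0 = 0) (h4 : X.1 1 1 = m) (k : ℕ) :
    (X ^ k).1 0 0 = l ^ k ∧ (X ^ k).1 0 1 = 0 ∧ (X ^ k).1 1 0 = 0 ∧ (X ^ k).1 1 1 = m ^ k := by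
  induction k with
  | zero => simp
  | succ k ih =>
    obtain ⟨a, b, c, d⟩ := ih
    rw [pow_succ]
    simp only [mul_ent, a, b, c, d, h1, h2, h3, h4, pow_succ]
    simp

theorem ratio_zero {B r : ℕ → ℂ} {β : ℂ} (hβ : ‖β‖ < 1) (hr : Tendsto r atTop (𝓝 β)) (hB : ∀ k, B (k + 1) = r k * B k) :
    Tendsto B atTop (𝓝 0) := by
  obtain ⟨ρ, h1, h2⟩ := exists_between hβ
  have h3 : ∀ᶠ k in atTop, ‖r k‖ < ρ := hr.norm.eventually_lt_const h1
  have : Summable B := by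
    apply summable_of_ratio_norm_eventually_le h2
    filter_upwards [h3] with k hk
    rw [hB, norm_mul]
    exact mul_le_mul_of_nonneg_right hk.le (norm_nonneg _)
  exact this.tendsto_atTop_zero

theorem J_diag {Γ : Subgroup SL2C} (hΓ : Disc Γ) {X Y : SL2C} (hX : X ∈ Γ) (hY : Y ∈ Γ) {l m : ℂ} (hlm : l * m = 1) (hne : l ≠ m)
    (h1 : X.1 0 0 = l) (h2 : X.1 0 1 = 0) (h3 : X.1 1 0 = 0) (h4 : X.1 1 1 = m)
    (hb : ‖(l - m) ^ 2‖ * (1 + ‖Y.1 0 1 * Y.1 1 0‖) < 1) :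
    (Y.1 0 1 = 0 ∧ Y.1 1 0 = 0) ∨ (Y.1 0 0 = 0 ∧ Y.1 1 1 = 0) := by
  set Z := itc X Y with hZ
  have hm0 : m ≠ 0 := right_ne_zero_of_mul_eq_one hlm
  have hl0 : l ≠ 0 := left_ne_zero_of_mul_eq_one hlm
  have ea : ∀ k, (Z (k + 1)).1 0 0 = l + ((Z k).1 0 1 * (Z k).1 1 0) * (l - m) := by
    intro k
    have := det_ent (Z k)
    simp only [hZ, itc, mul_ent, inv00, inv01, inv10, inv11, h1, h2, h3, h4] at this ⊢
    linear_combination l * this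
  have ed : ∀ k, (Z (k + 1)).1 1 1 = m - ((Z k).1 0 1 * (Z k).1 1 0) * (l - m) := by
    intro k
    have := det_ent (Z k)
    simp only [hZ, itc, mul_ent, inv00, inv01, inv10, inv11, h1, h2, h3, h4] at this ⊢
    linear_combination m * this
  have eb : ∀ k, (Z (k + 1)).1 0 1 = (Z k).1 0 0 * (Z k).1 0 1 * (m - l) := by
    intro k
    simp only [hZ, itc, mul_ent, inv00, inv01, inv10, inv11, h1, h2, h3, h4]
    ring
  have ec : ∀ k, (Z (k + 1)).1 1 0 = (Z k).1 1 0 * (Z k).1 1 1 * (l - m) := by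
    intro k
    simp only [hZ, itc, mul_ent, inv00, inv01, inv10, inv11, h1, h2, h3, h4]
    ring
  set p : ℕ → ℂ := fun k => (Z k).1 0 1 * (Z k).1 1 0 with hp
  have ep : ∀ k, p (k + 1) = -(l - m) ^ 2 * (1 + p k) * p k := by
    intro k
    have := det_ent (Z k)
    simp only [hp, eb, ec]
    linear_combination -(l - m) ^ 2 * ((Z k).1 0 1 * (Z k).1 1 0) * this
  set β := (l - m) ^ 2 with hβ
  have hβ1 : ‖β‖ < 1 := by
    have : 0 ≤ ‖β‖ * ‖Y.1 0 1 * Y.1 1 0‖ := by positivity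
    linarith
  have bp : ∀ k, ‖p k‖ ≤ ‖p 0‖ * (‖β‖ * (1 + ‖p 0‖)) ^ k ∧ ‖p k‖ ≤ ‖p 0‖ := by
    intro k
    induction k with
    | zero => simp
    | succ k ih =>
      have h5 : ‖p (k + 1)‖ ≤ (‖β‖ * (1 + ‖p 0‖)) * ‖p k‖ := by
        rw [ep, norm_mul, norm_mul, norm_neg]
        have : ‖1 + p k‖ ≤ 1 + ‖p 0‖ := (norm_add_le _ _).trans (by simpa using ih.2)
        gcongr
      have h6 : (‖β‖ * (1 + ‖p 0‖)) * ‖p k‖ ≤ (‖β‖ * (1 + ‖p 0‖)) * (‖p 0‖ * (‖β‖ * (1 + ‖p 0‖)) ^ k) := by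
        gcongr; exact ih.1
      constructor
      · rw [pow_succ]; linarith
      · have : (‖β‖ * (1 + ‖p 0‖)) * ‖p k‖ ≤ 1 * ‖p k‖ := mul_le_mul_of_nonneg_right hb.le (norm_nonneg _)
        linarith [ih.2]
  have tp : Tendsto p atTop (𝓝 0) := by
    apply squeeze_zero_norm (fun k => (bp k).1)
    have := (tendsto_pow_atTop_nhds_zero_of_lt_one (by positivity : 0 ≤ ‖β‖ * (1 + ‖p 0‖)) hb).const_mul ‖p 0‖
    simpa using this
  have ta : Tendsto (fun k => (Z (k + 1)).1 0 0) atTop (𝓝 l) := by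
    simp only [ea]
    have := (tp.mul_const (l - m)).const_add l
    simpa using this
  have td : Tendsto (fun k => (Z (k + 1)).1 1 1) atTop (𝓝 m) := by
    simp only [ed]
    have := (tp.mul_const (l - m)).const_sub m
    simpa using this
  have ta' : Tendsto (fun k => (Z k).1 0 0) atTop (𝓝 l) := (tendsto_add_atTop_iff_nat 1).mp ta
  have td' : Tendsto (fun k => (Z k).1 1 1) atTop (𝓝 m) := (tendsto_add_atTop_iff_nat 1).mp td
  have t2 : Tendsto (fun k : ℕ => 2 * k) atTop atTop := tendsto_id.const_mul_atTop' (by norm_num)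
  have tB : Tendsto (fun k => (Z (2 * k)).1 0 1 * m ^ (2 * k)) atTop (𝓝 0) := by
    refine ratio_zero (r := fun k => (Z (2 * k + 1)).1 0 0 * (Z (2 * k)).1 0 0 * β * m ^ 2) hβ1 ?_ ?_
    · have := ((((ta.comp t2).mul (ta'.comp t2)).mul_const β).mul_const (m ^ 2))
      have e : l * l * β * m ^ 2 = β := by linear_combination β * (l * m + 1) * hlm
      rw [e] at this
      exact this
    · intro k
      show (Z (2 * k + 1 + 1)).1 0 1 * m ^ (2 * k + 2) = _
      rw [eb, eb, hβ]; ring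
  have tC : Tendsto (fun k => (Z (2 * k)).1 1 0 * l ^ (2 * k)) atTop (𝓝 0) := by
    refine ratio_zero (r := fun k => (Z (2 * k + 1)).1 1 1 * (Z (2 * k)).1 1 1 * β * l ^ 2) hβ1 ?_ ?_
    · have := ((((td.comp t2).mul (td'.comp t2)).mul_const β).mul_const (l ^ 2))
      have e : m * m * β * l ^ 2 = β := by linear_combination β * (l * m + 1) * hlm
      rw [e] at this
      exact this
    · intro k
      show (Z (2 * k + 1 + 1)).1 1 0 * l ^ (2 * k + 2) = _
      rw [ec, ec, hβ]; ring
  have hW : ∀ᶠ k in atTop, (X⁻¹) ^ k * Z (2 * k) * X ^ k * X⁻¹ = 1 := by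
    apply hΓ
    · intro k
      exact Γ.mul_mem (Γ.mul_mem (Γ.mul_mem (Γ.pow_mem (Γ.inv_mem hX) _) (itc_mem hX hY _)) (Γ.pow_mem hX _)) (Γ.inv_mem hX)
    · have q1 := fun k => pow_diag h1 h2 h3 h4 k
      have q2 := fun k => pow_diag (X := X⁻¹) (l := m) (m := l) (by rw [inv00, h4]) (by rw [inv01, h2, neg_zero]) (by rw [inv10, h3, neg_zero]) (by rw [inv11, h1]) k
      have hk : ∀ k, m ^ k * l ^ k = 1 := fun k => by rw [← mul_pow, mul_comm, hlm, one_pow]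
      apply tends_ent
      · have : (fun k => ((X⁻¹) ^ k * Z (2 * k) * X ^ k * X⁻¹).1 0 0) = fun k => (Z (2 * k)).1 0 0 * m := by
          funext k
          simp only [mul_ent, (q1 k).1, (q1 k).2.1, (q1 k).2.2.1, (q1 k).2.2.2, (q2 k).1, (q2 k).2.1, (q2 k).2.2.1, (q2 k).2.2.2, inv00, inv01, inv10, inv11, h1, h2, h3, h4]
          linear_combination (Z (2 * k)).1 0 0 * m * hk k
        rw [this]
        have := (ta'.comp t2).mul_const m
        rwa [hlm] at this
      · have : (fun k => ((X⁻¹) ^ k * Z (2 * k) * X ^ k * X⁻¹).1 0 1) = fun k => (Z (2 * k)).1 0 1 * m ^ (2 * k) * l := by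
          funext k
          simp only [mul_ent, (q1 k).1, (q1 k).2.1, (q1 k).2.2.1, (q1 k).2.2.2, (q2 k).1, (q2 k).2.1, (q2 k).2.2.1, (q2 k).2.2.2, inv00, inv01, inv10, inv11, h1, h2, h3, h4]
          ring
        rw [this]
        simpa using tB.mul_const l
      · have : (fun k => ((X⁻¹) ^ k * Z (2 * k) * X ^ k * X⁻¹).1 1 0) = fun k => (Z (2 * k)).1 1 0 * l ^ (2 * k) * m := by
          funext k
          simp only [mul_ent, (q1 k).1, (q1 k).2.1, (q1 k).2.2.1, (q1 k).2.2.2, (q2 k).1, (q2 k).2.1, (q2 k).2.2.1, (q2 k).2.2.2, inv00, inv01, inv10, inv11, h1, h2, h3, h4]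
          ring
        rw [this]
        simpa using tC.mul_const m
      · have : (fun k => ((X⁻¹) ^ k * Z (2 * k) * X ^ k * X⁻¹).1 1 1) = fun k => (Z (2 * k)).1 1 1 * l := by
          funext k
          simp only [mul_ent, (q1 k).1, (q1 k).2.1, (q1 k).2.2.1, (q1 k).2.2.2, (q2 k).1, (q2 k).2.1, (q2 k).2.2.1, (q2 k).2.2.2, inv00, inv01, inv10, inv11, h1, h2, h3, h4]
          linear_combination (Z (2 * k)).1 1 1 * l * hk k
        rw [this]
        have := (td'.comp t2).mul_const l
        rwa [mul_comm m l, hlm] at this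
  obtain ⟨k, hk⟩ := hW.exists
  have hk' : Z (2 * k) = X := by
    have e : Z (2 * k) = X ^ k * ((X⁻¹) ^ k * Z (2 * k) * X ^ k * X⁻¹) * (X * (X ^ k)⁻¹) := by
      rw [inv_pow]; group
    rw [e, hk, mul_one, ← mul_assoc, ← pow_succ, pow_succ', mul_assoc, mul_inv_cancel, mul_one]
  have back : ∀ k, (Z (k + 1)).1 0 1 = 0 → (Z (k + 1)).1 1 0 = 0 →
      ((Z k).1 0 1 = 0 ∧ (Z k).1 1 0 = 0) ∨ ((Z k).1 0 0 = 0 ∧ (Z k).1 1 1 = 0) := by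
    intro k hb hc
    have hd := det_ent (Z k)
    rw [eb] at hb
    rw [ec] at hc
    have hs : l - m ≠ 0 := sub_ne_zero.mpr hne
    have hs' : m - l ≠ 0 := sub_ne_zero.mpr hne.symm
    have hb' := (mul_eq_zero.mp hb).resolve_right hs'
    have hc' := (mul_eq_zero.mp hc).resolve_right hs
    rcases mul_eq_zero.mp hb' with h | h <;> rcases mul_eq_zero.mp hc' with h' | h'
    · rw [h, h'] at hd; simp at hd
    · exact Or.inr ⟨h, h'⟩
    · exact Or.inl ⟨h, h'⟩
    · rw [h, h'] at hd; simp at hd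
  have main : ∀ j, (Z j).1 0 1 = 0 → (Z j).1 1 0 = 0 → ((Y.1 0 1 = 0 ∧ Y.1 1 0 = 0) ∨ (Y.1 0 0 = 0 ∧ Y.1 1 1 = 0)) := by
    intro j
    induction j with
    | zero => intro h h'; exact Or.inl ⟨h, h'⟩
    | succ j ih =>
      intro h h'
      rcases back j h h' with h5 | h5
      · exact ih h5.1 h5.2
      · rcases j with _ | j
        · exact Or.inr h5
        · exfalso
          have e1 := ea j
          have e2 := ed j
          rw [h5.1] at e1
          rw [h5.2] at e2
          have hs : l + m = 0 := by linear_combination -e1 - e2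
          have : β = -4 := by rw [hβ]; linear_combination (l + m) * hs - 4 * hlm
          rw [this] at hβ1
          norm_num at hβ1
  exact main (2 * k) (by rw [hk', h2]) (by rw [hk', h3])

theorem tr_conj (C X : SL2C) : (C * X * C⁻¹).1.trace = X.1.trace := by
  have hd := det_ent C
  simp only [tr_ent, mul_ent, inv00, inv01, inv10, inv11]
  linear_combination (X.1 0 0 + X.1 1 1) * hd

theorem gam_conj (C X Y : SL2C) : γp (C * X * C⁻¹) (C * Y * C⁻¹) = γp X Y := by
  have : C * X * C⁻¹ * (C * Y * C⁻¹) * (C * X * C⁻¹)⁻¹ * (C * Y * C⁻¹)⁻¹ = C * (X * Y * X⁻¹ * Y⁻¹) * C⁻¹ := by group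
  simp only [γp]
  rw [this, tr_conj]

/-- Jørgensen's inequality. -/
theorem lemJ {Γ : Subgroup SL2C} (hΓ : Disc Γ) {X Y : SL2C} (hX : X ∈ Γ) (hY : Y ∈ Γ) (h4 : X.1.trace ^ 2 ≠ 4)
    (h : ‖X.1.trace ^ 2 - 4‖ + ‖γp X Y‖ < 1) : X * Y = Y * X ∨ Y.1.trace = 0 := by
  obtain ⟨C, l, m, e1, e2, e3⟩ := exists_diag X.1 (by rw [X.2]; intro hh; exact h4 (by linear_combination hh))
  rw [X.2] at e2
  have e3' : (C * X * C⁻¹).1 = !![l, 0; 0, m] := e3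
  have a1 : (C * X * C⁻¹).1 0 0 = l := by rw [e3']; rfl
  have a2 : (C * X * C⁻¹).1 0 1 = 0 := by rw [e3']; rfl
  have a3 : (C * X * C⁻¹).1 1 0 = 0 := by rw [e3']; rfl
  have a4 : (C * X * C⁻¹).1 1 1 = m := by rw [e3']; rfl
  have hβ : X.1.trace ^ 2 - 4 = (l - m) ^ 2 := by rw [← e1]; linear_combination 4 * e2
  rw [← tr_conj C Y]
  rw [hβ, ← gam_conj C] at h
  have comm : (C * X * C⁻¹) * (C * Y * C⁻¹) = (C * Y * C⁻¹) * (C * X * C⁻¹) → X * Y = Y * X := by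
    intro hh
    have : C * (X * Y) * C⁻¹ = C * (Y * X) * C⁻¹ := by
      calc _ = (C * X * C⁻¹) * (C * Y * C⁻¹) := by group
        _ = _ := hh
        _ = _ := by group
    simpa using this
  have hXm := mem_conj hX C
  have hYm := mem_conj hY C
  generalize C * X * C⁻¹ = X' at *
  generalize C * Y * C⁻¹ = Y' at *
  have hg : γp X' Y' = -(l - m) ^ 2 * (Y'.1 0 1 * Y'.1 1 0) := by
    have hd := det_ent Y'
    simp only [γp, tr_ent, mul_ent, inv00, inv01, inv10, inv11, a1, a2, a3, a4]
    linear_combination (2 * l * m) * hd + 2 * e2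
  have hne : l ≠ m := by
    rintro rfl
    apply h4; linear_combination hβ
  have hh := J_diag (hΓ.conj C) hXm hYm e2 hne a1 a2 a3 a4 (by
    rw [hg, norm_mul, norm_neg] at h
    linarith)
  rcases hh with ⟨h5, h6⟩ | ⟨h5, h6⟩
  · left
    apply comm
    apply ext4 <;> simp only [mul_ent, a1, a2, a3, a4, h5, h6] <;> ring
  · right
    rw [tr_ent, h5, h6, add_zero]

end Marg

namespace Marg
set_option linter.unusedSimpArgs false
open Filter Topology

theorem SL_coord {Γ : Subgroup SL2C} (hΓ : Disc Γ) {P Y : SL2C} (hX : P ∈ Γ) (hY : Y ∈ Γ) {w : ℂ} (hw : w ≠ 0)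
    (h1 : P.1 0 0 = 1) (h2 : P.1 0 1 = w) (h3 : P.1 1 0 = 0) (h4 : P.1 1 1 = 1)
    (hb : ‖w * Y.1 1 0‖ < 1) : Y.1 1 0 = 0 := by
  set Z := itc P Y with hZ
  have ea : ∀ k, (Z (k + 1)).1 0 0 = 1 - w * (Z k).1 1 0 * (Z k).1 0 0 := by
    intro k
    have := det_ent (Z k)
    simp only [hZ, itc, mul_ent, inv00, inv01, inv10, inv11, h1, h2, h3, h4] at this ⊢
    linear_combination this
  have ed : ∀ k, (Z (k + 1)).1 1 1 = 1 + w * (Z k).1 1 0 * (Z k).1 0 0 := by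
    intro k
    have := det_ent (Z k)
    simp only [hZ, itc, mul_ent, inv00, inv01, inv10, inv11, h1, h2, h3, h4] at this ⊢
    linear_combination this
  have eb : ∀ k, (Z (k + 1)).1 0 1 = w * ((Z k).1 0 0 * (Z k).1 0 0) := by
    intro k
    simp only [hZ, itc, mul_ent, inv00, inv01, inv10, inv11, h1, h2, h3, h4]
    ring
  have ec : ∀ k, (Z (k + 1)).1 1 0 = -(w * (Z k).1 1 0 * (Z k).1 1 0) := by
    intro k
    simp only [hZ, itc, mul_ent, inv00, inv01, inv10, inv11, h1, h2, h3, h4]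
    ring
  set r := ‖w * Y.1 1 0‖ with hr
  have r0 : 0 ≤ r := norm_nonneg _
  have bc : ∀ k, ‖w * (Z k).1 1 0‖ ≤ r ^ (k + 1) := by
    intro k
    induction k with
    | zero => simp [hr, hZ, itc]
    | succ k ih =>
      have e : w * (Z (k + 1)).1 1 0 = -((w * (Z k).1 1 0) * (w * (Z k).1 1 0)) := by rw [ec]; ring
      rw [e, norm_neg, norm_mul]
      have h5 : r ^ (k + 1) ≤ r := pow_le_of_le_one r0 hb.le (by omega)
      calc _ ≤ r ^ (k + 1) * r := mul_le_mul ih (ih.trans h5) (norm_nonneg _) (by positivity)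
        _ = _ := by ring
  have bc1 : ∀ k, ‖w * (Z k).1 1 0‖ ≤ r := fun k => (bc k).trans (pow_le_of_le_one r0 hb.le (by omega))
  set M := max ‖Y.1 0 0‖ (1 / (1 - r)) with hM
  have hM1 : 1 + r * M ≤ M := by
    have : 1 / (1 - r) ≤ M := le_max_right _ _
    rw [div_le_iff₀ (by linarith)] at this
    linarith
  have ba : ∀ k, ‖(Z k).1 0 0‖ ≤ M := by
    intro k
    induction k with
    | zero => exact le_max_left _ _
    | succ k ih =>
      rw [ea]
      refine (norm_sub_le _ _).trans ?_
      rw [norm_mul, norm_one]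
      have := mul_le_mul (bc1 k) ih (norm_nonneg _) r0
      linarith
  have tw : Tendsto (fun k => w * (Z k).1 1 0) atTop (𝓝 0) := by
    apply squeeze_zero_norm bc
    exact (tendsto_add_atTop_iff_nat 1).mpr (tendsto_pow_atTop_nhds_zero_of_lt_one r0 hb)
  have twa : Tendsto (fun k => w * (Z k).1 1 0 * (Z k).1 0 0) atTop (𝓝 0) := by
    apply squeeze_zero_norm (a := fun k => ‖w * (Z k).1 1 0‖ * M)
    · intro k; rw [norm_mul]; exact mul_le_mul_of_nonneg_left (ba k) (norm_nonneg _)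
    · simpa using tw.norm.mul_const M
  have ta : Tendsto (fun k => (Z k).1 0 0) atTop (𝓝 1) := by
    apply (tendsto_add_atTop_iff_nat 1).mp
    simp only [ea]
    simpa using twa.const_sub 1
  have td : Tendsto (fun k => (Z k).1 1 1) atTop (𝓝 1) := by
    apply (tendsto_add_atTop_iff_nat 1).mp
    simp only [ed]
    simpa using twa.const_add 1
  have tb : Tendsto (fun k => (Z k).1 0 1) atTop (𝓝 w) := by
    apply (tendsto_add_atTop_iff_nat 1).mp
    simp only [eb]
    simpa using (ta.mul ta).const_mul w
  have tc : Tendsto (fun k => (Z k).1 1 0) atTop (𝓝 0) := by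
    have := tw.const_mul w⁻¹
    simpa [← mul_assoc, hw] using this
  have hW : ∀ᶠ k in atTop, Z k * P⁻¹ = 1 := by
    apply hΓ
    · intro k
      exact Γ.mul_mem (itc_mem hX hY _) (Γ.inv_mem hX)
    · apply tends_ent
      · simp only [mul_ent, inv00, inv01, inv10, inv11, h1, h2, h3, h4]
        simpa using ta
      · simp only [mul_ent, inv00, inv01, inv10, inv11, h1, h2, h3, h4]
        simpa using (ta.mul_const (-w)).add tb
      · simp only [mul_ent, inv00, inv01, inv10, inv11, h1, h2, h3, h4]
        simpa using tc
      · simp only [mul_ent, inv00, inv01, inv10, inv11, h1, h2, h3, h4]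
        simpa using (tc.mul_const (-w)).add td
  obtain ⟨k, hk⟩ := hW.exists
  have hk' : Z k = P := by rwa [mul_inv_eq_one] at hk
  have main : ∀ j, (Z j).1 1 0 = 0 → Y.1 1 0 = 0 := by
    intro j
    induction j with
    | zero => intro h; exact h
    | succ j ih =>
      intro h
      rw [ec] at h
      apply ih
      simpa [hw] using h
  exact main k (by rw [hk', h3])

/-- `v` is an eigenvector of `Y`. -/
def Eig (v : Fin 2 → ℂ) (Y : SL2C) : Prop := ∃ a : ℂ, Y.1.mulVec v = a • v

theorem Eig.mul {v : Fin 2 → ℂ} {X Y : SL2C} (hX : Eig v X) (hY : Eig v Y) : Eig v (X * Y) := by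
  obtain ⟨a, ha⟩ := hX
  obtain ⟨b, hb⟩ := hY
  refine ⟨a * b, ?_⟩
  show (X.1 * Y.1).mulVec v = _
  rw [← Matrix.mulVec_mulVec, hb, Matrix.mulVec_smul, ha, smul_smul, mul_comm]

theorem inv_mul_mat (X : SL2C) : (X⁻¹).1 * X.1 = 1 := by
  have : ((X⁻¹ * X : SL2C)).1 = (1 : SL2C).1 := by rw [inv_mul_cancel]
  exact this
theorem mul_inv_mat (X : SL2C) : X.1 * (X⁻¹).1 = 1 := by
  have : ((X * X⁻¹ : SL2C)).1 = (1 : SL2C).1 := by rw [mul_inv_cancel]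
  exact this

theorem Eig.inv {v : Fin 2 → ℂ} (hv : v ≠ 0) {X : SL2C} (hX : Eig v X) : Eig v X⁻¹ := by
  obtain ⟨a, ha⟩ := hX
  have h1 : (X⁻¹).1.mulVec (a • v) = v := by
    rw [← ha, Matrix.mulVec_mulVec, inv_mul_mat, Matrix.one_mulVec]
  have ha0 : a ≠ 0 := by
    rintro rfl
    rw [zero_smul, Matrix.mulVec_zero] at h1
    exact hv h1.symm
  refine ⟨a⁻¹, ?_⟩
  rw [Matrix.mulVec_smul] at h1
  rw [eq_inv_smul_iff₀ ha0, h1]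

theorem Eig.closure {v : Fin 2 → ℂ} (hv : v ≠ 0) {A B : SL2C} (hA : Eig v A) (hB : Eig v B) {S : SL2C}
    (hS : S ∈ Subgroup.closure {A, B}) : Eig v S := by
  induction hS using Subgroup.closure_induction with
  | mem x hx => rcases hx with rfl | rfl <;> assumption
  | one => exact ⟨1, by simp⟩
  | mul x y _ _ hx hy => exact hx.mul hy
  | inv x _ hx => exact hx.inv hv

theorem no_common {A B : SL2C} (hne : IsNonelementary (Subgroup.closure {A, B})) {v : Fin 2 → ℂ} (hv : v ≠ 0)
    (hA : Eig v A) (hB : Eig v B) : False := by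
  obtain ⟨S, hS, T, hT, -, -, h⟩ := hne
  exact h ⟨v, hv, hA.closure hv hB hS, hA.closure hv hB hT⟩

/-- Shimizu–Leutbecher. -/
theorem lemSL {Γ : Subgroup SL2C} (hΓ : Disc Γ) {P : SL2C} (hP : P ∈ Γ) (ht : P.1.trace = 2) (hP1 : P ≠ 1) :
    ∃ v : Fin 2 → ℂ, v ≠ 0 ∧ (∀ Y ∈ Γ, ‖((P.1 - 1) * Y.1 * (P.1 - 1) * (Y⁻¹).1).trace‖ < 1 → Eig v Y) ∧
      (P.1 - 1).mulVec v = 0 := by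
  have hd := det_ent P
  rw [tr_ent] at ht
  obtain ⟨C, w, hw, hC⟩ : ∃ (C : SL2C) (w : ℂ), w ≠ 0 ∧ (P.1 - 1) = (C⁻¹).1 * !![0, w; 0, 0] * C.1 := by
    by_cases hs : P.1 1 0 = 0
    · have hp : (P.1 0 0 - 1) ^ 2 = 0 := by
        linear_combination (P.1 0 0) * ht - hd - P.1 0 1 * hs
      have hp' : P.1 0 0 = 1 := by simpa [sub_eq_zero] using hp
      have hq : P.1 1 1 = 1 := by linear_combination ht - hp'
      refine ⟨1, P.1 0 1, ?_, ?_⟩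
      · intro h0
        exact hP1 (ext4 (by rw [hp', one00]) (by rw [h0, one01]) (by rw [hs, one10]) (by rw [hq, one11]))
      · simp only [inv_one]
        apply mext <;> simp [hs, hp', hq, Matrix.mul_apply, Fin.sum_univ_two]
    · let V : SL2C := ⟨!![P.1 0 0 - 1, -1 / P.1 1 0; P.1 1 0, 0], by
        rw [Matrix.det_fin_two]; simp; field_simp⟩
      refine ⟨V⁻¹, -1 / P.1 1 0, by simp [hs], ?_⟩
      rw [inv_inv]
      have : (P.1 - 1) * V.1 = V.1 * !![0, -1 / P.1 1 0; 0, 0] := by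
        apply mext <;> simp [V, Matrix.mul_apply, Fin.sum_univ_two] <;> field_simp
        · linear_combination (P.1 0 0) * ht - hd
        · linear_combination P.1 1 0 * ht
      rw [← this, mul_assoc, mul_inv_mat, mul_one]
  refine ⟨(C⁻¹).1.mulVec ![1, 0], ?_, ?_, ?_⟩
  · intro h0
    have : C.1.mulVec ((C⁻¹).1.mulVec ![1, 0]) = 0 := by rw [h0, Matrix.mulVec_zero]
    rw [Matrix.mulVec_mulVec, mul_inv_mat, Matrix.one_mulVec] at this
    have := congrFun this 0
    simp at this
  · intro Y hY hb
    have hPm := mem_conj hP C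
    have hYm := mem_conj hY C
    have eP : (C * P * C⁻¹).1 = 1 + !![0, w; 0, 0] := by
      have : P.1 = 1 + (C⁻¹).1 * !![0, w; 0, 0] * C.1 := by rw [← hC]; abel
      show C.1 * P.1 * (C⁻¹).1 = _
      rw [this, mul_add, add_mul, mul_one, mul_inv_mat]
      congr 1
      calc _ = (C.1 * (C⁻¹).1) * !![0, w; 0, 0] * (C.1 * (C⁻¹).1) := by simp only [mul_assoc]
        _ = _ := by rw [mul_inv_mat, one_mul, mul_one]
    have key : (C * Y * C⁻¹).1 1 0 = 0 := by
      refine SL_coord (hΓ.conj C) hPm hYm hw (by rw [eP]; simp) (by rw [eP]; simp) (by rw [eP]; simp) (by rw [eP]; simp) ?_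
      have e1 : ((P.1 - 1) * Y.1 * (P.1 - 1) * (Y⁻¹).1).trace =
          (!![0, w; 0, 0] * (C * Y * C⁻¹).1 * !![0, w; 0, 0] * ((C * Y * C⁻¹)⁻¹).1).trace := by
        rw [hC]
        have e0 : ∀ N1 N2 N3 N4 : Matrix (Fin 2) (Fin 2) ℂ, (((C⁻¹).1 * N1 * N2) * N3 * ((C⁻¹).1 * N1 * N2) * N4).trace =
            (N1 * N2 * N3 * ((C⁻¹).1 * N1 * N2) * N4 * (C⁻¹).1).trace := by
          intro N1 N2 N3 N4
          rw [Matrix.trace_mul_comm _ (C⁻¹).1]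
          simp only [mul_assoc]
        rw [e0]
        congr 1
        have : (C * Y * C⁻¹)⁻¹ = C * Y⁻¹ * C⁻¹ := by group
        rw [this]
        show _ = !![0, w; 0, 0] * (C.1 * Y.1 * (C⁻¹).1) * !![0, w; 0, 0] * (C.1 * (Y⁻¹).1 * (C⁻¹).1)
        simp only [mul_assoc]
      rw [e1] at hb
      generalize C * Y * C⁻¹ = Y' at *
      have e2 : (!![0, w; 0, 0] * Y'.1 * !![0, w; 0, 0] * (Y'⁻¹).1).trace = -(w * Y'.1 1 0) ^ 2 := by
        rw [tr_ent]
        simp only [Matrix.mul_apply, Fin.sum_univ_two, inv00, inv01, inv10, inv11]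
        simp
        ring
      rw [e2, norm_neg, norm_pow] at hb
      exact (sq_lt_one_iff₀ (norm_nonneg _)).mp hb
    refine ⟨(C * Y * C⁻¹).1 0 0, ?_⟩
    have e3 : Y.1 = (C⁻¹).1 * (C * Y * C⁻¹).1 * C.1 := by
      have : Y = C⁻¹ * (C * Y * C⁻¹) * C := by group
      exact congrArg Subtype.val this
    rw [Matrix.mulVec_mulVec]
    nth_rewrite 1 [e3]
    rw [mul_assoc, mul_inv_mat, mul_one, ← Matrix.mulVec_mulVec, ← Matrix.mulVec_smul]
    congr 1
    generalize C * Y * C⁻¹ = Y' at *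
    ext i
    fin_cases i <;> simp [Matrix.mulVec, dotProduct, Fin.sum_univ_two, key]
  · rw [hC, Matrix.mulVec_mulVec, mul_assoc, mul_inv_mat, mul_one, ← Matrix.mulVec_mulVec]
    have : (!![0, w; 0, 0] : Matrix (Fin 2) (Fin 2) ℂ).mulVec ![1, 0] = 0 := by
      ext i; fin_cases i <;> simp [Matrix.mulVec, dotProduct, Fin.sum_univ_two]
    rw [this, Matrix.mulVec_zero]

end Marg

namespace Marg
set_option linter.unusedSimpArgs false
open Complex (normSq)

abbrev M2 := Matrix (Fin 2) (Fin 2) ℂ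

/-- Half the squared Frobenius norm. -/
def hn (X : M2) : ℝ := (normSq (X 0 0) + normSq (X 0 1) + normSq (X 1 0) + normSq (X 1 1)) / 2

theorem fnorm_sq (X : M2) : fnorm X ^ 2 = 2 * hn X := by
  unfold fnorm
  rw [Matrix.frobenius_norm_def]
  have h : 0 ≤ ∑ i, ∑ j, ‖X i j‖ ^ (2:ℝ) := by positivity
  rw [← Real.sqrt_eq_rpow, Real.sq_sqrt h]
  simp only [Fin.sum_univ_two, hn, Complex.normSq_eq_norm_sq, Real.rpow_two]
  ring

theorem hn_nonneg (X : M2) : 0 ≤ hn X := by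
  unfold hn
  have := Complex.normSq_nonneg (X 0 0)
  have := Complex.normSq_nonneg (X 0 1)
  have := Complex.normSq_nonneg (X 1 0)
  have := Complex.normSq_nonneg (X 1 1)
  linarith

theorem cs3 (a1 a2 a3 b1 b2 b3 : ℝ) : a1 * b1 + a2 * b2 + a3 * b3 ≤
    Real.sqrt (a1 ^ 2 + a2 ^ 2 + a3 ^ 2) * Real.sqrt (b1 ^ 2 + b2 ^ 2 + b3 ^ 2) := by
  rw [← Real.sqrt_mul (by positivity)]
  apply Real.le_sqrt_of_sq_le
  nlinarith [sq_nonneg (a1 * b2 - a2 * b1), sq_nonneg (a1 * b3 - a3 * b1), sq_nonneg (a2 * b3 - a3 * b2)]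

/-- Triangle inequality in hyperbolic space, in matrix form. -/
theorem tri (X Y : M2) : hn (X * Y) ≤ hn X * hn Y +
    Real.sqrt (hn X ^ 2 - normSq X.det) * Real.sqrt (hn Y ^ 2 - normSq Y.det) := by
  simp only [hn, Matrix.det_fin_two, Matrix.mul_apply, Fin.sum_univ_two]
  generalize X 0 0 = x1
  generalize X 0 1 = x2
  generalize X 1 0 = x3
  generalize X 1 1 = x4
  generalize Y 0 0 = y1
  generalize Y 0 1 = y2
  generalize Y 1 0 = y3
  generalize Y 1 1 = y4
  have e1 : ((normSq x1 + normSq x2 + normSq x3 + normSq x4) / 2) ^ 2 - normSq (x1 * x4 - x2 * x3) =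
      ((normSq x1 + normSq x3 - normSq x2 - normSq x4) / 2) ^ 2 + (x1.re * x2.re + x1.im * x2.im + x3.re * x4.re + x3.im * x4.im) ^ 2 +
      (x1.re * x2.im - x1.im * x2.re + x3.re * x4.im - x3.im * x4.re) ^ 2 := by
    simp only [Complex.normSq_apply, Complex.sub_re, Complex.sub_im, Complex.mul_re, Complex.mul_im]
    ring
  have e2 : ((normSq y1 + normSq y2 + normSq y3 + normSq y4) / 2) ^ 2 - normSq (y1 * y4 - y2 * y3) =
      ((normSq y1 + normSq y2 - normSq y3 - normSq y4) / 2) ^ 2 + (y1.re * y3.re + y1.im * y3.im + y2.re * y4.re + y2.im * y4.im) ^ 2 +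
      (-(y1.re * y3.im - y1.im * y3.re + y2.re * y4.im - y2.im * y4.re)) ^ 2 := by
    simp only [Complex.normSq_apply, Complex.sub_re, Complex.sub_im, Complex.mul_re, Complex.mul_im]
    ring
  rw [e1, e2]
  have h := cs3 ((normSq x1 + normSq x3 - normSq x2 - normSq x4) / 2) (x1.re * x2.re + x1.im * x2.im + x3.re * x4.re + x3.im * x4.im)
      (x1.re * x2.im - x1.im * x2.re + x3.re * x4.im - x3.im * x4.re)
      ((normSq y1 + normSq y2 - normSq y3 - normSq y4) / 2) (y1.re * y3.re + y1.im * y3.im + y2.re * y4.re + y2.im * y4.im)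
      (-(y1.re * y3.im - y1.im * y3.re + y2.re * y4.im - y2.im * y4.re))
  refine le_trans (le_of_eq ?_) (add_le_add_right h _)
  simp only [Complex.normSq_apply, Complex.add_re, Complex.add_im, Complex.mul_re, Complex.mul_im]
  ring

/-- Lower bound of the norm by trace and determinant. -/
theorem trl (X : M2) {κ δ : ℂ} (ht : X.trace = 2 * κ) (hd : X.det = δ) : ‖κ‖ ^ 2 + ‖κ ^ 2 - δ‖ ≤ hn X := by
  rw [tr_ent] at ht
  rw [Matrix.det_fin_two] at hd
  unfold hn
  obtain ⟨p, hp⟩ : ∃ p, X 0 0 = κ + p := ⟨X 0 0 - κ, by ring⟩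
  have hq : X 1 1 = κ - p := by linear_combination ht - hp
  rw [hp, hq] at hd ⊢
  have e : κ ^ 2 - δ = p ^ 2 + X 0 1 * X 1 0 := by rw [← hd]; ring
  rw [e]
  have h1 : ‖p ^ 2 + X 0 1 * X 1 0‖ ≤ ‖p‖ ^ 2 + ‖X 0 1‖ * ‖X 1 0‖ := by
    refine (norm_add_le _ _).trans ?_
    rw [norm_pow, norm_mul]
  have h2 := sq_nonneg (‖X 0 1‖ - ‖X 1 0‖)
  have h3 : normSq (κ + p) + normSq (κ - p) = 2 * ‖κ‖ ^ 2 + 2 * ‖p‖ ^ 2 := by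
    rw [← Complex.normSq_eq_norm_sq, ← Complex.normSq_eq_norm_sq]
    simp only [Complex.normSq_apply, Complex.add_re, Complex.add_im, Complex.sub_re, Complex.sub_im]
    ring
  rw [Complex.normSq_eq_norm_sq (X 0 1), Complex.normSq_eq_norm_sq (X 1 0)]
  nlinarith

theorem hn_ge (X : M2) : ‖X.det‖ ≤ hn X := by
  have h := trl X (κ := X.trace / 2) (δ := X.det) (by ring) rfl
  have h2 : ‖X.det‖ ≤ ‖X.trace / 2‖ ^ 2 + ‖(X.trace / 2) ^ 2 - X.det‖ := by
    rw [← norm_pow]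
    have := norm_sub_le ((X.trace / 2) ^ 2) ((X.trace / 2) ^ 2 - X.det)
    simpa using this
  linarith

theorem hn_one_le (X : SL2C) : 1 ≤ hn X.1 := by
  have := hn_ge X.1
  rwa [X.2, norm_one] at this

theorem hn_inv (X : SL2C) : hn (X⁻¹).1 = hn X.1 := by
  simp only [hn, inv00, inv01, inv10, inv11, Complex.normSq_neg]; ring

/-- Upper bound function. -/
def gf (u v : ℝ) : ℝ := u * v + Real.sqrt (u ^ 2 - 1) * Real.sqrt (v ^ 2 - 1)

theorem gf_mono {u v u' v' : ℝ} (hu : 1 ≤ u) (hv : 1 ≤ v) (hu' : u ≤ u') (hv' : v ≤ v') : gf u v ≤ gf u' v' := by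
  unfold gf
  have h1 : u ^ 2 ≤ u' ^ 2 := by gcongr
  have h2 : v ^ 2 ≤ v' ^ 2 := by gcongr
  gcongr
  linarith

theorem gf_self {u : ℝ} (hu : 1 ≤ u) : gf u u = 2 * u ^ 2 - 1 := by
  unfold gf
  rw [Real.mul_self_sqrt (by nlinarith)]; ring

theorem gf_one_le {u v : ℝ} (hu : 1 ≤ u) (hv : 1 ≤ v) : 1 ≤ gf u v := by
  unfold gf
  have : 0 ≤ Real.sqrt (u ^ 2 - 1) * Real.sqrt (v ^ 2 - 1) := by positivity
  nlinarith

theorem tri1 (X Y : M2) (hX : normSq X.det = 1) (hY : normSq Y.det = 1) : hn (X * Y) ≤ gf (hn X) (hn Y) := by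
  have := tri X Y
  rwa [hX, hY] at this

end Marg

namespace Marg
set_option linter.unusedSimpArgs false
open Complex (normSq)

def Mx (v : W3) : M2 := !![v.a, v.b; v.c, -v.a]

/-- `v` is the axis of a rotation with half-angle cosine and sine `c`, `s` in `Γ`. -/
def AxG (c s : ℝ) (Γ : Subgroup SL2C) (v : W3) : Prop :=
  dot v v = 1 ∧ ∃ X ∈ Γ, X.1 0 0 = c + Complex.I * s * v.a ∧ X.1 0 1 = Complex.I * s * v.b ∧
    X.1 1 0 = Complex.I * s * v.c ∧ X.1 1 1 = c - Complex.I * s * v.a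

theorem gam_det (X Y : SL2C) : γp X Y = -(X.1 * Y.1 - Y.1 * X.1).det := by
  have h1 := det_ent X
  have h2 := det_ent Y
  simp only [γp, tr_ent, mul_ent, inv00, inv01, inv10, inv11, Matrix.det_fin_two, Matrix.sub_apply, Matrix.mul_apply, Fin.sum_univ_two]
  linear_combination (2 * (Y.1 0 0 * Y.1 1 1 - Y.1 0 1 * Y.1 1 0)) * h1 + 2 * h2

theorem pow_cheb (W : SL2C) {T : ℂ} (hT : W.1.trace = T) (m : ℕ) :
    (W ^ m).1 0 0 = (Up T m).1 * W.1 0 0 + ((Up T m).2 - T * (Up T m).1) ∧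
    (W ^ m).1 0 1 = (Up T m).1 * W.1 0 1 ∧ (W ^ m).1 1 0 = (Up T m).1 * W.1 1 0 ∧
    (W ^ m).1 1 1 = (Up T m).1 * W.1 1 1 + ((Up T m).2 - T * (Up T m).1) := by
  have hd := det_ent W
  rw [tr_ent] at hT
  induction m with
  | zero => simp [Up]
  | succ m ih =>
    obtain ⟨e1, e2, e3, e4⟩ := ih
    rw [pow_succ]
    simp only [mul_ent, e1, e2, e3, e4, Up]
    refine ⟨?_, ?_, ?_, ?_⟩
    · linear_combination (Up T m).1 * W.1 0 0 * hT - (Up T m).1 * hd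
    · linear_combination (Up T m).1 * W.1 0 1 * hT
    · linear_combination (Up T m).1 * W.1 1 0 * hT
    · linear_combination (Up T m).1 * W.1 1 1 * hT - (Up T m).1 * hd

theorem Up_m2 (m : ℕ) : (Up (-2) m).1 = (-1) ^ (m + 1) * m ∧ (Up (-2) m).2 = (-1) ^ m * (m + 1) := by
  induction m with
  | zero => simp [Up]
  | succ m ih =>
    simp only [Up, ih.1, ih.2]
    push_cast
    constructor <;> ring

theorem test_core {Γ : Subgroup SL2C} (hΓ : Disc Γ) {W Y : SL2C} (hW : W ∈ Γ) (hY : Y ∈ Γ) (hty : Y.1.trace ≠ 0)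
    {T G : ℂ} (hT : W.1.trace = T) (hG : γp W Y = G) (hT2 : T = 2 → G = 0) (hTm : T = -2 → 1 ≤ ‖G‖) (m : ℕ)
    (h : (‖T ^ 2 - 4‖ + ‖G‖) * ‖(Up T m).1‖ ^ 2 < 1) : G = 0 ∨ (Up T m).1 = 0 := by
  have hp := pow_cheb W hT m
  have hd := det_ent W
  have hdm := det_ent (W ^ m)
  by_cases hp0 : (Up T m).1 = 0
  · exact Or.inr hp0
  left
  have e1 : (W ^ m).1.trace ^ 2 - 4 = (Up T m).1 ^ 2 * (T ^ 2 - 4) := by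
    rw [tr_ent] at hT ⊢
    rw [hp.1, hp.2.1, hp.2.2.1, hp.2.2.2] at hdm
    rw [hp.1, hp.2.2.2]
    generalize (Up T m).1 = p at *
    generalize (Up T m).2 - T * p = r at *
    have e0 : p ^ 2 + p * r * T + r ^ 2 = 1 := by
      linear_combination hdm - p ^ 2 * hd - p * r * hT
    have : p * W.1 0 0 + r + (p * W.1 1 1 + r) = p * T + 2 * r := by linear_combination p * hT
    rw [this]
    linear_combination 4 * e0
  have e2 : γp (W ^ m) Y = (Up T m).1 ^ 2 * G := by
    rw [← hG, gam_det, gam_det]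
    simp only [Matrix.det_fin_two, Matrix.sub_apply, Matrix.mul_apply, Fin.sum_univ_two, hp.1, hp.2.1, hp.2.2.1, hp.2.2.2]
    ring
  by_cases h4 : (W ^ m).1.trace ^ 2 = 4
  · have h5 : T ^ 2 - 4 = 0 := by
      rw [h4, sub_self] at e1
      rcases mul_eq_zero.mp e1.symm with h6 | h6
      · exact absurd (pow_eq_zero_iff (by norm_num) |>.mp h6) hp0
      · exact h6
    have h6 : (T - 2) * (T + 2) = 0 := by linear_combination h5
    rcases mul_eq_zero.mp h6 with h7 | h7
    · exact hT2 (by linear_combination h7)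
    · exfalso
      have h8 : T = -2 := by linear_combination h7
      have h9 := hTm h8
      rw [h8, (Up_m2 m).1] at h hp0
      have hm : m ≠ 0 := by rintro rfl; simp at hp0
      have hm1 : (1:ℝ) ≤ m := by exact_mod_cast Nat.one_le_iff_ne_zero.mpr hm
      have h10 : ‖((-1:ℂ)) ^ (m + 1) * (m:ℂ)‖ = m := by
        rw [norm_mul, norm_pow, norm_neg, norm_one, one_pow, one_mul, Complex.norm_natCast]
      rw [h10] at h
      norm_num at h
      nlinarith
  · have := lemJ hΓ (Γ.pow_mem hW m) hY h4 (by
      rw [e1, e2, norm_mul, norm_mul, norm_pow]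
      linarith)
    rcases this with h5 | h5
    · have h6 : γp (W ^ m) Y = 0 := by
        rw [gam_det]
        have : (W ^ m).1 * Y.1 = Y.1 * (W ^ m).1 := congrArg Subtype.val h5
        rw [this, sub_self]; simp
      rw [e2] at h6
      rcases mul_eq_zero.mp h6 with h7 | h7
      · exact absurd (pow_eq_zero_iff (by norm_num) |>.mp h7) hp0
      · exact h7
    · exact absurd h5 hty

theorem axsys {c s : ℝ} (hcs : c ^ 2 + s ^ 2 = 1) (hc : 1 / 16 ≤ c ^ 2) (hs : s ≠ 0) {Γ : Subgroup SL2C} (hΓ : Disc Γ) {c2 s2 : ℝ}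
    (h2 : c2 = c ^ 2 - s ^ 2) (h3 : s2 = 2 * c * s) : AxSys c2 s2 (AxG c s Γ) := by
  have hcs' : (c:ℂ) ^ 2 + (s:ℂ) ^ 2 = 1 := by exact_mod_cast hcs
  have h2' : (c2:ℂ) = c ^ 2 - s ^ 2 := by exact_mod_cast h2
  have h3' : (s2:ℂ) = 2 * c * s := by exact_mod_cast h3
  have hI := Complex.I_sq
  refine ⟨fun v h => h.1, ?_, ?_, ?_⟩
  · rintro v ⟨h1, X, hX, a1, a2, a3, a4⟩
    refine ⟨by simpa [dot, W3.neg] using h1, X⁻¹, Γ.inv_mem hX, ?_, ?_, ?_, ?_⟩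
    · rw [inv00, a4]; simp [W3.neg]; ring
    · rw [inv01, a2]; simp [W3.neg]
    · rw [inv10, a3]; simp [W3.neg]
    · rw [inv11, a1]; simp [W3.neg]
  · rintro v u ⟨hv, X, hX, a1, a2, a3, a4⟩ ⟨hu, Y, hY, b1, b2, b3, b4⟩ σ
    have hsg : sg σ ^ 2 = 1 := by cases σ <;> simp [sg]
    have hmem : ∃ Z ∈ Γ, Z.1 0 0 = c + sg σ * (Complex.I * s * v.a) ∧ Z.1 0 1 = sg σ * (Complex.I * s * v.b) ∧
        Z.1 1 0 = sg σ * (Complex.I * s * v.c) ∧ Z.1 1 1 = c - sg σ * (Complex.I * s * v.a) := by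
      cases σ
      · refine ⟨X⁻¹, Γ.inv_mem hX, ?_⟩
        simp only [inv00, inv01, inv10, inv11, a1, a2, a3, a4, sg, cond_false]
        refine ⟨?_, ?_, ?_, ?_⟩ <;> ring
      · refine ⟨X, hX, ?_⟩
        simp only [a1, a2, a3, a4, sg, cond_true]
        refine ⟨?_, ?_, ?_, ?_⟩ <;> ring
    obtain ⟨Z, hZ, d1, d2, d3, d4⟩ := hmem
    generalize sg σ = τ at *
    have hM : Z * Y * Z⁻¹ ∈ Γ := Γ.mul_mem (Γ.mul_mem hZ hY) (Γ.inv_mem hZ)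
    have hdet := det_ent (Z * Y * Z⁻¹)
    have n1 : (Z * Y * Z⁻¹).1 0 0 = c + Complex.I * s * (rot c2 s2 v τ u).a := by
      simp only [mul_ent, inv00, inv01, inv10, inv11, d1, d2, d3, d4, b1, b2, b3, b4, rot, cr, h2', h3']
      simp only [dot] at hv ⊢
      linear_combination (τ ^ 2 * (-c * s ^ 2 * (v.a * v.a + (v.b * v.c + v.c * v.b) / 2) - Complex.I * s ^ 3 * (2 * (u.a * v.a + (u.b * v.c + u.c * v.b) / 2) * v.a - (v.a * v.a + (v.b * v.c + v.c * v.b) / 2) * u.a))) * hI - (-c * s ^ 2 * (v.a * v.a + (v.b * v.c + v.c * v.b) / 2) - Complex.I * s ^ 3 * (2 * (u.a * v.a + (u.b * v.c + u.c * v.b) / 2) * v.a - (v.a * v.a + (v.b * v.c + v.c * v.b) / 2) * u.a)) * hsg + (c * s ^ 2 - Complex.I * s ^ 3 * u.a) * hv + (c + Complex.I * s * (u.a * v.a + (u.b * v.c + u.c * v.b) / 2) * v.a) * hcs'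
    have n2 : (Z * Y * Z⁻¹).1 0 1 = Complex.I * s * (rot c2 s2 v τ u).b := by
      simp only [mul_ent, inv00, inv01, inv10, inv11, d1, d2, d3, d4, b1, b2, b3, b4, rot, cr, h2', h3']
      simp only [dot] at hv ⊢
      linear_combination (τ ^ 2 * (-Complex.I * s ^ 3 * (2 * (u.a * v.a + (u.b * v.c + u.c * v.b) / 2) * v.b - (v.a * v.a + (v.b * v.c + v.c * v.b) / 2) * u.b))) * hI - (-Complex.I * s ^ 3 * (2 * (u.a * v.a + (u.b * v.c + u.c * v.b) / 2) * v.b - (v.a * v.a + (v.b * v.c + v.c * v.b) / 2) * u.b)) * hsg + (-Complex.I * s ^ 3 * u.b) * hv + (Complex.I * s * (u.a * v.a + (u.b * v.c + u.c * v.b) / 2) * v.b) * hcs'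
    have n3 : (Z * Y * Z⁻¹).1 1 0 = Complex.I * s * (rot c2 s2 v τ u).c := by
      simp only [mul_ent, inv00, inv01, inv10, inv11, d1, d2, d3, d4, b1, b2, b3, b4, rot, cr, h2', h3']
      simp only [dot] at hv ⊢
      linear_combination (τ ^ 2 * (-Complex.I * s ^ 3 * (2 * (u.a * v.a + (u.b * v.c + u.c * v.b) / 2) * v.c - (v.a * v.a + (v.b * v.c + v.c * v.b) / 2) * u.c))) * hI - (-Complex.I * s ^ 3 * (2 * (u.a * v.a + (u.b * v.c + u.c * v.b) / 2) * v.c - (v.a * v.a + (v.b * v.c + v.c * v.b) / 2) * u.c)) * hsg + (-Complex.I * s ^ 3 * u.c) * hv + (Complex.I * s * (u.a * v.a + (u.b * v.c + u.c * v.b) / 2) * v.c) * hcs'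
    have n4 : (Z * Y * Z⁻¹).1 1 1 = c - Complex.I * s * (rot c2 s2 v τ u).a := by
      simp only [mul_ent, inv00, inv01, inv10, inv11, d1, d2, d3, d4, b1, b2, b3, b4, rot, cr, h2', h3']
      simp only [dot] at hv ⊢
      linear_combination (τ ^ 2 * (-c * s ^ 2 * (v.a * v.a + (v.b * v.c + v.c * v.b) / 2) + Complex.I * s ^ 3 * (2 * (u.a * v.a + (u.b * v.c + u.c * v.b) / 2) * v.a - (v.a * v.a + (v.b * v.c + v.c * v.b) / 2) * u.a))) * hI - (-c * s ^ 2 * (v.a * v.a + (v.b * v.c + v.c * v.b) / 2) + Complex.I * s ^ 3 * (2 * (u.a * v.a + (u.b * v.c + u.c * v.b) / 2) * v.a - (v.a * v.a + (v.b * v.c + v.c * v.b) / 2) * u.a)) * hsg + (c * s ^ 2 + Complex.I * s ^ 3 * u.a) * hv + (c - Complex.I * s * (u.a * v.a + (u.b * v.c + u.c * v.b) / 2) * v.a) * hcs'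
    refine ⟨?_, _, hM, n1, n2, n3, n4⟩
    rw [n1, n2, n3, n4] at hdet
    have hs' : (s:ℂ) ≠ 0 := by exact_mod_cast hs
    have : (s:ℂ) ^ 2 * dot (rot c2 s2 v τ u) (rot c2 s2 v τ u) = s ^ 2 * 1 := by
      simp only [dot]
      generalize rot c2 s2 v τ u = r at *
      linear_combination hdet - hcs' + s ^ 2 * (r.a * r.a + r.b * r.c) * hI
    exact mul_left_cancel₀ (pow_ne_zero 2 hs') this
  · rintro u v ⟨hu, X, hX, a1, a2, a3, a4⟩ ⟨hv, Y, hY, b1, b2, b3, b4⟩ m q h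
    have hty : Y.1.trace ≠ 0 := by
      rw [tr_ent, b1, b4]
      have : (2 * c : ℂ) ≠ 0 := by
        have : c ≠ 0 := by rintro rfl; norm_num at hc
        simpa using this
      intro h0; apply this; linear_combination h0
    have hG0 : (s:ℂ) ^ 4 * (4 * (dot u v ^ 2 - 1)) = (1 - c2 : ℂ) ^ 2 * (dot u v ^ 2 - 1) := by
      have e : (1 - c2 : ℂ) = 2 * s ^ 2 := by rw [h2']; linear_combination -hcs'
      rw [e]; ring
    have hGx : γp X Y = (s:ℂ) ^ 4 * (4 * (dot u v ^ 2 - 1)) := by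
      rw [gam_det]
      simp only [Matrix.det_fin_two, Matrix.sub_apply, Matrix.mul_apply, Fin.sum_univ_two, a1, a2, a3, a4, b1, b2, b3, b4]
      have hI4 : Complex.I ^ 4 = 1 := Complex.I_pow_four
      simp only [dot] at hu hv ⊢
      linear_combination 4 * (s:ℂ) ^ 4 * ((u.a * v.a + (u.b * v.c + u.c * v.b) / 2) ^ 2 - (u.a * u.a + (u.b * u.c + u.c * u.b) / 2) * (v.a * v.a + (v.b * v.c + v.c * v.b) / 2)) * hI4 - 4 * (s:ℂ) ^ 4 * ((v.a * v.a + (v.b * v.c + v.c * v.b) / 2) * hu + hv)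
    have main : ∀ W : SL2C, W ∈ Γ → W.1.trace = Tq c2 q (dot u v) → γp W Y = (1 - c2 : ℂ) ^ 2 * (dot u v ^ 2 - 1) →
        dot u v ^ 2 = 1 ∨ (Up (Tq c2 q (dot u v)) m).1 = 0 := by
      intro W hW hT hG
      have hc2 : (1 - c2 : ℂ) ≠ 0 := by
        have : 1 - c2 = 2 * s ^ 2 := by rw [h2]; linarith
        have h' : 1 - c2 ≠ 0 := by rw [this]; positivity
        exact_mod_cast h'
      have := test_core hΓ hW hY hty hT hG ?_ ?_ m h
      · rcases this with h5 | h5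
        · left
          have := (mul_eq_zero.mp h5).resolve_left (pow_ne_zero 2 hc2)
          linear_combination this
        · exact Or.inr h5
      · intro hT
        cases q <;> simp only [Tq, cond_true, cond_false] at hT
        · linear_combination (-(1 - c2) * (dot u v - 1)) * hT
        · linear_combination ((1 - c2) * (dot u v + 1)) * hT
      · intro hT
        have e : (1 - c2 : ℂ) ^ 2 * (dot u v ^ 2 - 1) = ((8 + 8 * c2 : ℝ) : ℂ) := by
          push_cast
          cases q <;> simp only [Tq, cond_true, cond_false] at hT
          · linear_combination (-((1 - c2) * dot u v + 3 + c2)) * hT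
          · linear_combination ((1 - c2) * dot u v - 3 - c2) * hT
        rw [e, Complex.norm_real, Real.norm_eq_abs]
        refine le_trans ?_ (le_abs_self _)
        rw [h2]; nlinarith
    rw [← hG0, ← hGx] at main
    cases q
    · refine main (X * Y) (Γ.mul_mem hX hY) ?_ ?_
      · simp only [tr_ent, mul_ent, a1, a2, a3, a4, b1, b2, b3, b4, Tq, cond_false, h2', dot]
        linear_combination (2 * s ^ 2 * (u.a * v.a + (u.b * v.c + u.c * v.b) / 2)) * hI + (1 - (u.a * v.a + (u.b * v.c + u.c * v.b) / 2)) * hcs'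
      · have : X * Y * Y * (X * Y)⁻¹ * Y⁻¹ = X * Y * X⁻¹ * Y⁻¹ := by group
        simp only [γp, this]
    · refine main (X * Y⁻¹) (Γ.mul_mem hX (Γ.inv_mem hY)) ?_ ?_
      · simp only [tr_ent, mul_ent, inv00, inv01, inv10, inv11, a1, a2, a3, a4, b1, b2, b3, b4, Tq, cond_true, h2', dot]
        linear_combination (-2 * s ^ 2 * (u.a * v.a + (u.b * v.c + u.c * v.b) / 2)) * hI + (1 + (u.a * v.a + (u.b * v.c + u.c * v.b) / 2)) * hcs'
      · have : X * Y⁻¹ * Y * (X * Y⁻¹)⁻¹ * Y⁻¹ = X * Y * X⁻¹ * Y⁻¹ := by group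
        simp only [γp, this]

end Marg

namespace Marg
set_option linter.unusedSimpArgs false
open Complex (normSq)
open Filter Topology

structure Good (A B : SL2C) (Γ : Subgroup SL2C) : Prop where
  disc : Disc Γ
  hA : A ∈ Γ
  hB : B ∈ Γ
  neg : ∀ g ∈ Γ, -g ∈ Γ
  ne : IsNonelementary (Subgroup.closure {A, B})

theorem disc_of {H : Subgroup SL2C} (h : IsDiscreteSubgroup H) : Disc H := by
  intro g hg ht
  have h1 : Tendsto g atTop (𝓝 (1 : SL2C)) := by
    rw [nhds_induced, tendsto_comap_iff]
    exact ht
  have h2 : Tendsto (fun k => (⟨g k, hg k⟩ : H)) atTop (𝓝 (1 : H)) := by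
    rw [nhds_induced, tendsto_comap_iff]
    exact h1
  haveI : DiscreteTopology H := h
  rw [nhds_discrete, tendsto_pure] at h2
  filter_upwards [h2] with k hk
  exact congrArg Subtype.val hk

/-- `H` together with negatives. -/
def pm (H : Subgroup SL2C) : Subgroup SL2C where
  carrier := {g | g ∈ H ∨ -g ∈ H}
  one_mem' := Or.inl H.one_mem
  mul_mem' := by
    rintro a b (ha | ha) (hb | hb)
    · exact Or.inl (H.mul_mem ha hb)
    · right; have := H.mul_mem ha hb; rwa [mul_neg] at this
    · right; have := H.mul_mem ha hb; rwa [neg_mul] at this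
    · left; have := H.mul_mem ha hb; rwa [neg_mul_neg] at this
  inv_mem' := by
    rintro a (ha | ha)
    · exact Or.inl (H.inv_mem ha)
    · right; have := H.inv_mem ha; rwa [inv_neg] at this

theorem neg_ent (X : SL2C) (i j : Fin 2) : (-X).1 i j = -(X.1 i j) := rfl

theorem sq_one {X : SL2C} (h : X * X = 1) : X = 1 ∨ X = -1 := by
  have h1 : X = X⁻¹ := eq_inv_of_mul_eq_one_left h
  have e1 : X.1 0 0 = X.1 1 1 := by conv_lhs => rw [h1, inv00]
  have e2 : X.1 0 1 = 0 := by
    have : X.1 0 1 = -X.1 0 1 := by conv_lhs => rw [h1, inv01]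
    exact self_eq_neg.mp this
  have e3 : X.1 1 0 = 0 := by
    have : X.1 1 0 = -X.1 1 0 := by conv_lhs => rw [h1, inv10]
    exact self_eq_neg.mp this
  have hd := det_ent X
  have : (X.1 1 1 - 1) * (X.1 1 1 + 1) = 0 := by
    rw [e1, e2] at hd; linear_combination hd
  rcases mul_eq_zero.mp this with h5 | h5
  · left
    have h6 : X.1 1 1 = 1 := by linear_combination h5
    exact ext4 (by rw [e1, h6, one00]) (by rw [e2, one01]) (by rw [e3, one10]) (by rw [h6, one11])
  · right
    have h6 : X.1 1 1 = -1 := by linear_combination h5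
    exact ext4 (by rw [e1, h6, neg_ent, one00]) (by rw [e2, neg_ent, one01, neg_zero]) (by rw [e3, neg_ent, one10, neg_zero]) (by rw [h6, neg_ent, one11])

theorem disc_pm {H : Subgroup SL2C} (h : Disc H) : Disc (pm H) := by
  intro g hg ht
  have h1 : ∀ᶠ k in atTop, g k * g k = 1 := by
    apply h
    · intro k
      rcases hg k with h5 | h5
      · exact H.mul_mem h5 h5
      · have := H.mul_mem h5 h5; rwa [neg_mul_neg] at this
    · have := ht.mul ht
      rw [one_mul] at this
      exact this
  have h2 : Tendsto (fun k => (g k).1 0 0) atTop (𝓝 1) := by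
    have := tendsto_pi_nhds.mp (tendsto_pi_nhds.mp ht 0) 0
    simpa using this
  have h3 : ∀ᶠ k in atTop, (g k).1 0 0 ≠ -1 := h2.eventually_ne (by norm_num)
  filter_upwards [h1, h3] with k h5 h6
  rcases sq_one h5 with h7 | h7
  · exact h7
  · exfalso; apply h6; rw [h7, neg_ent, one00]

theorem good_of {A B : SL2C} (hd : IsDiscreteSubgroup (Subgroup.closure {A, B}))
    (hne : IsNonelementary (Subgroup.closure {A, B})) : Good A B (pm (Subgroup.closure {A, B})) where
  disc := disc_pm (disc_of hd)
  hA := Or.inl (Subgroup.subset_closure (by simp))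
  hB := Or.inl (Subgroup.subset_closure (by simp))
  neg := by
    rintro g (hg | hg)
    · right; rwa [neg_neg]
    · exact Or.inl hg
  ne := hne

theorem conj_eq_one {C S : SL2C} : C * S * C⁻¹ = 1 ↔ S = 1 := by
  constructor
  · intro h
    have : S = C⁻¹ * (C * S * C⁻¹) * C := by group
    rw [this, h]; group
  · rintro rfl; group

theorem conj_neg (C S : SL2C) : C * (-S) * C⁻¹ = -(C * S * C⁻¹) := by
  rw [mul_neg, neg_mul]

theorem conj_eq_neg_one {C S : SL2C} : C * S * C⁻¹ = -1 ↔ S = -1 := by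
  rw [← neg_eq_iff_eq_neg, ← conj_neg, conj_eq_one, neg_eq_iff_eq_neg]

theorem conj_pow' (C S : SL2C) (k : ℕ) : (C * S * C⁻¹) ^ k = C * S ^ k * C⁻¹ := conj_pow

theorem Good.conj {A B : SL2C} {Γ : Subgroup SL2C} (h : Good A B Γ) (C : SL2C) :
    Good (C * A * C⁻¹) (C * B * C⁻¹) (Γ.map (MulAut.conj C).toMonoidHom) where
  disc := h.disc.conj C
  hA := mem_conj h.hA C
  hB := mem_conj h.hB C
  neg := by
    intro g hg
    obtain ⟨x, hx, he⟩ := Subgroup.mem_map.mp hg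
    have : -g = C * (-x) * C⁻¹ := by
      rw [conj_neg, ← he]; simp
    rw [this]
    exact mem_conj (h.neg x hx) C
  ne := by
    obtain ⟨S, hS, T, hT, h1, h2, h3⟩ := h.ne
    have hm : ∀ X ∈ Subgroup.closure {A, B}, C * X * C⁻¹ ∈ Subgroup.closure {C * A * C⁻¹, C * B * C⁻¹} := by
      intro X hX
      have := Subgroup.mem_map_of_mem (MulAut.conj C).toMonoidHom hX
      rw [MonoidHom.map_closure, Set.image_pair] at this
      simpa using this
    refine ⟨_, hm S hS, _, hm T hT, ?_, ?_, ?_⟩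
    · intro k hk
      rw [conj_pow', Ne, Ne, conj_eq_one, conj_eq_neg_one]
      exact h1 k hk
    · intro k hk
      rw [conj_pow', Ne, Ne, conj_eq_one, conj_eq_neg_one]
      exact h2 k hk
    · rintro ⟨v, hv, ⟨a, ha⟩, b, hb⟩
      have key : ∀ (X : SL2C) (x : ℂ), (C * X * C⁻¹).1.mulVec v = x • v → X.1.mulVec ((C⁻¹).1.mulVec v) = x • (C⁻¹).1.mulVec v := by
        intro X x hx
        rw [← Matrix.mulVec_smul, ← hx, Matrix.mulVec_mulVec, Matrix.mulVec_mulVec]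
        congr 1
        have : X * C⁻¹ = C⁻¹ * (C * X * C⁻¹) := by group
        exact congrArg Subtype.val this
      refine h3 ⟨(C⁻¹).1.mulVec v, ?_, ⟨a, key S a ha⟩, b, key T b hb⟩
      intro h0
      have : C.1.mulVec ((C⁻¹).1.mulVec v) = 0 := by rw [h0, Matrix.mulVec_zero]
      rw [Matrix.mulVec_mulVec, mul_inv_mat, Matrix.one_mulVec] at this
      exact hv this

/-- Diagonal and antidiagonal matrices generate an elementary group. -/
theorem elem_diag {A B : SL2C} (hne : IsNonelementary (Subgroup.closure {A, B}))
    (hA : A.1 0 1 = 0 ∧ A.1 1 0 = 0) (hB : (B.1 0 1 = 0 ∧ B.1 1 0 = 0) ∨ (B.1 0 0 = 0 ∧ B.1 1 1 = 0)) : False := by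
  have key : ∀ X ∈ Subgroup.closure {A, B}, (X.1 0 1 = 0 ∧ X.1 1 0 = 0) ∨ (X.1 0 0 = 0 ∧ X.1 1 1 = 0) := by
    intro X hX
    induction hX using Subgroup.closure_induction with
    | mem x hx =>
      rcases hx with rfl | rfl
      · exact Or.inl hA
      · exact hB
    | one => left; simp
    | mul x y _ _ hx hy =>
      simp only [mul_ent]
      rcases hx with ⟨h1, h2⟩ | ⟨h1, h2⟩ <;> rcases hy with ⟨h3, h4⟩ | ⟨h3, h4⟩ <;> simp [h1, h2, h3, h4]
    | inv x _ hx =>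
      simp only [inv00, inv01, inv10, inv11]
      rcases hx with ⟨h1, h2⟩ | ⟨h1, h2⟩ <;> simp [h1, h2]
  have key2 : ∀ X ∈ Subgroup.closure {A, B}, (∀ k : ℕ, 1 ≤ k → X ^ k ≠ 1 ∧ X ^ k ≠ -1) → Eig ![1, 0] X := by
    intro X hX h
    rcases key X hX with ⟨h1, h2⟩ | ⟨h1, h2⟩
    · refine ⟨X.1 0 0, ?_⟩
      ext i; fin_cases i <;> simp [Matrix.mulVec, dotProduct, Fin.sum_univ_two, h1, h2]
    · exfalso
      apply (h 2 (by norm_num)).2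
      have hd := det_ent X
      rw [h1, h2] at hd
      rw [pow_two]
      apply ext4 <;> simp only [mul_ent, neg_ent, one00, one01, one10, one11, h1, h2]
      · linear_combination -hd
      · ring
      · ring
      · linear_combination -hd
  obtain ⟨S, hS, T, hT, h1, h2, h3⟩ := hne
  refine h3 ⟨![1, 0], ?_, key2 S hS h1, key2 T hT h2⟩
  intro h0
  have := congrFun h0 0
  simp at this

/-- Bounded (unitary) discrete groups are elementary. -/
theorem elem_unit {A B : SL2C} {Γ : Subgroup SL2C} (h : Good A B Γ)
    (hA : A.1 1 1 = (starRingEnd ℂ) (A.1 0 0) ∧ A.1 1 0 = -(starRingEnd ℂ) (A.1 0 1))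
    (hB : B.1 1 1 = (starRingEnd ℂ) (B.1 0 0) ∧ B.1 1 0 = -(starRingEnd ℂ) (B.1 0 1)) : False := by
  have key : ∀ X ∈ Subgroup.closure {A, B}, X.1 1 1 = (starRingEnd ℂ) (X.1 0 0) ∧ X.1 1 0 = -(starRingEnd ℂ) (X.1 0 1) := by
    intro X hX
    induction hX using Subgroup.closure_induction with
    | mem x hx =>
      rcases hx with rfl | rfl
      · exact hA
      · exact hB
    | one => simp
    | mul x y _ _ hx hy =>
      simp only [mul_ent, hx.1, hx.2, hy.1, hy.2, map_add, map_mul, map_neg, Complex.conj_conj]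
      constructor <;> ring
    | inv x _ hx =>
      simp only [inv00, inv01, inv10, inv11, hx.1, hx.2, map_neg, Complex.conj_conj]
      simp
  have bd : ∀ X ∈ Subgroup.closure {A, B}, ∀ i j, ‖X.1 i j‖ ≤ 1 := by
    intro X hX
    have hd := det_ent X
    rw [(key X hX).1, (key X hX).2] at hd
    have e : ‖X.1 0 0‖ ^ 2 + ‖X.1 0 1‖ ^ 2 = 1 := by
      rw [← Complex.normSq_eq_norm_sq, ← Complex.normSq_eq_norm_sq]
      have : ((normSq (X.1 0 0) + normSq (X.1 0 1) : ℝ) : ℂ) = 1 := by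
        push_cast
        rw [← Complex.mul_conj, ← Complex.mul_conj]; linear_combination hd
      exact_mod_cast this
    have n0 : ‖X.1 0 0‖ ≤ 1 := by nlinarith [norm_nonneg (X.1 0 0), sq_nonneg ‖X.1 0 1‖]
    have n1 : ‖X.1 0 1‖ ≤ 1 := by nlinarith [norm_nonneg (X.1 0 1), sq_nonneg ‖X.1 0 0‖]
    intro i j
    fin_cases i <;> fin_cases j
    · exact n0
    · exact n1
    · show ‖X.1 1 0‖ ≤ 1
      rw [(key X hX).2, norm_neg, RCLike.norm_conj]; exact n1
    · show ‖X.1 1 1‖ ≤ 1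
      rw [(key X hX).1, RCLike.norm_conj]; exact n0
  have hsub : ∀ X ∈ Subgroup.closure {A, B}, X ∈ Γ := by
    intro X hX
    have : Subgroup.closure {A, B} ≤ Γ := by
      rw [Subgroup.closure_le]
      rintro x (rfl | rfl)
      · exact h.hA
      · exact h.hB
    exact this hX
  obtain ⟨S, hS, T, hT, h1, h2, h3⟩ := h.ne
  have hcomp : IsCompact (Set.pi Set.univ fun _ : Fin 2 => Set.pi Set.univ fun _ : Fin 2 => Metric.closedBall (0:ℂ) 1) :=
    isCompact_univ_pi fun _ => isCompact_univ_pi fun _ => isCompact_closedBall _ _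
  obtain ⟨L, hL, φ, hφ, hlim⟩ := hcomp.tendsto_subseq (X := Fin 2 → Fin 2 → ℂ) (x := fun k : ℕ => (fun i j => (S ^ k).1 i j : Fin 2 → Fin 2 → ℂ)) (by
    intro k i _ j _
    rw [mem_closedBall_zero_iff]
    exact bd _ (Subgroup.pow_mem _ hS k) i j)
  have lim2 : Tendsto (fun k => (fun i j => (S ^ φ (k + 1)).1 i j : Fin 2 → Fin 2 → ℂ)) atTop (𝓝 L) := hlim.comp (tendsto_add_atTop_nat 1)
  have ent : ∀ (ψ : ℕ → ℕ), Tendsto (fun k => (fun i j => (S ^ ψ k).1 i j : Fin 2 → Fin 2 → ℂ)) atTop (𝓝 L) → ∀ i j, Tendsto (fun k => (S ^ ψ k).1 i j) atTop (𝓝 (L i j)) :=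
    fun ψ hψ i j => tendsto_pi_nhds.mp (tendsto_pi_nhds.mp hψ i) j
  have e1 := ent φ hlim
  have e2 := ent (fun k => φ (k + 1)) lim2
  have hdL : L 0 0 * L 1 1 - L 0 1 * L 1 0 = 1 := by
    have := ((e1 0 0).mul (e1 1 1)).sub ((e1 0 1).mul (e1 1 0))
    simp only [det_ent] at this
    exact (tendsto_nhds_unique this tendsto_const_nhds)
  have fin : ∀ᶠ k in atTop, S ^ φ (k + 1) * (S ^ φ k)⁻¹ = 1 := by
    apply h.disc
    · intro k
      exact Γ.mul_mem (Γ.pow_mem (hsub S hS) _) (Γ.inv_mem (Γ.pow_mem (hsub S hS) _))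
    · apply tends_ent
      · simp only [mul_ent, inv00, inv01, inv10, inv11]
        have := ((e2 0 0).mul (e1 1 1)).add ((e2 0 1).mul (e1 1 0).neg)
        rwa [show L 0 0 * L 1 1 + L 0 1 * -L 1 0 = 1 by linear_combination hdL] at this
      · simp only [mul_ent, inv00, inv01, inv10, inv11]
        have := ((e2 0 0).mul (e1 0 1).neg).add ((e2 0 1).mul (e1 0 0))
        rwa [show L 0 0 * -L 0 1 + L 0 1 * L 0 0 = 0 by ring] at this
      · simp only [mul_ent, inv00, inv01, inv10, inv11]
        have := ((e2 1 0).mul (e1 1 1)).add ((e2 1 1).mul (e1 1 0).neg)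
        rwa [show L 1 0 * L 1 1 + L 1 1 * -L 1 0 = 0 by ring] at this
      · simp only [mul_ent, inv00, inv01, inv10, inv11]
        have := ((e2 1 0).mul (e1 0 1).neg).add ((e2 1 1).mul (e1 0 0))
        rwa [show L 1 0 * -L 0 1 + L 1 1 * L 0 0 = 1 by linear_combination hdL] at this
  obtain ⟨k, hk⟩ := fin.exists
  have hlt : φ k < φ (k + 1) := hφ (Nat.lt_succ_self k)
  apply (h1 (φ (k + 1) - φ k) (by omega)).1
  rw [pow_sub _ hlt.le]
  exact hk

end Marg

namespace Marg
set_option linter.unusedSimpArgs false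
open Complex (normSq)

/-- `X = p + i q E`. -/
def Rt (p q : ℝ) (v : W3) (X : SL2C) : Prop :=
  X.1 0 0 = p + Complex.I * q * v.a ∧ X.1 0 1 = Complex.I * q * v.b ∧
    X.1 1 0 = Complex.I * q * v.c ∧ X.1 1 1 = p - Complex.I * q * v.a

theorem Up_p2 (m : ℕ) : (Up 2 m).1 = m ∧ (Up 2 m).2 = (m + 1) := by
  induction m with
  | zero => simp [Up]
  | succ m ih =>
    simp only [Up, ih.1, ih.2]
    push_cast
    constructor <;> ring

theorem ell_tr {A : SL2C} {n : ℕ} (h3 : 3 ≤ n) (hE : IsEllipticOfOrder A n) : A.1.trace ^ 2 - 4 * A.1.det ≠ 0 := by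
  rw [A.2]
  intro h0
  have hU : (Up A.1.trace n).1 ≠ 0 := by
    have : (A.1.trace - 2) * (A.1.trace + 2) = 0 := by linear_combination h0
    have hn0 : (n:ℂ) ≠ 0 := by exact_mod_cast (by omega : n ≠ 0)
    rcases mul_eq_zero.mp this with h | h
    · rw [show A.1.trace = 2 by linear_combination h, (Up_p2 n).1]; exact hn0
    · rw [show A.1.trace = -2 by linear_combination h, (Up_m2 n).1]
      exact mul_ne_zero (pow_ne_zero _ (by norm_num)) hn0
  have hp := pow_cheb A rfl n
  have z1 : (A ^ n).1 0 1 = 0 := by rcases hE.1 with h | h <;> rw [h] <;> simp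
  have z2 : (A ^ n).1 1 0 = 0 := by rcases hE.1 with h | h <;> rw [h] <;> simp
  rw [hp.2.1] at z1
  rw [hp.2.2.1] at z2
  have y1 := (mul_eq_zero.mp z1).resolve_left hU
  have y2 := (mul_eq_zero.mp z2).resolve_left hU
  have hd := det_ent A
  rw [y1] at hd
  rw [tr_ent] at h0
  have e : A.1 0 0 = A.1 1 1 := by
    have : (A.1 0 0 - A.1 1 1) ^ 2 = 0 := by linear_combination h0 - 4 * hd
    have := pow_eq_zero_iff (by norm_num) |>.mp this
    linear_combination this
  have : A * A = 1 := by
    apply ext4 <;> simp only [mul_ent, one00, one01, one10, one11, y1, y2]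
    · linear_combination hd + A.1 0 0 * e
    · ring
    · ring
    · linear_combination hd - A.1 1 1 * e
  have h1 := hE.2 1 le_rfl (by omega)
  rw [pow_one] at h1
  rcases sq_one this with h | h
  · exact h1.1 h
  · exact h1.2 h

/-- Axis vector of `V⁻¹ diag(1,-1) V`. -/
def axV (V : SL2C) : W3 := ⟨V.1 0 0 * V.1 1 1 + V.1 0 1 * V.1 1 0, 2 * V.1 0 1 * V.1 1 1, -2 * V.1 0 0 * V.1 1 0⟩

theorem axV_dot (V : SL2C) : dot (axV V) (axV V) = 1 := by
  have hd := det_ent V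
  simp only [dot, axV]
  linear_combination (V.1 0 0 * V.1 1 1 - V.1 0 1 * V.1 1 0 + 1) * hd

theorem axV_rt (V D : SL2C) {p q : ℝ} (h0 : D.1 0 0 = p + Complex.I * q) (h1 : D.1 0 1 = 0) (h2 : D.1 1 0 = 0) (h3 : D.1 1 1 = p - Complex.I * q) :
    Rt p q (axV V) (V⁻¹ * D * V) := by
  have hd := det_ent V
  simp only [Rt, mul_ent, inv00, inv01, inv10, inv11, h0, h1, h2, h3, axV]
  refine ⟨?_, ?_, ?_, ?_⟩
  · linear_combination (p:ℂ) * hd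
  · ring
  · ring
  · linear_combination (p:ℂ) * hd

theorem det_Mx {v : W3} (h : dot v v = 1) : (Mx v).det = -1 := by
  simp only [dot] at h
  simp only [Mx, Matrix.det_fin_two_of]
  linear_combination -h

theorem hn_Mx_one {v : W3} (h : dot v v = 1) : 1 ≤ hn (Mx v) := by
  have := hn_ge (Mx v)
  rw [det_Mx h] at this; simpa using this

theorem rt_det {v : W3} (h : dot v v = 1) {p q : ℝ} {X : SL2C} (hX : Rt p q v X) : p ^ 2 + q ^ 2 = 1 := by
  have hd := det_ent X
  rw [hX.1, hX.2.1, hX.2.2.1, hX.2.2.2] at hd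
  simp only [dot] at h
  have : ((p ^ 2 + q ^ 2 : ℝ) : ℂ) = (1:ℝ) := by
    push_cast
    linear_combination hd - (q:ℂ) ^ 2 * h + (q:ℂ) ^ 2 * (v.a ^ 2 + v.b * v.c) * Complex.I_sq
  exact_mod_cast this

theorem rt_hn {v : W3} (h : dot v v = 1) {p q : ℝ} {X : SL2C} (hX : Rt p q v X) : hn X.1 = 1 + q ^ 2 * (hn (Mx v) - 1) := by
  have h1 := rt_det h hX
  have : hn X.1 = p ^ 2 + q ^ 2 * hn (Mx v) := by
    simp only [hn, hX.1, hX.2.1, hX.2.2.1, hX.2.2.2, Mx]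
    simp [Complex.normSq_apply]
    ring
  rw [this]; linarith

theorem sin_mult {n j : ℕ} (hj : 0 < j) (hjn : j < n) : Real.sin (π / n) ≤ Real.sin (π * j / n) := by
  have hn0 : (0:ℝ) < n := by exact_mod_cast (by omega : 0 < n)
  have hj1 : (1:ℝ) ≤ j := by exact_mod_cast hj
  have hj2 : (j:ℝ) + 1 ≤ n := by exact_mod_cast hjn
  have hpi := Real.pi_pos
  have a1 : π / n ≤ π * j / n := by
    rw [div_le_div_iff_of_pos_right hn0]; nlinarith
  have a2 : π * j / n ≤ π - π / n := by
    rw [show π - π / n = π * (n - 1) / n by field_simp]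
    rw [div_le_div_iff_of_pos_right hn0]; nlinarith
  have a0 : 0 < π / n := by positivity
  rcases le_total (π * j / n) (π / 2) with h | h
  · exact Real.sin_le_sin_of_le_of_le_pi_div_two (by linarith) h a1
  · rw [← Real.sin_pi_sub (π * j / n)]
    exact Real.sin_le_sin_of_le_of_le_pi_div_two (by linarith) (by linarith) (by linarith)

theorem red {A B : SL2C} {Γ : Subgroup SL2C} (h : Good A B Γ) {n : ℕ} (h3 : 3 ≤ n) (hE : IsEllipticOfOrder A n) {t : ℝ} (ht : hn A.1 < t) :
    ∃ V : SL2C, AxG (Real.cos (π / n)) (Real.sin (π / n)) Γ (axV V) ∧ (∃ p q : ℝ, Rt p q (axV V) A) ∧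
      Real.sin (π / n) ^ 2 * (hn (Mx (axV V)) - 1) < t - 1 := by
  obtain ⟨V, l, m, -, hlm, hdiag⟩ := exists_diag A.1 (ell_tr h3 hE)
  rw [A.2] at hlm
  set D : SL2C := V * A * V⁻¹ with hD
  have hDm : D.1 = !![l, 0; 0, m] := hdiag
  have d0 : D.1 0 0 = l := by rw [hDm]; rfl
  have d1 : D.1 0 1 = 0 := by rw [hDm]; rfl
  have d2 : D.1 1 0 = 0 := by rw [hDm]; rfl
  have d3 : D.1 1 1 = m := by rw [hDm]; rfl
  have hAD : A = V⁻¹ * D * V := by rw [hD]; group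
  have hpow : ∀ k, A ^ k = V⁻¹ * D ^ k * V := by
    intro k
    have := conj_pow' V⁻¹ D k
    rw [inv_inv] at this
    rw [hAD, this]
  have hDp := pow_diag d0 d1 d2 d3
  have hlmk : ∀ k, l ^ k * m ^ k = 1 := fun k => by rw [← mul_pow, hlm, one_pow]
  have hn0 : (n:ℂ) ≠ 0 := by exact_mod_cast (by omega : n ≠ 0)
  have hnr : (n:ℝ) ≠ 0 := by exact_mod_cast (by omega : n ≠ 0)
  have hln : (l ^ 2) ^ n = 1 := by
    have e : D ^ n = V * A ^ n * V⁻¹ := conj_pow' V A n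
    have e0 := (hDp n).1
    have : l ^ n = 1 ∨ l ^ n = -1 := by
      rcases hE.1 with h5 | h5
      · left; rw [← e0, e, h5]; simp
      · right; rw [← e0, e, h5, conj_eq_neg_one.mpr rfl, neg_ent, one00]
    rw [← pow_mul, mul_comm, pow_mul]
    rcases this with h5 | h5 <;> rw [h5] <;> norm_num
  have hprim : IsPrimitiveRoot (l ^ 2) n := by
    refine IsPrimitiveRoot.mk_of_lt _ (by omega) hln ?_
    intro k hk hkn h5
    have h6 : (l ^ k - 1) * (l ^ k + 1) = 0 := by
      have : (l ^ k) ^ 2 = 1 := by rw [← pow_mul, mul_comm, pow_mul]; exact h5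
      linear_combination this
    have hh := hE.2 k hk hkn
    have hm := hlmk k
    rcases mul_eq_zero.mp h6 with h7 | h7
    · apply hh.1
      have h8 : l ^ k = 1 := by linear_combination h7
      rw [h8, one_mul] at hm
      have : D ^ k = 1 := ext4 (by rw [(hDp k).1, h8, one00]) (by rw [(hDp k).2.1, one01]) (by rw [(hDp k).2.2.1, one10]) (by rw [(hDp k).2.2.2, hm, one11])
      rw [hpow, this]; group
    · apply hh.2
      have h8 : l ^ k = -1 := by linear_combination h7
      rw [h8] at hm
      have hm' : m ^ k = -1 := by linear_combination -hm
      have : D ^ k = -1 := ext4 (by rw [(hDp k).1, h8, neg_ent, one00]) (by rw [(hDp k).2.1, neg_ent, one01, neg_zero]) (by rw [(hDp k).2.2.1, neg_ent, one10, neg_zero]) (by rw [(hDp k).2.2.2, hm', neg_ent, one11])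
      rw [hpow, this]; simp
  have hexp := Complex.isPrimitiveRoot_exp n (by omega)
  set c := Real.cos (π / n) with hc
  set s := Real.sin (π / n) with hs
  have hcs : (c:ℂ) ^ 2 + (s:ℂ) ^ 2 = 1 := by
    have := Real.cos_sq_add_sin_sq (π / n)
    exact_mod_cast this
  have hw2 : Complex.exp (2 * π * Complex.I / n) = (c + Complex.I * s) ^ 2 := by
    rw [show (2 * π * Complex.I / n : ℂ) = (2:ℕ) * (((π / n : ℝ) : ℂ) * Complex.I) by push_cast; ring, Complex.exp_nat_mul,
      Complex.exp_mul_I, ← Complex.ofReal_cos, ← Complex.ofReal_sin]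
    ring
  haveI : NeZero n := ⟨by omega⟩
  obtain ⟨i, -, hi⟩ := hprim.eq_pow_of_pow_eq_one (hexp.pow_eq_one)
  obtain ⟨j, hjn, hj⟩ := hexp.eq_pow_of_pow_eq_one hln
  have hj0 : 0 < j := by
    rcases Nat.eq_zero_or_pos j with h5 | h5
    · exfalso
      rw [h5, pow_zero] at hj
      have := hprim.pow_ne_one_of_pos_of_lt (l := 1) (by norm_num) (by omega)
      rw [pow_one] at this; exact this hj.symm
    · exact h5
  refine ⟨V, ⟨axV_dot V, ?_⟩, ?_⟩
  · have h6 : (l ^ i - (c + Complex.I * s)) * (l ^ i + (c + Complex.I * s)) = 0 := by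
      have : (l ^ i) ^ 2 = (c + Complex.I * s) ^ 2 := by rw [← hw2, ← hi, ← pow_mul, ← pow_mul, mul_comm]
      linear_combination this
    have hm := hlmk i
    have hww : (c + Complex.I * s : ℂ) * (c - Complex.I * s) = 1 := by linear_combination hcs - (s:ℂ) ^ 2 * Complex.I_sq
    have hw0 : (c + Complex.I * s : ℂ) ≠ 0 := left_ne_zero_of_mul_eq_one hww
    rcases mul_eq_zero.mp h6 with h7 | h7
    · have h8 : l ^ i = c + Complex.I * s := by linear_combination h7
      have h9 : m ^ i = c - Complex.I * s := by
        apply mul_left_cancel₀ hw0; rw [hww, ← hm, h8]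
      refine ⟨A ^ i, Γ.pow_mem h.hA i, ?_⟩
      rw [hpow]
      exact axV_rt V (D ^ i) (by rw [(hDp i).1, h8]) (hDp i).2.1 (hDp i).2.2.1 (by rw [(hDp i).2.2.2, h9])
    · have h8 : l ^ i = -(c + Complex.I * s) := by linear_combination h7
      have h9 : m ^ i = -(c - Complex.I * s) := by
        apply mul_left_cancel₀ hw0; rw [mul_neg, hww, ← hm, h8]; ring
      refine ⟨-(A ^ i), h.neg _ (Γ.pow_mem h.hA i), ?_⟩
      rw [hpow]
      have e : -(V⁻¹ * D ^ i * V) = V⁻¹ * (-(D ^ i)) * V := by rw [mul_neg, neg_mul]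
      rw [e]
      exact axV_rt V (-(D ^ i)) (by rw [neg_ent, (hDp i).1, h8, neg_neg]) (by rw [neg_ent, (hDp i).2.1, neg_zero]) (by rw [neg_ent, (hDp i).2.2.1, neg_zero]) (by rw [neg_ent, (hDp i).2.2.2, h9, neg_neg])
  · have hnl : ‖l‖ = 1 := by
      have : ‖(l ^ 2) ^ n‖ = 1 := by rw [hln, norm_one]
      rw [norm_pow, norm_pow, ← pow_mul] at this
      exact (pow_eq_one_iff_of_nonneg (norm_nonneg _) (by omega)).mp this
    have hl : l = (l.re : ℂ) + Complex.I * l.im := by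
      conv_lhs => rw [← Complex.re_add_im l]
      ring
    have hm : m = (l.re : ℂ) - Complex.I * l.im := by
      have h5 : (starRingEnd ℂ) l = (l.re : ℂ) - Complex.I * l.im := by
        apply Complex.ext <;> simp
      rw [← h5]
      have h6 : l * (starRingEnd ℂ) l = 1 := by
        rw [Complex.mul_conj, Complex.normSq_eq_norm_sq, hnl]; norm_num
      have hl0 : l ≠ 0 := left_ne_zero_of_mul_eq_one hlm
      exact mul_left_cancel₀ hl0 (by rw [hlm, h6])
    have hR : Rt l.re l.im (axV V) A := by
      conv_rhs => rw [hAD]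
      exact axV_rt V D (by rw [d0]; exact hl) d1 d2 (by rw [d3]; exact hm)
    refine ⟨⟨_, _, hR⟩, ?_⟩
    have hN := rt_hn (axV_dot V) hR
    have hN1 := hn_Mx_one (axV_dot V)
    have hq : s ^ 2 ≤ l.im ^ 2 := by
      have e1 : l ^ 2 = Complex.exp (((2 * (π * j / n) : ℝ) : ℂ) * Complex.I) := by
        rw [← hj, ← Complex.exp_nat_mul]
        congr 1
        push_cast; ring
      have e2 := congrArg Complex.re e1
      rw [Complex.exp_ofReal_mul_I_re, Real.cos_two_mul] at e2
      have e3 : (l ^ 2).re = l.re ^ 2 - l.im ^ 2 := by rw [pow_two]; simp; ring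
      have e4 : l.re ^ 2 + l.im ^ 2 = 1 := by
        have := Complex.normSq_eq_norm_sq l
        rw [hnl, Complex.normSq_apply] at this; linarith
      have e5 := Real.cos_sq_add_sin_sq (π * j / n)
      have e6 := sin_mult hj0 hjn
      have e7 : 0 ≤ Real.sin (π / n) := Real.sin_nonneg_of_nonneg_of_le_pi (by positivity) (by
        apply div_le_self Real.pi_pos.le
        exact_mod_cast (by omega : 1 ≤ n))
      have e8 : s ^ 2 ≤ Real.sin (π * j / n) ^ 2 := by
        rw [hs]; exact pow_le_pow_left₀ e7 e6 2
      linarith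
    nlinarith
end Marg

namespace Marg
set_option linter.unusedSimpArgs false
open Complex (normSq)

/-- The action of `B` on axes. -/
def ac (B : SL2C) (v : W3) : W3 :=
  ⟨(B.1 0 0 * v.a + B.1 0 1 * v.c) * B.1 1 1 - (B.1 0 0 * v.b - B.1 0 1 * v.a) * B.1 1 0,
   -(B.1 0 0 * v.a + B.1 0 1 * v.c) * B.1 0 1 + (B.1 0 0 * v.b - B.1 0 1 * v.a) * B.1 0 0,
   (B.1 1 0 * v.a + B.1 1 1 * v.c) * B.1 1 1 - (B.1 1 0 * v.b - B.1 1 1 * v.a) * B.1 1 0⟩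

theorem ac_dot (B : SL2C) (v : W3) : dot (ac B v) (ac B v) = dot v v := by
  have hd := det_ent B
  have : dot (ac B v) (ac B v) = (B.1 0 0 * B.1 1 1 - B.1 0 1 * B.1 1 0) ^ 2 * dot v v := by
    simp only [dot, ac]; ring
  rw [this, hd]; ring

theorem ac_rt {p q : ℝ} {v : W3} {X : SL2C} (h : Rt p q v X) (B : SL2C) : Rt p q (ac B v) (B * X * B⁻¹) := by
  have hd := det_ent B
  simp only [Rt, mul_ent, inv00, inv01, inv10, inv11, h.1, h.2.1, h.2.2.1, h.2.2.2, ac]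
  refine ⟨?_, ?_, ?_, ?_⟩
  · linear_combination (p:ℂ) * hd
  · ring
  · ring
  · linear_combination (p:ℂ) * hd

theorem ac_ax {c s : ℝ} {Γ : Subgroup SL2C} {v : W3} (h : AxG c s Γ v) {B : SL2C} (hB : B ∈ Γ) : AxG c s Γ (ac B v) := by
  obtain ⟨h1, X, hX, h2⟩ := h
  exact ⟨by rw [ac_dot, h1], B * X * B⁻¹, Γ.mul_mem (Γ.mul_mem hB hX) (Γ.inv_mem hB), ac_rt h2 B⟩

theorem kap_tr (B : SL2C) (v : W3) : ((Mx v * B.1) * (Mx v * (B⁻¹).1)).trace = 2 * dot v (ac B v) := by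
  rw [tr_ent]
  simp only [Matrix.mul_apply, Fin.sum_univ_two, inv00, inv01, inv10, inv11, Mx, dot, ac]
  simp
  ring

theorem disp {B : SL2C} {v : W3} (hv : dot v v = 1) :
    ‖dot v (ac B v)‖ ^ 2 + ‖dot v (ac B v) ^ 2 - 1‖ ≤ 2 * gf (hn (Mx v)) (hn B.1) ^ 2 - 1 := by
  have dm : ∀ X : SL2C, (Mx v * X.1).det = -1 := by
    intro X; rw [Matrix.det_mul, det_Mx hv, X.2]; norm_num
  have h1 : hn (Mx v * B.1) ≤ gf (hn (Mx v)) (hn B.1) := tri1 _ _ (by rw [det_Mx hv]; simp) (by rw [B.2]; simp)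
  have h2 : hn (Mx v * (B⁻¹).1) ≤ gf (hn (Mx v)) (hn B.1) := by
    have := tri1 (Mx v) (B⁻¹).1 (by rw [det_Mx hv]; simp) (by rw [(B⁻¹).2]; simp)
    rwa [hn_inv] at this
  have g1 : 1 ≤ hn (Mx v * B.1) := by
    have := hn_ge (Mx v * B.1); rw [dm] at this; simpa using this
  have g2 : 1 ≤ hn (Mx v * (B⁻¹).1) := by
    have := hn_ge (Mx v * (B⁻¹).1); rw [dm] at this; simpa using this
  have h3 := tri1 (Mx v * B.1) (Mx v * (B⁻¹).1) (by rw [dm]; simp) (by rw [dm]; simp)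
  have h4 := gf_mono g1 g2 h1 h2
  rw [gf_self (gf_one_le (hn_Mx_one hv) (hn_one_le B))] at h4
  have h5 := trl _ (kap_tr B v) (δ := 1) (by rw [Matrix.det_mul, dm, dm]; norm_num)
  linarith

/-- Confocal ellipse description. -/
theorem ell_of {κ : ℂ} {G : ℝ} (hG : 1 < G) (h : ‖κ‖ ^ 2 + ‖κ ^ 2 - 1‖ ≤ 2 * G ^ 2 - 1) :
    κ.re ^ 2 * (G ^ 2 - 1) + κ.im ^ 2 * G ^ 2 ≤ G ^ 2 * (G ^ 2 - 1) := by
  have h1 : ‖κ ^ 2 - 1‖ ^ 2 = (‖κ‖ ^ 2 + 1) ^ 2 - 4 * κ.re ^ 2 := by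
    rw [← Complex.normSq_eq_norm_sq, ← Complex.normSq_eq_norm_sq, pow_two κ]
    simp only [Complex.normSq_apply, Complex.sub_re, Complex.sub_im, Complex.mul_re, Complex.mul_im, Complex.one_re, Complex.one_im]
    ring
  have h2 : ‖κ‖ ^ 2 = κ.re ^ 2 + κ.im ^ 2 := by
    rw [← Complex.normSq_eq_norm_sq, Complex.normSq_apply]; ring
  have h3 := norm_nonneg (κ ^ 2 - 1)
  generalize ‖κ ^ 2 - 1‖ = K at *
  rw [h2] at h h1
  have h4 : K ^ 2 ≤ (2 * G ^ 2 - 1 - (κ.re ^ 2 + κ.im ^ 2)) ^ 2 := pow_le_pow_left₀ h3 (by linarith) 2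
  nlinarith

theorem InE_of {κ : ℂ} {G : ℝ} {EA EB : ℕ} (hG : 1 < G) (h : ‖κ‖ ^ 2 + ‖κ ^ 2 - 1‖ ≤ 2 * G ^ 2 - 1)
    (hA : (1048576 * G) ^ 2 ≤ (EA:ℝ) ^ 2) (hB : 1048576 ^ 2 * (G ^ 2 - 1) ≤ (EB:ℝ) ^ 2) : InE EA EB κ := by
  have h1 := ell_of hG h
  have p1 : 0 < G ^ 2 := by positivity
  have p2 : 0 < G ^ 2 - 1 := by nlinarith
  have h2 : κ.re ^ 2 / G ^ 2 + κ.im ^ 2 / (G ^ 2 - 1) ≤ 1 := by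
    rw [div_add_div _ _ p1.ne' p2.ne', div_le_one (by positivity)]; linarith
  unfold InE
  have a1 : (1048576 * κ.re) ^ 2 ≤ κ.re ^ 2 / G ^ 2 * EA ^ 2 := by
    have : (1048576 * κ.re) ^ 2 = κ.re ^ 2 / G ^ 2 * (1048576 * G) ^ 2 := by field_simp
    rw [this]; gcongr
  have a2 : (1048576 * κ.im) ^ 2 ≤ κ.im ^ 2 / (G ^ 2 - 1) * EB ^ 2 := by
    have : (1048576 * κ.im) ^ 2 = κ.im ^ 2 / (G ^ 2 - 1) * (1048576 ^ 2 * (G ^ 2 - 1)) := by field_simp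
    rw [this]; gcongr
  have b1 : 0 ≤ (EA:ℝ) ^ 2 := sq_nonneg _
  have b2 : 0 ≤ (EB:ℝ) ^ 2 := sq_nonneg _
  calc _ ≤ κ.re ^ 2 / G ^ 2 * EA ^ 2 * EB ^ 2 + κ.im ^ 2 / (G ^ 2 - 1) * EB ^ 2 * EA ^ 2 := by gcongr
    _ = (κ.re ^ 2 / G ^ 2 + κ.im ^ 2 / (G ^ 2 - 1)) * (EA ^ 2 * EB ^ 2) := by ring
    _ ≤ 1 * (EA ^ 2 * EB ^ 2) := by gcongr
    _ = _ := by ring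

theorem sqrt_t {v : ℝ} (h1 : 1 ≤ v) (h2 : v ≤ 1.0168) : v + Real.sqrt (v ^ 2 - 1) ≤ 1.21 := by
  have : Real.sqrt (v ^ 2 - 1) ≤ 0.185 := by
    rw [Real.sqrt_le_left (by norm_num)]; nlinarith
  linarith

/-- The smallness needed for the Shimizu-Leutbecher inequality. -/
theorem sl_small {P Y : SL2C} (ht : P.1.trace = 2) (hP : hn P.1 ≤ 1.3) (hY : hn Y.1 ≤ 1.0168) :
    ‖((P.1 - 1) * Y.1 * (P.1 - 1) * (Y⁻¹).1).trace‖ < 1 := by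
  have hdP := det_ent P
  rw [tr_ent] at ht
  have hN : hn (P.1 - 1) ≤ 0.3 := by
    have e : hn (P.1 - 1) = hn P.1 - 1 := by
      have h2 := congrArg Complex.re ht
      simp only [Complex.add_re, Complex.re_ofNat] at h2
      simp only [hn, Matrix.sub_apply, Matrix.one_apply, Complex.normSq_apply]
      simp
      linarith
    rw [e]; linarith
  have hdN : (P.1 - 1).det = 0 := by
    rw [Matrix.det_fin_two]
    simp [Matrix.sub_apply, Matrix.one_apply]
    linear_combination hdP - ht
  have hN0 := hn_nonneg (P.1 - 1)
  have key : ∀ X : SL2C, hn X.1 ≤ 1.0168 → hn ((P.1 - 1) * X.1) ≤ 0.363 := by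
    intro X hX
    have h1 := tri (P.1 - 1) X.1
    rw [hdN, X.2] at h1
    simp only [map_zero, map_one, sub_zero] at h1
    rw [Real.sqrt_sq hN0] at h1
    have h2 := sqrt_t (hn_one_le X) hX
    have h3 := hn_one_le X
    have h4 := Real.sqrt_nonneg (hn X.1 ^ 2 - 1)
    nlinarith
  have k1 := key Y hY
  have k2 := key Y⁻¹ (by rw [hn_inv]; exact hY)
  have n1 := hn_nonneg ((P.1 - 1) * Y.1)
  have n2 := hn_nonneg ((P.1 - 1) * (Y⁻¹).1)
  have h1 := tri ((P.1 - 1) * Y.1) ((P.1 - 1) * (Y⁻¹).1)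
  rw [Matrix.det_mul, Matrix.det_mul, hdN] at h1
  simp only [zero_mul, map_zero, sub_zero] at h1
  rw [Real.sqrt_sq n1, Real.sqrt_sq n2] at h1
  set T := ((P.1 - 1) * Y.1 * (P.1 - 1) * (Y⁻¹).1).trace with hT
  have h2 := trl ((P.1 - 1) * Y.1 * ((P.1 - 1) * (Y⁻¹).1)) (κ := T / 2) (δ := 0) (by
    rw [hT, ← mul_assoc]; ring) (by rw [Matrix.det_mul, Matrix.det_mul, hdN]; ring)
  rw [sub_zero, norm_pow, norm_div, Complex.norm_ofNat] at h2
  have h3 := norm_nonneg T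
  nlinarith [mul_le_mul k1 k2 n2 (by norm_num)]

theorem rt_eig {E : W3} {c s p q : ℝ} (hs : s ≠ 0) {f A : SL2C} (hf : Rt c s E f) (hA : Rt p q E A) {v : Fin 2 → ℂ} (h : Eig v f) : Eig v A := by
  obtain ⟨a, ha⟩ := h
  have hs' : (s:ℂ) ≠ 0 := by exact_mod_cast hs
  refine ⟨p + q * (a - c) / s, ?_⟩
  have e0 := congrFun ha 0
  have e1 := congrFun ha 1
  simp only [Matrix.mulVec, dotProduct, Fin.sum_univ_two, Pi.smul_apply, smul_eq_mul, hf.1, hf.2.1, hf.2.2.1, hf.2.2.2] at e0 e1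
  ext i
  fin_cases i
  · simp only [Matrix.mulVec, dotProduct, Fin.sum_univ_two, Pi.smul_apply, smul_eq_mul, hA.1, hA.2.1, Fin.zero_eta]
    field_simp
    linear_combination (q:ℂ) * e0
  · simp only [Matrix.mulVec, dotProduct, Fin.sum_univ_two, Pi.smul_apply, smul_eq_mul, hA.2.2.1, hA.2.2.2, Fin.mk_one]
    field_simp
    linear_combination (q:ℂ) * e1

theorem rt_diag {V X : SL2C} {p q : ℝ} (h : Rt p q (axV V) X) :
    (V * X * V⁻¹).1 0 0 = p + Complex.I * q ∧ (V * X * V⁻¹).1 0 1 = 0 ∧ (V * X * V⁻¹).1 1 0 = 0 ∧ (V * X * V⁻¹).1 1 1 = p - Complex.I * q := by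
  have hpq : (p:ℂ) ^ 2 + (q:ℂ) ^ 2 = 1 := by exact_mod_cast rt_det (axV_dot V) h
  let D : SL2C := ⟨!![p + Complex.I * q, 0; 0, p - Complex.I * q], by
    rw [Matrix.det_fin_two_of]; linear_combination hpq - (q:ℂ) ^ 2 * Complex.I_sq⟩
  have hr := axV_rt V D (p := p) (q := q) rfl rfl rfl rfl
  have : X = V⁻¹ * D * V := ext4 (by rw [h.1, hr.1]) (by rw [h.2.1, hr.2.1]) (by rw [h.2.2.1, hr.2.2.1]) (by rw [h.2.2.2, hr.2.2.2])
  have e : V * X * V⁻¹ = D := by rw [this]; group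
  rw [e]
  exact ⟨rfl, rfl, rfl, rfl⟩

theorem para {A B : SL2C} {Γ : Subgroup SL2C} (h : Good A B Γ) {f P : SL2C} (hP : P ∈ Γ) (hf : f ∈ Γ) (htr : P.1.trace = 2) (hP1 : P ≠ 1)
    (hPn : hn P.1 ≤ 1.3) (hfn : hn f.1 ≤ 1.0168) (hBn : hn B.1 ≤ 1.0168) (hfA : ∀ v, Eig v f → Eig v A) : False := by
  obtain ⟨v, hv, h1, -⟩ := lemSL h.disc hP htr hP1
  exact no_common h.ne hv (hfA v (h1 f hf (sl_small htr hPn hfn))) (h1 B h.hB (sl_small htr hPn hBn))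

theorem kap1 {A B V : SL2C} {Γ : Subgroup SL2C} (h : Good A B Γ) {c s p q : ℝ} (hs : s ≠ 0) (hax : AxG c s Γ (axV V))
    (hA : Rt p q (axV V) A) (hN : s ^ 2 * (hn (Mx (axV V)) - 1) ≤ 0.0168) (hB : hn B.1 ≤ 1.0168)
    (hκ : dot (axV V) (ac B (axV V)) ^ 2 = 1) : False := by
  obtain ⟨hE, f, hf, hr⟩ := hax
  have hr' : Rt c s (axV V) f := hr
  have hfn : hn f.1 ≤ 1.0168 := by rw [rt_hn hE hr']; linarith
  have hcs := rt_det hE hr'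
  have hcs' : (c:ℂ) ^ 2 + (s:ℂ) ^ 2 = 1 := by exact_mod_cast hcs
  have hs' : (s:ℂ) ≠ 0 := by exact_mod_cast hs
  have h1 := ac_rt hr' B
  -- generic bound
  have bd : ∀ F : SL2C, hn F.1 ≤ 1.0168 → hn (f * (B * F * B⁻¹)).1 ≤ 1.3 := by
    intro F hF
    have e : (f * (B * F * B⁻¹)).1 = (f * B).1 * (F * B⁻¹).1 := by
      have : f * (B * F * B⁻¹) = (f * B) * (F * B⁻¹) := by group
      rw [this]; rfl
    rw [e]
    have g : gf 1.0168 1.0168 = 2 * 1.0168 ^ 2 - 1 := gf_self (by norm_num)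
    have n1 : hn (f * B).1 ≤ gf 1.0168 1.0168 := (tri1 f.1 B.1 (by rw [f.2]; simp) (by rw [B.2]; simp)).trans
      (gf_mono (hn_one_le f) (hn_one_le B) hfn hB)
    have n2 : hn (F * B⁻¹).1 ≤ gf 1.0168 1.0168 := (tri1 F.1 (B⁻¹).1 (by rw [F.2]; simp) (by rw [(B⁻¹).2]; simp)).trans
      (gf_mono (hn_one_le F) (hn_one_le B⁻¹) hF (by rw [hn_inv]; exact hB))
    rw [g] at n1 n2
    refine ((tri1 _ _ (by rw [(f * B).2]; simp) (by rw [(F * B⁻¹).2]; simp)).trans (gf_mono (hn_one_le _) (hn_one_le _) n1 n2)).trans ?_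
    rw [gf_self (by norm_num)]; norm_num
  have fin : ∀ F ∈ Γ, hn F.1 ≤ 1.0168 → (f * (B * F * B⁻¹)).1.trace = 2 → f * (B * F * B⁻¹) = 1 := by
    intro F hF hFn ht
    by_contra hne
    exact para h (Γ.mul_mem hf (Γ.mul_mem (Γ.mul_mem h.hB hF) (Γ.inv_mem h.hB))) hf ht hne (bd F hFn) hfn hB
      (fun v hv => rt_eig hs hr' hA hv)
  have hd := rt_diag hr'
  have hAd := rt_diag hA
  have hne := (h.conj V).ne
  have k0 : (dot (axV V) (ac B (axV V)) - 1) * (dot (axV V) (ac B (axV V)) + 1) = 0 := by linear_combination hκ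
  have IS : Complex.I * s ≠ 0 := mul_ne_zero Complex.I_ne_zero hs'
  have z : ∀ x : ℂ, (c + Complex.I * s) * x = (c - Complex.I * s) * x → x = 0 := by
    intro x hx
    have : (Complex.I * s) * x = 0 := by linear_combination hx / 2
    exact (mul_eq_zero.mp this).resolve_left IS
  rcases mul_eq_zero.mp k0 with hk | hk
  · have := fin f⁻¹ (Γ.inv_mem hf) (by rw [hn_inv]; exact hfn) (by
      have e : B * f⁻¹ * B⁻¹ = (B * f * B⁻¹)⁻¹ := by group
      rw [e]
      simp only [tr_ent, mul_ent f, inv00, inv01, inv10, inv11, hr'.1, hr'.2.1, hr'.2.2.1, hr'.2.2.2, h1.1, h1.2.1, h1.2.2.1, h1.2.2.2]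
      generalize ac B (axV V) = w at *
      generalize axV V = v at *
      simp only [dot] at hk
      linear_combination 2 * hcs' + 2 * (s:ℂ) ^ 2 * hk - 2 * (s:ℂ) ^ 2 * (v.a * w.a + (v.b * w.c + v.c * w.b) / 2) * Complex.I_sq)
    have e : (V * f * V⁻¹) * (V * B * V⁻¹) = (V * B * V⁻¹) * (V * f * V⁻¹) := by
      have h5 : f * B = B * f := by
        have : f * B = (f * (B * f⁻¹ * B⁻¹)) * B * f := by group
        rw [this, ‹f * (B * f⁻¹ * B⁻¹) = 1›, one_mul]
      calc _ = V * (f * B) * V⁻¹ := by group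
        _ = V * (B * f) * V⁻¹ := by rw [h5]
        _ = _ := by group
    refine elem_diag hne ⟨hAd.2.1, hAd.2.2.1⟩ (Or.inl ?_)
    generalize V * B * V⁻¹ = B' at *
    have e1 := congrArg (fun X : SL2C => X.1 0 1) e
    have e2 := congrArg (fun X : SL2C => X.1 1 0) e
    simp only [mul_ent (V * f * V⁻¹), mul_ent B', hd.1, hd.2.1, hd.2.2.1, hd.2.2.2] at e1 e2
    exact ⟨z _ (by linear_combination e1), z _ (by linear_combination -e2)⟩
  · have := fin f hf hfn (by
      simp only [tr_ent, mul_ent f, inv00, inv01, inv10, inv11, hr'.1, hr'.2.1, hr'.2.2.1, hr'.2.2.2, h1.1, h1.2.1, h1.2.2.1, h1.2.2.2]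
      generalize ac B (axV V) = w at *
      generalize axV V = v at *
      simp only [dot] at hk
      linear_combination 2 * hcs' - 2 * (s:ℂ) ^ 2 * hk + 2 * (s:ℂ) ^ 2 * (v.a * w.a + (v.b * w.c + v.c * w.b) / 2) * Complex.I_sq)
    have e : (V * f * V⁻¹) * (V * B * V⁻¹) * (V * f * V⁻¹) = (V * B * V⁻¹) := by
      have h5 : f * B * f = B := by
        have : f * B * f = (f * (B * f * B⁻¹)) * B := by group
        rw [this, ‹f * (B * f * B⁻¹) = 1›, one_mul]
      calc _ = V * (f * B * f) * V⁻¹ := by group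
        _ = _ := by rw [h5]
    refine elem_diag hne ⟨hAd.2.1, hAd.2.2.1⟩ (Or.inr ?_)
    generalize V * B * V⁻¹ = B' at *
    have e1 := congrArg (fun X : SL2C => X.1 0 0) e
    have e2 := congrArg (fun X : SL2C => X.1 1 1) e
    simp only [mul_ent _ (V * f * V⁻¹), mul_ent (V * f * V⁻¹), hd.1, hd.2.1, hd.2.2.1, hd.2.2.2] at e1 e2
    refine ⟨z _ ?_, z _ ?_⟩
    · linear_combination (c - Complex.I * s) * e1 - (c + Complex.I * s) * B'.1 0 0 * hcs' + (c + Complex.I * s) * B'.1 0 0 * (s:ℂ) ^ 2 * Complex.I_sq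
    · linear_combination -(c + Complex.I * s) * e2 + (c - Complex.I * s) * B'.1 1 1 * hcs' - (c - Complex.I * s) * B'.1 1 1 * (s:ℂ) ^ 2 * Complex.I_sq
end Marg

namespace Marg
set_option linter.unusedSimpArgs false
open Complex (normSq)

theorem kap_ent (V B : SL2C) : dot (axV V) (ac B (axV V)) =
    (V * B * V⁻¹).1 0 0 * (V * B * V⁻¹).1 1 1 + (V * B * V⁻¹).1 0 1 * (V * B * V⁻¹).1 1 0 := by
  simp only [dot, axV, ac, mul_ent, inv00, inv01, inv10, inv11]
  ring

theorem mu_ent (V B : SL2C) : (Mx (axV V) * B.1).trace = (V * B * V⁻¹).1 0 0 - (V * B * V⁻¹).1 1 1 := by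
  simp only [tr_ent, Mx, axV, Matrix.mul_apply, Fin.sum_univ_two, mul_ent, inv00, inv01, inv10, inv11]
  simp
  ring

/-- The second displacement inequality. -/
theorem disp2 {V B : SL2C} {t N κ0 : ℝ} (hκ1 : κ0 ≤ 1) (hB : hn B.1 ≤ t) (hN : hn (Mx (axV V)) ≤ N)
    (hκ : dot (axV V) (ac B (axV V)) = κ0) {q : ℂ} (hq : q = (B.1.trace / 2) ^ 2) :
    ‖q‖ + ‖q - 1‖ ≤ t ∧
    ‖q - (1 + κ0) / 2‖ + (1 - κ0) / 2 ≤ N * (t - ‖q‖) + Real.sqrt (N ^ 2 - 1) * Real.sqrt ((t - ‖q‖) ^ 2 - ‖q - 1‖ ^ 2) := by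
  set τ := B.1.trace / 2 with hτ
  have hnq : ‖q‖ = ‖τ‖ ^ 2 := by rw [hq, norm_pow]
  have h1 := trl B.1 (κ := τ) (δ := 1) (by rw [hτ]; ring) B.2
  rw [← hq, ← hnq] at h1
  refine ⟨h1.trans hB, ?_⟩
  set Y : M2 := B.1 - τ • (1 : M2) with hY
  have hdB := det_ent B
  have htB : B.1 0 0 + B.1 1 1 = 2 * τ := by rw [hτ, tr_ent]; ring
  have hdY : Y.det = 1 - q := by
    rw [hY, Matrix.det_fin_two, hq]
    simp [Matrix.sub_apply, Matrix.one_apply]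
    linear_combination hdB - τ * htB
  have hnY : hn Y = hn B.1 - ‖q‖ := by
    rw [hnq, ← Complex.normSq_eq_norm_sq]
    have r1 := congrArg Complex.re htB
    have r2 := congrArg Complex.im htB
    simp at r1 r2
    simp only [hn, hY, Matrix.sub_apply, Matrix.smul_apply, Matrix.one_apply, Complex.normSq_apply]
    simp
    linear_combination -τ.re * r1 - τ.im * r2
  have hE := axV_dot V
  have hN1 := hn_Mx_one hE
  have h2 := tri (Mx (axV V)) Y
  rw [det_Mx hE, hdY, hnY, Complex.normSq_eq_norm_sq (1 - q), norm_sub_rev] at h2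
  simp only [Complex.normSq_neg, Complex.normSq_one] at h2
  set b := V * B * V⁻¹ with hb
  have hdb := det_ent b
  have hkb := kap_ent V B
  rw [hκ, ← hb] at hkb
  have htb : b.1 0 0 + b.1 1 1 = 2 * τ := by rw [← htB, ← tr_ent, ← tr_ent, hb, tr_conj]
  have htX : (Mx (axV V) * Y).trace = 2 * ((b.1 0 0 - b.1 1 1) / 2) := by
    rw [hY, Matrix.mul_sub, Matrix.trace_sub, mu_ent, ← hb]
    simp [tr_ent, Mx]
    ring
  have h3 := trl (Mx (axV V) * Y) htX (δ := q - 1) (by rw [Matrix.det_mul, det_Mx hE, hdY]; ring)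
  have hmu : ((b.1 0 0 - b.1 1 1) / 2) ^ 2 = q - (1 + κ0) / 2 := by
    rw [hq]
    linear_combination (b.1 0 0 + b.1 1 1 + 2 * τ) / 4 * htb - hdb / 2 + hkb / 2
  rw [← norm_pow, hmu, show q - (1 + κ0) / 2 - (q - 1) = ((1 - κ0) / 2 : ℝ) by push_cast; ring, Complex.norm_real, Real.norm_eq_abs,
    abs_of_nonneg (by linarith)] at h3
  refine (h3.trans h2).trans ?_
  have hy : 0 ≤ hn B.1 - ‖q‖ := by rw [← hnY]; exact hn_nonneg _
  have e1 : (hn B.1 - ‖q‖) ^ 2 ≤ (t - ‖q‖) ^ 2 := pow_le_pow_left₀ hy (by linarith) 2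
  have e2 : hn (Mx (axV V)) ^ 2 ≤ N ^ 2 := pow_le_pow_left₀ (by linarith) hN 2
  gcongr
  linarith

theorem nf {A B V : SL2C} {Γ : Subgroup SL2C} (h : Good A B Γ) {c s p q : ℝ} (hax : AxG c s Γ (axV V))
    (hA : Rt p q (axV V) A) {t N κ0 s0 : ℝ} (hB : hn B.1 ≤ t) (hN : hn (Mx (axV V)) ≤ N)
    (hκ : dot (axV V) (ac B (axV V)) = κ0) (hs0 : 0 < s0) (hs : s0 ^ 2 = 1 - κ0 ^ 2) :
    ∃ (Γ' : Subgroup SL2C) (g : ℂ), g ≠ 0 ∧ Disc Γ' ∧ AxG c s Γ' w0 ∧ AxG c s Γ' (ef κ0 s0 g) ∧ AxG c s Γ' (eF κ0 s0 g) ∧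
      Disp κ0 t N g ∧ (‖g‖ = 1 → False) := by
  have k2 : κ0 ^ 2 < 1 := by nlinarith
  have k3 : κ0 < 1 := by nlinarith
  have k4 : -1 < κ0 := by nlinarith
  set a := Real.sqrt ((1 + κ0) / 2) with ha
  set b := Real.sqrt ((1 - κ0) / 2) with hb
  have a2 : a ^ 2 = (1 + κ0) / 2 := Real.sq_sqrt (by linarith)
  have b2 : b ^ 2 = (1 - κ0) / 2 := Real.sq_sqrt (by linarith)
  have a0 : 0 < a := Real.sqrt_pos.mpr (by linarith)
  have b0 : 0 < b := Real.sqrt_pos.mpr (by linarith)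
  have hab : s0 = 2 * a * b := by
    have h5 : s0 ^ 2 = (2 * a * b) ^ 2 := by
      rw [hs, mul_pow, mul_pow, a2, b2]; ring
    exact (pow_left_inj₀ hs0.le (by positivity) (by norm_num)).mp h5
  have a0' : (a:ℂ) ≠ 0 := by exact_mod_cast a0.ne'
  have b0' : (b:ℂ) ≠ 0 := by exact_mod_cast b0.ne'
  have a2' : (a:ℂ) ^ 2 = (1 + κ0) / 2 := by exact_mod_cast a2
  have b2' : (b:ℂ) ^ 2 = (1 - κ0) / 2 := by exact_mod_cast b2
  have hab' : (s0:ℂ) = 2 * a * b := by exact_mod_cast hab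
  have kb := kap_ent V B
  rw [hκ] at kb
  have hdb := det_ent (V * B * V⁻¹)
  have pt : (V * B * V⁻¹).1 0 0 * (V * B * V⁻¹).1 1 1 = a ^ 2 := by rw [a2']; linear_combination (hdb - kb) / 2
  have qr : (V * B * V⁻¹).1 0 1 * (V * B * V⁻¹).1 1 0 = -b ^ 2 := by rw [b2']; linear_combination (-hdb - kb) / 2
  have q0 : (V * B * V⁻¹).1 0 1 ≠ 0 := by
    intro h0; rw [h0, zero_mul] at qr
    exact pow_ne_zero 2 b0' (by linear_combination qr)
  have p0 : (V * B * V⁻¹).1 0 0 ≠ 0 := by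
    intro h0; rw [h0, zero_mul] at pt
    exact pow_ne_zero 2 a0' (by linear_combination -pt)
  obtain ⟨d, hd⟩ := IsAlgClosed.exists_pow_nat_eq (-b / (V * B * V⁻¹).1 0 1) (show 0 < 2 by norm_num)
  have d0 : d ≠ 0 := by
    rintro rfl
    have : (-b / (V * B * V⁻¹).1 0 1 : ℂ) = 0 := by rw [← hd]; norm_num
    rw [div_eq_zero_iff] at this
    rcases this with h5 | h5
    · exact b0' (by linear_combination -h5)
    · exact q0 h5
  let Δ : SL2C := ⟨!![d, 0; 0, d⁻¹], by rw [Matrix.det_fin_two_of]; field_simp; norm_num⟩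
  have D0 : Δ.1 0 0 = d := rfl
  have D1 : Δ.1 0 1 = 0 := rfl
  have D2 : Δ.1 1 0 = 0 := rfl
  have D3 : Δ.1 1 1 = d⁻¹ := rfl
  set W : SL2C := Δ * V with hW
  have hWV : axV W = axV V := by
    have e : d * d⁻¹ = 1 := mul_inv_cancel₀ d0
    simp only [axV, hW, mul_ent, D0, D1, D2, D3]
    congr 1
    · linear_combination (V.1 0 0 * V.1 1 1 + V.1 0 1 * V.1 1 0) * e
    · linear_combination (2 * V.1 0 1 * V.1 1 1) * e
    · linear_combination (-2 * V.1 0 0 * V.1 1 0) * e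
  set β : SL2C := W * B * W⁻¹ with hβ
  have hβ' : β = Δ * (V * B * V⁻¹) * Δ⁻¹ := by rw [hβ, hW]; group
  have e00 : β.1 0 0 = (V * B * V⁻¹).1 0 0 := by
    rw [hβ', mul_ent _ Δ⁻¹, mul_ent Δ, mul_ent Δ, inv00, inv10, D0, D1, D2, D3]; field_simp; ring
  have e11 : β.1 1 1 = (V * B * V⁻¹).1 1 1 := by
    rw [hβ', mul_ent _ Δ⁻¹, mul_ent Δ, mul_ent Δ, inv01, inv11, D0, D1, D2, D3]; field_simp; ring
  have e01 : β.1 0 1 = -b := by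
    rw [hβ', mul_ent _ Δ⁻¹, mul_ent Δ, mul_ent Δ, inv01, inv11, D0, D1]
    have : (V * B * V⁻¹).1 0 1 * d ^ 2 = -b := by rw [hd]; field_simp
    linear_combination this
  have e10 : β.1 1 0 = b := by
    have hdβ := det_ent β
    rw [e00, e11, pt, e01, a2'] at hdβ
    apply mul_left_cancel₀ b0'
    linear_combination hdβ - b2'
  set g : ℂ := (V * B * V⁻¹).1 0 0 / a with hg
  have g0 : g ≠ 0 := div_ne_zero p0 a0'
  have f00 : β.1 0 0 = a * g := by rw [e00, hg]; field_simp
  have f11 : β.1 1 1 = a * g⁻¹ := by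
    rw [e11, hg, inv_div]
    field_simp
    linear_combination pt
  obtain ⟨hE, f, hf, hr⟩ := hax
  have hr' : Rt c s (axV W) f := by rw [hWV]; exact hr
  have hA' : Rt p q (axV W) A := by rw [hWV]; exact hA
  have hG := h.conj W
  have hfd := rt_diag hr'
  have hAd := rt_diag hA'
  have ax0 : AxG c s (Γ.map (MulAut.conj W).toMonoidHom) w0 := by
    refine ⟨by simp [dot, w0], W * f * W⁻¹, mem_conj hf W, ?_⟩
    simp only [w0, hfd.1, hfd.2.1, hfd.2.2.1, hfd.2.2.2]
    refine ⟨?_, ?_, ?_, ?_⟩ <;> ring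
  have gi : g * g⁻¹ = 1 := mul_inv_cancel₀ g0
  refine ⟨_, g, g0, hG.disc, ax0, ?_, ?_, ?_, ?_⟩
  · have h5 := ac_ax ax0 ((Γ.map (MulAut.conj W).toMonoidHom).inv_mem hG.hB)
    have : ac β⁻¹ w0 = ef κ0 s0 g := by
      simp only [ac, ef, w0, inv00, inv01, inv10, inv11, f00, f11, e01, e10, hab']
      congr 1
      · linear_combination (a:ℂ) ^ 2 * gi + a2' - b2'
      · ring
      · ring
    rwa [← this]
  · have h5 := ac_ax ax0 hG.hB
    have : ac β w0 = eF κ0 s0 g := by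
      simp only [ac, eF, w0, f00, f11, e01, e10, hab']
      congr 1
      · linear_combination (a:ℂ) ^ 2 * gi + a2' - b2'
      · ring
      · ring
    rwa [← this]
  · have h5 := disp2 k3.le hB hN hκ (q := (1 + κ0) / 8 * (g + g⁻¹) ^ 2) (by
      have : B.1.trace = a * (g + g⁻¹) := by
        rw [← tr_conj W B, tr_ent, ← hβ, f00, f11]; ring
      rw [this]
      linear_combination -(g + g⁻¹) ^ 2 / 4 * a2')
    exact h5
  · intro hgn
    have hgc : g⁻¹ = (starRingEnd ℂ) g := by
      apply mul_left_cancel₀ g0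
      rw [gi, Complex.mul_conj, Complex.normSq_eq_norm_sq, hgn]; norm_num
    refine elem_unit hG ⟨?_, ?_⟩ ⟨?_, ?_⟩
    · rw [hAd.1, hAd.2.2.2]; simp; ring
    · rw [hAd.2.1, hAd.2.2.1]; simp
    · rw [← hβ, f00, f11, hgc]; simp
    · rw [← hβ, e01, e10]; simp
end Marg

namespace Marg
set_option linter.unusedSimpArgs false
open Complex (normSq)

theorem gf_lt {u v u' v' : ℝ} (hu : 1 ≤ u) (hv : 1 ≤ v) (hu' : u < u') (hv' : v ≤ v') : gf u v < gf u' v' := by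
  unfold gf
  have h1 : u ^ 2 ≤ u' ^ 2 := by gcongr
  have h2 : v ^ 2 ≤ v' ^ 2 := by gcongr
  have h3 : Real.sqrt (u ^ 2 - 1) * Real.sqrt (v ^ 2 - 1) ≤ Real.sqrt (u' ^ 2 - 1) * Real.sqrt (v' ^ 2 - 1) := by gcongr
  nlinarith

theorem gf3 : gf (1 + (tc - 1) * (4 / 3)) tc ≤ (1 + Real.sqrt 5) / 3 := by
  have h5 := s5sq
  have hq := tc_quad
  have h8 := s85sq
  have t1 := tc_lo
  have t2 := tc_hi
  have l1 := s5lo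
  have l2 := s5hi
  have hp : (41 - 12 * Real.sqrt 5) * tc ^ 2 + 2 * (1 + 5 * Real.sqrt 5) * tc - 26 - 6 * Real.sqrt 5 = 0 := by
    linear_combination ((6 - Real.sqrt 5) * tc + (1 + Real.sqrt 5) + 2 * Real.sqrt (8 + 2 * Real.sqrt 5)) * hq + 4 * h8 - (tc ^ 2 - 2 * tc + 1) * h5
  have hp2 : (17 - 8 * Real.sqrt 5) * tc ^ 2 + (2 * Real.sqrt 5 - 6) * tc + 2 * Real.sqrt 5 - 2 = 0 := by
    linear_combination (7 - 4 * Real.sqrt 5) / 31 * hp + (-48 / 31 * tc ^ 2 + 40 / 31 * tc - 24 / 31) * h5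
  unfold gf
  rw [← Real.sqrt_mul (by nlinarith)]
  have : Real.sqrt (((1 + (tc - 1) * (4 / 3)) ^ 2 - 1) * (tc ^ 2 - 1)) ≤ (1 + Real.sqrt 5) / 3 - (1 + (tc - 1) * (4 / 3)) * tc := by
    rw [Real.sqrt_le_left (by nlinarith)]
    apply le_of_eq
    linear_combination -1 / 9 * h5 - 1 / 9 * hp2
  linarith

theorem gf_num {N r x : ℝ} (hN : 1 ≤ N) (hr : N ≤ r) (hx : 0 ≤ x) (h : r ^ 2 - 1 ≤ x ^ 2) : gf N tc ≤ r * 1.0167863 + x * 0.184 := by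
  have t1 := tc_lo
  have t2 := tc_hi
  have a1 : Real.sqrt (N ^ 2 - 1) ≤ x := by
    rw [Real.sqrt_le_left hx]
    have : N ^ 2 ≤ r ^ 2 := by gcongr
    linarith
  have a2 : Real.sqrt (tc ^ 2 - 1) ≤ 0.184 := by
    rw [Real.sqrt_le_left (by norm_num)]; nlinarith
  unfold gf
  have b1 := Real.sqrt_nonneg (tc ^ 2 - 1)
  have b2 := Real.sqrt_nonneg (N ^ 2 - 1)
  have hr0 : 0 ≤ r := by linarith
  gcongr

/-- Strict displacement bound. -/
theorem dispN {B : SL2C} {v : W3} (hv : dot v v = 1) {N : ℝ} (hN : hn (Mx v) < N) (hB : hn B.1 < tc) {G : ℝ} (hG : gf N tc ≤ G) :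
    ‖dot v (ac B v)‖ ^ 2 + ‖dot v (ac B v) ^ 2 - 1‖ < 2 * G ^ 2 - 1 := by
  have h1 := disp (B := B) hv
  have h2 := gf_lt (hn_Mx_one hv) (hn_one_le B) hN hB.le
  have h3 := gf_one_le (hn_Mx_one hv) (hn_one_le B)
  nlinarith

theorem gam_ax {c s : ℝ} {u v : W3} {X Y : SL2C} (hu : dot u u = 1) (hv : dot v v = 1) (hX : Rt c s u X) (hY : Rt c s v Y) :
    γp X Y = (s:ℂ) ^ 4 * (4 * (dot u v ^ 2 - 1)) := by
  obtain ⟨a1, a2, a3, a4⟩ := hX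
  obtain ⟨b1, b2, b3, b4⟩ := hY
  rw [gam_det]
  simp only [Matrix.det_fin_two, Matrix.sub_apply, Matrix.mul_apply, Fin.sum_univ_two, a1, a2, a3, a4, b1, b2, b3, b4]
  have hI4 : Complex.I ^ 4 = 1 := Complex.I_pow_four
  simp only [dot] at hu hv ⊢
  linear_combination 4 * (s:ℂ) ^ 4 * ((u.a * v.a + (u.b * v.c + u.c * v.b) / 2) ^ 2 - (u.a * u.a + (u.b * u.c + u.c * u.b) / 2) * (v.a * v.a + (v.b * v.c + v.c * v.b) / 2)) * hI4 - 4 * (s:ℂ) ^ 4 * ((v.a * v.a + (v.b * v.c + v.c * v.b) / 2) * hu + hv)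

theorem case7 {A B V : SL2C} {Γ : Subgroup SL2C} (h : Good A B Γ) {c s p q : ℝ} (hs : s ≠ 0) (hs2 : s ^ 2 ≤ 0.19) (hax : AxG c s Γ (axV V))
    (hA : Rt p q (axV V) A) (hN : s ^ 2 * (hn (Mx (axV V)) - 1) < tc - 1) (hB : hn B.1 < tc) : False := by
  have t2 := tc_hi
  refine kap1 h hs hax hA (by linarith) (by linarith) ?_
  obtain ⟨hE, f, hf, hr⟩ := hax
  have hr' : Rt c s (axV V) f := hr
  have h1 := ac_rt hr' B
  have hE1 : dot (ac B (axV V)) (ac B (axV V)) = 1 := by rw [ac_dot, hE]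
  have hg := gam_ax hE hE1 hr' h1
  have hcs := rt_det hE hr'
  have hcs' : (c:ℂ) ^ 2 + (s:ℂ) ^ 2 = 1 := by exact_mod_cast hcs
  have hs' : (s:ℂ) ≠ 0 := by exact_mod_cast hs
  have hd := disp (B := B) hE
  have htr : f.1.trace ^ 2 - 4 = ((-(4 * s ^ 2) : ℝ) : ℂ) := by
    rw [tr_ent, hr'.1, hr'.2.2.2]; push_cast; linear_combination 4 * hcs'
  have htr1 : (B * f * B⁻¹).1.trace ≠ 0 := by
    rw [tr_ent, h1.1, h1.2.2.2]
    have : c ≠ 0 := by rintro rfl; nlinarith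
    have : (c:ℂ) ≠ 0 := by exact_mod_cast this
    intro h0; apply this; linear_combination h0 / 2
  set κ := dot (axV V) (ac B (axV V)) with hκ
  set N := hn (Mx (axV V)) with hNd
  have hN1 : 1 ≤ N := hn_Mx_one hE
  have hu1 := hn_one_le B
  set u := hn B.1 with hu
  have hK : ‖κ ^ 2 - 1‖ ≤ gf N u ^ 2 := by
    have : ‖κ ^ 2 - 1‖ ≤ ‖κ‖ ^ 2 + 1 := by
      refine (norm_sub_le _ _).trans ?_
      rw [norm_pow, norm_one]
    linarith
  have hsg : s ^ 2 * gf N u ≤ 0.2255 := by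
    have e1 : s ^ 2 * Real.sqrt (N ^ 2 - 1) ≤ 0.0818 := by
      have : s ^ 2 * Real.sqrt (N ^ 2 - 1) = Real.sqrt ((s ^ 2) ^ 2 * (N ^ 2 - 1)) := by
        rw [Real.sqrt_mul (by positivity), Real.sqrt_sq (by positivity)]
      rw [this, Real.sqrt_le_left (by norm_num)]
      have e : (s ^ 2) ^ 2 * (N ^ 2 - 1) = (s ^ 2 * (N - 1)) * (s ^ 2 * (N - 1) + 2 * s ^ 2) := by ring
      rw [e]
      have p0 : 0 ≤ s ^ 2 * (N - 1) := mul_nonneg (sq_nonneg _) (by linarith)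
      have p1 : s ^ 2 * (N - 1) ≤ 0.0168 := by linarith
      have p2 := sq_nonneg s
      have : s ^ 2 * (N - 1) * (s ^ 2 * (N - 1) + 2 * s ^ 2) ≤ 0.0168 * (0.0168 + 2 * 0.19) := by gcongr
      norm_num at this ⊢
      linarith
    have e2 : Real.sqrt (u ^ 2 - 1) ≤ 0.184 := by
      rw [Real.sqrt_le_left (by norm_num)]; nlinarith
    have e3 : s ^ 2 * N ≤ 0.2068 := by linarith
    have e : s ^ 2 * gf N u = (s ^ 2 * N) * u + (s ^ 2 * Real.sqrt (N ^ 2 - 1)) * Real.sqrt (u ^ 2 - 1) := by unfold gf; ring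
    rw [e]
    have e4 := Real.sqrt_nonneg (u ^ 2 - 1)
    have : (s ^ 2 * N) * u + (s ^ 2 * Real.sqrt (N ^ 2 - 1)) * Real.sqrt (u ^ 2 - 1) ≤ 0.2068 * 1.0167863 + 0.0818 * 0.184 := by
      have : u ≤ 1.0167863 := by linarith
      gcongr
    norm_num at this ⊢
    linarith
  have hg0 : 0 ≤ s ^ 2 * gf N u := mul_nonneg (sq_nonneg _) (by linarith [gf_one_le hN1 hu1])
  have hJ := lemJ h.disc hf (Γ.mul_mem (Γ.mul_mem h.hB hf) (Γ.inv_mem h.hB)) (by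
      intro h0
      rw [h0, sub_self] at htr
      have : -(4 * s ^ 2) = 0 := by exact_mod_cast htr.symm
      have : 0 < s ^ 2 := by positivity
      linarith) (by
      rw [htr, hg, Complex.norm_real, norm_mul, norm_mul, norm_pow, Complex.norm_real, Real.norm_eq_abs, Real.norm_eq_abs, abs_neg, abs_of_nonneg (by positivity),
        show |s| ^ 4 = (s ^ 2) ^ 2 by rw [← sq_abs s]; ring, Complex.norm_ofNat]
      have : (s ^ 2) ^ 2 * ‖κ ^ 2 - 1‖ ≤ (s ^ 2) ^ 2 * gf N u ^ 2 := by gcongr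
      nlinarith)
  rcases hJ with h5 | h5
  · have h6 : γp f (B * f * B⁻¹) = 0 := by
      rw [gam_det]
      have : f.1 * (B * f * B⁻¹).1 = (B * f * B⁻¹).1 * f.1 := congrArg Subtype.val h5
      rw [this, sub_self]; simp
    rw [hg] at h6
    have := (mul_eq_zero.mp h6).resolve_left (pow_ne_zero 4 hs')
    linear_combination this / 4
  · exact absurd h5 htr1

theorem case3 {A B V : SL2C} {Γ : Subgroup SL2C} (h : Good A B Γ) {p q : ℝ} (hax : AxG (Real.cos (π / 3)) (Real.sin (π / 3)) Γ (axV V))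
    (hA : Rt p q (axV V) A) (hN : Real.sin (π / 3) ^ 2 * (hn (Mx (axV V)) - 1) < tc - 1) (hB : hn B.1 < tc) : False := by
  have t2 := tc_hi
  have l1 := s5lo
  have l2 := s5hi
  have h5 := s5sq
  rw [Real.cos_pi_div_three, Real.sin_pi_div_three] at hax
  rw [Real.sin_pi_div_three] at hN
  have h3 : Real.sqrt 3 ^ 2 = 3 := Real.sq_sqrt (by norm_num)
  have h30 : 0 < Real.sqrt 3 := by positivity
  set r := Real.sqrt 3 with hr
  have hs : r / 2 ≠ 0 := by positivity
  have hN' : hn (Mx (axV V)) < 1 + (tc - 1) * (4 / 3) := by nlinarith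
  have sys : ∀ Γ' : Subgroup SL2C, Disc Γ' → AxSys (-1/2) (r / 2) (AxG (1 / 2) (r / 2) Γ') := fun Γ' hd =>
    axsys (by nlinarith) (by norm_num) hs hd (by nlinarith) (by ring)
  have hcs : (-1/2:ℝ) ^ 2 + (r / 2) ^ 2 = 1 := by nlinarith
  have hd := dispN hax.1 hN' hB gf3
  have hQ := stage1_3 (sys Γ h.disc) hcs ⟨_, _, hax, ac_ax hax h.hB, rfl⟩ (InE_of (G := (1 + Real.sqrt 5) / 3) (by linarith) hd.le
    (by push_cast; nlinarith) (by push_cast; nlinarith))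
  have fin : ∀ κ0 : ℝ, dot (axV V) (ac B (axV V)) = κ0 → (κ0 ^ 2 = 1/9 ∨ κ0 ^ 2 = 5/9) → False := by
    intro κ0 hκ hk
    have h1 : 0 < 1 - κ0 ^ 2 := by rcases hk with hk | hk <;> rw [hk] <;> norm_num
    obtain ⟨Γ', g, g1, g2, g3, g4, g5, g6, g7⟩ := nf h hax hA hB.le hN'.le hκ (Real.sqrt_pos.mpr h1) (Real.sq_sqrt h1.le)
    exact g7 (st2_3 (by positivity) hcs (Real.sqrt_pos.mpr h1) (Real.sq_sqrt h1.le) hk (sys Γ' g2) g1 g3 g4 g5 g6)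
  generalize hκ : dot (axV V) (ac B (axV V)) = κ at *
  have re : ∀ r : ℝ, 0 ≤ r → κ ^ 2 = r → κ = κ.re ∧ κ.re ^ 2 = r := by
    intro r hr hk
    have := sq_real_pos hk hr
    exact ⟨Complex.ext rfl (by simpa using this.1), this.2⟩
  rcases hQ with hk | hk | hk | hk
  · exact kap1 h hs hax hA (by linarith) (by linarith) (by rw [hκ]; exact hk)
  · obtain ⟨e1, e2⟩ := re (1/9) (by norm_num) (by rw [hk]; norm_num)
    exact fin _ e1 (Or.inl e2)
  · obtain ⟨e1, e2⟩ := re (5/9) (by norm_num) (by rw [hk]; norm_num)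
    exact fin _ e1 (Or.inr e2)
  · rw [← norm_pow, hk, ← Complex.ofReal_one, ← Complex.ofReal_sub, Complex.norm_real, Complex.norm_real, Real.norm_eq_abs, Real.norm_eq_abs,
      abs_of_nonpos (by linarith), abs_of_nonpos (by linarith)] at hd
    nlinarith

theorem case4 {A B V : SL2C} {Γ : Subgroup SL2C} (h : Good A B Γ) {p q : ℝ} (hax : AxG (Real.cos (π / 4)) (Real.sin (π / 4)) Γ (axV V))
    (hA : Rt p q (axV V) A) (hN : Real.sin (π / 4) ^ 2 * (hn (Mx (axV V)) - 1) < tc - 1) (hB : hn B.1 < tc) : False := by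
  have t1 := tc_lo
  have t2 := tc_hi
  rw [Real.cos_pi_div_four, Real.sin_pi_div_four] at hax
  rw [Real.sin_pi_div_four] at hN
  have h3 : Real.sqrt 2 ^ 2 = 2 := Real.sq_sqrt (by norm_num)
  have h30 : 0 < Real.sqrt 2 := by positivity
  set r := Real.sqrt 2 with hr
  have hs : r / 2 ≠ 0 := by positivity
  have hN' : hn (Mx (axV V)) < 1 + (tc - 1) * 2 := by nlinarith
  have sys : ∀ Γ' : Subgroup SL2C, Disc Γ' → AxSys 0 1 (AxG (r / 2) (r / 2) Γ') := fun Γ' hd =>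
    axsys (by nlinarith) (by nlinarith) hs hd (by nlinarith) (by nlinarith)
  have hcs : (0:ℝ) ^ 2 + 1 ^ 2 = 1 := by norm_num
  have hd := dispN hax.1 hN' hB (G := 1.105) ((gf_num (r := 1.0335726) (x := 0.2615) (by linarith) (by linarith) (by norm_num) (by norm_num)).trans (by norm_num))
  have hQ := stage1_4 (sys Γ h.disc) hcs ⟨_, _, hax, ac_ax hax h.hB, rfl⟩ (InE_of (G := 1.105) (by norm_num) hd.le
    (by norm_num) (by norm_num))
  rcases hQ with hk | hk
  · exact kap1 h hs hax hA (by linarith) (by linarith) hk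
  · obtain ⟨Γ', g, g1, g2, g3, g4, g5, g6, g7⟩ := nf (κ0 := 0) (s0 := 1) h hax hA hB.le hN'.le (by rw [hk]; simp) one_pos (by norm_num)
    exact g7 (st2_4 (by norm_num) hcs one_pos (by norm_num) rfl (sys Γ' g2) g1 g3 g4 g5 g6)

theorem case5 {A B V : SL2C} {Γ : Subgroup SL2C} (h : Good A B Γ) {p q : ℝ} (hax : AxG (Real.cos (π / 5)) (Real.sin (π / 5)) Γ (axV V))
    (hA : Rt p q (axV V) A) (hN : Real.sin (π / 5) ^ 2 * (hn (Mx (axV V)) - 1) < tc - 1) (hB : hn B.1 < tc) : False := by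
  have t1 := tc_lo
  have t2 := tc_hi
  have l1 := s5lo
  have l2 := s5hi
  have h5 := s5sq
  have hsp : 0 < Real.sin (π / 5) := Real.sin_pos_of_pos_of_lt_pi (by positivity) (by linarith [Real.pi_pos])
  have hcs0 := Real.cos_sq_add_sin_sq (π / 5)
  rw [Real.cos_pi_div_five] at hax hcs0
  set s := Real.sin (π / 5) with hsd
  have hs : s ≠ 0 := hsp.ne'
  have hs2 : s ^ 2 = (5 - Real.sqrt 5) / 8 := by nlinarith
  have hs8 : s ^ 2 * (8 / (5 - Real.sqrt 5)) = 1 := by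
    rw [hs2]; have : 5 - Real.sqrt 5 ≠ 0 := by linarith
    field_simp
  have hs80 : 0 < 8 / (5 - Real.sqrt 5) := by
    have : 0 < 5 - Real.sqrt 5 := by linarith
    positivity
  have hs81 : 8 / (5 - Real.sqrt 5) ≤ 2.8945 := by
    rw [div_le_iff₀ (by linarith)]; linarith
  have hN' : hn (Mx (axV V)) < 1 + (tc - 1) * (8 / (5 - Real.sqrt 5)) := by
    have := mul_lt_mul_of_pos_right hN hs80
    have e : s ^ 2 * (hn (Mx (axV V)) - 1) * (8 / (5 - Real.sqrt 5)) = hn (Mx (axV V)) - 1 := by linear_combination (hn (Mx (axV V)) - 1) * hs8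
    linarith
  have sys : ∀ Γ' : Subgroup SL2C, Disc Γ' → AxSys ((Real.sqrt 5 - 1) / 4) (2 * ((1 + Real.sqrt 5) / 4) * s) (AxG ((1 + Real.sqrt 5) / 4) s Γ') := fun Γ' hd =>
    axsys hcs0 (by nlinarith) hs hd (by nlinarith) rfl
  have hcs : ((Real.sqrt 5 - 1) / 4) ^ 2 + (2 * ((1 + Real.sqrt 5) / 4) * s) ^ 2 = 1 := by
    linear_combination ((1 + Real.sqrt 5) ^ 2 / 4) * hs2 + (5 / 32 - Real.sqrt 5 / 32 + 0) * h5
  have hd := dispN hax.1 hN' hB (G := 1.13) ((gf_num (r := 1.0486) (x := 0.3156) (by nlinarith) (by nlinarith) (by norm_num) (by norm_num)).trans (by norm_num))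
  have hQ := stage1_5 (sys Γ h.disc) hcs ⟨_, _, hax, ac_ax hax h.hB, rfl⟩ (InE_of (G := 1.13) (by norm_num) hd.le
    (by norm_num) (by norm_num))
  rcases hQ with hk | hk
  · exact kap1 h hs hax hA (by linarith) (by linarith) hk
  · generalize hκ : dot (axV V) (ac B (axV V)) = κ at *
    have e := sq_real_pos (z := κ) (r := 1/5) (by rw [hk]; norm_num) (by norm_num)
    have hκ' : dot (axV V) (ac B (axV V)) = κ.re := by rw [hκ]; exact Complex.ext rfl (by simpa using e.1)
    have h1 : 0 < 1 - κ.re ^ 2 := by rw [e.2]; norm_num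
    obtain ⟨Γ', g, g1, g2, g3, g4, g5, g6, g7⟩ := nf h hax hA hB.le hN'.le hκ' (Real.sqrt_pos.mpr h1) (Real.sq_sqrt h1.le)
    exact g7 (st2_5 (by positivity) hcs (Real.sqrt_pos.mpr h1) (Real.sq_sqrt h1.le) e.2 (sys Γ' g2) g1 g3 g4 g5 g6)

theorem case6 {A B V : SL2C} {Γ : Subgroup SL2C} (h : Good A B Γ) {p q : ℝ} (hax : AxG (Real.cos (π / 6)) (Real.sin (π / 6)) Γ (axV V))
    (hA : Rt p q (axV V) A) (hN : Real.sin (π / 6) ^ 2 * (hn (Mx (axV V)) - 1) < tc - 1) (hB : hn B.1 < tc) : False := by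
  have t1 := tc_lo
  have t2 := tc_hi
  rw [Real.cos_pi_div_six, Real.sin_pi_div_six] at hax
  rw [Real.sin_pi_div_six] at hN
  have h3 : Real.sqrt 3 ^ 2 = 3 := Real.sq_sqrt (by norm_num)
  have h30 : 0 < Real.sqrt 3 := by positivity
  set r := Real.sqrt 3 with hr
  have hN' : hn (Mx (axV V)) < 1 + (tc - 1) * 4 := by nlinarith
  have sys : AxSys (1/2) (r / 2) (AxG (r / 2) (1 / 2) Γ) :=
    axsys (by nlinarith) (by nlinarith) (by norm_num) h.disc (by nlinarith) (by ring)
  have hcs : (1/2:ℝ) ^ 2 + (r / 2) ^ 2 = 1 := by nlinarith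
  have hd := dispN hax.1 hN' hB (G := 1.16) ((gf_num (r := 1.0671452) (x := 0.3727) (by linarith) (by linarith) (by norm_num) (by norm_num)).trans (by norm_num))
  have hQ := stage1_6 sys hcs ⟨_, _, hax, ac_ax hax h.hB, rfl⟩ (InE_of (G := 1.16) (by norm_num) hd.le
    (by norm_num) (by norm_num))
  exact kap1 h (by norm_num) hax hA (by linarith) (by linarith) hQ

theorem sin7 {n : ℕ} (h : 7 ≤ n) : Real.sin (π / n) ^ 2 ≤ 0.19 ∧ Real.sin (π / n) ≠ 0 := by
  have hn : (7:ℝ) ≤ n := by exact_mod_cast h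
  have hp := Real.pi_pos
  have hp6 := Real.pi_lt_d6
  have e0 : 0 < π / n := by positivity
  have e1 : π / n ≤ 0.4488 := by
    rw [div_le_iff₀ (by linarith)]; nlinarith
  have e2 : 0 < Real.sin (π / n) := Real.sin_pos_of_pos_of_lt_pi e0 (by linarith [Real.pi_gt_three])
  have e3 : Real.sin (π / n) ≤ Real.sin 0.4488 :=
    Real.sin_le_sin_of_le_of_le_pi_div_two (by linarith) (by linarith [Real.pi_gt_three]) e1
  have e4 := (abs_le.mp (Real.sin_bound (x := 0.4488) (by rw [abs_of_pos] <;> norm_num))).2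
  rw [abs_of_pos (by norm_num)] at e4
  norm_num at e4
  refine ⟨?_, e2.ne'⟩
  have e5 : Real.sin (π / n) ≤ 0.43586 := by norm_num at e3 ⊢; linarith
  nlinarith

theorem ell_conj {A : SL2C} {n : ℕ} (h : IsEllipticOfOrder A n) (C : SL2C) : IsEllipticOfOrder (C * A * C⁻¹) n := by
  unfold IsEllipticOfOrder at *
  simp only [conj_pow', Ne, conj_eq_one, conj_eq_neg_one]
  exact h

theorem main_ell {A B : SL2C} {Γ : Subgroup SL2C} (h : Good A B Γ) {n : ℕ} (h3 : 3 ≤ n) (hE : IsEllipticOfOrder A n) (hA : hn A.1 < tc) (hB : hn B.1 < tc) : False := by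
  obtain ⟨V, hax, ⟨p, q, hr⟩, hN⟩ := red h h3 hE hA
  by_cases h7 : 7 ≤ n
  · exact case7 h (sin7 h7).2 (sin7 h7).1 hax hr hN hB
  · have : n = 3 ∨ n = 4 ∨ n = 5 ∨ n = 6 := by omega
    rcases this with rfl | rfl | rfl | rfl
    · exact case3 h (by exact_mod_cast hax) hr (by exact_mod_cast hN) hB
    · exact case4 h (by exact_mod_cast hax) hr (by exact_mod_cast hN) hB
    · exact case5 h (by exact_mod_cast hax) hr (by exact_mod_cast hN) hB
    · exact case6 h (by exact_mod_cast hax) hr (by exact_mod_cast hN) hB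

theorem main_par {A B : SL2C} {Γ : Subgroup SL2C} (h : Good A B Γ) (hP : IsParabolic A) (hA : hn A.1 < tc) (hB : hn B.1 < tc) : False := by
  have t2 := tc_hi
  obtain ⟨h1, h2, h3⟩ := hP
  rcases h3 with h3 | h3
  · exact para h h.hA h.hA h3 h1 (by linarith) (by linarith) (by linarith) (fun v hv => hv)
  · have hneg := h.neg A h.hA
    have e : hn (-A).1 = hn A.1 := by simp only [hn, neg_ent, Complex.normSq_neg]
    refine para (P := -A) (f := A) h hneg h.hA ?_ ?_ (by rw [e]; linarith) (by linarith) (by linarith) (fun v hv => hv)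
    · rw [tr_ent] at h3 ⊢
      rw [neg_ent, neg_ent]; linear_combination -h3
    · intro h0; apply h2; rw [← h0, neg_neg]

end Marg

theorem margulis_parabolic_or_elliptic (A B : SL2C)
    (hd : IsDiscreteSubgroup (Subgroup.closure {A, B}))
    (hne : IsNonelementary (Subgroup.closure {A, B}))
    (hA : IsParabolic A ∨ ∃ n : ℕ, 3 ≤ n ∧ IsEllipticOfOrder A n) :
    ∀ C : SL2C,
      max (fnorm ((C * A * C⁻¹ : SL2C) : Matrix (Fin 2) (Fin 2) ℂ) ^ 2)
      (fnorm ((C * B * C⁻¹ : SL2C) : Matrix (Fin 2) (Fin 2) ℂ) ^ 2) ≥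
      2 * ((2 * Real.sqrt (8 + 2 * Real.sqrt 5) - (1 + Real.sqrt 5)) / (6 - Real.sqrt 5)) := by
  intro C
  by_contra hcon
  rw [ge_iff_le, not_le, max_lt_iff, Marg.fnorm_sq, Marg.fnorm_sq] at hcon
  have h1 : Marg.hn (C * A * C⁻¹).1 < Marg.tc := by unfold Marg.tc; linarith [hcon.1]
  have h2 : Marg.hn (C * B * C⁻¹).1 < Marg.tc := by unfold Marg.tc; linarith [hcon.2]
  have hG := (Marg.good_of hd hne).conj C
  rcases hA with ⟨a1, a2, a3⟩ | ⟨n, h3, hE⟩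
  · refine Marg.main_par hG ⟨?_, ?_, ?_⟩ h1 h2
    · rw [Ne, Marg.conj_eq_one]; exact a1
    · rw [Ne, Marg.conj_eq_neg_one]; exact a2
    · have := Marg.tr_conj C A
      rw [this]; exact a3
  · exact Marg.main_ell hG h3 (Marg.ell_conj hE C) h1 h2

end
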